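/- (Generalized area theorem) Let n ≥ 1, let g be a holomorphic function on B_n, let 0 < p < ∞ and 0 < t < ∞, and fix an aperture α > 1. Define I_{p,t}(g) = ∫_{S_n} ( ∫_{Γ_α(ζ)} |g(z)|^{2t−2} |Rg(z)|² (1−|z|²)^{1−n} dv(z) )^{p/2} dσ(ζ). Then g ∈ H^{pt} if and only if I_{p,t}(g) < ∞. Moreover, if g(0) = 0, then ‖g‖_{H^{pt}}^{pt} is comparable to I_{p,t}(g), with comparison constants depending only on n, p, t and α. -/

import Mathlib

open MeasureTheory Metric Set Filter
open scoped ENNReal NNReal Topology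

noncomputable section

/-- ℂⁿ with its Euclidean (Hermitian) structure. -/
abbrev En (n : ℕ) := EuclideanSpace ℂ (Fin n)

instance (n : ℕ) : MeasurableSpace (En n) := borel _
instance (n : ℕ) : BorelSpace (En n) := ⟨rfl⟩

/-- The open unit ball `B_n` of ℂⁿ. -/
def Bn (n : ℕ) : Set (En n) := Metric.ball 0 1

/-- The unit sphere `S_n = ∂B_n`. -/
def Sn (n : ℕ) : Set (En n) := Metric.sphere 0 1

/-- The Hermitian inner product `⟨z,w⟩ = ∑ z_k * conj (w_k)`. -/
def herm {n : ℕ} (z w : En n) : ℂ := ∑ k, z k * (starRingEnd ℂ) (w k)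

/-- The surface measure on the unit sphere, normalized so that `σ(S_n) = 1`
(the `(2n-1)`-dimensional Hausdorff measure restricted to the sphere, normalized). -/
def sigmaS (n : ℕ) : Measure (En n) :=
  ((μH[(2 * n - 1 : ℝ)] (Sn n))⁻¹) • (μH[(2 * n - 1 : ℝ)]).restrict (Sn n)

/-- Lebesgue measure on the unit ball, normalized so that `v(B_n) = 1`. -/
def volN (n : ℕ) : Measure (En n) :=
  ((volume (Bn n))⁻¹) • volume.restrict (Bn n)

/-- The radial derivative `Rg(z) = ∑ z_k ∂g/∂z_k (z) = (Dg)(z)[z]`. -/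
def radD {n : ℕ} (g : En n → ℂ) (z : En n) : ℂ := fderiv ℂ g z z

/-- The Volterra-type integration operator `J_g f(z) = ∫₀¹ f(tz) Rg(tz) dt/t`. -/
def J {n : ℕ} (g f : En n → ℂ) (z : En n) : ℂ :=
  ∫ t in Set.Ioo (0 : ℝ) 1, f (t • z) * radD g (t • z) / (t : ℂ)

/-- The Hardy space quasinorm `‖f‖_{H^p}`, with values in `ℝ≥0∞`:
`‖f‖_{H^p}^p = sup_{0<r<1} ∫_{S_n} |f(rζ)|^p dσ(ζ)`. -/
def hNorm (n : ℕ) (p : ℝ) (f : En n → ℂ) : ℝ≥0∞ :=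
  (⨆ r ∈ Set.Ioo (0 : ℝ) 1,
    ∫⁻ ζ, (‖f (r • ζ)‖₊ : ℝ≥0∞) ^ p ∂(sigmaS n)) ^ (1 / p)

/-- Membership in the Hardy space `H^p(B_n)`. -/
def MemHp (n : ℕ) (p : ℝ) (f : En n → ℂ) : Prop :=
  DifferentiableOn ℂ f (Bn n) ∧ hNorm n p f < ⊤

/-- The Carleson box `B_δ(ζ) = {z ∈ B_n : |1 - ⟨z,ζ⟩| < δ}`. -/
def cBox {n : ℕ} (ζ : En n) (δ : ℝ) : Set (En n) :=
  {z ∈ Bn n | ‖(1 : ℂ) - herm z ζ‖ < δ}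

/-- The measure `dμ_g(z) = |Rg(z)|²(1-|z|²) dv(z)`. -/
def muJ (n : ℕ) (g : En n → ℂ) : Measure (En n) :=
  (volN n).withDensity
    (fun z => (‖radD g z‖₊ : ℝ≥0∞) ^ 2 * ENNReal.ofReal (1 - ‖z‖ ^ 2))

/-- The admissible approach region `Γ_α(ζ) = {z ∈ B_n : |1-⟨z,ζ⟩| < (α/2)(1-|z|²)}`. -/
def Gam {n : ℕ} (α : ℝ) (ζ : En n) : Set (En n) :=
  {z ∈ Bn n | ‖(1 : ℂ) - herm z ζ‖ < α / 2 * (1 - ‖z‖ ^ 2)}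

open Classical in
/-- The involutive automorphism `φ_a` of the unit ball interchanging `0` and `a`:
`φ_a(z) = (a - P_a z - √(1-|a|²) (z - P_a z)) / (1 - ⟨z,a⟩)`, where `P_a` is the
orthogonal projection onto `ℂa`. -/
def mob {n : ℕ} (a z : En n) : En n :=
  if a = 0 then -z
  else ((1 : ℂ) - herm z a)⁻¹ •
    ((a - (herm z a / herm a a) • a) -
      ((Real.sqrt (1 - ‖a‖ ^ 2) : ℂ)) • (z - (herm z a / herm a a) • a))

/-- The norm of the invariant (real) gradient `∇̃f(z) = ∇(f ∘ φ_z)(0)`. -/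
def invGrad {n : ℕ} {F : Type*} [NormedAddCommGroup F] [NormedSpace ℝ F]
    (f : En n → F) (z : En n) : ℝ :=
  ‖fderiv ℝ (fun w => f (mob z w)) 0‖

/-- The invariant measure `dλ_n(z) = (1-|z|²)^{-(n+1)} dv(z)`. -/
def lamN (n : ℕ) : Measure (En n) :=
  (volN n).withDensity (fun z => ENNReal.ofReal ((1 - ‖z‖ ^ 2) ^ (-(n + 1 : ℝ))))

/-- The invariant Poisson integral `u_φ(z) = ∫_{S_n} φ(ζ) (1-|z|²)ⁿ/|1-⟨z,ζ⟩|^{2n} dσ(ζ)`. -/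
def poisson (n : ℕ) (φ : En n → ℝ) (z : En n) : ℝ :=
  ∫ ζ, φ ζ * ((1 - ‖z‖ ^ 2) ^ n / ‖(1 : ℂ) - herm z ζ‖ ^ (2 * n)) ∂(sigmaS n)

/-- The function `μ̃(ζ) = ∫_{Γ_α(ζ)} (1-|z|²)^{-n} dμ(z)`. -/
def tildeMu (n : ℕ) (α : ℝ) (μ : Measure (En n)) (ζ : En n) : ℝ≥0∞ :=
  ∫⁻ z in Gam α ζ, ENNReal.ofReal ((1 - ‖z‖ ^ 2) ^ (-(n : ℝ))) ∂μ

/-- The `L^{p/(p-s)}(S_n)`-norm of `μ̃`. -/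
def tildeMuNorm (n : ℕ) (α p s : ℝ) (μ : Measure (En n)) : ℝ≥0∞ :=
  (∫⁻ ζ, tildeMu n α μ ζ ^ (p / (p - s)) ∂(sigmaS n)) ^ ((p - s) / p)


/-- The quantity `I_{p,t}(g)` of the generalized area theorem. -/
def Ipt (n : ℕ) (α p t : ℝ) (g : En n → ℂ) : ℝ≥0∞ :=
  ∫⁻ ζ, (∫⁻ z in Gam α ζ,
      (‖g z‖₊ : ℝ≥0∞) ^ (2 * t - 2) * (‖radD g z‖₊ : ℝ≥0∞) ^ 2 *
        ENNReal.ofReal ((1 - ‖z‖ ^ 2) ^ (1 - (n : ℝ))) ∂(volN n)) ^ (p / 2) ∂(sigmaS n)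

section InvariantSphere

variable {E : Type*} [NormedAddCommGroup E] [InnerProductSpace ℝ E]
  [MeasurableSpace E] [BorelSpace E]

omit [MeasurableSpace E] [BorelSpace E] in
lemma exists_linearIsometryEquiv_map_eq {x y : E} (h : ‖x‖ = ‖y‖) :
    ∃ e : E ≃ₗᵢ[ℝ] E, e x = y := by
  refine ⟨(ℝ ∙ (x - y))ᗮ.reflection, ?_⟩
  exact Submodule.reflection_sub h

/-- Balls centred on the sphere have the same mass for an isometry-invariant measure. -/
lemma measure_ball_eq_of_invariant {μ : Measure E}
    (hμ : ∀ e : E ≃ₗᵢ[ℝ] E, μ.map e = μ) {x y : E} (h : ‖x‖ = ‖y‖) (r : ℝ) :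
    μ (ball x r) = μ (ball y r) := by
  obtain ⟨e, rfl⟩ := exists_linearIsometryEquiv_map_eq h
  conv_rhs => rw [← hμ e]
  rw [Measure.map_apply e.continuous.measurable measurableSet_ball]
  congr 1
  ext z
  simp

variable [SecondCountableTopology E]

lemma measure_ball_pos_of_invariant {μ : Measure E} [IsProbabilityMeasure μ]
    (hμ : ∀ e : E ≃ₗᵢ[ℝ] E, μ.map e = μ) (hs : μ (sphere 0 1)ᶜ = 0) {x : E} (hx : ‖x‖ = 1)
    {r : ℝ} (hr : 0 < r) : 0 < μ (ball x r) := by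
  rw [pos_iff_ne_zero]
  intro h0
  have : μ (sphere (0 : E) 1) = 0 := by
    refine measure_null_of_locally_null _ fun y hy => ⟨ball y r, ?_, ?_⟩
    · exact mem_nhdsWithin_of_mem_nhds (ball_mem_nhds _ hr)
    · rw [measure_ball_eq_of_invariant hμ (y := x) (by simp_all) r, h0]
  have h1 : μ univ = 0 := by
    rw [← union_compl_self (sphere (0 : E) 1)]
    exact measure_union_null this hs
  simp at h1

lemma measure_isOpen_le_liminf {μ ν : Measure E} [IsProbabilityMeasure μ] [IsProbabilityMeasure ν]
    (hμ : ∀ e : E ≃ₗᵢ[ℝ] E, μ.map e = μ) (hν : ∀ e : E ≃ₗᵢ[ℝ] E, ν.map e = ν)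
    (hsμ : μ (sphere 0 1)ᶜ = 0) (hsν : ν (sphere 0 1)ᶜ = 0) {x₀ : E} (hx₀ : ‖x₀‖ = 1)
    {U : Set E} (hU : IsOpen U) :
    μ U ≤ liminf (fun k : ℕ => μ (ball x₀ (1 / (k + 1 : ℝ))) / ν (ball x₀ (1 / (k + 1 : ℝ))))
      atTop * ν U := by
  have hpos : ∀ k : ℕ, 0 < 1 / (k + 1 : ℝ) := fun k => by positivity
  have hae : ∀ {m : Measure E}, m (sphere 0 1)ᶜ = 0 → ∀ᵐ x ∂m, ‖x‖ = 1 := by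
    intro m hm
    filter_upwards [(measure_eq_zero_iff_ae_notMem.1 hm)] with x hx
    simpa using hx
  have hmeas : ∀ k : ℕ, Measurable fun x : E => ν (U ∩ ball x (1 / (k + 1 : ℝ))) := by
    intro k
    have hset : MeasurableSet {p : E × E | p.2 ∈ U ∧ dist p.2 p.1 < 1 / (k + 1 : ℝ)} := by
      refine (hU.measurableSet.preimage measurable_snd).inter ?_
      exact measurableSet_lt (measurable_snd.dist measurable_fst) measurable_const
    have := measurable_measure_prodMk_left (ν := ν) hset
    exact this
  have key : ∀ x ∈ U, ‖x‖ = 1 → (1 : ℝ≥0∞) ≤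
      liminf (fun k : ℕ => ν (U ∩ ball x (1 / (k + 1 : ℝ))) / ν (ball x₀ (1 / (k + 1 : ℝ)))) atTop := by
    intro x hx hx1
    refine le_liminf_of_le (by isBoundedDefault) ?_
    obtain ⟨ε, hε, hεU⟩ := Metric.isOpen_iff.1 hU x hx
    obtain ⟨N, hN⟩ := exists_nat_one_div_lt hε
    filter_upwards [eventually_ge_atTop N] with k hk
    have hsub : ball x (1 / (k + 1 : ℝ)) ⊆ U :=
      (ball_subset_ball ((Nat.one_div_le_one_div hk).trans hN.le)).trans hεU
    rw [inter_eq_right.2 hsub, measure_ball_eq_of_invariant hν (hx1.trans hx₀.symm),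
      ENNReal.div_self (measure_ball_pos_of_invariant hν hsν hx₀ (hpos k)).ne' (measure_ne_top _ _)]
  calc μ U = ∫⁻ x in U, 1 ∂μ := by simp
    _ ≤ ∫⁻ x in U, liminf (fun k : ℕ => ν (U ∩ ball x (1 / (k + 1 : ℝ))) /
        ν (ball x₀ (1 / (k + 1 : ℝ)))) atTop ∂μ := by
      refine lintegral_mono_ae ?_
      filter_upwards [ae_restrict_mem hU.measurableSet, ae_restrict_of_ae (hae hsμ)] with x h1 h2
      exact key x h1 h2
    _ ≤ liminf (fun k : ℕ => ∫⁻ x in U, ν (U ∩ ball x (1 / (k + 1 : ℝ))) /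
        ν (ball x₀ (1 / (k + 1 : ℝ))) ∂μ) atTop :=
      lintegral_liminf_le fun k => (hmeas k).div_const _
    _ ≤ liminf (fun k : ℕ => μ (ball x₀ (1 / (k + 1 : ℝ))) / ν (ball x₀ (1 / (k + 1 : ℝ))) * ν U)
        atTop := by
      refine liminf_le_liminf (Eventually.of_forall fun k => ?_)
      simp only [div_eq_mul_inv _ (ν _)]
      rw [lintegral_mul_const _ (hmeas k), mul_right_comm]
      gcongr
      have h1 : ∀ x : E, ν (U ∩ ball x (1 / (k + 1 : ℝ))) =
          ∫⁻ y in U, (ball x (1 / (k + 1 : ℝ))).indicator 1 y ∂ν := by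
        intro x
        rw [lintegral_indicator_one measurableSet_ball, Measure.restrict_apply measurableSet_ball,
          inter_comm]
      simp_rw [h1]
      rw [lintegral_lintegral_swap]
      · have h2 : ∀ y : E, ∫⁻ x in U, (ball x (1 / (k + 1 : ℝ))).indicator 1 y ∂μ
            ≤ μ (ball y (1 / (k + 1 : ℝ))) := by
          intro y
          refine (setLIntegral_le_lintegral _ _).trans (le_of_eq ?_)
          rw [← lintegral_indicator_one measurableSet_ball]
          congr 1
          ext x
          simp only [indicator, mem_ball, dist_comm]
          rfl
        calc _ ≤ ∫⁻ y in U, μ (ball x₀ (1 / (k + 1 : ℝ))) ∂ν := by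
              refine lintegral_mono_ae ?_
              filter_upwards [ae_restrict_of_ae (hae hsν)] with y hy
              exact (h2 y).trans (measure_ball_eq_of_invariant hμ (hy.trans hx₀.symm) _).le
          _ = _ := by simp
      · refine Measurable.aemeasurable ?_
        have hset : MeasurableSet {p : E × E | dist p.2 p.1 < 1 / (k + 1 : ℝ)} :=
          measurableSet_lt (measurable_snd.dist measurable_fst) measurable_const
        exact (measurable_one.indicator hset : Measurable
          ({p : E × E | dist p.2 p.1 < 1 / (k + 1 : ℝ)}.indicator (1 : E × E → ℝ≥0∞)))
    _ = _ := by
      rw [ENNReal.liminf_mul_const_of_ne_top (measure_ne_top _ _), mul_comm]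

/-- An isometry-invariant probability measure on the unit sphere is unique. -/
theorem eq_of_invariant_sphere {μ ν : Measure E} [IsProbabilityMeasure μ] [IsProbabilityMeasure ν]
    (hμ : ∀ e : E ≃ₗᵢ[ℝ] E, μ.map e = μ) (hν : ∀ e : E ≃ₗᵢ[ℝ] E, ν.map e = ν)
    (hsμ : μ (sphere 0 1)ᶜ = 0) (hsν : ν (sphere 0 1)ᶜ = 0) : μ = ν := by
  obtain ⟨x₀, hx₀⟩ : ∃ x₀ : E, ‖x₀‖ = 1 := by
    by_contra! h
    have : (sphere (0 : E) 1)ᶜ = univ := by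
      ext x; simpa using h x
    rw [this] at hsμ
    simp at hsμ
  have main : ∀ {μ ν : Measure E} [IsProbabilityMeasure μ] [IsProbabilityMeasure ν]
      (hμ : ∀ e : E ≃ₗᵢ[ℝ] E, μ.map e = μ) (hν : ∀ e : E ≃ₗᵢ[ℝ] E, ν.map e = ν)
      (hsμ : μ (sphere 0 1)ᶜ = 0) (hsν : ν (sphere 0 1)ᶜ = 0) {U : Set E} (hU : IsOpen U),
      μ U ≤ ν U := by
    intro μ ν _ _ hμ hν hsμ hsν U hU
    refine (measure_isOpen_le_liminf hμ hν hsμ hsν hx₀ hU).trans ?_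
    have h1 := measure_isOpen_le_liminf hν hμ hsν hsμ hx₀ isOpen_univ
    simp only [measure_univ, mul_one] at h1
    have h2 : liminf (fun k : ℕ => μ (ball x₀ (1 / (k + 1 : ℝ))) / ν (ball x₀ (1 / (k + 1 : ℝ))))
        atTop ≤ 1 := by
      refine (Filter.liminf_le_limsup (by isBoundedDefault) (by isBoundedDefault)).trans ?_
      have h3 := ENNReal.inv_le_inv.2 h1
      rw [ENNReal.inv_liminf, inv_one] at h3
      refine le_trans (le_of_eq ?_) h3
      congr 1
      ext k
      have hk : 0 < 1 / (k + 1 : ℝ) := by positivity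
      rw [ENNReal.inv_div (Or.inl (measure_ne_top _ _))
        (Or.inl (measure_ball_pos_of_invariant hμ hsμ hx₀ hk).ne')]
    calc _ ≤ 1 * ν U := by gcongr
      _ = ν U := one_mul _
  refine ext_of_generate_finite _ (BorelSpace.measurable_eq (α := E) ▸ rfl) isPiSystem_isOpen ?_ (by simp)
  intro U hU
  exact le_antisymm (main hμ hν hsμ hsν hU) (main hν hμ hsν hsμ hU)

end InvariantSphere

set_option linter.unusedSectionVars false

section HausdorffSphere

variable {E : Type*} [NormedAddCommGroup E] [InnerProductSpace ℝ E] [FiniteDimensional ℝ E]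
  [MeasurableSpace E] [BorelSpace E]

lemma finrank_orthogonal_span_of_norm_one {m : ℕ} (hm : Module.finrank ℝ E = m + 1) {x : E}
    (hx : ‖x‖ = 1) : Module.finrank ℝ (ℝ ∙ x)ᗮ = m := by
  have : Fact (Module.finrank ℝ E = m + 1) := ⟨hm⟩
  exact Submodule.finrank_orthogonal_span_singleton (by rintro rfl; simp at hx)

lemma hausdorffMeasure_sphere_pos {m : ℕ} (hm : Module.finrank ℝ E = m + 1) :
    0 < μH[m] (sphere (0 : E) 1) := by
  have : Nontrivial E := Module.nontrivial_of_finrank_pos (R := ℝ) (by omega)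
  obtain ⟨x, hx⟩ := exists_norm_eq E zero_le_one
  set F := (ℝ ∙ x)ᗮ with hF
  have hd := finrank_orthogonal_span_of_norm_one hm hx
  have hsub : closedBall (0 : F) 1 ⊆ F.orthogonalProjectionOnto '' sphere (0 : E) 1 := by
    intro y hy
    have hy1 : ‖(y : E)‖ ≤ 1 := by simpa using hy
    have hyx : inner ℝ (y : E) x = 0 := by
      rw [real_inner_comm]
      exact Submodule.mem_orthogonal_singleton_iff_inner_right.1 y.2
    refine ⟨(y : E) + Real.sqrt (1 - ‖(y : E)‖ ^ 2) • x, ?_, ?_⟩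
    · have h2 := norm_add_sq_real (y : E) (Real.sqrt (1 - ‖(y : E)‖ ^ 2) • x)
      rw [inner_smul_right, hyx, norm_smul, hx, mul_one, Real.norm_eq_abs, sq_abs,
        Real.sq_sqrt (by nlinarith [norm_nonneg (y : E)])] at h2
      have h3 : ‖(y : E) + Real.sqrt (1 - ‖(y : E)‖ ^ 2) • x‖ ^ 2 = 1 := by rw [h2]; ring
      rw [mem_sphere_zero_iff_norm]
      exact (pow_eq_one_iff_of_nonneg (norm_nonneg _) two_ne_zero).1 h3
    · have hxF : x ∈ Fᗮ := by
        rw [hF, Submodule.orthogonal_orthogonal]; exact Submodule.mem_span_singleton_self x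
      rw [map_add, map_smul, Submodule.orthogonalProjectionOnto_eq_zero_iff.2 hxF, smul_zero, add_zero]
      simp
  have h1 : 0 < μH[m] (closedBall (0 : F) 1) := by
    have : (μH[m] : Measure F) = μH[Module.finrank ℝ F] := by rw [hd]
    rw [this]
    exact measure_closedBall_pos _ _ one_pos
  have hl : LipschitzWith 1 F.orthogonalProjectionOnto := by
    refine (ContinuousLinearMap.lipschitz _).weaken ?_
    exact F.orthogonalProjectionOnto_norm_le
  have h2 := hl.hausdorffMeasure_image_le (d := m) (by positivity) (sphere (0 : E) 1)
  simp only [ENNReal.coe_one, ENNReal.one_rpow, one_mul] at h2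
  exact h1.trans_le ((measure_mono hsub).trans h2)

lemma norm_normalize_sub_le {u v : E} (hu : 1 ≤ ‖u‖) (hv : 1 ≤ ‖v‖) :
    ‖‖u‖⁻¹ • u - ‖v‖⁻¹ • v‖ ≤ 2 * ‖u - v‖ := by
  have h : ‖u‖⁻¹ • u - ‖v‖⁻¹ • v = ‖u‖⁻¹ • ((u - v) + (‖v‖ - ‖u‖) • (‖v‖⁻¹ • v)) := by
    have hu0 : ‖u‖ ≠ 0 := by positivity
    have hv0 : ‖v‖ ≠ 0 := by positivity
    rw [smul_add, smul_sub, smul_smul, smul_smul]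
    rw [show ‖u‖⁻¹ * (‖v‖ - ‖u‖) * ‖v‖⁻¹ = ‖u‖⁻¹ - ‖v‖⁻¹ by field_simp]
    rw [sub_smul]; abel
  rw [h, norm_smul, norm_inv, norm_norm]
  have h1 : ‖(u - v) + (‖v‖ - ‖u‖) • (‖v‖⁻¹ • v)‖ ≤ 2 * ‖u - v‖ := by
    refine (norm_add_le _ _).trans ?_
    rw [norm_smul, norm_smul, norm_inv, norm_norm, inv_mul_cancel₀ (by positivity), mul_one,
      Real.norm_eq_abs]
    have := abs_norm_sub_norm_le v u
    rw [norm_sub_rev] at this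
    linarith
  calc _ ≤ 1 * (2 * ‖u - v‖) := by
        gcongr
        exact inv_le_one_of_one_le₀ hu
    _ = _ := one_mul _

lemma hausdorffMeasure_sphere_lt_top {m : ℕ} (hm : Module.finrank ℝ E = m + 1) :
    μH[m] (sphere (0 : E) 1) < ⊤ := by
  refine (isCompact_sphere (0 : E) 1).measure_lt_top_of_nhdsWithin fun x hx => ?_
  have hx1 : ‖x‖ = 1 := by simpa using hx
  set F := (ℝ ∙ x)ᗮ with hF
  have hd := finrank_orthogonal_span_of_norm_one hm hx1
  have horth : ∀ y : F, inner ℝ (y : E) x = 0 := fun y => by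
    rw [real_inner_comm]; exact Submodule.mem_orthogonal_singleton_iff_inner_right.1 y.2
  have hge : ∀ y : F, 1 ≤ ‖(y : E) + x‖ := fun y => by
    have h2 := norm_add_sq_real (y : E) x
    rw [horth, hx1] at h2
    nlinarith [norm_nonneg ((y : E) + x), sq_nonneg ‖(y : E)‖]
  have hl : LipschitzWith 2 (fun y : F => ‖(y : E) + x‖⁻¹ • ((y : E) + x)) := by
    refine LipschitzWith.of_dist_le_mul fun y z => ?_
    rw [dist_eq_norm, dist_eq_norm]
    refine (norm_normalize_sub_le (hge y) (hge z)).trans (le_of_eq ?_)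
    rw [add_sub_add_right_eq_sub]; rfl
  have hfin : μH[m] (closedBall (0 : F) 2) < ⊤ := by
    have : (μH[m] : Measure F) = μH[Module.finrank ℝ F] := by rw [hd]
    rw [this]
    exact measure_closedBall_lt_top
  have h2 := hl.hausdorffMeasure_image_le (d := m) (by positivity) (closedBall (0 : F) 2)
  have h3 : μH[m] ((fun y : F => ‖(y : E) + x‖⁻¹ • ((y : E) + x)) '' closedBall (0 : F) 2) < ⊤ :=
    h2.trans_lt (ENNReal.mul_lt_top (ENNReal.rpow_lt_top_of_nonneg (by positivity) (by simp)) hfin)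
  refine ⟨_, ?_, h3⟩
  have hopen : {z : E | 1 / 2 < inner ℝ x z} ∈ 𝓝 x := by
    refine IsOpen.mem_nhds (isOpen_lt continuous_const (by fun_prop)) ?_
    simp [hx1]; norm_num
  filter_upwards [inter_mem_nhdsWithin (sphere (0 : E) 1) hopen] with z hz
  obtain ⟨hz1, hz2⟩ := hz
  have hz1 : ‖z‖ = 1 := by simpa using hz1
  set c := inner ℝ x z with hc
  have hz2 : 1 / 2 < c := hz2
  have hmem : c⁻¹ • z - x ∈ F := by
    rw [hF, Submodule.mem_orthogonal_singleton_iff_inner_right, inner_sub_right, inner_smul_right,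
      ← hc, real_inner_self_eq_norm_sq, hx1, inv_mul_cancel₀ (by positivity)]
    norm_num
  have hw := norm_sub_sq_real (c⁻¹ • z) x
  refine ⟨⟨_, hmem⟩, ?_, ?_⟩
  · have : ‖c⁻¹ • z - x‖ ≤ 2 := by
      rw [real_inner_smul_left, real_inner_comm, ← hc, inv_mul_cancel₀ (by positivity), norm_smul,
        hz1, hx1] at hw
      have hci : c⁻¹ < 2 := by
        rw [inv_lt_comm₀ (by positivity) (by norm_num)]; linarith
      have hc0 : 0 < c⁻¹ := by positivity
      rw [Real.norm_of_nonneg hc0.le] at hw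
      nlinarith [norm_nonneg (c⁻¹ • z - x)]
    simpa using this
  · have hc0 : 0 < c⁻¹ := by have : 0 < c := by linarith
                             positivity
    simp only [sub_add_cancel]
    rw [norm_smul, hz1, mul_one, Real.norm_of_nonneg hc0.le, smul_smul, inv_mul_cancel₀ hc0.ne',
      one_smul]

end HausdorffSphere

section SphereMeasure

variable {n : ℕ}

lemma finrank_real_En (n : ℕ) : Module.finrank ℝ (En n) = 2 * n := by
  have := finrank_real_of_complex (En n)
  rw [this, finrank_euclideanSpace_fin]

lemma hausdorff_Sn_ne_zero (hn : n ≠ 0) : μH[(2 * n - 1 : ℝ)] (Sn n) ≠ 0 := by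
  have h := hausdorffMeasure_sphere_pos (E := En n) (m := 2 * n - 1)
    (by rw [finrank_real_En]; omega)
  rw [show (2 * n - 1 : ℝ) = ((2 * n - 1 : ℕ) : ℝ) by
    rw [Nat.cast_sub (by omega)]; push_cast; rfl]
  exact h.ne'

lemma hausdorff_Sn_ne_top (hn : n ≠ 0) : μH[(2 * n - 1 : ℝ)] (Sn n) ≠ ⊤ := by
  have h := hausdorffMeasure_sphere_lt_top (E := En n) (m := 2 * n - 1)
    (by rw [finrank_real_En]; omega)
  rw [show (2 * n - 1 : ℝ) = ((2 * n - 1 : ℕ) : ℝ) by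
    rw [Nat.cast_sub (by omega)]; push_cast; rfl]
  exact h.ne

instance isProbabilityMeasure_sigmaS [NeZero n] : IsProbabilityMeasure (sigmaS n) := by
  constructor
  rw [sigmaS, Measure.smul_apply, Measure.restrict_apply_univ, smul_eq_mul]
  exact ENNReal.inv_mul_cancel (hausdorff_Sn_ne_zero (NeZero.ne n)) (hausdorff_Sn_ne_top (NeZero.ne n))

lemma measurableSet_Bn : MeasurableSet (Bn n) := isOpen_ball.measurableSet

lemma sigmaS_compl : sigmaS n (sphere 0 1)ᶜ = 0 := by
  rw [sigmaS, Measure.smul_apply, Measure.restrict_apply isClosed_sphere.measurableSet.compl]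
  simp [Sn]

lemma sigmaS_ae_norm : ∀ᵐ ζ ∂(sigmaS n), ‖ζ‖ = 1 := by
  filter_upwards [measure_eq_zero_iff_ae_notMem.1 (sigmaS_compl (n := n))] with x hx
  simpa using hx

lemma sigmaS_map (e : En n ≃ₗᵢ[ℝ] En n) : (sigmaS n).map e = sigmaS n := by
  ext s hs
  rw [Measure.map_apply e.continuous.measurable hs, sigmaS, Measure.smul_apply, Measure.smul_apply,
    Measure.restrict_apply hs, Measure.restrict_apply (e.continuous.measurable hs)]
  congr 1
  have : e ⁻¹' s ∩ Sn n = e ⁻¹' (s ∩ Sn n) := by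
    ext x; simp [Sn]
  rw [this]
  have h := e.isometry.hausdorffMeasure_preimage (d := (2 * n - 1 : ℝ)) (Or.inr e.surjective) (s ∩ Sn n)
  rwa [e.surjective.range_eq, inter_univ] at h

lemma volume_Bn_ne_zero : volume (Bn n) ≠ 0 := (measure_ball_pos _ _ one_pos).ne'

lemma volume_Bn_ne_top : volume (Bn n) ≠ ⊤ := measure_ball_lt_top.ne

instance isProbabilityMeasure_volN : IsProbabilityMeasure (volN n) := by
  constructor
  rw [volN, Measure.smul_apply, Measure.restrict_apply_univ, smul_eq_mul]
  exact ENNReal.inv_mul_cancel volume_Bn_ne_zero volume_Bn_ne_top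

lemma volN_map (e : En n ≃ₗᵢ[ℝ] En n) : (volN n).map e = volN n := by
  ext s hs
  rw [Measure.map_apply e.continuous.measurable hs, volN, Measure.smul_apply, Measure.smul_apply,
    Measure.restrict_apply hs, Measure.restrict_apply (e.continuous.measurable hs)]
  congr 1
  have : e ⁻¹' s ∩ Bn n = e ⁻¹' (s ∩ Bn n) := by
    ext x; simp [Bn]
  rw [this, e.measurePreserving.measure_preimage (hs.inter measurableSet_Bn).nullMeasurableSet]

lemma measurable_normalize : Measurable (fun z : En n => ‖z‖⁻¹ • z) :=
  (measurable_norm.inv).smul measurable_id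

lemma map_normalize_volN [NeZero n] : (volN n).map (fun z => ‖z‖⁻¹ • z) = sigmaS n := by
  have : IsProbabilityMeasure ((volN n).map (fun z => ‖z‖⁻¹ • z)) :=
    Measure.isProbabilityMeasure_map measurable_normalize.aemeasurable
  refine eq_of_invariant_sphere (fun e => ?_) sigmaS_map ?_ sigmaS_compl
  · rw [Measure.map_map e.continuous.measurable measurable_normalize]
    conv_rhs => rw [← volN_map e]
    rw [Measure.map_map measurable_normalize e.continuous.measurable]
    congr 1
    ext z : 1
    simp
  · rw [Measure.map_apply measurable_normalize isClosed_sphere.measurableSet.compl]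
    have : (fun z : En n => ‖z‖⁻¹ • z) ⁻¹' (sphere 0 1)ᶜ ⊆ {0} := by
      intro z hz
      by_contra h
      have : ‖z‖ ≠ 0 := by simpa using h
      simp [norm_smul, this] at hz
    refine measure_mono_null this ?_
    have : Nontrivial (En n) := Module.nontrivial_of_finrank_pos (R := ℝ)
      (by rw [finrank_real_En]; have := NeZero.pos n; omega)
    rw [volN, Measure.smul_apply, Measure.restrict_apply (measurableSet_singleton _)]
    rw [measure_mono_null inter_subset_left (measure_singleton (0 : En n)), smul_zero]

lemma map_val_toSphere [NeZero n] :
    ((volume : Measure (En n)).toSphere).map Subtype.val =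
      ((2 * n : ℕ) * volume (Bn n)) • sigmaS n := by
  ext s hs
  rw [Measure.map_apply measurable_subtype_coe hs,
    Measure.toSphere_apply' _ (measurable_subtype_coe hs), finrank_real_En, ← map_normalize_volN,
    Measure.smul_apply, Measure.map_apply measurable_normalize hs, volN, Measure.smul_apply,
    Measure.restrict_apply (measurable_normalize hs), smul_eq_mul, smul_eq_mul, mul_assoc,
    ← mul_assoc (volume _), ENNReal.mul_inv_cancel volume_Bn_ne_zero volume_Bn_ne_top, one_mul]
  congr 1
  have : Nontrivial (En n) := Module.nontrivial_of_finrank_pos (R := ℝ)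
      (by rw [finrank_real_En]; have := NeZero.pos n; omega)
  have h0 : volume ({0} : Set (En n)) = 0 := measure_singleton 0
  rw [← measure_sdiff_null h0 (s := (fun z : En n => ‖z‖⁻¹ • z) ⁻¹' s ∩ Bn n)]
  congr 1
  ext z
  simp only [Set.mem_smul, mem_image, mem_preimage, Subtype.exists, exists_and_left, exists_prop,
    Set.mem_sdiff, mem_inter_iff, mem_singleton_iff, mem_Ioo, Bn, mem_ball_zero_iff]
  constructor
  · rintro ⟨r, ⟨hr0, hr1⟩, y, ⟨⟩, rfl⟩
    rename_i y hy
    obtain ⟨h1, h2, rfl⟩ := hy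
    have hy1 : ‖y‖ = 1 := by simpa using h2
    have hy0 : y ≠ 0 := by rintro rfl; simp at hy1
    refine ⟨⟨?_, ?_⟩, by simp [hr0.ne', hy0]⟩
    · show ‖r • y‖⁻¹ • r • y ∈ s
      rw [norm_smul, hy1, mul_one, Real.norm_of_nonneg hr0.le, smul_smul, inv_mul_cancel₀ hr0.ne',
        one_smul]; exact h1
    · rw [norm_smul, hy1, mul_one, Real.norm_of_nonneg hr0.le]; exact hr1
  · rintro ⟨⟨h1, h2⟩, h3⟩
    have h4 : 0 < ‖z‖ := norm_pos_iff.2 h3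
    refine ⟨‖z‖, ⟨h4, h2⟩, ‖z‖⁻¹ • z, ⟨_, h1, ?_, rfl⟩, ?_⟩
    · simp [norm_smul, h4.ne']
    · rw [smul_smul, mul_inv_cancel₀ h4.ne', one_smul]

/-- Integration in polar coordinates. -/
theorem lintegral_volN_eq [NeZero n] {f : En n → ℝ≥0∞} (hf : Measurable f) :
    ∫⁻ z, f z ∂(volN n) = ∫⁻ r in Ioo (0 : ℝ) 1, ENNReal.ofReal (2 * n * r ^ (2 * n - 1)) *
      ∫⁻ ζ, f (r • ζ) ∂(sigmaS n) := by
  have : Nontrivial (En n) := Module.nontrivial_of_finrank_pos (R := ℝ)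
      (by rw [finrank_real_En]; have := NeZero.pos n; omega)
  set F : En n → ℝ≥0∞ := (Bn n).indicator f with hF
  have hFm : Measurable F := hf.indicator measurableSet_Bn
  have h1 : ∫⁻ z, f z ∂(volN n) = (volume (Bn n))⁻¹ * ∫⁻ z, F z := by
    rw [volN, lintegral_smul_measure, hF, lintegral_indicator measurableSet_Bn, smul_eq_mul]
  have h2 : ∫⁻ z, F z = ∫⁻ z : ({0}ᶜ : Set (En n)), F z ∂(volume.comap Subtype.val) := by
    rw [lintegral_subtype_comap (measurableSet_singleton _).compl, restrict_compl_singleton]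
  have mp := (volume : Measure (En n)).measurePreserving_homeomorphUnitSphereProd
  have h3 : ∫⁻ z : ({0}ᶜ : Set (En n)), F z ∂(volume.comap Subtype.val) =
      ∫⁻ q : sphere (0 : En n) 1 × Ioi (0 : ℝ), F ((q.2 : ℝ) • (q.1 : En n))
        ∂(((volume : Measure (En n)).toSphere).prod (Measure.volumeIoiPow (2 * n - 1))) := by
    rw [finrank_real_En] at mp
    rw [← mp.lintegral_comp (f := fun q => F ((q.2 : ℝ) • (q.1 : En n))) (hFm.comp (by fun_prop))]
    refine lintegral_congr fun z => ?_
    have hz : ‖(z : En n)‖ ≠ 0 := norm_ne_zero_iff.2 z.2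
    simp [smul_smul, mul_inv_cancel₀ hz]
  have hm2 : Measurable (fun q : sphere (0 : En n) 1 × Ioi (0 : ℝ) =>
      F ((q.2 : ℝ) • (q.1 : En n))) := hFm.comp (by fun_prop)
  rw [h1, h2, h3, lintegral_prod_symm _ hm2.aemeasurable, Measure.volumeIoiPow,
    lintegral_withDensity_eq_lintegral_mul _ (by fun_prop) hm2.lintegral_prod_left']
  have hm3 : Measurable fun r : ℝ => ∫⁻ ζ, F (r • ζ) ∂(sigmaS n) := by
    have : Measurable fun q : ℝ × En n => F (q.1 • q.2) := hFm.comp (by fun_prop)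
    exact this.lintegral_prod_right'
  have h4 : ∀ r : Ioi (0 : ℝ), ∫⁻ ζ : sphere (0 : En n) 1, F ((r : ℝ) • (ζ : En n))
      ∂(volume : Measure (En n)).toSphere =
      ((2 * n : ℕ) * volume (Bn n)) * ∫⁻ ζ, F ((r : ℝ) • ζ) ∂(sigmaS n) := by
    intro r
    rw [← smul_eq_mul, ← lintegral_smul_measure, ← map_val_toSphere,
      lintegral_map (f := fun a => F ((r : ℝ) • a)) (hFm.comp (by fun_prop)) measurable_subtype_coe]
  simp only [Pi.mul_apply, h4]
  rw [lintegral_subtype_comap measurableSet_Ioi (fun r : ℝ => ENNReal.ofReal (r ^ (2 * n - 1)) *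
    (((2 * n : ℕ) * volume (Bn n)) * ∫⁻ ζ, F ((r : ℝ) • ζ) ∂(sigmaS n)))]
  rw [← lintegral_const_mul _ (by fun_prop (disch := assumption))]
  rw [← lintegral_indicator measurableSet_Ioi, ← lintegral_indicator measurableSet_Ioo]
  refine lintegral_congr fun r => ?_
  by_cases hr : 0 < r
  · rw [indicator_of_mem (mem_Ioi.2 hr)]
    have h5 : (volume (Bn n))⁻¹ * (ENNReal.ofReal (r ^ (2 * n - 1)) * (((2 * n : ℕ) : ℝ≥0∞) *
        volume (Bn n) * ∫⁻ ζ, F (r • ζ) ∂(sigmaS n))) = ENNReal.ofReal (2 * n * r ^ (2 * n - 1)) *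
        ∫⁻ ζ, F (r • ζ) ∂(sigmaS n) := by
      rw [ENNReal.ofReal_mul (by positivity)]
      have h6 : ENNReal.ofReal (2 * n : ℝ) = ((2 * n : ℕ) : ℝ≥0∞) := by
        rw [← ENNReal.ofReal_natCast]; push_cast; rfl
      rw [h6]
      calc _ = ((volume (Bn n))⁻¹ * volume (Bn n)) * ((((2 * n : ℕ) : ℝ≥0∞)) *
            ENNReal.ofReal (r ^ (2 * n - 1)) * ∫⁻ ζ, F (r • ζ) ∂(sigmaS n)) := by ring
        _ = _ := by rw [ENNReal.inv_mul_cancel volume_Bn_ne_zero volume_Bn_ne_top, one_mul]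
    refine h5.trans ?_
    by_cases hr1 : r < 1
    · rw [indicator_of_mem (mem_Ioo.2 ⟨hr, hr1⟩)]
      congr 1
      refine lintegral_congr_ae ?_
      filter_upwards [sigmaS_ae_norm (n := n)] with ζ hζ
      rw [hF, indicator_of_mem]
      simp only [Bn, mem_ball_zero_iff, norm_smul, hζ, mul_one, Real.norm_of_nonneg hr.le, hr1]
    · rw [indicator_of_notMem (fun h => hr1 h.2)]
      have : ∫⁻ ζ, F (r • ζ) ∂(sigmaS n) = 0 := by
        rw [lintegral_eq_zero_iff (f := fun ζ => F (r • ζ)) (hFm.comp (by fun_prop))]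
        filter_upwards [sigmaS_ae_norm (n := n)] with ζ hζ
        rw [hF, indicator_of_notMem]
        · rfl
        · simp only [Bn, mem_ball_zero_iff, norm_smul, hζ, mul_one, Real.norm_of_nonneg hr.le, hr1,
            not_false_eq_true]
      rw [this, mul_zero]
  · rw [indicator_of_notMem (by simpa using hr), indicator_of_notMem (fun h => hr h.1)]

end SphereMeasure

section HardySteinIdentity

/-- The first derivative of `(‖h‖² + ε) ^ β` along a curve. -/
def powD1 (ε β : ℝ) (z z₁ : ℂ) : ℝ := 2 * β * (‖z‖ ^ 2 + ε) ^ (β - 1) * inner ℝ z z₁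

/-- The second derivative of `(‖h‖² + ε) ^ β` along a curve. -/
def powD2 (ε β : ℝ) (z z₁ z₂ : ℂ) : ℝ :=
  2 * β * (‖z‖ ^ 2 + ε) ^ (β - 1) * (‖z₁‖ ^ 2 + inner ℝ z z₂) +
    4 * β * (β - 1) * (‖z‖ ^ 2 + ε) ^ (β - 2) * inner ℝ z z₁ ^ 2

/-- The Laplacian of `(‖G‖² + ε) ^ β` for holomorphic `G` with derivative `z₁`. -/
def powLap (ε β : ℝ) (z z₁ : ℂ) : ℝ :=
  4 * β * (‖z‖ ^ 2 + ε) ^ (β - 2) * ‖z₁‖ ^ 2 * (β * ‖z‖ ^ 2 + ε)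

lemma hasDerivAt_normSq_add_rpow {ε β : ℝ} (hε : 0 < ε) {h : ℝ → ℂ} {h₁ : ℂ} {x : ℝ}
    (hh : HasDerivAt h h₁ x) :
    HasDerivAt (fun y => (‖h y‖ ^ 2 + ε) ^ β) (powD1 ε β (h x) h₁) x := by
  have h1 : HasDerivAt (fun y => ‖h y‖ ^ 2 + ε) (2 * inner ℝ (h x) h₁) x := hh.norm_sq.add_const ε
  have := h1.rpow_const (p := β) (Or.inl (by positivity))
  convert this using 1
  rw [powD1]; ring

lemma hasDerivAt_powD1 {ε β : ℝ} (hε : 0 < ε) {h h₁ : ℝ → ℂ} {h₂ : ℂ} {x : ℝ}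
    (hh : HasDerivAt h (h₁ x) x) (hh₁ : HasDerivAt h₁ h₂ x) :
    HasDerivAt (fun y => powD1 ε β (h y) (h₁ y)) (powD2 ε β (h x) (h₁ x) h₂) x := by
  have h1 : HasDerivAt (fun y => ‖h y‖ ^ 2 + ε) (2 * inner ℝ (h x) (h₁ x)) x := hh.norm_sq.add_const ε
  have h2 := (h1.rpow_const (p := β - 1) (Or.inl (by positivity))).const_mul (2 * β)
  have h3 := h2.mul (hh.inner ℝ hh₁)
  refine HasDerivAt.congr_deriv (f := fun y => powD1 ε β (h y) (h₁ y)) h3 ?_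
  rw [powD2, real_inner_self_eq_norm_sq, show β - 1 - 1 = β - 2 by ring]; ring

lemma powD2_add_powD2 {ε β : ℝ} (hε : 0 < ε) (z z₁ z₂ : ℂ) :
    powD2 ε β z z₁ z₂ + powD2 ε β z (Complex.I * z₁) (-z₂) = powLap ε β z z₁ := by
  have hX : (‖z‖ ^ 2 + ε) ^ (β - 1) = (‖z‖ ^ 2 + ε) ^ (β - 2) * (‖z‖ ^ 2 + ε) := by
    rw [← Real.rpow_add_one (by positivity)]; congr 1; ring
  have hin : inner ℝ z z₁ ^ 2 + inner ℝ z (Complex.I * z₁) ^ 2 = ‖z‖ ^ 2 * ‖z₁‖ ^ 2 := by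
    rw [Complex.inner, Complex.inner, ← Complex.normSq_eq_norm_sq, ← Complex.normSq_eq_norm_sq,
      Complex.normSq_apply, Complex.normSq_apply]
    simp; ring
  rw [powD2, powD2, powLap, hX, inner_neg_right, norm_mul, Complex.norm_I, one_mul]
  linear_combination 4 * β * (β - 1) * (‖z‖ ^ 2 + ε) ^ (β - 2) * hin

lemma continuousOn_powD2 {X : Type*} [TopologicalSpace X] {s : Set X} {ε β : ℝ} (hε : 0 < ε)
    {f g h : X → ℂ} (hf : ContinuousOn f s) (hg : ContinuousOn g s) (hh : ContinuousOn h s) :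
    ContinuousOn (fun x => powD2 ε β (f x) (g x) (h x)) s := by
  have : ∀ γ : ℝ, ContinuousOn (fun x => (‖f x‖ ^ 2 + ε) ^ γ) s := fun γ =>
    ((hf.norm.pow 2).add continuousOn_const).rpow_const fun p _ => Or.inl
      (by show ‖f p‖ ^ 2 + ε ≠ 0; positivity)
  have h1 := this (β - 1)
  have h2 := this (β - 2)
  unfold powD2
  fun_prop

lemma second_difference_eq {u u₁ u₂ : ℝ → ℝ} {a b : ℝ} (hab : a ≤ b)
    (hu : ∀ x ∈ Icc a b, HasDerivAt u (u₁ x) x) (hu₁ : ∀ x ∈ Icc a b, HasDerivAt u₁ (u₂ x) x)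
    (hu₂ : ContinuousOn u₂ (Icc a b)) :
    ∫ τ in a..b, min (b - τ) (τ - a) * u₂ τ = u b + u a - 2 * u ((a + b) / 2) := by
  set m := (a + b) / 2 with hm
  have ham : a ≤ m := by linarith
  have hmb : m ≤ b := by linarith
  have hi : ∀ c d, c ∈ Icc a b → d ∈ Icc a b → ContinuousOn u₂ (uIcc c d) := fun c d hc hd =>
    hu₂.mono (uIcc_subset_Icc hc hd)
  have hK : Continuous fun τ : ℝ => min (b - τ) (τ - a) := by fun_prop
  have hma : m ∈ Icc a b := ⟨ham, hmb⟩
  have haa : a ∈ Icc a b := ⟨le_rfl, hab⟩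
  have hbb : b ∈ Icc a b := ⟨hab, le_rfl⟩
  have hintg : ∀ c d, c ∈ Icc a b → d ∈ Icc a b →
      IntervalIntegrable (fun τ => min (b - τ) (τ - a) * u₂ τ) volume c d := fun c d hc hd =>
    (hK.continuousOn.mul (hi c d hc hd)).intervalIntegrable
  have hu1i : ∀ c d, c ∈ Icc a b → d ∈ Icc a b → IntervalIntegrable u₁ volume c d :=
    fun c d hc hd => ContinuousOn.intervalIntegrable fun x hx =>
      (hu₁ x (uIcc_subset_Icc hc hd hx)).continuousAt.continuousWithinAt
  rw [← intervalIntegral.integral_add_adjacent_intervals (hintg a m haa hma) (hintg m b hma hbb)]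
  have e1 : ∫ τ in a..m, min (b - τ) (τ - a) * u₂ τ = ∫ τ in a..m, (τ - a) * u₂ τ := by
    refine intervalIntegral.integral_congr fun τ hτ => ?_
    rw [uIcc_of_le ham] at hτ
    rw [min_eq_right (by linarith [hτ.2])]
  have e2 : ∫ τ in m..b, min (b - τ) (τ - a) * u₂ τ = ∫ τ in m..b, (b - τ) * u₂ τ := by
    refine intervalIntegral.integral_congr fun τ hτ => ?_
    rw [uIcc_of_le hmb] at hτ
    rw [min_eq_left (by linarith [hτ.1])]
  rw [e1, e2,
    intervalIntegral.integral_mul_deriv_eq_deriv_mul (u := fun τ => τ - a) (u' := fun _ => 1) (v := u₁)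
      (fun x _ => (hasDerivAt_id x).sub_const a)
      (fun x hx => hu₁ x (uIcc_subset_Icc haa hma hx)) (by simp)
      (hi a m haa hma).intervalIntegrable,
    intervalIntegral.integral_mul_deriv_eq_deriv_mul (u := fun τ => b - τ) (u' := fun _ => -1) (v := u₁)
      (fun x _ => (hasDerivAt_id x).const_sub b)
      (fun x hx => hu₁ x (uIcc_subset_Icc hma hbb hx)) (by simp)
      (hi m b hma hbb).intervalIntegrable]
  simp only [one_mul, neg_one_mul, intervalIntegral.integral_neg]
  rw [intervalIntegral.integral_eq_sub_of_hasDerivAt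
      (fun x hx => hu x (uIcc_subset_Icc haa hma hx)) (hu1i a m haa hma),
    intervalIntegral.integral_eq_sub_of_hasDerivAt
      (fun x hx => hu x (uIcc_subset_Icc hma hbb hx)) (hu1i m b hma hbb)]
  rw [show b - m = m - a by rw [hm]; ring]
  ring

set_option maxHeartbeats 1000000 in
/-- The regularized Hardy–Stein identity in logarithmic coordinates. -/
theorem hardyStein_identity {L ε β : ℝ} (hε : 0 < ε) {G : ℂ → ℂ}
    (hG : DifferentiableOn ℂ G {w | w.re < L}) (hper : ∀ w, G (w + 2 * Real.pi * Complex.I) = G w)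
    {a b : ℝ} (hab : a ≤ b) (hb : b < L) :
    ∫ θ in (-Real.pi)..Real.pi, ((‖G (b + θ * Complex.I)‖ ^ 2 + ε) ^ β +
      (‖G (a + θ * Complex.I)‖ ^ 2 + ε) ^ β -
        2 * (‖G ((((a + b) / 2 : ℝ) : ℂ) + θ * Complex.I)‖ ^ 2 + ε) ^ β) =
    ∫ τ in a..b, min (b - τ) (τ - a) *
      ∫ θ in (-Real.pi)..Real.pi, powLap ε β (G (τ + θ * Complex.I)) (deriv G (τ + θ * Complex.I)) := by
  set H : Set ℂ := {w | w.re < L} with hH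
  have hHo : IsOpen H := isOpen_lt Complex.continuous_re continuous_const
  have hG1 : DifferentiableOn ℂ (deriv G) H := hG.deriv hHo
  have hG2 : DifferentiableOn ℂ (deriv (deriv G)) H := hG1.deriv hHo
  have hmem : ∀ τ θ : ℝ, τ < L → (τ : ℂ) + θ * Complex.I ∈ H := fun τ θ h => by simpa [hH] using h
  have hd : ∀ w ∈ H, HasDerivAt G (deriv G w) w := fun w hw =>
    (hG.differentiableAt (hHo.mem_nhds hw)).hasDerivAt
  have hd1 : ∀ w ∈ H, HasDerivAt (deriv G) (deriv (deriv G) w) w := fun w hw =>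
    (hG1.differentiableAt (hHo.mem_nhds hw)).hasDerivAt
  have hmapτ : ∀ τ θ : ℝ, HasDerivAt (fun τ : ℝ => (τ : ℂ) + θ * Complex.I) 1 τ := fun τ θ =>
    (Complex.ofRealCLM.hasDerivAt (x := τ)).add_const _
  have hmapθ : ∀ τ θ : ℝ, HasDerivAt (fun θ : ℝ => (τ : ℂ) + θ * Complex.I) Complex.I θ := fun τ θ => by
    have := ((Complex.ofRealCLM.hasDerivAt (x := θ)).mul_const Complex.I).const_add (τ : ℂ)
    simpa using this
  have hper1 : ∀ w, deriv G (w + 2 * Real.pi * Complex.I) = deriv G w := fun w => by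
    rw [← deriv_comp_add_const]
    congr 1
    ext w; exact hper w
  have hc2 : ∀ z₁ z₂ : ℂ, ContinuousOn (fun p : ℝ × ℝ => powD2 ε β (G (p.1 + p.2 * Complex.I))
      (z₁ * deriv G (p.1 + p.2 * Complex.I)) (z₂ * deriv (deriv G) (p.1 + p.2 * Complex.I)))
      {p | p.1 < L} := by
    intro z₁ z₂
    have hmaps : MapsTo (fun p : ℝ × ℝ => (p.1 : ℂ) + p.2 * Complex.I) {p | p.1 < L} H := fun p hp =>
      hmem p.1 p.2 hp
    have hcm : ContinuousOn (fun p : ℝ × ℝ => (p.1 : ℂ) + p.2 * Complex.I) {p | p.1 < L} := by fun_prop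
    have c0 : ContinuousOn (fun p : ℝ × ℝ => G (p.1 + p.2 * Complex.I)) {p | p.1 < L} :=
      hG.continuousOn.comp hcm hmaps
    have c1 : ContinuousOn (fun p : ℝ × ℝ => z₁ * deriv G (p.1 + p.2 * Complex.I)) {p | p.1 < L} :=
      continuousOn_const.mul (hG1.continuousOn.comp hcm hmaps)
    have c2 : ContinuousOn (fun p : ℝ × ℝ => z₂ * deriv (deriv G) (p.1 + p.2 * Complex.I))
        {p | p.1 < L} := continuousOn_const.mul (hG2.continuousOn.comp hcm hmaps)
    exact continuousOn_powD2 hε c0 c1 c2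
  have hrect : uIcc (-Real.pi) Real.pi ×ˢ uIcc a b ⊆ {p : ℝ × ℝ | p.2 < L} := by
    rintro ⟨θ, τ⟩ ⟨_, h2⟩
    rw [uIcc_of_le hab] at h2
    exact h2.2.trans_lt hb
  have step1 : ∀ θ : ℝ, ((‖G (b + θ * Complex.I)‖ ^ 2 + ε) ^ β +
      (‖G (a + θ * Complex.I)‖ ^ 2 + ε) ^ β -
        2 * (‖G ((((a + b) / 2 : ℝ) : ℂ) + θ * Complex.I)‖ ^ 2 + ε) ^ β) =
      ∫ τ in a..b, min (b - τ) (τ - a) * powD2 ε β (G (τ + θ * Complex.I))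
        (1 * deriv G (τ + θ * Complex.I)) (1 * deriv (deriv G) (τ + θ * Complex.I)) := by
    intro θ
    refine (second_difference_eq (u := fun τ : ℝ => (‖G (τ + θ * Complex.I)‖ ^ 2 + ε) ^ β)
      (u₁ := fun τ : ℝ => powD1 ε β (G (τ + θ * Complex.I)) (deriv G (τ + θ * Complex.I)))
      hab (fun τ hτ => ?_) (fun τ hτ => ?_) ?_).symm
    · have := (hd _ (hmem τ θ (hτ.2.trans_lt hb))).comp τ (hmapτ τ θ)
      rw [mul_one] at this
      exact hasDerivAt_normSq_add_rpow hε this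
    · have h1 := (hd _ (hmem τ θ (hτ.2.trans_lt hb))).comp τ (hmapτ τ θ)
      have h2 := (hd1 _ (hmem τ θ (hτ.2.trans_lt hb))).comp τ (hmapτ τ θ)
      rw [mul_one] at h1 h2
      rw [one_mul, one_mul]
      exact hasDerivAt_powD1 hε (h := fun τ : ℝ => G (τ + θ * Complex.I))
        (h₁ := fun τ : ℝ => deriv G (τ + θ * Complex.I)) h1 h2
    · exact (hc2 1 1).comp (f := fun τ : ℝ => (τ, θ)) (by fun_prop) fun τ hτ => hτ.2.trans_lt hb
  have step2 : ∀ τ ∈ Icc a b, ∫ θ in (-Real.pi)..Real.pi, powD2 ε β (G (τ + θ * Complex.I))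
        (Complex.I * deriv G (τ + θ * Complex.I)) (-1 * deriv (deriv G) (τ + θ * Complex.I)) = 0 := by
    intro τ hτ
    have hτL := hτ.2.trans_lt hb
    rw [intervalIntegral.integral_eq_sub_of_hasDerivAt (f := fun θ : ℝ => powD1 ε β
      (G (τ + θ * Complex.I)) (Complex.I * deriv G (τ + θ * Complex.I)))]
    · have hw : (τ : ℂ) + (Real.pi : ℝ) * Complex.I =
          (τ + ((-Real.pi : ℝ) : ℂ) * Complex.I) + 2 * Real.pi * Complex.I := by push_cast; ring
      rw [hw, hper, hper1, sub_self]
    · intro θ _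
      have h1 := (hd _ (hmem τ θ hτL)).comp θ (hmapθ τ θ)
      have h2 := ((hd1 _ (hmem τ θ hτL)).comp θ (hmapθ τ θ)).const_mul Complex.I
      rw [mul_comm] at h1
      rw [show Complex.I * (deriv (deriv G) (↑τ + ↑θ * Complex.I) * Complex.I) =
        (Complex.I * Complex.I) * deriv (deriv G) (↑τ + ↑θ * Complex.I) by ring, Complex.I_mul_I] at h2
      exact hasDerivAt_powD1 hε (h := fun θ : ℝ => G (τ + θ * Complex.I))
        (h₁ := fun θ : ℝ => Complex.I * deriv G (τ + θ * Complex.I)) h1 h2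
    · refine ContinuousOn.intervalIntegrable ?_
      exact (hc2 Complex.I (-1)).comp (f := fun θ : ℝ => (τ, θ)) (by fun_prop) fun θ _ => hτL
  rw [intervalIntegral.integral_congr fun θ _ => step1 θ,
    MeasureTheory.intervalIntegral_intervalIntegral_swap]
  · refine intervalIntegral.integral_congr fun τ hτ => ?_
    rw [uIcc_of_le hab] at hτ
    have hτL := hτ.2.trans_lt hb
    have hci : ∀ z₁ z₂ : ℂ, IntervalIntegrable (fun θ : ℝ => powD2 ε β (G (τ + θ * Complex.I))
        (z₁ * deriv G (τ + θ * Complex.I)) (z₂ * deriv (deriv G) (τ + θ * Complex.I))) volume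
        (-Real.pi) Real.pi := fun z₁ z₂ =>
      ContinuousOn.intervalIntegrable
        ((hc2 z₁ z₂).comp (f := fun θ : ℝ => (τ, θ)) (by fun_prop) fun θ _ => hτL)
    rw [intervalIntegral.integral_const_mul]
    congr 1
    rw [← add_zero (∫ θ in (-Real.pi)..Real.pi, _), ← step2 τ hτ,
      ← intervalIntegral.integral_add (hci 1 1) (hci Complex.I (-1))]
    refine intervalIntegral.integral_congr fun θ _ => ?_
    simp only [one_mul, neg_one_mul]
    exact powD2_add_powD2 hε _ _ _
  · have hK : Continuous fun p : ℝ × ℝ => min (b - p.2) (p.2 - a) := by fun_prop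
    have hc : ContinuousOn (fun p : ℝ × ℝ => min (b - p.2) (p.2 - a) *
        powD2 ε β (G (p.2 + p.1 * Complex.I)) (1 * deriv G (p.2 + p.1 * Complex.I))
          (1 * deriv (deriv G) (p.2 + p.1 * Complex.I))) (uIcc (-Real.pi) Real.pi ×ˢ uIcc a b) :=
      hK.continuousOn.mul ((hc2 1 1).comp (f := fun p : ℝ × ℝ => (p.2, p.1)) (by fun_prop)
        fun p hp => hrect hp)
    exact (hc.integrableOn_compact (isCompact_uIcc.prod isCompact_uIcc)).mono_set
      (prod_mono uIoc_subset_uIcc uIoc_subset_uIcc)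

end HardySteinIdentity

section LogHolomorphic

/-- Normalized Lebesgue measure on `(-π, π]`. -/
def thetaM : Measure ℝ := (ENNReal.ofReal (2 * Real.pi))⁻¹ • volume.restrict (Ioc (-Real.pi) Real.pi)

instance : IsProbabilityMeasure thetaM := by
  constructor
  rw [thetaM, Measure.smul_apply, Measure.restrict_apply_univ, Real.volume_Ioc, smul_eq_mul,
    show Real.pi - -Real.pi = 2 * Real.pi by ring]
  exact ENNReal.inv_mul_cancel (by simp [Real.pi_pos]) ENNReal.ofReal_ne_top

/-- Functions on a left half-plane which are holomorphic, `2πi`-periodic and bounded to the left: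
these are the functions `w ↦ f (exp w)` with `f` holomorphic on a disc of radius `exp L`. -/
structure LogHol (L : ℝ) (G : ℂ → ℂ) : Prop where
  diff : DifferentiableOn ℂ G {w | w.re < L}
  per : ∀ w, G (w + 2 * Real.pi * Complex.I) = G w
  bdd : ∀ b < L, ∃ C : ℝ, ∀ w : ℂ, w.re ≤ b → ‖G w‖ ≤ C
  meas : Measurable G

/-- The integral mean of `|G|^q` on a vertical line. -/
def logMean (G : ℂ → ℂ) (q τ : ℝ) : ℝ≥0∞ := ∫⁻ θ, ‖G (τ + θ * Complex.I)‖ₑ ^ q ∂thetaM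

/-- The integral mean of `|G|^(q-2) |G'|^2` on a vertical line. -/
def logEnergy (G : ℂ → ℂ) (q τ : ℝ) : ℝ≥0∞ :=
  ∫⁻ θ, ‖G (τ + θ * Complex.I)‖ₑ ^ (q - 2) * ‖deriv G (τ + θ * Complex.I)‖ₑ ^ 2 ∂thetaM

/-- The tent kernel. -/
def tent (a b τ : ℝ) : ℝ≥0∞ := ENNReal.ofReal (min (b - τ) (τ - a))

variable {L : ℝ} {G : ℂ → ℂ}

lemma measurable_line (τ : ℝ) : Measurable fun θ : ℝ => (τ : ℂ) + θ * Complex.I := by fun_prop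

lemma measurable_plane : Measurable fun p : ℝ × ℝ => (p.1 : ℂ) + p.2 * Complex.I := by fun_prop

lemma measurable_tent (a b : ℝ) : Measurable (tent a b) := by unfold tent; fun_prop

lemma ofReal_intervalIntegral_pi {f : ℝ → ℝ} (hf : Continuous f) (h0 : ∀ x, 0 ≤ f x) :
    ENNReal.ofReal (∫ θ in (-Real.pi)..Real.pi, f θ) =
      ENNReal.ofReal (2 * Real.pi) * ∫⁻ θ, ENNReal.ofReal (f θ) ∂thetaM := by
  rw [intervalIntegral.integral_of_le (by linarith [Real.pi_pos]),
    ofReal_integral_eq_lintegral_ofReal (hf.integrableOn_Ioc) (Eventually.of_forall h0), thetaM,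
    lintegral_smul_measure, smul_eq_mul, ← mul_assoc,
    ENNReal.mul_inv_cancel (by simp [Real.pi_pos]) ENNReal.ofReal_ne_top, one_mul]

/-- Regularized version of `logMean`. -/
def regMean (G : ℂ → ℂ) (ε β τ : ℝ) : ℝ≥0∞ :=
  ∫⁻ θ, ENNReal.ofReal ((‖G (τ + θ * Complex.I)‖ ^ 2 + ε) ^ β) ∂thetaM

/-- Regularized version of `logEnergy`. -/
def regEnergy (G : ℂ → ℂ) (ε β τ : ℝ) : ℝ≥0∞ :=
  ∫⁻ θ, ENNReal.ofReal (powLap ε β (G (τ + θ * Complex.I)) (deriv G (τ + θ * Complex.I))) ∂thetaM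

lemma continuous_powLap {ε β : ℝ} (hε : 0 < ε) : Continuous fun p : ℂ × ℂ => powLap ε β p.1 p.2 := by
  have : Continuous fun p : ℂ × ℂ => (‖p.1‖ ^ 2 + ε) ^ (β - 2) :=
    (by fun_prop : Continuous fun p : ℂ × ℂ => ‖p.1‖ ^ 2 + ε).rpow_const
      fun p => Or.inl (by positivity)
  unfold powLap
  fun_prop

lemma _root_.ContinuousOn.powLap {X : Type*} [TopologicalSpace X] {s : Set X} {ε β : ℝ} (hε : 0 < ε)
    {f g : X → ℂ} (hf : ContinuousOn f s) (hg : ContinuousOn g s) :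
    ContinuousOn (fun x => powLap ε β (f x) (g x)) s := by
  have : ContinuousOn (fun x => (‖f x‖ ^ 2 + ε) ^ (β - 2)) s :=
    ((hf.norm.pow 2).add continuousOn_const).rpow_const fun p _ => Or.inl
      (by show ‖f p‖ ^ 2 + ε ≠ 0; positivity)
  unfold _root_.powLap
  fun_prop

lemma powLap_nonneg {ε β : ℝ} (hε : 0 < ε) (hβ : 0 < β) (z z₁ : ℂ) : 0 ≤ powLap ε β z z₁ := by
  unfold powLap; positivity

namespace LogHol

lemma isOpen_half (L : ℝ) : IsOpen {w : ℂ | w.re < L} := isOpen_lt Complex.continuous_re continuous_const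

lemma continuous_line (hG : LogHol L G) {τ : ℝ} (hτ : τ < L) :
    Continuous fun θ : ℝ => G (τ + θ * Complex.I) :=
  hG.diff.continuousOn.comp_continuous (by fun_prop) fun θ => by simpa using hτ

lemma continuous_deriv_line (hG : LogHol L G) {τ : ℝ} (hτ : τ < L) :
    Continuous fun θ : ℝ => deriv G (τ + θ * Complex.I) :=
  (hG.diff.deriv (isOpen_half L)).continuousOn.comp_continuous (by fun_prop) fun θ => by simpa using hτ

lemma mul {G' : ℂ → ℂ} (hG : LogHol L G) (hG' : LogHol L G') : LogHol L fun w => G w * G' w where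
  diff := hG.diff.mul hG'.diff
  per w := by rw [hG.per, hG'.per]
  bdd b hb := by
    obtain ⟨C, hC⟩ := hG.bdd b hb
    obtain ⟨C', hC'⟩ := hG'.bdd b hb
    refine ⟨C * C', fun w hw => ?_⟩
    rw [norm_mul]
    exact mul_le_mul (hC w hw) (hC' w hw) (norm_nonneg _) ((norm_nonneg _).trans (hC w hw))
  meas := hG.meas.mul hG'.meas

lemma exists_logMean_le (hG : LogHol L G) {b q : ℝ} (hb : b < L) (hq : 0 ≤ q) :
    ∃ C : ℝ≥0∞, C ≠ ⊤ ∧ ∀ τ ≤ b, logMean G q τ ≤ C := by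
  obtain ⟨C, hC⟩ := hG.bdd b hb
  refine ⟨ENNReal.ofReal C ^ q, ENNReal.rpow_ne_top_of_nonneg hq ENNReal.ofReal_ne_top, fun τ hτ => ?_⟩
  calc logMean G q τ ≤ ∫⁻ _, ENNReal.ofReal C ^ q ∂thetaM := by
        refine lintegral_mono fun θ => ?_
        gcongr
        rw [← ofReal_norm]
        exact ENNReal.ofReal_le_ofReal (hC _ (by simpa using hτ))
    _ = _ := by simp

lemma logMean_ne_top (hG : LogHol L G) {τ q : ℝ} (hτ : τ < L) (hq : 0 ≤ q) : logMean G q τ ≠ ⊤ := by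
  obtain ⟨C, hC, h⟩ := hG.exists_logMean_le hτ hq
  exact ne_top_of_le_ne_top hC (h τ le_rfl)

lemma measurable_regEnergy (hG : LogHol L G) {ε : ℝ} (hε : 0 < ε) (β : ℝ) :
    Measurable (regEnergy G ε β) := by
  have : Measurable fun p : ℝ × ℝ => ENNReal.ofReal (powLap ε β (G (p.1 + p.2 * Complex.I))
      (deriv G (p.1 + p.2 * Complex.I))) :=
    ((continuous_powLap hε).measurable.comp ((hG.meas.comp measurable_plane).prodMk
      ((measurable_deriv G).comp measurable_plane))).ennreal_ofReal
  exact this.lintegral_prod_right'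

lemma measurable_logEnergy (hG : LogHol L G) (q : ℝ) : Measurable (logEnergy G q) := by
  have : Measurable fun p : ℝ × ℝ => ‖G (p.1 + p.2 * Complex.I)‖ₑ ^ (q - 2) *
      ‖deriv G (p.1 + p.2 * Complex.I)‖ₑ ^ 2 :=
    ((hG.meas.comp measurable_plane).enorm.pow_const _).mul
      (((measurable_deriv G).comp measurable_plane).enorm.pow_const _)
  exact this.lintegral_prod_right'

lemma continuous_regMean_integrand (hG : LogHol L G) {ε : ℝ} (hε : 0 < ε) (β : ℝ) {τ : ℝ} (hτ : τ < L) :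
    Continuous fun θ : ℝ => (‖G (τ + θ * Complex.I)‖ ^ 2 + ε) ^ β :=
  (((hG.continuous_line hτ).norm.pow 2).add continuous_const).rpow_const
    fun θ => Or.inl (by show ‖G (τ + θ * Complex.I)‖ ^ 2 + ε ≠ 0; positivity)

lemma continuousOn_powLap (hG : LogHol L G) {ε : ℝ} (hε : 0 < ε) (β : ℝ) {a b : ℝ} (hb : b < L) :
    ContinuousOn (fun p : ℝ × ℝ => powLap ε β (G (p.1 + p.2 * Complex.I))
      (deriv G (p.1 + p.2 * Complex.I))) (Icc a b ×ˢ Icc (-Real.pi) Real.pi) := by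
  have hm : MapsTo (fun p : ℝ × ℝ => (p.1 : ℂ) + p.2 * Complex.I) (Icc a b ×ˢ Icc (-Real.pi) Real.pi)
      {w | w.re < L} := fun p hp => by simpa using hp.1.2.trans_lt hb
  have hc : ContinuousOn (fun p : ℝ × ℝ => (p.1 : ℂ) + p.2 * Complex.I)
      (Icc a b ×ˢ Icc (-Real.pi) Real.pi) := by fun_prop
  have h1 : ContinuousOn (fun p : ℝ × ℝ => G (p.1 + p.2 * Complex.I)) _ :=
    hG.diff.continuousOn.comp hc hm
  have h2 : ContinuousOn (fun p : ℝ × ℝ => deriv G (p.1 + p.2 * Complex.I)) _ :=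
    (hG.diff.deriv (isOpen_half L)).continuousOn.comp hc hm
  exact ContinuousOn.powLap hε h1 h2

lemma integrableOn_tent_mul {p : ℝ → ℝ → ℝ} {a b : ℝ}
    (hp : ContinuousOn (fun x : ℝ × ℝ => p x.1 x.2) (Icc a b ×ˢ Icc (-Real.pi) Real.pi)) :
    IntegrableOn (fun τ => min (b - τ) (τ - a) * ∫ θ in (-Real.pi)..Real.pi, p τ θ) (Icc a b) := by
  refine IntegrableOn.continuousOn_mul (by fun_prop) ?_ isCompact_Icc
  have h1 := hp.integrableOn_compact (μ := volume) (isCompact_Icc.prod isCompact_Icc)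
  rw [IntegrableOn, Measure.volume_eq_prod, ← Measure.prod_restrict] at h1
  have h2 := h1.integral_prod_left
  refine h2.congr (Eventually.of_forall fun τ => ?_)
  simp only
  rw [intervalIntegral.integral_of_le (by linarith [Real.pi_pos]), integral_Icc_eq_integral_Ioc]

lemma regMean_ne_top (hG : LogHol L G) {ε : ℝ} (hε : 0 < ε) {β τ : ℝ} (hτ : τ < L) :
    regMean G ε β τ ≠ ⊤ := by
  have hc : Continuous fun θ : ℝ => (‖G (τ + θ * Complex.I)‖ ^ 2 + ε) ^ β :=
    hG.continuous_regMean_integrand hε β hτ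
  have := ofReal_intervalIntegral_pi hc fun θ => by positivity
  intro h
  rw [regMean] at h
  rw [h, ENNReal.mul_top (by simp [Real.pi_pos])] at this
  exact ENNReal.ofReal_ne_top this

lemma ofReal_tent_identity {u p : ℝ → ℝ → ℝ} {a b m : ℝ} (hab : a ≤ b)
    (hu0 : ∀ τ θ, 0 ≤ u τ θ) (hp0 : ∀ τ θ, 0 ≤ p τ θ) (hua : Continuous (u a)) (hub : Continuous (u b))
    (hum : Continuous (u m)) (hpc : ∀ τ ≤ b, Continuous (p τ))
    (hp : ContinuousOn (fun x : ℝ × ℝ => p x.1 x.2) (Icc a b ×ˢ Icc (-Real.pi) Real.pi))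
    (hpm : Measurable fun τ => ∫⁻ θ, ENNReal.ofReal (p τ θ) ∂thetaM)
    (hid : ∫ θ in (-Real.pi)..Real.pi, (u b θ + u a θ - 2 * u m θ) =
      ∫ τ in a..b, min (b - τ) (τ - a) * ∫ θ in (-Real.pi)..Real.pi, p τ θ) :
    ∫⁻ θ, ENNReal.ofReal (u a θ) ∂thetaM + ∫⁻ θ, ENNReal.ofReal (u b θ) ∂thetaM =
      2 * ∫⁻ θ, ENNReal.ofReal (u m θ) ∂thetaM +
        ∫⁻ τ in Ioc a b, tent a b τ * ∫⁻ θ, ENNReal.ofReal (p τ θ) ∂thetaM := by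
  have hpi : (-Real.pi) ≤ Real.pi := by linarith [Real.pi_pos]
  have hl : ∫ θ in (-Real.pi)..Real.pi, (u b θ + u a θ - 2 * u m θ) =
      (∫ θ in (-Real.pi)..Real.pi, u b θ) + (∫ θ in (-Real.pi)..Real.pi, u a θ) -
        2 * ∫ θ in (-Real.pi)..Real.pi, u m θ := by
    rw [intervalIntegral.integral_sub
      ((hub.intervalIntegrable _ _).add (hua.intervalIntegrable _ _))
      ((hum.intervalIntegrable _ _).const_mul 2),
      intervalIntegral.integral_add (hub.intervalIntegrable _ _) (hua.intervalIntegrable _ _),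
      intervalIntegral.integral_const_mul]
  have hid' : (∫ θ in (-Real.pi)..Real.pi, u a θ) + (∫ θ in (-Real.pi)..Real.pi, u b θ) =
      2 * (∫ θ in (-Real.pi)..Real.pi, u m θ) +
      ∫ τ in a..b, min (b - τ) (τ - a) * ∫ θ in (-Real.pi)..Real.pi, p τ θ := by
    linarith [hl.symm.trans hid]
  have hi0 : ∀ τ, 0 ≤ ∫ θ in (-Real.pi)..Real.pi, p τ θ := fun τ =>
    intervalIntegral.integral_nonneg hpi fun θ _ => hp0 τ θ
  have hiu0 : ∀ τ, 0 ≤ ∫ θ in (-Real.pi)..Real.pi, u τ θ := fun τ =>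
    intervalIntegral.integral_nonneg hpi fun θ _ => hu0 τ θ
  have hK0 : ∀ τ ∈ Ioc a b, 0 ≤ min (b - τ) (τ - a) := fun τ hτ =>
    le_min (by linarith [hτ.2]) (by linarith [hτ.1])
  have hR : ENNReal.ofReal (∫ τ in a..b, min (b - τ) (τ - a) * ∫ θ in (-Real.pi)..Real.pi, p τ θ) =
      ENNReal.ofReal (2 * Real.pi) * ∫⁻ τ in Ioc a b, tent a b τ * ∫⁻ θ, ENNReal.ofReal (p τ θ) ∂thetaM := by
    have hmeas : Measurable fun τ => tent a b τ * ∫⁻ θ, ENNReal.ofReal (p τ θ) ∂thetaM :=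
      (measurable_tent a b).mul hpm
    rw [intervalIntegral.integral_of_le hab, ofReal_integral_eq_lintegral_ofReal,
      ← lintegral_const_mul _ hmeas]
    · refine setLIntegral_congr_fun measurableSet_Ioc fun τ hτ => ?_
      rw [ENNReal.ofReal_mul (hK0 τ hτ), ofReal_intervalIntegral_pi (hpc τ hτ.2) (hp0 τ),
        tent]
      ring
    · exact (integrableOn_tent_mul hp).mono_set Ioc_subset_Icc_self
    · filter_upwards [ae_restrict_mem measurableSet_Ioc] with τ hτ
      exact mul_nonneg (hK0 τ hτ) (hi0 τ)
  have hfin := congrArg ENNReal.ofReal hid'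
  rw [ENNReal.ofReal_add (hiu0 a) (hiu0 b), ENNReal.ofReal_add (by linarith [hiu0 m])
    (intervalIntegral.integral_nonneg hab fun τ hτ => mul_nonneg (le_min (by linarith [hτ.2])
      (by linarith [hτ.1])) (hi0 τ)), hR, ENNReal.ofReal_mul (by norm_num),
    ofReal_intervalIntegral_pi hua (hu0 a), ofReal_intervalIntegral_pi hub (hu0 b),
    ofReal_intervalIntegral_pi hum (hu0 _)] at hfin
  rw [ENNReal.ofReal_ofNat] at hfin
  refine (ENNReal.mul_right_inj (a := ENNReal.ofReal (2 * Real.pi)) (by simp [Real.pi_pos])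
    ENNReal.ofReal_ne_top).1 ?_
  rw [mul_add, hfin]
  ring

lemma continuous_powLap_line (hG : LogHol L G) {ε : ℝ} (hε : 0 < ε) (β : ℝ) {τ : ℝ} (hτ : τ < L) :
    Continuous fun θ : ℝ => powLap ε β (G (τ + θ * Complex.I)) (deriv G (τ + θ * Complex.I)) := by
  rw [← continuousOn_univ]
  exact ContinuousOn.powLap hε (hG.continuous_line hτ).continuousOn
    (hG.continuous_deriv_line hτ).continuousOn

lemma regMean_identity (hG : LogHol L G) {ε β : ℝ} (hε : 0 < ε) (hβ : 0 < β) {a b : ℝ}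
    (hab : a ≤ b) (hb : b < L) :
    regMean G ε β a + regMean G ε β b = 2 * regMean G ε β ((a + b) / 2) +
      ∫⁻ τ in Ioc a b, tent a b τ * regEnergy G ε β τ := by
  have hid := hardyStein_identity (β := β) hε hG.diff hG.per hab hb
  have h1 := hG.measurable_regEnergy hε β
  have ha : a < L := by linarith
  have hm : (a + b) / 2 < L := by linarith
  unfold regEnergy at h1
  refine ofReal_tent_identity (m := (a + b) / 2)
    (u := fun τ θ => (‖G (τ + θ * Complex.I)‖ ^ 2 + ε) ^ β)
    (p := fun τ θ => powLap ε β (G (τ + θ * Complex.I)) (deriv G (τ + θ * Complex.I))) hab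
    (fun τ θ => by positivity) (fun τ θ => powLap_nonneg hε hβ _ _)
    (hG.continuous_regMean_integrand hε β ha) (hG.continuous_regMean_integrand hε β hb)
    (hG.continuous_regMean_integrand hε β hm)
    (fun τ hτ => hG.continuous_powLap_line hε β (hτ.trans_lt hb))
    (hG.continuousOn_powLap hε β hb) h1 ?_
  exact hid

end LogHol
end LogHolomorphic

section HardySteinInequalities

variable {L : ℝ} {G : ℂ → ℂ}

lemma ofReal_normSq_add_rpow {ε β : ℝ} (hε : 0 < ε) (z : ℂ) :
    ENNReal.ofReal ((‖z‖ ^ 2 + ε) ^ β) = (‖z‖ₑ ^ 2 + ENNReal.ofReal ε) ^ β := by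
  rw [← ENNReal.ofReal_rpow_of_pos (by positivity), ENNReal.ofReal_add (by positivity) hε.le,
    ENNReal.ofReal_pow (norm_nonneg _), ofReal_norm]

lemma enn_rpow_le_rpow_of_nonpos {x y : ℝ≥0∞} {r : ℝ} (h : x ≤ y) (hr : r ≤ 0) : y ^ r ≤ x ^ r := by
  have h1 : ∀ u : ℝ≥0∞, u ^ r = (u ^ (-r))⁻¹ := fun u => by rw [ENNReal.rpow_neg, inv_inv]
  rw [h1, h1 x, ENNReal.inv_le_inv]
  exact ENNReal.rpow_le_rpow h (by linarith)

lemma enorm_sq_rpow (z : ℂ) (β : ℝ) : (‖z‖ₑ ^ 2) ^ β = ‖z‖ₑ ^ (2 * β) := by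
  rw [← ENNReal.rpow_natCast, ← ENNReal.rpow_mul]; norm_num

lemma le_ofReal_powLap {ε β : ℝ} (hε : 0 < ε) (hβ : 0 < β) (z z₁ : ℂ) :
    ENNReal.ofReal (4 * β * min β 1) * ((‖z‖ₑ ^ 2 + ENNReal.ofReal ε) ^ (β - 1) * ‖z₁‖ₑ ^ 2) ≤
      ENNReal.ofReal (powLap ε β z z₁) := by
  rw [← ofReal_normSq_add_rpow hε, ← ofReal_norm z₁, ← ENNReal.ofReal_pow (norm_nonneg _),
    ← ENNReal.ofReal_mul (by positivity), ← ENNReal.ofReal_mul (by positivity)]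
  apply ENNReal.ofReal_le_ofReal
  have hX : (‖z‖ ^ 2 + ε) ^ (β - 1) = (‖z‖ ^ 2 + ε) ^ (β - 2) * (‖z‖ ^ 2 + ε) := by
    rw [← Real.rpow_add_one (by positivity)]; congr 1; ring
  rw [powLap, hX]
  have h1 : min β 1 * (‖z‖ ^ 2 + ε) ≤ β * ‖z‖ ^ 2 + ε := by
    have := mul_le_mul_of_nonneg_right (min_le_left β 1) (sq_nonneg ‖z‖)
    have := mul_le_mul_of_nonneg_right (min_le_right β 1) hε.le
    nlinarith
  calc 4 * β * min β 1 * ((‖z‖ ^ 2 + ε) ^ (β - 2) * (‖z‖ ^ 2 + ε) * ‖z₁‖ ^ 2) =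
      4 * β * (‖z‖ ^ 2 + ε) ^ (β - 2) * ‖z₁‖ ^ 2 * (min β 1 * (‖z‖ ^ 2 + ε)) := by ring
    _ ≤ _ := by gcongr

lemma ofReal_powLap_le {ε β : ℝ} (hε : 0 < ε) (hβ : 0 < β) (z z₁ : ℂ) :
    ENNReal.ofReal (powLap ε β z z₁) ≤
      ENNReal.ofReal (4 * β * max β 1) * ((‖z‖ₑ ^ 2 + ENNReal.ofReal ε) ^ (β - 1) * ‖z₁‖ₑ ^ 2) := by
  rw [← ofReal_normSq_add_rpow hε, ← ofReal_norm z₁, ← ENNReal.ofReal_pow (norm_nonneg _),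
    ← ENNReal.ofReal_mul (by positivity), ← ENNReal.ofReal_mul (by positivity)]
  apply ENNReal.ofReal_le_ofReal
  have hX : (‖z‖ ^ 2 + ε) ^ (β - 1) = (‖z‖ ^ 2 + ε) ^ (β - 2) * (‖z‖ ^ 2 + ε) := by
    rw [← Real.rpow_add_one (by positivity)]; congr 1; ring
  rw [powLap, hX]
  have h1 : β * ‖z‖ ^ 2 + ε ≤ max β 1 * (‖z‖ ^ 2 + ε) := by
    have := mul_le_mul_of_nonneg_right (le_max_left β 1) (sq_nonneg ‖z‖)
    have := mul_le_mul_of_nonneg_right (le_max_right β 1) hε.le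
    nlinarith
  calc 4 * β * (‖z‖ ^ 2 + ε) ^ (β - 2) * ‖z₁‖ ^ 2 * (β * ‖z‖ ^ 2 + ε)
      ≤ 4 * β * (‖z‖ ^ 2 + ε) ^ (β - 2) * ‖z₁‖ ^ 2 * (max β 1 * (‖z‖ ^ 2 + ε)) := by gcongr
    _ = _ := by ring

/-- A sequence of positive numbers tending to zero. -/
def epsSeq (k : ℕ) : ℝ := 1 / ((k : ℝ) + 1)

lemma epsSeq_pos (k : ℕ) : 0 < epsSeq k := by unfold epsSeq; positivity

lemma epsSeq_le_one (k : ℕ) : epsSeq k ≤ 1 := by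
  unfold epsSeq; rw [div_le_one (by positivity)]; linarith [(Nat.cast_nonneg k : (0:ℝ) ≤ k)]

lemma tendsto_ofReal_epsSeq : Tendsto (fun k => ENNReal.ofReal (epsSeq k)) atTop (𝓝 0) := by
  have : Tendsto epsSeq atTop (𝓝 0) := tendsto_one_div_add_atTop_nhds_zero_nat
  simpa using ENNReal.tendsto_ofReal this

lemma tendsto_enorm_sq_add_rpow (z : ℂ) (β : ℝ) :
    Tendsto (fun k => (‖z‖ₑ ^ 2 + ENNReal.ofReal (epsSeq k)) ^ β) atTop (𝓝 (‖z‖ₑ ^ (2 * β))) := by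
  rw [← enorm_sq_rpow]
  refine (ENNReal.continuous_rpow_const.tendsto _).comp ?_
  simpa using tendsto_ofReal_epsSeq.const_add (‖z‖ₑ ^ 2)

namespace LogHol

lemma tendsto_regMean (hG : LogHol L G) {q τ : ℝ} (hq : 0 ≤ q) (hτ : τ < L) :
    Tendsto (fun k => regMean G (epsSeq k) (q / 2) τ) atTop (𝓝 (logMean G q τ)) := by
  obtain ⟨C, hC⟩ := hG.bdd τ hτ
  refine tendsto_lintegral_of_dominated_convergence
    (bound := fun _ => (ENNReal.ofReal C ^ 2 + 1) ^ (q / 2)) (fun k => ?_) (fun k => ?_) ?_ ?_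
  · exact ((hG.continuous_regMean_integrand (epsSeq_pos k) _ hτ).measurable).ennreal_ofReal
  · refine Eventually.of_forall fun θ => ?_
    simp only
    rw [ofReal_normSq_add_rpow (epsSeq_pos k)]
    gcongr
    · rw [← ofReal_norm]
      exact ENNReal.ofReal_le_ofReal (hC _ (by simp))
    · rw [← ENNReal.ofReal_one]
      exact ENNReal.ofReal_le_ofReal (epsSeq_le_one k)
  · rw [lintegral_const, measure_univ, mul_one]
    exact ENNReal.rpow_ne_top_of_nonneg (by positivity) (by finiteness)
  · refine Eventually.of_forall fun θ => ?_
    simp_rw [ofReal_normSq_add_rpow (epsSeq_pos _)]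
    convert tendsto_enorm_sq_add_rpow (G (τ + θ * Complex.I)) (q / 2) using 2
    ring_nf

end LogHol

lemma lintegral_tent_mul {φ : ℝ × ℝ → ℝ≥0∞} (hφ : Measurable φ) (a b : ℝ) :
    ∫⁻ τ in Ioc a b, tent a b τ * ∫⁻ θ, φ (τ, θ) ∂thetaM =
      ∫⁻ p, tent a b p.1 * φ p ∂((volume.restrict (Ioc a b)).prod thetaM) := by
  rw [lintegral_prod]
  · refine lintegral_congr fun τ => ?_
    exact (lintegral_const_mul _ (hφ.comp measurable_prodMk_left)).symm
  · exact (((measurable_tent a b).comp measurable_fst).mul hφ).aemeasurable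

namespace LogHol

lemma measurable_comp_plane (hG : LogHol L G) :
    Measurable fun p : ℝ × ℝ => G (p.1 + p.2 * Complex.I) := hG.meas.comp measurable_plane

lemma measurable_deriv_plane :
    Measurable fun p : ℝ × ℝ => deriv G (p.1 + p.2 * Complex.I) :=
  (measurable_deriv G).comp measurable_plane

lemma measurable_regPow (hG : LogHol L G) (e : ℝ≥0∞) (γ : ℝ) :
    Measurable fun p : ℝ × ℝ => (‖G (p.1 + p.2 * Complex.I)‖ₑ ^ 2 + e) ^ γ *
      ‖deriv G (p.1 + p.2 * Complex.I)‖ₑ ^ 2 :=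
  (((hG.measurable_comp_plane.enorm.pow_const _).add_const _).pow_const _).mul
      (measurable_deriv_plane.enorm.pow_const _)

/-- The upper Hardy–Stein inequality. -/
lemma tent_logEnergy_le (hG : LogHol L G) {q a b : ℝ} (hq : 0 < q) (hab : a ≤ b) (hb : b < L) :
    ENNReal.ofReal (2 * q * min (q / 2) 1) * (∫⁻ τ in Ioc a b, tent a b τ * logEnergy G q τ) +
      2 * logMean G q ((a + b) / 2) ≤ logMean G q a + logMean G q b := by
  have ha : a < L := by linarith
  have hm : (a + b) / 2 < L := by linarith
  have hβ : 0 < q / 2 := by positivity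
  set c := ENNReal.ofReal (2 * q * min (q / 2) 1) with hc
  have hcT : c ≠ ⊤ := ENNReal.ofReal_ne_top
  set φ : ℕ → ℝ × ℝ → ℝ≥0∞ := fun k p => (‖G (p.1 + p.2 * Complex.I)‖ₑ ^ 2 +
      ENNReal.ofReal (epsSeq k)) ^ (q / 2 - 1) * ‖deriv G (p.1 + p.2 * Complex.I)‖ₑ ^ 2 with hφ
  have hφm : ∀ k, Measurable (φ k) := fun k => hG.measurable_regPow _ _
  have h1 : ∀ k, ∫⁻ p, c * (tent a b p.1 * φ k p) ∂((volume.restrict (Ioc a b)).prod thetaM) +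
      2 * regMean G (epsSeq k) (q / 2) ((a + b) / 2) ≤
      regMean G (epsSeq k) (q / 2) a + regMean G (epsSeq k) (q / 2) b := fun k => by
    rw [hG.regMean_identity (epsSeq_pos k) hβ hab hb, add_comm, lintegral_const_mul' _ _ hcT, ← lintegral_tent_mul (hφm k),
      ← lintegral_const_mul' _ _ hcT]
    refine add_le_add le_rfl (lintegral_mono fun τ => ?_)
    rw [mul_left_comm, regEnergy]
    gcongr
    rw [← lintegral_const_mul' _ _ hcT]
    refine lintegral_mono fun θ => ?_
    have := le_ofReal_powLap (epsSeq_pos k) hβ (G (τ + θ * Complex.I)) (deriv G (τ + θ * Complex.I))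
    rwa [show 4 * (q / 2) * min (q / 2) 1 = 2 * q * min (q / 2) 1 by ring] at this
  have h2 : c * ∫⁻ τ in Ioc a b, tent a b τ * logEnergy G q τ ≤
      liminf (fun k => ∫⁻ p, c * (tent a b p.1 * φ k p)
        ∂((volume.restrict (Ioc a b)).prod thetaM)) atTop := by
    have hm0 : Measurable fun p : ℝ × ℝ => ‖G (p.1 + p.2 * Complex.I)‖ₑ ^ (q - 2) *
      ‖deriv G (p.1 + p.2 * Complex.I)‖ₑ ^ 2 :=
      (hG.measurable_comp_plane.enorm.pow_const _).mul (measurable_deriv_plane.enorm.pow_const _)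
    unfold logEnergy
    rw [lintegral_tent_mul hm0, ← lintegral_const_mul' _ _ hcT]
    refine le_trans (le_of_eq ?_) (lintegral_liminf_le fun k =>
      (((measurable_tent a b).comp measurable_fst).mul (hφm k)).const_mul c)
    refine lintegral_congr fun p => ((ENNReal.Tendsto.const_mul (ENNReal.Tendsto.const_mul
      (ENNReal.Tendsto.mul_const ?_ (Or.inr (by finiteness))) (Or.inr (by simp [tent])))
      (Or.inr (by simp [hc]))).liminf_eq).symm
    convert tendsto_enorm_sq_add_rpow (G (p.1 + p.2 * Complex.I)) (q / 2 - 1) using 2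
    ring_nf
  have h3 := ((hG.tendsto_regMean hq.le ha).add (hG.tendsto_regMean hq.le hb))
  have h4 := ENNReal.Tendsto.const_mul (a := 2) (hG.tendsto_regMean hq.le hm) (Or.inr (by simp))
  have h5 : 2 * logMean G q ((a + b) / 2) ≤ logMean G q a + logMean G q b :=
    le_of_tendsto_of_tendsto' h4 h3 fun k => le_add_self.trans (h1 k)
  have h6 := (ENNReal.Tendsto.sub h3 h4 (Or.inl (ENNReal.add_ne_top.2
    ⟨hG.logMean_ne_top ha hq.le, hG.logMean_ne_top hb hq.le⟩))).liminf_eq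
  have h7 := h2.trans (liminf_le_liminf (Eventually.of_forall fun k =>
    ENNReal.le_sub_of_add_le_right (ENNReal.mul_ne_top (by simp)
      (hG.regMean_ne_top (epsSeq_pos k) hm)) (h1 k)))
  rw [h6] at h7
  exact (add_le_add h7 le_rfl).trans_eq (tsub_add_cancel_of_le h5)

/-- The lower Hardy–Stein inequality. -/
lemma exists_logMean_add_le {q : ℝ} (hq : 0 < q) : ∃ C : ℝ≥0∞, C ≠ ⊤ ∧ ∀ (L : ℝ) (G : ℂ → ℂ) (a b : ℝ),
    LogHol L G → a ≤ b → b < L → logMean G q a + logMean G q b ≤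
      2 * logMean G q ((a + b) / 2) + C * ∫⁻ τ in Ioc a b, tent a b τ * logEnergy G q τ := by
  have hβ : 0 < q / 2 := by positivity
  set c := ENNReal.ofReal (4 * (q / 2) * max (q / 2) 1) with hc
  have hcT : c ≠ ⊤ := ENNReal.ofReal_ne_top
  obtain ⟨γ, d, hγT, hdT, hd, hγ⟩ : ∃ (γ : ℝ≥0∞) (d : ℕ → ℝ≥0∞), γ ≠ ⊤ ∧ (∀ k, d k ≠ ⊤) ∧
      Tendsto d atTop (𝓝 0) ∧ ∀ x k, (x ^ 2 + ENNReal.ofReal (epsSeq k)) ^ (q / 2 - 1) ≤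
        γ * x ^ (q - 2) + d k := by
    have hx : ∀ x : ℝ≥0∞, (x ^ 2) ^ (q / 2 - 1) = x ^ (q - 2) := fun x => by
      rw [← ENNReal.rpow_natCast, ← ENNReal.rpow_mul]; congr 1; push_cast; ring
    rcases le_or_gt q 2 with h | h
    · refine ⟨1, 0, by simp, by simp, tendsto_const_nhds, fun x k => ?_⟩
      rw [← hx, one_mul, Pi.zero_apply, add_zero]
      exact enn_rpow_le_rpow_of_nonpos le_self_add (by linarith)
    · have hr : 0 < q / 2 - 1 := by linarith
      have h2T : (2 : ℝ≥0∞) ^ (q / 2 - 1) ≠ ⊤ := ENNReal.rpow_ne_top_of_nonneg hr.le (by simp)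
      refine ⟨2 ^ (q / 2 - 1), fun k => 2 ^ (q / 2 - 1) * ENNReal.ofReal (epsSeq k) ^ (q / 2 - 1), h2T,
        fun k => ENNReal.mul_ne_top h2T (ENNReal.rpow_ne_top_of_nonneg hr.le ENNReal.ofReal_ne_top),
        ?_, fun x k => ?_⟩
      · have h1 := (ENNReal.continuous_rpow_const (y := q / 2 - 1)).tendsto 0 |>.comp tendsto_ofReal_epsSeq
        rw [ENNReal.zero_rpow_of_pos hr] at h1
        simpa using ENNReal.Tendsto.const_mul h1 (Or.inr h2T)
      · rw [← hx, ← mul_add]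
        set y := x ^ 2
        set e := ENNReal.ofReal (epsSeq k)
        calc (y + e) ^ (q / 2 - 1) ≤ (2 * max y e) ^ (q / 2 - 1) := by
              gcongr; rw [two_mul]; exact add_le_add (le_max_left _ _) (le_max_right _ _)
          _ = 2 ^ (q / 2 - 1) * (max y e) ^ (q / 2 - 1) := ENNReal.mul_rpow_of_nonneg _ _ hr.le
          _ ≤ _ := by
            gcongr
            rcases le_total y e with h | h
            · rw [max_eq_right h]; exact le_add_self
            · rw [max_eq_left h]; exact le_self_add
  refine ⟨c * γ, ENNReal.mul_ne_top hcT hγT, fun L G a b hG hab hb => ?_⟩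
  have ha : a < L := by linarith
  have hm : (a + b) / 2 < L := by linarith
  set E : ℝ → ℝ≥0∞ := fun p => ∫⁻ τ in Ioc a b, tent a b τ * logEnergy G p τ with hE
  have hE2 : E 2 ≠ ⊤ := by
    have h1 := hG.tent_logEnergy_le (q := 2) (by norm_num) hab hb
    have h2 : ENNReal.ofReal (2 * 2 * min (2 / 2) 1) * E 2 ≠ ⊤ :=
      ne_top_of_le_ne_top (ENNReal.add_ne_top.2 ⟨hG.logMean_ne_top ha (by norm_num),
        hG.logMean_ne_top hb (by norm_num)⟩) (le_self_add.trans h1)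
    intro h
    rw [h, ENNReal.mul_top (by norm_num)] at h2
    exact h2 rfl
  have h1 : ∀ k, regMean G (epsSeq k) (q / 2) a + regMean G (epsSeq k) (q / 2) b ≤
      2 * regMean G (epsSeq k) (q / 2) ((a + b) / 2) + (c * γ * E q + c * d k * E 2) := fun k => by
    rw [hG.regMean_identity (epsSeq_pos k) hβ hab hb, hE]
    have hmm : Measurable fun τ => c * γ * (tent a b τ * logEnergy G q τ) :=
      ((measurable_tent a b).mul (hG.measurable_logEnergy q)).const_mul _
    rw [← lintegral_const_mul' _ _ (ENNReal.mul_ne_top hcT hγT),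
      ← lintegral_const_mul' _ _ (ENNReal.mul_ne_top hcT (hdT k)), ← lintegral_add_left hmm]
    refine add_le_add le_rfl (lintegral_mono fun τ => ?_)
    calc tent a b τ * regEnergy G (epsSeq k) (q / 2) τ ≤
        tent a b τ * (c * γ * logEnergy G q τ + c * d k * logEnergy G 2 τ) := by
          gcongr
          unfold regEnergy logEnergy
          have hm1 : Measurable fun θ : ℝ => ‖G (τ + θ * Complex.I)‖ₑ ^ (q - 2) *
              ‖deriv G (τ + θ * Complex.I)‖ₑ ^ 2 :=
            ((hG.meas.comp (measurable_line τ)).enorm.pow_const _).mul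
              (((measurable_deriv G).comp (measurable_line τ)).enorm.pow_const _)
          have hm2 : Measurable fun θ : ℝ => c * γ * (‖G (τ + θ * Complex.I)‖ₑ ^ (q - 2) *
              ‖deriv G (τ + θ * Complex.I)‖ₑ ^ 2) := hm1.const_mul _
          rw [← lintegral_const_mul' _ _ (ENNReal.mul_ne_top hcT hγT),
            ← lintegral_const_mul' _ _ (ENNReal.mul_ne_top hcT (hdT k)),
            ← lintegral_add_left hm2]
          refine lintegral_mono fun θ => (ofReal_powLap_le (epsSeq_pos k) hβ _ _).trans ?_
          calc _ ≤ c * ((γ * ‖G (τ + θ * Complex.I)‖ₑ ^ (q - 2) + d k) *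
                ‖deriv G (τ + θ * Complex.I)‖ₑ ^ 2) := by gcongr; exact hγ _ _
            _ = _ := by simp; ring
      _ = _ := by ring
  have h3 := ((hG.tendsto_regMean hq.le ha).add (hG.tendsto_regMean hq.le hb))
  have h4 := ENNReal.Tendsto.const_mul (a := 2) (hG.tendsto_regMean hq.le hm) (Or.inr (by simp))
  have h5 : Tendsto (fun k => c * γ * E q + c * d k * E 2) atTop (𝓝 (c * γ * E q + 0)) := by
    refine tendsto_const_nhds.add ?_
    have := ENNReal.Tendsto.mul_const (ENNReal.Tendsto.const_mul hd (Or.inr hcT)) (Or.inr hE2)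
    simpa using this
  have := le_of_tendsto_of_tendsto' h3 (h4.add h5) h1
  rwa [add_zero] at this

end LogHol
end HardySteinInequalities

section HardySteinConsequences

variable {L : ℝ} {G : ℂ → ℂ}

namespace LogHol

lemma two_mul_logMean_le (hG : LogHol L G) {q a b : ℝ} (hq : 0 < q) (hab : a ≤ b) (hb : b < L) :
    2 * logMean G q ((a + b) / 2) ≤ logMean G q a + logMean G q b :=
  le_add_self.trans (hG.tent_logEnergy_le hq hab hb)

lemma logMean_mono (hG : LogHol L G) {q a b : ℝ} (hq : 0 < q) (hab : a ≤ b) (hb : b < L) :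
    logMean G q a ≤ logMean G q b := by
  obtain ⟨C, hC, h⟩ := hG.exists_logMean_le hb hq.le
  set S := ⨆ τ : Iic b, logMean G q τ with hS
  have hS1 : S ≠ ⊤ := ne_top_of_le_ne_top hC (iSup_le fun τ => h τ τ.2)
  have hS2 : 2 * S ≤ S + logMean G q b := by
    rw [hS, ENNReal.mul_iSup]
    refine iSup_le fun τ => ?_
    have h1 := hG.two_mul_logMean_le (a := 2 * τ - b) hq (by linarith [τ.2.out]) hb
    rw [show (2 * (τ : ℝ) - b + b) / 2 = τ by ring] at h1
    refine h1.trans (add_le_add ?_ le_rfl)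
    exact le_iSup (fun τ : Iic b => logMean G q τ) ⟨2 * τ - b, by
      have := τ.2.out; simp only [mem_Iic]; linarith⟩
  rw [two_mul] at hS2
  exact (le_iSup (fun τ : Iic b => logMean G q τ) ⟨a, hab⟩).trans
    ((ENNReal.add_le_add_iff_left hS1).1 hS2)

/-- The global upper Hardy–Stein inequality. -/
lemma lintegral_Iio_logEnergy_le (hG : LogHol L G) {q b : ℝ} (hq : 0 < q) (hb : b < L) :
    ENNReal.ofReal (2 * q * min (q / 2) 1) * ∫⁻ τ in Iio b, ENNReal.ofReal (b - τ) * logEnergy G q τ ≤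
      2 * logMean G q b := by
  have h1 : ∀ k : ℕ, ENNReal.ofReal (2 * q * min (q / 2) 1) *
      ∫⁻ τ in Ioo (b - k) b, ENNReal.ofReal (b - τ) * logEnergy G q τ ≤ 2 * logMean G q b := fun k => by
    have hk : (0 : ℝ) ≤ k := Nat.cast_nonneg k
    have h2 := hG.tent_logEnergy_le (a := b - 2 * k) hq (by linarith) hb
    refine le_trans ?_ ((le_self_add.trans h2).trans (?_ : logMean G q (b - 2 * k) + logMean G q b ≤ 2 * logMean G q b))
    · refine mul_le_mul_right ?_ _
      calc ∫⁻ τ in Ioo (b - k) b, ENNReal.ofReal (b - τ) * logEnergy G q τ =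
          ∫⁻ τ in Ioo (b - k) b, tent (b - 2 * k) b τ * logEnergy G q τ := by
            refine setLIntegral_congr_fun measurableSet_Ioo fun τ hτ => ?_
            simp only [tent]
            rw [min_eq_left (by linarith [hτ.1])]
        _ ≤ _ := lintegral_mono_set (fun τ hτ => ⟨by linarith [hτ.1], hτ.2.le⟩ :
            Ioo (b - k) b ⊆ Ioc (b - 2 * k) b)
    · rw [two_mul (logMean G q b)]
      exact add_le_add (hG.logMean_mono hq (by linarith : b - 2 * k ≤ b) hb) le_rfl
  have h2 : Iio b = ⋃ k : ℕ, Ioo (b - k) b := by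
    ext τ
    simp only [mem_Iio, mem_iUnion, mem_Ioo]
    refine ⟨fun h => ?_, fun ⟨k, hk⟩ => hk.2⟩
    obtain ⟨k, hk⟩ := exists_nat_gt (b - τ)
    exact ⟨k, by linarith, h⟩
  rw [h2, setLIntegral_iUnion_of_directed, ENNReal.mul_iSup]
  · exact iSup_le h1
  · refine directed_of_isDirected_le fun i j hij => Ioo_subset_Ioo_left ?_
    have : (i : ℝ) ≤ j := by exact_mod_cast hij
    linarith

lemma logMean_exp_mul (K : ℂ → ℂ) {q : ℝ} (hq : 0 < q) (τ : ℝ) :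
    logMean (fun w => Complex.exp w * K w) q τ = ENNReal.ofReal (Real.exp (q * τ)) * logMean K q τ := by
  unfold logMean
  rw [← lintegral_const_mul' _ _ ENNReal.ofReal_ne_top]
  refine lintegral_congr fun θ => ?_
  rw [enorm_mul, ENNReal.mul_rpow_of_nonneg _ _ hq.le, ← ofReal_norm (Complex.exp _), Complex.norm_exp,
    ENNReal.ofReal_rpow_of_pos (Real.exp_pos _), ← Real.exp_mul]
  simp [mul_comm]

/-- If `G` vanishes at `-∞`, its means are strictly log-convex, with a quantitative bound. -/
lemma logMean_le_of_exp_mul {K : ℂ → ℂ} (hK : LogHol L K) {q a d : ℝ} (hq : 0 < q) (hd : 0 ≤ d)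
    (hb : a + 2 * d < L) :
    2 * logMean (fun w => Complex.exp w * K w) q (a + d) +
      ENNReal.ofReal ((1 - Real.exp (-(q * d))) ^ 2) *
        logMean (fun w => Complex.exp w * K w) q (a + 2 * d) ≤
      logMean (fun w => Complex.exp w * K w) q a +
        logMean (fun w => Complex.exp w * K w) q (a + 2 * d) := by
  have h1 := hK.two_mul_logMean_le hq (by linarith : a ≤ a + 2 * d) hb
  have h2 := hK.logMean_mono hq (by linarith : a ≤ a + 2 * d) hb
  rw [show (a + (a + 2 * d)) / 2 = a + d by ring] at h1
  rw [logMean_exp_mul _ hq, logMean_exp_mul _ hq, logMean_exp_mul _ hq]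
  lift logMean K q (a) to ℝ≥0 using hK.logMean_ne_top (by linarith) hq.le with x
  lift logMean K q (a + d) to ℝ≥0 using hK.logMean_ne_top (by linarith) hq.le with y
  lift logMean K q (a + 2 * d) to ℝ≥0 using hK.logMean_ne_top hb hq.le with z
  rw [ENNReal.coe_le_coe] at h2
  have h1' : 2 * (y : ℝ) ≤ x + z := by exact_mod_cast h1
  have h2' : (x : ℝ) ≤ z := by exact_mod_cast h2
  rw [← ENNReal.ofReal_coe_nnreal, ← ENNReal.ofReal_coe_nnreal, ← ENNReal.ofReal_coe_nnreal,
    ← ENNReal.ofReal_ofNat 2]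
  have e0 := Real.exp_pos (q * a)
  have e1 := Real.exp_pos (q * d)
  have he1 : 1 ≤ Real.exp (q * d) := Real.one_le_exp (by positivity)
  rw [← ENNReal.ofReal_mul (by positivity), ← ENNReal.ofReal_mul (by positivity),
    ← ENNReal.ofReal_mul (by positivity), ← ENNReal.ofReal_mul (by positivity),
    ← ENNReal.ofReal_mul (by positivity),
    ← ENNReal.ofReal_add (by positivity) (by positivity),
    ← ENNReal.ofReal_add (by positivity) (by positivity)]
  apply ENNReal.ofReal_le_ofReal
  rw [show q * (a + d) = q * a + q * d by ring, show q * (a + 2 * d) = q * a + (q * d + q * d) by ring,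
    Real.exp_add, Real.exp_add, Real.exp_add, Real.exp_neg]
  set A := Real.exp (q * a)
  set B := Real.exp (q * d)
  have : (1 - B⁻¹) ^ 2 * (A * (B * B) * z) = A * (B - 1) ^ 2 * z := by field_simp
  rw [this]
  have h3 : B * (2 * y) ≤ B * (x + z) := by gcongr
  have h4 : (B - 1) * x ≤ (B - 1) * z := by gcongr
  nlinarith [mul_nonneg e0.le (sub_nonneg.2 h3), mul_nonneg e0.le (sub_nonneg.2 h4)]

end LogHol

/-- A holomorphic function on a disc, in logarithmic coordinates. -/
lemma LogHol.comp_exp {f : ℂ → ℂ} {L : ℝ} (hf : DifferentiableOn ℂ f (ball 0 (Real.exp L)))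
    (hm : Measurable f) : LogHol L fun w => f (Complex.exp w) where
  diff := hf.comp Complex.differentiable_exp.differentiableOn fun w hw => by
    simpa [Complex.norm_exp] using hw
  per w := by rw [Complex.exp_add, Complex.exp_two_pi_mul_I, mul_one]
  bdd b hb := by
    have hs : closedBall (0 : ℂ) (Real.exp b) ⊆ ball 0 (Real.exp L) :=
      closedBall_subset_ball (Real.exp_lt_exp.2 hb)
    obtain ⟨C, hC⟩ := (isCompact_closedBall (0 : ℂ) (Real.exp b)).exists_bound_of_continuousOn
      (hf.continuousOn.mono hs)
    exact ⟨C, fun w hw => hC _ (by simpa [Complex.norm_exp] using hw)⟩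
  meas := hm.comp Complex.measurable_exp

end HardySteinConsequences

section KernelEstimate

open scoped ComplexConjugate

variable {L : ℝ} {G : ℂ → ℂ}

lemma enorm_le_logMean {f : ℂ → ℂ} {L q b : ℝ} (hf : DifferentiableOn ℂ f (ball 0 (Real.exp L)))
    (hm : Measurable f) (hq : 0 < q) (hb : b < L) :
    ‖f 0‖ₑ ^ q ≤ logMean (fun w => f (Complex.exp w)) q b := by
  have hG := LogHol.comp_exp hf hm
  have hlim : ∀ θ : ℝ, Tendsto (fun k : ℕ => ‖f (Complex.exp (((-(k : ℝ) : ℝ) : ℂ) + θ * Complex.I))‖ₑ ^ q)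
      atTop (𝓝 (‖f 0‖ₑ ^ q)) := fun θ => by
    have h0 : ContinuousAt f 0 := (hf.differentiableAt (ball_mem_nhds 0 (Real.exp_pos L))).continuousAt
    refine ((ENNReal.continuous_rpow_const.tendsto _).comp ((continuous_enorm.tendsto _).comp
      (h0.tendsto.comp ?_)))
    rw [tendsto_zero_iff_norm_tendsto_zero]
    simp only [Complex.norm_exp]
    simp only [Complex.add_re, Complex.ofReal_re, Complex.mul_re, Complex.I_re, mul_zero,
      Complex.ofReal_im, Complex.I_im, sub_self, add_zero, mul_one]
    exact Real.tendsto_exp_neg_atTop_nhds_zero.comp tendsto_natCast_atTop_atTop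
  calc ‖f 0‖ₑ ^ q = ∫⁻ _, ‖f 0‖ₑ ^ q ∂thetaM := by simp
    _ = ∫⁻ θ, liminf (fun k : ℕ => ‖f (Complex.exp (((-(k : ℝ) : ℝ) : ℂ) + θ * Complex.I))‖ₑ ^ q) atTop
        ∂thetaM := lintegral_congr fun θ => (hlim θ).liminf_eq.symm
    _ ≤ liminf (fun k : ℕ => logMean (fun w => f (Complex.exp w)) q (-(k : ℝ))) atTop :=
        lintegral_liminf_le fun k => (hG.meas.comp (measurable_line _)).enorm.pow_const _
    _ ≤ _ := by
        refine liminf_le_of_frequently_le' (Eventually.frequently ?_)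
        obtain ⟨k₀, hk₀⟩ := exists_nat_gt (-b)
        filter_upwards [eventually_ge_atTop k₀] with k hk
        have : (k₀ : ℝ) ≤ k := by exact_mod_cast hk
        exact hG.logMean_mono hq (by linarith) hb

/-- The argument of the boundary values of the Möbius map `z ↦ (z - x) / (1 - x z)`. -/
def mobArg (x θ : ℝ) : ℝ := θ + 2 * (Complex.log (1 - x * Complex.exp (-(θ * Complex.I)))).im

/-- The Poisson kernel on the circle. -/
def circPoisson (x θ : ℝ) : ℝ := (1 - x ^ 2) / ‖1 - x * Complex.exp (θ * Complex.I)‖ ^ 2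

lemma norm_mul_exp_lt {x : ℝ} (h0 : 0 ≤ x) (h1 : x < 1) (θ : ℝ) :
    ‖(x : ℂ) * Complex.exp (θ * Complex.I)‖ < 1 := by
  rw [norm_mul, Complex.norm_exp_ofReal_mul_I, mul_one, Complex.norm_real, Real.norm_of_nonneg h0]
  exact h1

lemma one_sub_mem_slitPlane {z : ℂ} (hz : ‖z‖ < 1) : 1 - z ∈ Complex.slitPlane := by
  left
  have := (Complex.abs_re_le_norm z).trans_lt hz
  simp only [Complex.sub_re, Complex.one_re]
  linarith [(abs_lt.1 this).2]

lemma conj_exp_mul_I (θ : ℝ) : conj (Complex.exp (θ * Complex.I)) = Complex.exp (-(θ * Complex.I)) := by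
  rw [← Complex.exp_conj]; simp

lemma exp_neg_mul_I (θ : ℝ) : Complex.exp (-(θ * Complex.I)) = Complex.exp (((-θ : ℝ) : ℂ) * Complex.I) := by
  congr 1; push_cast; ring

lemma hasDerivAt_mobArg {x : ℝ} (h0 : 0 ≤ x) (h1 : x < 1) (θ : ℝ) :
    HasDerivAt (mobArg x) (circPoisson x θ) θ := by
  set e := Complex.exp (-(θ * Complex.I)) with he
  have hne : ‖(x : ℂ) * e‖ < 1 := by rw [he, exp_neg_mul_I]; exact norm_mul_exp_lt h0 h1 _
  have hs := one_sub_mem_slitPlane hne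
  have hs0 := Complex.slitPlane_ne_zero hs
  have h2 : HasDerivAt (fun θ : ℝ => -((θ : ℂ) * Complex.I)) (-(1 * Complex.I)) θ :=
    (Complex.ofRealCLM.hasDerivAt.mul_const Complex.I).neg
  have h3 : HasDerivAt (fun θ : ℝ => Complex.log (1 - x * Complex.exp (-(θ * Complex.I))))
      (-(x * (e * -(1 * Complex.I))) / (1 - x * e)) θ :=
    ((h2.cexp.const_mul (x : ℂ)).const_sub 1).clog_real hs
  have h4 : HasDerivAt (fun θ : ℝ => (Complex.log (1 - x * Complex.exp (-(θ * Complex.I)))).im)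
      (-(x * (e * -(1 * Complex.I))) / (1 - x * e)).im θ :=
    (Complex.imCLM.hasFDerivAt.comp_hasDerivAt θ h3)
  have h5 := (hasDerivAt_id θ).add (h4.const_mul 2)
  refine HasDerivAt.congr_deriv (f := mobArg x) h5 ?_
  have hconj : Complex.exp (θ * Complex.I) = conj e := by rw [he, ← conj_exp_mul_I, Complex.conj_conj]
  have hnorm : ‖1 - (x : ℂ) * conj e‖ = ‖1 - (x : ℂ) * e‖ := by
    rw [← Complex.norm_conj]; simp
  have hee : e.re ^ 2 + e.im ^ 2 = 1 := by
    have : ‖e‖ = 1 := by rw [he, exp_neg_mul_I, Complex.norm_exp_ofReal_mul_I]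
    have h6 := Complex.sq_norm e
    rw [this, Complex.normSq_apply] at h6
    nlinarith
  have hns : Complex.normSq (1 - x * e) ≠ 0 := by simpa using hs0
  rw [circPoisson, hconj, hnorm, Complex.sq_norm, Complex.div_im]
  have hnv : Complex.normSq (1 - x * e) = 1 - 2 * x * e.re + x ^ 2 := by
    rw [Complex.normSq_apply]
    simp
    linear_combination x ^ 2 * hee
  rw [hnv] at hns ⊢
  field_simp
  simp
  linear_combination (-2 * x ^ 2) * hee

lemma exp_mobArg {x : ℝ} (h0 : 0 ≤ x) (h1 : x < 1) (θ : ℝ) :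
    Complex.exp (mobArg x θ * Complex.I) =
      (Complex.exp (θ * Complex.I) - x) / (1 - x * Complex.exp (θ * Complex.I)) := by
  set e := Complex.exp (-(θ * Complex.I)) with he
  have hne : ‖(x : ℂ) * e‖ < 1 := by rw [he, exp_neg_mul_I]; exact norm_mul_exp_lt h0 h1 _
  have hs0 := Complex.slitPlane_ne_zero (one_sub_mem_slitPlane hne)
  have hs1 := Complex.slitPlane_ne_zero (one_sub_mem_slitPlane (norm_mul_exp_lt h0 h1 θ))
  have hee : Complex.exp (θ * Complex.I) * e = 1 := by rw [he, ← Complex.exp_add]; simp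
  set l := Complex.log (1 - x * e) with hl
  have hle : Complex.exp l = 1 - x * e := Complex.exp_log hs0
  have hlc : Complex.exp (conj l) = 1 - x * Complex.exp (θ * Complex.I) := by
    rw [Complex.exp_conj, hle, he, ← conj_exp_mul_I]; simp
  have h2 : ((mobArg x θ : ℝ) : ℂ) * Complex.I = θ * Complex.I + (l - conj l) := by
    rw [mobArg, ← he, ← hl, Complex.sub_conj]; push_cast; ring
  rw [h2, Complex.exp_add, Complex.exp_sub, hle, hlc]
  rw [← mul_div_assoc]
  congr 1
  linear_combination (-(x : ℂ)) * hee

lemma continuous_circPoisson {x : ℝ} (h0 : 0 ≤ x) (h1 : x < 1) : Continuous (circPoisson x) := by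
  unfold circPoisson
  refine Continuous.div (by fun_prop) (by fun_prop) fun θ => ?_
  have := Complex.slitPlane_ne_zero (one_sub_mem_slitPlane (norm_mul_exp_lt h0 h1 θ))
  positivity

lemma mobArg_pi {x : ℝ} (h0 : 0 ≤ x) : mobArg x Real.pi = Real.pi := by
  have : Complex.exp (-((Real.pi : ℂ) * Complex.I)) = -1 := by rw [Complex.exp_neg, Complex.exp_pi_mul_I]; norm_num
  rw [mobArg, this, Complex.log_im, show (1 : ℂ) - x * -1 = ((1 + x : ℝ) : ℂ) by push_cast; ring,
    Complex.arg_ofReal_of_nonneg (by linarith)]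
  ring

lemma mobArg_neg_pi {x : ℝ} (h0 : 0 ≤ x) : mobArg x (-Real.pi) = -Real.pi := by
  have : Complex.exp (-(((-Real.pi : ℝ) : ℂ) * Complex.I)) = -1 := by
    rw [← Complex.exp_pi_mul_I]; congr 1; push_cast; ring
  rw [mobArg, this, Complex.log_im, show (1 : ℂ) - x * -1 = ((1 + x : ℝ) : ℂ) by push_cast; ring,
    Complex.arg_ofReal_of_nonneg (by linarith)]
  ring

lemma integral_mobius {x : ℝ} (h0 : 0 ≤ x) (h1 : x < 1) {h : ℝ → ℝ} (hc : Continuous h) :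
    ∫ s in (-Real.pi)..Real.pi, h s =
      ∫ θ in (-Real.pi)..Real.pi, h (mobArg x θ) * circPoisson x θ := by
  have := intervalIntegral.integral_comp_mul_deriv (a := -Real.pi) (b := Real.pi)
    (f := mobArg x) (f' := circPoisson x) (g := h) (fun θ _ => hasDerivAt_mobArg h0 h1 θ)
    (continuous_circPoisson h0 h1).continuousOn hc
  rw [mobArg_pi h0, mobArg_neg_pi h0] at this
  exact this.symm

/-- The Möbius map moving `0` to `x`. -/
def mobMap (x : ℝ) (z : ℂ) : ℂ := (z + x) / (1 + x * z)

lemma mobMap_exp_mobArg {x : ℝ} (h0 : 0 ≤ x) (h1 : x < 1) (θ : ℝ) :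
    mobMap x (Complex.exp (mobArg x θ * Complex.I)) = Complex.exp (θ * Complex.I) := by
  rw [exp_mobArg h0 h1, mobMap]
  set e := Complex.exp (θ * Complex.I)
  have hs1 := Complex.slitPlane_ne_zero (one_sub_mem_slitPlane (norm_mul_exp_lt h0 h1 θ))
  change 1 - (x : ℂ) * e ≠ 0 at hs1
  have hx : (1 - (x : ℂ) ^ 2) ≠ 0 := by
    have : (1 - x ^ 2) ≠ 0 := by nlinarith
    exact_mod_cast this
  have e1 : (e - x) / (1 - x * e) + x = e * (1 - (x : ℂ) ^ 2) / (1 - x * e) := by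
    rw [eq_div_iff hs1, add_mul, div_mul_cancel₀ _ hs1]; ring
  have e2 : 1 + x * ((e - x) / (1 - x * e)) = (1 - (x : ℂ) ^ 2) / (1 - x * e) := by
    rw [eq_div_iff hs1, add_mul, mul_assoc, div_mul_cancel₀ _ hs1]; ring
  rw [e1, e2, div_div_div_cancel_right₀ hs1, mul_div_cancel_right₀ _ hx]

lemma mobMap_denom_ne_zero {x : ℝ} (h0 : 0 ≤ x) (h1 : x < 1) {z : ℂ} (hz : ‖z‖ ≤ 1) :
    1 + x * z ≠ 0 := by
  have hn : ‖-((x : ℂ) * z)‖ < 1 := by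
    rw [norm_neg, norm_mul, Complex.norm_real, Real.norm_of_nonneg h0]
    nlinarith [norm_nonneg z]
  have := Complex.slitPlane_ne_zero (one_sub_mem_slitPlane hn)
  rwa [sub_neg_eq_add] at this

lemma norm_mobMap_le {x : ℝ} (h0 : 0 ≤ x) (h1 : x < 1) {z : ℂ} (hz : ‖z‖ ≤ 1) : ‖mobMap x z‖ ≤ 1 := by
  have hd := mobMap_denom_ne_zero h0 h1 hz
  rw [mobMap, norm_div, div_le_one (by positivity)]
  apply le_of_sq_le_sq _ (norm_nonneg _)
  rw [Complex.sq_norm, Complex.sq_norm, Complex.normSq_apply, Complex.normSq_apply]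
  have hz2 : z.re * z.re + z.im * z.im ≤ 1 := by
    rw [← Complex.normSq_apply, ← Complex.sq_norm]; nlinarith [norm_nonneg z]
  simp
  nlinarith [mul_nonneg (sub_nonneg.2 hz2) (by nlinarith : 0 ≤ 1 - x ^ 2)]

lemma measurable_mobMap (x : ℝ) : Measurable (mobMap x) := by unfold mobMap; fun_prop

lemma exists_differentiableOn_mobMap {x : ℝ} (h0 : 0 ≤ x) (h1 : x < 1) {U : Set ℂ} (hU : IsOpen U)
    (hs : closedBall 0 1 ⊆ U) {F : ℂ → ℂ} (hF : DifferentiableOn ℂ F U) :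
    ∃ L : ℝ, 0 < L ∧ DifferentiableOn ℂ (fun z => F (mobMap x z)) (ball 0 (Real.exp L)) := by
  set V : Set ℂ := {z | 1 + x * z ≠ 0} with hV
  have hVo : IsOpen V := isOpen_ne_fun (by fun_prop) (by fun_prop)
  have hd : DifferentiableOn ℂ (mobMap x) V := by
    unfold mobMap
    exact DifferentiableOn.div (by fun_prop) (by fun_prop) fun z hz => hz
  have hW : IsOpen (V ∩ mobMap x ⁻¹' U) := hd.continuousOn.isOpen_inter_preimage hVo hU
  have hsub : closedBall (0 : ℂ) 1 ⊆ V ∩ mobMap x ⁻¹' U := fun z hz => by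
    rw [mem_closedBall_zero_iff] at hz
    exact ⟨mobMap_denom_ne_zero h0 h1 hz, hs (by simpa using norm_mobMap_le h0 h1 hz)⟩
  obtain ⟨δ, hδ, hδ'⟩ := (isCompact_closedBall (0 : ℂ) 1).exists_thickening_subset_open hW hsub
  rw [thickening_closedBall hδ zero_le_one] at hδ'
  refine ⟨Real.log (δ + 1), Real.log_pos (by linarith), ?_⟩
  rw [Real.exp_log (by linarith)]
  exact hF.comp (hd.mono fun z hz => (hδ' hz).1) fun z hz => (hδ' hz).2

lemma enorm_rpow_le_poisson {x : ℝ} (h0 : 0 ≤ x) (h1 : x < 1) {U : Set ℂ} (hU : IsOpen U)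
    (hs : closedBall 0 1 ⊆ U) {F : ℂ → ℂ} (hF : DifferentiableOn ℂ F U) (hm : Measurable F)
    {q : ℝ} (hq : 0 < q) :
    ‖F x‖ₑ ^ q ≤ ∫⁻ θ, ‖F (Complex.exp (θ * Complex.I))‖ₑ ^ q * ENNReal.ofReal (circPoisson x θ)
      ∂thetaM := by
  obtain ⟨L, hL, hd⟩ := exists_differentiableOn_mobMap h0 h1 hU hs hF
  have h2 := enorm_le_logMean hd (hm.comp (measurable_mobMap x)) hq hL
  have h3 : mobMap x 0 = x := by simp [mobMap]
  rw [h3] at h2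
  refine h2.trans (le_of_eq ?_)
  have hc : Continuous fun s : ℝ => ‖F (mobMap x (Complex.exp (s * Complex.I)))‖ ^ q :=
    (hd.continuousOn.comp_continuous (by fun_prop) fun s => by
      rw [mem_ball_zero_iff, Complex.norm_exp_ofReal_mul_I]; exact Real.one_lt_exp_iff.2 hL).norm.rpow_const
        fun _ => Or.inr hq.le
  have hcF : Continuous fun s : ℝ => ‖F (Complex.exp (s * Complex.I))‖ ^ q :=
    (hF.continuousOn.comp_continuous (by fun_prop) fun s => hs (by simp)).norm.rpow_const
        fun _ => Or.inr hq.le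
  have h4 := integral_mobius h0 h1 hc
  simp only [mobMap_exp_mobArg h0 h1] at h4
  have hP : ∀ θ, 0 ≤ circPoisson x θ := fun θ => by
    have : 0 ≤ 1 - x ^ 2 := by nlinarith
    unfold circPoisson; positivity
  have h5 := congrArg ENNReal.ofReal h4
  have hcP : Continuous fun s : ℝ => ‖F (Complex.exp (s * Complex.I))‖ ^ q * circPoisson x s :=
    hcF.mul (continuous_circPoisson h0 h1)
  rw [ofReal_intervalIntegral_pi hc fun _ => by positivity, ofReal_intervalIntegral_pi
    hcP fun θ => mul_nonneg (by positivity) (hP θ)] at h5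
  have h6 := (ENNReal.mul_right_inj (by simp [Real.pi_pos]) ENNReal.ofReal_ne_top).1 h5
  have he : ∀ z : ℂ, ‖z‖ₑ ^ q = ENNReal.ofReal (‖z‖ ^ q) := fun z => by
    rw [← ofReal_norm, ENNReal.ofReal_rpow_of_nonneg (norm_nonneg _) hq.le]
  calc _ = ∫⁻ s : ℝ, ENNReal.ofReal (‖F (mobMap x (Complex.exp (s * Complex.I)))‖ ^ q) ∂thetaM := by
        unfold logMean
        simp [he]
    _ = _ := h6
    _ = _ := lintegral_congr fun θ => by rw [he, ENNReal.ofReal_mul (by positivity)]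

/-- A higher order Poisson estimate for `|f|^q`. -/
lemma enorm_rpow_le_kernel {x : ℝ} (h0 : 0 ≤ x) (h1 : x < 1) {U : Set ℂ} (hU : IsOpen U)
    (hs : closedBall 0 1 ⊆ U) {f : ℂ → ℂ} (hf : DifferentiableOn ℂ f U) (hm : Measurable f)
    {q : ℝ} (hq : 0 < q) (N : ℕ) :
    ‖f x‖ₑ ^ q ≤ ∫⁻ θ, ‖f (Complex.exp (θ * Complex.I))‖ₑ ^ q *
      ENNReal.ofReal ((1 - x ^ 2) ^ (N + 1) / ‖1 - x * Complex.exp (θ * Complex.I)‖ ^ (N + 2)) ∂thetaM := by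
  have hx : 0 < 1 - x ^ 2 := by nlinarith
  set k : ℂ → ℂ := fun z => Complex.exp (((N / q : ℝ) : ℂ) * (Real.log (1 - x ^ 2) - Complex.log (1 - x * z)))
    with hk
  have hkn : ∀ z : ℂ, ‖(x : ℂ) * z‖ < 1 → ‖k z‖ₑ ^ q =
      ENNReal.ofReal ((1 - x ^ 2) ^ N / ‖1 - x * z‖ ^ N) := fun z hz => by
    have hz0 := Complex.slitPlane_ne_zero (one_sub_mem_slitPlane hz)
    have hz1 : 0 < ‖1 - x * z‖ := by positivity
    rw [← ofReal_norm, ENNReal.ofReal_rpow_of_nonneg (norm_nonneg _) hq.le, hk]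
    simp only [Complex.norm_exp]
    rw [Complex.re_ofReal_mul, Complex.sub_re, Complex.ofReal_re, Complex.log_re, ← Real.log_div hx.ne' hz1.ne',
      ← Real.exp_mul, ← div_pow, ← Real.exp_log (div_pos hx hz1), ← Real.exp_nat_mul, Real.log_exp]
    congr 2
    field_simp
  set V : Set ℂ := U ∩ {z | ‖(x : ℂ) * z‖ < 1} with hV
  have hVo : IsOpen V := hU.inter (isOpen_lt (by fun_prop) continuous_const)
  have hsV : closedBall 0 1 ⊆ V := fun z hz => ⟨hs hz, by
    rw [mem_closedBall_zero_iff] at hz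
    show ‖(x : ℂ) * z‖ < 1
    rw [norm_mul, Complex.norm_real, Real.norm_of_nonneg h0]
    nlinarith [norm_nonneg z]⟩
  have hkd : DifferentiableOn ℂ k V := by
    have : DifferentiableOn ℂ (fun z : ℂ => Complex.log (1 - x * z)) V :=
      DifferentiableOn.clog (by fun_prop) fun z hz => one_sub_mem_slitPlane hz.2
    exact ((this.const_sub _).const_mul _).cexp
  have hkm : Measurable k := by fun_prop
  have h2 := enorm_rpow_le_poisson h0 h1 hVo hsV ((hf.mono inter_subset_left).mul hkd) (hm.mul hkm) hq
  have hxx : ‖k x‖ₑ ^ q = 1 := by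
    rw [hkn x (by rw [← Complex.ofReal_mul, Complex.norm_real, Real.norm_of_nonneg (by positivity)]; nlinarith),
      show (1 : ℂ) - x * x = ((1 - x ^ 2 : ℝ) : ℂ) by push_cast; ring, Complex.norm_real,
      Real.norm_of_nonneg hx.le, div_self (by positivity), ENNReal.ofReal_one]
  simp only [Pi.mul_apply, enorm_mul, ENNReal.mul_rpow_of_nonneg _ _ hq.le, hxx, mul_one] at h2
  refine h2.trans (le_of_eq (lintegral_congr fun θ => ?_))
  have hθ := norm_mul_exp_lt h0 h1 θ
  have hz0 := Complex.slitPlane_ne_zero (one_sub_mem_slitPlane hθ)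
  rw [hkn _ hθ, mul_assoc, ← ENNReal.ofReal_mul (by positivity), circPoisson]
  congr 2
  field_simp
  ring

end KernelEstimate

section Herglotz

open scoped ComplexConjugate

open Real (circleAverage)

lemma lintegral_rpow_le_lintegral_rpow {Ω : Type*} [MeasurableSpace Ω] {μ : Measure Ω}
    [IsProbabilityMeasure μ] {f : Ω → ℝ≥0∞} (hf : AEMeasurable f μ) {p : ℝ} (hp : 1 ≤ p) :
    (∫⁻ x, f x ∂μ) ^ p ≤ ∫⁻ x, f x ^ p ∂μ := by
  rcases hp.eq_or_lt with rfl | hp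
  · simp
  have h := ENNReal.lintegral_mul_le_Lp_mul_Lq μ (Real.HolderConjugate.conjExponent hp) hf
    (aemeasurable_const (b := 1))
  simp only [Pi.mul_apply, mul_one, ENNReal.one_rpow, lintegral_const, measure_univ] at h
  calc _ ≤ ((∫⁻ x, f x ^ p ∂μ) ^ (1 / p)) ^ p := ENNReal.rpow_le_rpow h (by linarith)
    _ = _ := by rw [← ENNReal.rpow_mul, one_div, inv_mul_cancel₀ (by linarith), ENNReal.rpow_one]

lemma circleAverage_eq_integral_thetaM {E : Type*} [NormedAddCommGroup E] [NormedSpace ℝ E]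
    (f : ℂ → E) : circleAverage f 0 1 = ∫ θ, f (Complex.exp (θ * Complex.I)) ∂thetaM := by
  have hpi := Real.pi_pos
  rw [thetaM, integral_smul_measure, ← intervalIntegral.integral_of_le (by linarith),
    Real.circleAverage_def, ENNReal.toReal_inv, ENNReal.toReal_ofReal (by positivity)]
  congr 1
  have hper : Function.Periodic (fun θ => f (circleMap 0 1 θ)) (2 * Real.pi) := fun θ => by
    simp only [periodic_circleMap 0 1 θ]
  have := hper.intervalIntegral_add_eq 0 (-Real.pi)
  rw [zero_add, show -Real.pi + 2 * Real.pi = Real.pi by ring] at this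
  rw [this]
  simp [circleMap]

lemma exists_cos_mul_le {s : ℝ} (h1 : 1 < s) (h3 : s < 3) :
    ∃ C c : ℝ, 0 < C ∧ 0 < c ∧ ∀ φ : ℝ, |φ| < Real.pi / 2 →
      Real.cos (s * φ) ≤ C * Real.cos φ ^ s - c := by
  have hpi := Real.pi_pos
  have hneg : Real.cos (s * (Real.pi / 2)) < 0 :=
    Real.cos_neg_of_pi_div_two_lt_of_lt (by nlinarith) (by nlinarith)
  set c := -Real.cos (s * (Real.pi / 2)) / 2 with hc
  have hc0 : 0 < c := by rw [hc]; linarith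
  have hcont : ContinuousAt (fun φ : ℝ => Real.cos (s * φ)) (Real.pi / 2) := by fun_prop
  have hev : ∀ᶠ φ in 𝓝 (Real.pi / 2), Real.cos (s * φ) < -c :=
    hcont.eventually_lt continuousAt_const (by show Real.cos (s * (Real.pi / 2)) < -c; linarith)
  obtain ⟨δ, hδ, hδ'⟩ := Metric.eventually_nhds_iff.1 hev
  set δ' := min δ (Real.pi / 2) / 2 with hd'
  have hm : 0 < min δ (Real.pi / 2) := lt_min hδ (by linarith)
  have hδ'0 : 0 < δ' := by positivity
  have hδ'1 : δ' < δ := by rw [hd']; linarith [min_le_left δ (Real.pi / 2)]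
  have hδ'2 : δ' < Real.pi / 2 := by rw [hd']; linarith [min_le_right δ (Real.pi / 2)]
  have hsin : 0 < Real.sin δ' := Real.sin_pos_of_pos_of_lt_pi hδ'0 (by linarith)
  refine ⟨(1 + c) / Real.sin δ' ^ s, c, by positivity, hc0, fun φ hφ => ?_⟩
  rw [← Real.cos_abs (s * φ), ← Real.cos_abs φ, abs_mul, abs_of_pos (by linarith : 0 < s)]
  have hφ0 := abs_nonneg φ
  set ψ := |φ|
  have hcos : 0 ≤ Real.cos ψ := Real.cos_nonneg_of_mem_Icc ⟨by linarith, hφ.le⟩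
  rcases lt_or_ge (Real.pi / 2 - δ') ψ with h | h
  · have := hδ' (y := ψ) (by rw [Real.dist_eq, abs_lt]; constructor <;> linarith)
    have h4 : 0 ≤ (1 + c) / Real.sin δ' ^ s * Real.cos ψ ^ s := by positivity
    linarith
  · have h4 : Real.sin δ' ≤ Real.cos ψ := by
      rw [← Real.cos_pi_div_two_sub]
      exact Real.cos_le_cos_of_nonneg_of_le_pi hφ0 (by linarith) h
    have h5 : Real.sin δ' ^ s ≤ Real.cos ψ ^ s := Real.rpow_le_rpow hsin.le h4 (by linarith)
    have h6 : 1 + c ≤ (1 + c) / Real.sin δ' ^ s * Real.cos ψ ^ s := by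
      rw [div_mul_eq_mul_div, le_div_iff₀ (by positivity)]
      exact mul_le_mul_of_nonneg_left h5 (by positivity)
    linarith [Real.cos_le_one (s * ψ)]

lemma cpow_re_le {s : ℝ} {C c : ℝ} (h : ∀ φ : ℝ, |φ| < Real.pi / 2 →
      Real.cos (s * φ) ≤ C * Real.cos φ ^ s - c) {z : ℂ} (hz : 0 < z.re) :
    (z ^ (s : ℂ)).re ≤ C * z.re ^ s - c * ‖z‖ ^ s := by
  have hz0 : z ≠ 0 := by rintro rfl; simp at hz
  have hn : 0 < ‖z‖ := by positivity
  have harg : |z.arg| < Real.pi / 2 := Complex.abs_arg_lt_pi_div_two_iff.2 (Or.inl hz)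
  have h1 := h _ harg
  rw [Complex.cpow_ofReal_re]
  have hc : Real.cos z.arg = z.re / ‖z‖ := Complex.cos_arg hz0
  rw [hc, Real.div_rpow hz.le hn.le] at h1
  calc ‖z‖ ^ s * Real.cos (z.arg * s) = ‖z‖ ^ s * Real.cos (s * z.arg) := by rw [mul_comm z.arg]
    _ ≤ ‖z‖ ^ s * (C * (z.re ^ s / ‖z‖ ^ s) - c) := mul_le_mul_of_nonneg_left h1 (by positivity)
    _ = _ := by field_simp

/-- M. Riesz's conjugate function estimate for functions with positive real part. -/
lemma exists_logMean_le_re {s : ℝ} (h1 : 1 < s) (h3 : s < 3) :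
    ∃ C : ℝ≥0∞, C ≠ ⊤ ∧ ∀ F : ℂ → ℂ, DifferentiableOn ℂ F (ball 0 1) →
      (∀ z ∈ ball (0 : ℂ) 1, 0 < (F z).re) → (F 0).im = 0 → ∀ b < 0,
      logMean (fun w => F (Complex.exp w)) s b ≤
        C * ∫⁻ θ, ENNReal.ofReal ((F (Complex.exp (b + θ * Complex.I))).re ^ s) ∂thetaM := by
  obtain ⟨C, c, hC, hc, h⟩ := exists_cos_mul_le h1 h3
  refine ⟨ENNReal.ofReal (C / c), ENNReal.ofReal_ne_top, fun F hF hre him b hb => ?_⟩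
  have hr1 : Real.exp b < 1 := by rwa [Real.exp_lt_one_iff]
  have hr0 := Real.exp_pos b
  have hdiff : DifferentiableOn ℂ (fun z => F z ^ (s : ℂ)) (ball 0 1) := fun z hz =>
    (hF z hz).cpow_const (Or.inl (hre z hz))
  have hin : ∀ θ : ℝ, Complex.exp (b + θ * Complex.I) ∈ ball (0 : ℂ) 1 := fun θ => by
    simpa [Complex.norm_exp] using hb
  have hcF : Continuous fun θ : ℝ => F (Complex.exp (b + θ * Complex.I)) :=
    hF.continuousOn.comp_continuous (by fun_prop) hin
  have hcp : Continuous fun θ : ℝ => F (Complex.exp (b + θ * Complex.I)) ^ (s : ℂ) :=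
    hdiff.continuousOn.comp_continuous (by fun_prop) hin
  have hmean : circleAverage (fun z => F (Real.exp b * z) ^ (s : ℂ)) 0 1 = F 0 ^ (s : ℂ) := by
    have hd2 : DifferentiableOn ℂ (fun z : ℂ => F (Real.exp b * z) ^ (s : ℂ)) (closedBall 0 1) := by
      refine hdiff.comp (t := ball 0 1) (by fun_prop) fun z hz => ?_
      rw [mem_closedBall_zero_iff] at hz
      rw [mem_ball_zero_iff, norm_mul, Complex.norm_real, Real.norm_of_nonneg hr0.le]
      nlinarith [norm_nonneg z]
    have := (hd2.mono closure_ball_subset_closedBall).diffContOnCl.circleAverage_poissonKernel_smul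
      (mem_ball_self (zero_lt_one (α := ℝ)))
    rw [mul_zero] at this
    rw [← this]
    refine Real.circleAverage_congr_sphere fun z hz => ?_
    have hz1 : ‖z‖ = 1 := by simpa using hz
    simp [poissonKernel_def, hz1]
  rw [circleAverage_eq_integral_thetaM] at hmean
  have hexp : ∀ θ : ℝ, (Real.exp b : ℂ) * Complex.exp (θ * Complex.I) = Complex.exp (b + θ * Complex.I) := fun θ => by
    rw [Complex.exp_add]; simp
  simp only [hexp] at hmean
  have hintg : ∀ {f : ℝ → ℝ}, Continuous f → Integrable f thetaM := fun {f} hf =>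
    (hf.integrableOn_Icc.mono_set Ioc_subset_Icc_self).smul_measure (by simp [Real.pi_pos])
  have hintc : Integrable (fun θ : ℝ => F (Complex.exp (b + θ * Complex.I)) ^ (s : ℂ)) thetaM :=
    (hcp.integrableOn_Icc.mono_set Ioc_subset_Icc_self).smul_measure (by simp [Real.pi_pos])
  have hre0 : 0 ≤ ∫ θ : ℝ, (F (Complex.exp (b + θ * Complex.I)) ^ (s : ℂ)).re ∂thetaM := by
    have h5 : ∫ θ : ℝ, (F (Complex.exp (b + θ * Complex.I)) ^ (s : ℂ)).re ∂thetaM =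
        (∫ θ : ℝ, F (Complex.exp (b + θ * Complex.I)) ^ (s : ℂ) ∂thetaM).re :=
      integral_re hintc
    have h6 : F 0 = (((F 0).re : ℝ) : ℂ) := Complex.ext rfl (by simpa using him)
    have h7 : 0 ≤ (F 0).re := (hre 0 (by simp)).le
    rw [h5, hmean, h6, ← Complex.ofReal_cpow h7, Complex.ofReal_re]
    positivity
  have hcre : Continuous fun θ : ℝ => (F (Complex.exp (b + θ * Complex.I))).re ^ s :=
    (Complex.continuous_re.comp hcF).rpow_const fun _ => Or.inr (by linarith)
  have hcn : Continuous fun θ : ℝ => ‖F (Complex.exp (b + θ * Complex.I))‖ ^ s :=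
    hcF.norm.rpow_const fun _ => Or.inr (by linarith)
  have hle : ∫ θ : ℝ, (F (Complex.exp (b + θ * Complex.I)) ^ (s : ℂ)).re ∂thetaM ≤
      C * (∫ θ : ℝ, (F (Complex.exp (b + θ * Complex.I))).re ^ s ∂thetaM) -
        c * ∫ θ : ℝ, ‖F (Complex.exp (b + θ * Complex.I))‖ ^ s ∂thetaM := by
    rw [← integral_const_mul, ← integral_const_mul, ← integral_sub ((hintg hcre).const_mul _)
      ((hintg hcn).const_mul _)]
    exact integral_mono (hintg (Complex.continuous_re.comp hcp))
      (((hintg hcre).const_mul _).sub ((hintg hcn).const_mul _)) fun θ => cpow_re_le h (hre _ (hin θ))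
  have hfin : ∫ θ : ℝ, ‖F (Complex.exp (b + θ * Complex.I))‖ ^ s ∂thetaM ≤
      C / c * ∫ θ : ℝ, (F (Complex.exp (b + θ * Complex.I))).re ^ s ∂thetaM := by
    rw [div_mul_eq_mul_div, le_div_iff₀ hc]
    linarith
  rw [← ofReal_integral_eq_lintegral_ofReal (hintg hcre) (Eventually.of_forall fun θ =>
    Real.rpow_nonneg (hre _ (hin θ)).le _), ← ENNReal.ofReal_mul (by positivity)]
  calc _ = ∫⁻ θ : ℝ, ENNReal.ofReal (‖F (Complex.exp (b + θ * Complex.I))‖ ^ s) ∂thetaM :=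
        lintegral_congr fun θ => by
          rw [← ofReal_norm, ENNReal.ofReal_rpow_of_nonneg (norm_nonneg _) (by linarith)]
    _ = ENNReal.ofReal (∫ θ : ℝ, ‖F (Complex.exp (b + θ * Complex.I))‖ ^ s ∂thetaM) :=
        (ofReal_integral_eq_lintegral_ofReal (hintg hcn) (Eventually.of_forall fun θ => by positivity)).symm
    _ ≤ _ := ENNReal.ofReal_le_ofReal hfin

end Herglotz

section HerglotzIntegral

open scoped ComplexConjugate

open Real (circleAverage)

/-- The Herglotz integral of a function on the unit circle. -/
def herglotz (Ψ : ℂ → ℝ) (z : ℂ) : ℂ :=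
  circleAverage (fun ζ => herglotzRieszKernel 0 z ζ • (Ψ ζ : ℂ)) 0 1

variable {Ψ : ℂ → ℝ} {B : ℝ}

lemma circleIntegrable_of_bdd (hm : Measurable Ψ) (hB : ∀ z, |Ψ z| ≤ B) : CircleIntegrable Ψ 0 1 := by
  rw [CircleIntegrable, intervalIntegrable_iff, uIoc_of_le (by positivity), IntegrableOn]
  refine Integrable.of_bound (C := B) (hm.comp (continuous_circleMap 0 1).measurable).aestronglyMeasurable
    (Eventually.of_forall fun θ => hB _)

lemma differentiableOn_herglotz (hm : Measurable Ψ) (hB : ∀ z, |Ψ z| ≤ B) :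
    DifferentiableOn ℂ (herglotz Ψ) (ball 0 1) := by
  have h := circleIntegrable_of_bdd hm hB
  refine differentiableOn_circleAverage_herglotzRieszKernel_smul ?_
  simp only [CircleIntegrable, intervalIntegrable_iff] at h ⊢
  exact Complex.ofRealCLM.integrable_comp h

lemma poissonKernel_nonneg {z w : ℂ} (hz : ‖z‖ < 1) (hw : ‖w‖ = 1) : 0 ≤ poissonKernel 0 z w := by
  have : 0 ≤ 1 - ‖z‖ ^ 2 := by nlinarith [norm_nonneg z]
  rw [poissonKernel_def]
  simp only [sub_zero, hw, one_pow]
  positivity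

lemma re_herglotz (hm : Measurable Ψ) (hB : ∀ z, |Ψ z| ≤ B) {z : ℂ} (hz : z ∈ ball (0 : ℂ) 1) :
    (herglotz Ψ z).re = ∫ θ, poissonKernel 0 z (Complex.exp (θ * Complex.I)) *
      Ψ (Complex.exp (θ * Complex.I)) ∂thetaM := by
  rw [herglotz, re_circleAverage_herglotzRieszKernel_smul (circleIntegrable_of_bdd hm hB) hz,
    ← poissonKernel_eq_re_herglotzRieszKernel, circleAverage_eq_integral_thetaM]
  rfl

lemma integral_poissonKernel {z : ℂ} (hz : z ∈ ball (0 : ℂ) 1) :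
    ∫ θ : ℝ, poissonKernel 0 z (Complex.exp (θ * Complex.I)) ∂thetaM = 1 := by
  have h := (diffContOnCl_const (c := (1 : ℂ)) (s := ball (0 : ℂ) 1)).circleAverage_poissonKernel_smul hz
  rw [circleAverage_eq_integral_thetaM] at h
  simp only [Pi.smul_apply', Complex.real_smul, mul_one] at h
  rw [integral_complex_ofReal] at h
  exact_mod_cast h

lemma continuous_poissonKernel {z : ℂ} (hz : z ∈ ball (0 : ℂ) 1) :
    Continuous fun θ : ℝ => poissonKernel 0 z (Complex.exp (θ * Complex.I)) := by
  rw [mem_ball_zero_iff] at hz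
  simp only [poissonKernel_def, sub_zero]
  refine Continuous.div (by fun_prop) (by fun_prop) fun θ => ?_
  have : Complex.exp (θ * Complex.I) - z ≠ 0 := fun h => by
    have := Complex.norm_exp_ofReal_mul_I θ
    rw [sub_eq_zero.1 h] at this
    linarith
  positivity

lemma integrable_thetaM {f : ℝ → ℝ} (hf : Continuous f) : Integrable f thetaM :=
  (hf.integrableOn_Icc.mono_set Ioc_subset_Icc_self).smul_measure (by simp [Real.pi_pos])

lemma integrable_poissonKernel_mul (hm : Measurable Ψ) (hB : ∀ z, |Ψ z| ≤ B) {z : ℂ}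
    (hz : z ∈ ball (0 : ℂ) 1) :
    Integrable (fun θ : ℝ => poissonKernel 0 z (Complex.exp (θ * Complex.I)) *
      Ψ (Complex.exp (θ * Complex.I))) thetaM :=
  (integrable_thetaM (continuous_poissonKernel hz)).mul_bdd
    (hm.comp (by fun_prop)).aestronglyMeasurable (Eventually.of_forall fun θ => hB _)

lemma lintegral_poissonKernel {z : ℂ} (hz : z ∈ ball (0 : ℂ) 1) :
    ∫⁻ θ : ℝ, ENNReal.ofReal (poissonKernel 0 z (Complex.exp (θ * Complex.I))) ∂thetaM = 1 := by
  rw [← ofReal_integral_eq_lintegral_ofReal (integrable_thetaM (continuous_poissonKernel hz))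
    (Eventually.of_forall fun θ => poissonKernel_nonneg (by simpa using hz) (Complex.norm_exp_ofReal_mul_I θ)),
    integral_poissonKernel hz, ENNReal.ofReal_one]

lemma ofReal_re_herglotz (hm : Measurable Ψ) (hB : ∀ z, |Ψ z| ≤ B) (h0 : ∀ z, 0 ≤ Ψ z) {z : ℂ}
    (hz : z ∈ ball (0 : ℂ) 1) :
    ENNReal.ofReal (herglotz Ψ z).re = ∫⁻ θ : ℝ, ENNReal.ofReal (Ψ (Complex.exp (θ * Complex.I)))
      ∂(thetaM.withDensity fun θ : ℝ => ENNReal.ofReal (poissonKernel 0 z (Complex.exp (θ * Complex.I)))) := by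
  have hmk := (continuous_poissonKernel hz).measurable.ennreal_ofReal
  have hmΨ : Measurable fun θ : ℝ => ENNReal.ofReal (Ψ (Complex.exp (θ * Complex.I))) :=
    (hm.comp (by fun_prop)).ennreal_ofReal
  have hk : ∀ θ : ℝ, 0 ≤ poissonKernel 0 z (Complex.exp (θ * Complex.I)) := fun θ =>
    poissonKernel_nonneg (by simpa using hz) (Complex.norm_exp_ofReal_mul_I θ)
  rw [re_herglotz hm hB hz, lintegral_withDensity_eq_lintegral_mul _ hmk hmΨ,
    ofReal_integral_eq_lintegral_ofReal (integrable_poissonKernel_mul hm hB hz)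
      (Eventually.of_forall fun θ => mul_nonneg (hk θ) (h0 _))]
  exact lintegral_congr fun θ => ENNReal.ofReal_mul (hk θ)

lemma poissonKernel_comm {z w : ℂ} (hz : ‖z‖ = 1) (hw : ‖w‖ = 1) {r : ℝ} :
    poissonKernel 0 (r * z) w = poissonKernel 0 (r * w) z := by
  have hz2 : z.re * z.re + z.im * z.im = 1 := by
    rw [← Complex.normSq_apply, ← Complex.sq_norm, hz]; norm_num
  have hw2 : w.re * w.re + w.im * w.im = 1 := by
    rw [← Complex.normSq_apply, ← Complex.sq_norm, hw]; norm_num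
  simp only [poissonKernel_def, sub_zero, norm_mul, hz, hw]
  congr 1
  rw [Complex.sq_norm, Complex.sq_norm, Complex.normSq_apply, Complex.normSq_apply]
  simp
  linear_combination (r ^ 2 - 1) * hz2 - (r ^ 2 - 1) * hw2

lemma exp_add_mul_I_mem_ball {b : ℝ} (hb : b < 0) (θ : ℝ) :
    Complex.exp (b + θ * Complex.I) ∈ ball (0 : ℂ) 1 := by
  simpa [Complex.norm_exp] using hb

lemma lintegral_re_herglotz_rpow_le (hm : Measurable Ψ) (hB : ∀ z, |Ψ z| ≤ B) (h0 : ∀ z, 0 ≤ Ψ z)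
    {s b : ℝ} (hs : 1 ≤ s) (hb : b < 0) :
    ∫⁻ θ, ENNReal.ofReal (herglotz Ψ (Complex.exp (b + θ * Complex.I))).re ^ s ∂thetaM ≤
      ∫⁻ θ : ℝ, ENNReal.ofReal (Ψ (Complex.exp (θ * Complex.I))) ^ s ∂thetaM := by
  have hin := exp_add_mul_I_mem_ball hb
  have hmΨ : Measurable fun θ : ℝ => ENNReal.ofReal (Ψ (Complex.exp (θ * Complex.I))) :=
    (hm.comp (by fun_prop)).ennreal_ofReal
  have hmk : ∀ θ : ℝ, Measurable fun η : ℝ => ENNReal.ofReal (poissonKernel 0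
      (Complex.exp (b + θ * Complex.I)) (Complex.exp (η * Complex.I))) := fun θ =>
    (continuous_poissonKernel (hin θ)).measurable.ennreal_ofReal
  have hsym : ∀ θ η : ℝ, poissonKernel 0 (Complex.exp (b + θ * Complex.I)) (Complex.exp (η * Complex.I)) =
      poissonKernel 0 (Complex.exp (b + η * Complex.I)) (Complex.exp (θ * Complex.I)) := fun θ η => by
    rw [Complex.exp_add, Complex.exp_add, ← Complex.ofReal_exp]
    exact poissonKernel_comm (Complex.norm_exp_ofReal_mul_I θ) (Complex.norm_exp_ofReal_mul_I η)
  have hm2 : Measurable (Function.uncurry fun θ η : ℝ => ENNReal.ofReal (poissonKernel 0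
      (Complex.exp (b + θ * Complex.I)) (Complex.exp (η * Complex.I)))) := by
    refine Measurable.ennreal_ofReal ?_
    simp only [poissonKernel_def, sub_zero]
    fun_prop
  calc _ ≤ ∫⁻ θ : ℝ, ∫⁻ η : ℝ, ENNReal.ofReal (poissonKernel 0 (Complex.exp (b + θ * Complex.I))
        (Complex.exp (η * Complex.I))) * ENNReal.ofReal (Ψ (Complex.exp (η * Complex.I))) ^ s ∂thetaM ∂thetaM := by
        refine lintegral_mono fun θ => ?_
        rw [ofReal_re_herglotz hm hB h0 (hin θ)]
        have : IsProbabilityMeasure (thetaM.withDensity fun η : ℝ => ENNReal.ofReal (poissonKernel 0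
          (Complex.exp (b + θ * Complex.I)) (Complex.exp (η * Complex.I)))) :=
          ⟨by rw [withDensity_apply _ MeasurableSet.univ, setLIntegral_univ, lintegral_poissonKernel (hin θ)]⟩
        refine (lintegral_rpow_le_lintegral_rpow hmΨ.aemeasurable hs).trans (le_of_eq ?_)
        rw [lintegral_withDensity_eq_lintegral_mul _ (hmk θ) (hmΨ.pow_const s)]
        rfl
    _ = ∫⁻ η : ℝ, ∫⁻ θ : ℝ, ENNReal.ofReal (poissonKernel 0 (Complex.exp (b + θ * Complex.I))
        (Complex.exp (η * Complex.I))) * ENNReal.ofReal (Ψ (Complex.exp (η * Complex.I))) ^ s ∂thetaM ∂thetaM := by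
        refine lintegral_lintegral_swap (Measurable.aemeasurable ?_)
        exact hm2.mul ((hmΨ.pow_const s).comp measurable_snd)
    _ = _ := by
        refine lintegral_congr fun η => ?_
        have hmη : Measurable fun θ : ℝ => ENNReal.ofReal (poissonKernel 0
          (Complex.exp (b + θ * Complex.I)) (Complex.exp (η * Complex.I))) :=
          Measurable.of_uncurry_right hm2
        rw [lintegral_mul_const _ hmη]
        simp only [hsym _ η]
        rw [lintegral_poissonKernel (hin η), one_mul]

lemma le_re_herglotz (hm : Measurable Ψ) (hB : ∀ z, |Ψ z| ≤ B) {κ : ℝ} (h0 : ∀ z, κ ≤ Ψ z) {z : ℂ}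
    (hz : z ∈ ball (0 : ℂ) 1) : κ ≤ (herglotz Ψ z).re := by
  rw [re_herglotz hm hB hz]
  calc κ = ∫ θ : ℝ, poissonKernel 0 z (Complex.exp (θ * Complex.I)) * κ ∂thetaM := by
        rw [integral_mul_const, integral_poissonKernel hz, one_mul]
    _ ≤ _ := integral_mono ((integrable_thetaM (continuous_poissonKernel hz)).mul_const _)
        (integrable_poissonKernel_mul hm hB hz) fun θ => mul_le_mul_of_nonneg_left (h0 _)
          (poissonKernel_nonneg (by simpa using hz) (Complex.norm_exp_ofReal_mul_I θ))

lemma im_herglotz_zero (Ψ : ℂ → ℝ) : (herglotz Ψ 0).im = 0 := by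
  have : herglotz Ψ 0 = circleAverage (fun ζ => (Ψ ζ : ℂ)) 0 1 := by
    rw [herglotz]
    refine Real.circleAverage_congr_sphere fun z hz => ?_
    have hz0 : z ≠ 0 := by rintro rfl; simp at hz
    simp [herglotzRieszKernel_def, hz0]
  rw [this, circleAverage_eq_integral_thetaM, integral_complex_ofReal, Complex.ofReal_im]

/-- The Herglotz integral dominates a nontangential minorant of its boundary function. -/
lemma le_re_herglotz_of_near (hm : Measurable Ψ) (hB : ∀ z, |Ψ z| ≤ B) (h0 : ∀ z, 0 ≤ Ψ z) {z : ℂ}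
    (hz : z ∈ ball (0 : ℂ) 1) {u : ℝ} (hu0 : 0 ≤ u)
    (hu : ∀ w : ℂ, ‖w‖ = 1 → ‖w - z‖ ≤ 2 * (1 - ‖z‖) → u ≤ Ψ w) :
    u ≤ 8 * Real.pi * (herglotz Ψ z).re := by
  have hpi := Real.pi_gt_three
  rw [mem_ball_zero_iff] at hz
  set δ := 1 - ‖z‖ with hδ
  have hδ0 : 0 < δ := by linarith
  have hδ1 : δ ≤ 1 := by linarith [norm_nonneg z]
  obtain ⟨a, ha1, ha2, hab⟩ : ∃ a : ℝ, -Real.pi ≤ a ∧ a + δ ≤ Real.pi ∧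
      ∀ θ ∈ Ioc a (a + δ), ‖Complex.exp (θ * Complex.I) - z‖ ≤ 2 * δ := by
    have hclose : ∀ θ : ℝ, |θ - z.arg| ≤ δ → ‖Complex.exp (θ * Complex.I) - z‖ ≤ 2 * δ := fun θ hθ => by
      have e1 : Complex.exp (θ * Complex.I) - z = Complex.exp (z.arg * Complex.I) *
          (Complex.exp (Complex.I * ((θ - z.arg : ℝ) : ℂ)) - 1) + (1 - ‖z‖ : ℝ) * Complex.exp (z.arg * Complex.I) := by
        have key : ∀ r x : ℝ, Complex.exp (θ * Complex.I) - r * Complex.exp (x * Complex.I) =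
            Complex.exp (x * Complex.I) * (Complex.exp (Complex.I * ((θ - x : ℝ) : ℂ)) - 1) +
              (1 - r : ℝ) * Complex.exp (x * Complex.I) := fun r x => by
          rw [mul_sub, ← Complex.exp_add]
          push_cast
          ring_nf
        have := key ‖z‖ z.arg
        rwa [Complex.norm_mul_exp_arg_mul_I] at this
      rw [e1]
      refine (norm_add_le _ _).trans ?_
      rw [norm_mul, norm_mul, Complex.norm_exp_ofReal_mul_I, Complex.norm_real,
        Real.norm_of_nonneg hδ0.le]
      have := Real.norm_exp_I_mul_ofReal_sub_one_le (x := θ - z.arg)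
      rw [Real.norm_eq_abs] at this
      linarith
    rcases le_or_gt z.arg 0 with h | h
    · exact ⟨z.arg, (Complex.neg_pi_lt_arg z).le, by linarith, fun θ hθ => hclose θ (by
        rw [abs_of_pos (by linarith [hθ.1])]; linarith [hθ.2])⟩
    · exact ⟨z.arg - δ, by linarith, by linarith [Complex.arg_le_pi z], fun θ hθ => hclose θ (by
        rw [abs_of_nonpos (by linarith [hθ.2])]; linarith [hθ.1])⟩
  have hsub : Ioc a (a + δ) ⊆ Ioc (-Real.pi) Real.pi := Ioc_subset_Ioc ha1 ha2
  have hμ : thetaM.real (Ioc a (a + δ)) = δ / (2 * Real.pi) := by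
    rw [measureReal_def, thetaM, Measure.smul_apply, Measure.restrict_apply measurableSet_Ioc,
      inter_eq_left.2 hsub, Real.volume_Ioc, smul_eq_mul, ENNReal.toReal_mul, ENNReal.toReal_inv,
      ENNReal.toReal_ofReal (by positivity), ENNReal.toReal_ofReal (by linarith)]
    rw [add_sub_cancel_left]; ring
  have hz' : z ∈ ball (0 : ℂ) 1 := by simpa using hz
  have hk : ∀ θ : ℝ, 0 ≤ poissonKernel 0 z (Complex.exp (θ * Complex.I)) * Ψ (Complex.exp (θ * Complex.I)) :=
    fun θ => mul_nonneg (poissonKernel_nonneg hz (Complex.norm_exp_ofReal_mul_I θ)) (h0 _)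
  have h1 : ∫ θ in Ioc a (a + δ), 1 / (4 * δ) * u ∂thetaM ≤ (herglotz Ψ z).re := by
    rw [re_herglotz hm hB hz']
    refine le_trans (setIntegral_mono_on (integrable_const _) (integrable_poissonKernel_mul hm hB hz').integrableOn
      measurableSet_Ioc fun θ hθ => ?_) (setIntegral_le_integral (integrable_poissonKernel_mul hm hB hz')
        (Eventually.of_forall hk))
    have hn := hab θ hθ
    refine mul_le_mul ?_ (hu _ (Complex.norm_exp_ofReal_mul_I θ) hn) hu0
      (poissonKernel_nonneg hz (Complex.norm_exp_ofReal_mul_I θ))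
    have hpos : 0 < ‖Complex.exp (θ * Complex.I) - z‖ := by
      have := norm_sub_norm_le (Complex.exp (θ * Complex.I)) z
      rw [Complex.norm_exp_ofReal_mul_I] at this
      linarith
    rw [poissonKernel_def]
    simp only [sub_zero, Complex.norm_exp_ofReal_mul_I]
    rw [div_le_div_iff₀ (by positivity) (by positivity)]
    have : ‖Complex.exp (θ * Complex.I) - z‖ ^ 2 ≤ (2 * δ) ^ 2 := pow_le_pow_left₀ hpos.le hn 2
    have hz2 : ‖z‖ = 1 - δ := by linarith
    rw [hz2]
    nlinarith
  rw [setIntegral_const, hμ, smul_eq_mul] at h1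
  have h2 : δ / (2 * Real.pi) * (1 / (4 * δ) * u) = u / (8 * Real.pi) := by field_simp; ring
  rw [h2, div_le_iff₀ (by positivity)] at h1
  linarith

end HerglotzIntegral

section WeightedEnergy

open scoped ComplexConjugate

lemma LogHol.lintegral_Iio_zero_logEnergy_le {G : ℂ → ℂ} (hG : LogHol 0 G) {q : ℝ} (hq : 0 < q)
    {M : ℝ≥0∞} (hM : ∀ b < 0, logMean G q b ≤ M) :
    ENNReal.ofReal (2 * q * min (q / 2) 1) *
      (∫⁻ τ in Iio 0, ENNReal.ofReal (-τ) * logEnergy G q τ) ≤ 2 * M := by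
  have hb : ∀ k : ℕ, -(1 / ((k : ℝ) + 1)) < 0 := fun k => by
    have : 0 < 1 / ((k : ℝ) + 1) := by positivity
    linarith
  have hlim : ∀ τ : ℝ, Tendsto (fun k : ℕ => ENNReal.ofReal (-(1 / ((k : ℝ) + 1)) - τ) * logEnergy G q τ)
      atTop (𝓝 (ENNReal.ofReal (-τ) * logEnergy G q τ)) := fun τ => by
    rcases le_or_gt 0 τ with h | h
    · have : ∀ k : ℕ, ENNReal.ofReal (-(1 / ((k : ℝ) + 1)) - τ) * logEnergy G q τ =
          ENNReal.ofReal (-τ) * logEnergy G q τ := fun k => by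
        rw [ENNReal.ofReal_of_nonpos (by linarith [hb k]), ENNReal.ofReal_of_nonpos (by linarith)]
      simp only [this]
      exact tendsto_const_nhds
    · have h0 : ENNReal.ofReal (-τ) ≠ 0 := by simpa using h
      refine ENNReal.Tendsto.mul_const (ENNReal.tendsto_ofReal ?_) (Or.inl h0)
      have := (tendsto_one_div_add_atTop_nhds_zero_nat (𝕜 := ℝ)).neg.sub_const τ
      simpa using this
  have hq2 : 0 < 2 * q * min (q / 2) 1 := by positivity
  calc _ = ENNReal.ofReal (2 * q * min (q / 2) 1) * (∫⁻ τ in Iio 0,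
        liminf (fun k : ℕ => ENNReal.ofReal (-(1 / ((k : ℝ) + 1)) - τ) * logEnergy G q τ) atTop) := by
        congr 1
        exact lintegral_congr fun τ => (hlim τ).liminf_eq.symm
    _ ≤ ENNReal.ofReal (2 * q * min (q / 2) 1) * liminf (fun k : ℕ => ∫⁻ τ in Iio 0,
        ENNReal.ofReal (-(1 / ((k : ℝ) + 1)) - τ) * logEnergy G q τ) atTop := by
        refine mul_le_mul_right (lintegral_liminf_le fun k => ?_) _
        exact (Measurable.ennreal_ofReal (by fun_prop)).mul (hG.measurable_logEnergy q)
    _ ≤ ENNReal.ofReal (2 * q * min (q / 2) 1) * ((2 * M) / ENNReal.ofReal (2 * q * min (q / 2) 1)) := by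
        refine mul_le_mul_right (liminf_le_of_frequently_le' (Frequently.of_forall fun k => ?_)) _
        rw [ENNReal.le_div_iff_mul_le (Or.inl (by simpa using hq2)) (Or.inl ENNReal.ofReal_ne_top), mul_comm]
        refine le_trans (mul_le_mul_right ?_ _) ((hG.lintegral_Iio_logEnergy_le hq (hb k)).trans
          (mul_le_mul_right (hM _ (hb k)) _))
        rw [← Iio_union_Ico_eq_Iio (hb k).le]
        refine (lintegral_union_le _ _ _).trans ?_
        rw [setLIntegral_congr_fun (g := fun _ => 0) measurableSet_Ico fun τ hτ => ?_, lintegral_zero, add_zero]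
        simp only
        rw [ENNReal.ofReal_of_nonpos (by linarith [hτ.1]), zero_mul]
    _ ≤ _ := ENNReal.mul_div_le

lemma rpow_sub_two_mul_sq {a : ℝ≥0∞} (ha : a ≠ ⊤) {p : ℝ} (hp : 0 < p) : a ^ (p - 2) * a ^ 2 = a ^ p := by
  rcases eq_or_ne a 0 with rfl | h0
  · simp [ENNReal.zero_rpow_of_pos hp]
  · rw [← ENNReal.rpow_natCast, ← ENNReal.rpow_add _ _ h0 ha]
    congr 1
    push_cast
    ring

lemma density_le {t s s' : ℝ} (ht : 0 < t) (hs : s.HolderConjugate s') {x x' h h' : ℂ} (hh : h ≠ 0) :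
    ‖x‖ₑ ^ (2 * t - 2) * ‖x'‖ₑ ^ 2 * ‖h‖ₑ ^ (2 * t) ≤
      2 * (‖x * h‖ₑ ^ (2 * t - 2) * ‖x' * h + x * h'‖ₑ ^ 2) +
        2 * (‖h‖ₑ ^ (2 * t * s' - 2) * ‖h'‖ₑ ^ 2) + ‖x‖ₑ ^ (2 * t * s - 2) * ‖x'‖ₑ ^ 2 := by
  have hs1 : 0 < s - 1 := by linarith [hs.lt]
  have hs2 : 0 < s' - 1 := by linarith [hs.symm.lt]
  have hh0 : ‖h‖ₑ ≠ 0 := by simpa using hh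
  have hprod : (s' - 1) * (s - 1) = 1 := by
    have := hs.mul_eq_add
    linarith
  rcases lt_or_ge (‖h‖ₑ ^ (2 * t * (s' - 1))) (‖x‖ₑ ^ (2 * t)) with hlt | hge
  · have hx0 : ‖x‖ₑ ≠ 0 := by
      intro h0
      rw [h0, ENNReal.zero_rpow_of_pos (by positivity)] at hlt
      exact not_lt_zero hlt
    have h1 : ‖h‖ₑ ^ (2 * t) ≤ ‖x‖ₑ ^ (2 * t * (s - 1)) := by
      have := ENNReal.rpow_le_rpow hlt.le hs1.le
      rwa [← ENNReal.rpow_mul, ← ENNReal.rpow_mul, mul_assoc, hprod, mul_one] at this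
    refine le_trans ?_ le_add_self
    calc _ ≤ ‖x‖ₑ ^ (2 * t - 2) * ‖x'‖ₑ ^ 2 * ‖x‖ₑ ^ (2 * t * (s - 1)) := mul_le_mul_right h1 _
      _ = ‖x‖ₑ ^ (2 * t - 2) * ‖x‖ₑ ^ (2 * t * (s - 1)) * ‖x'‖ₑ ^ 2 := by ring
      _ = _ := by
        rw [← ENNReal.rpow_add _ _ hx0 enorm_ne_top]
        congr 2
        ring
  · refine le_trans ?_ le_self_add
    have hsq : ‖x' * h‖ₑ ^ 2 ≤ 2 * ‖x' * h + x * h'‖ₑ ^ 2 + 2 * ‖x * h'‖ₑ ^ 2 := by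
      have e1 : x' * h = (x' * h + x * h') - x * h' := by ring
      calc ‖x' * h‖ₑ ^ 2 ≤ (‖x' * h + x * h'‖ₑ + ‖x * h'‖ₑ) ^ 2 := by
            nth_rewrite 1 [e1]
            gcongr
            exact enorm_sub_le
        _ ≤ _ := by
            rw [← mul_add]
            have := ENNReal.rpow_add_le_mul_rpow_add_rpow ‖x' * h + x * h'‖ₑ ‖x * h'‖ₑ (one_le_two)
            norm_num [-enorm_mul] at this
            exact_mod_cast this
    calc _ = (‖x‖ₑ * ‖h‖ₑ) ^ (2 * t - 2) * ‖x' * h‖ₑ ^ 2 := by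
          rw [ENNReal.mul_rpow_of_ne_top enorm_ne_top enorm_ne_top, enorm_mul, mul_pow,
            ← rpow_sub_two_mul_sq (enorm_ne_top (x := h)) (by positivity : 0 < 2 * t)]
          ring
      _ ≤ (‖x‖ₑ * ‖h‖ₑ) ^ (2 * t - 2) * (2 * ‖x' * h + x * h'‖ₑ ^ 2 + 2 * ‖x * h'‖ₑ ^ 2) :=
          mul_le_mul_right hsq _
      _ = 2 * (‖x * h‖ₑ ^ (2 * t - 2) * ‖x' * h + x * h'‖ₑ ^ 2) +
          2 * (‖x‖ₑ ^ (2 * t) * (‖h‖ₑ ^ (2 * t - 2) * ‖h'‖ₑ ^ 2)) := by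
          rw [← rpow_sub_two_mul_sq (enorm_ne_top (x := x)) (by positivity : 0 < 2 * t), enorm_mul x h,
            enorm_mul x h', ENNReal.mul_rpow_of_ne_top enorm_ne_top enorm_ne_top]
          ring
      _ ≤ _ := by
          gcongr _ + 2 * ?_
          calc _ ≤ ‖h‖ₑ ^ (2 * t * (s' - 1)) * (‖h‖ₑ ^ (2 * t - 2) * ‖h'‖ₑ ^ 2) := mul_le_mul_left hge _
            _ = _ := by
              rw [← mul_assoc, ← ENNReal.rpow_add _ _ hh0 enorm_ne_top]
              congr 2
              ring

lemma exists_weighted_energy_le_of_pos {t s s' : ℝ} (ht : 0 < t) (hs : s.HolderConjugate s') (hs3 : s' < 3) :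
    ∃ C : ℝ≥0∞, C ≠ ⊤ ∧ ∀ (f : ℂ → ℂ) (L : ℝ), 0 < L → DifferentiableOn ℂ f (ball 0 (Real.exp L)) →
      Measurable f → ∀ (Ψ : ℂ → ℝ) (B κ : ℝ), Measurable Ψ → (∀ z, |Ψ z| ≤ B) → 0 < κ → (∀ z, κ ≤ Ψ z) →
      ∀ U : ℂ → ℝ≥0∞, (∀ z ∈ ball (0 : ℂ) 1, ∀ w : ℂ, ‖w‖ = 1 → ‖w - z‖ ≤ 2 * (1 - ‖z‖) →
        U z ≤ ENNReal.ofReal (Ψ w)) →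
      ∫⁻ τ in Iio 0, ENNReal.ofReal (-τ) * ∫⁻ θ, ‖f (Complex.exp (τ + θ * Complex.I))‖ₑ ^ (2 * t - 2) *
          ‖deriv (fun w => f (Complex.exp w)) (τ + θ * Complex.I)‖ₑ ^ 2 *
            U (Complex.exp (τ + θ * Complex.I)) ∂thetaM ≤
        C * (logMean (fun w => f (Complex.exp w)) (2 * t * s) 0 +
          ∫⁻ θ : ℝ, ENNReal.ofReal (Ψ (Complex.exp (θ * Complex.I))) ^ s' ∂thetaM) := by
  have hs1 := hs.lt
  have hs1' := hs.symm.lt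
  obtain ⟨C₀, hC₀, hR⟩ := exists_logMean_le_re hs1' hs3
  set k : ℝ → ℝ≥0∞ := fun q => ENNReal.ofReal (2 * q * min (q / 2) 1) with hk
  have hk0 : ∀ q, 0 < q → k q ≠ 0 := fun q hq => by
    have : 0 < 2 * q * min (q / 2) 1 := by positivity
    simpa [hk] using this
  have hpi := Real.pi_pos
  refine ⟨ENNReal.ofReal (8 * Real.pi) * (2 * ((k (2 * t))⁻¹ * (2 * (1 + C₀))) +
    2 * ((k (2 * t * s'))⁻¹ * (2 * C₀)) + (k (2 * t * s))⁻¹ * 2), ?_, ?_⟩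
  · refine ENNReal.mul_ne_top ENNReal.ofReal_ne_top (ENNReal.add_ne_top.2 ⟨ENNReal.add_ne_top.2 ⟨?_, ?_⟩, ?_⟩)
    · exact ENNReal.mul_ne_top (by simp) (ENNReal.mul_ne_top (ENNReal.inv_ne_top.2 (hk0 _ (by positivity)))
        (ENNReal.mul_ne_top (by simp) (by simp [hC₀])))
    · exact ENNReal.mul_ne_top (by simp) (ENNReal.mul_ne_top (ENNReal.inv_ne_top.2 (hk0 _ (by positivity)))
        (ENNReal.mul_ne_top (by simp) hC₀))
    · exact ENNReal.mul_ne_top (ENNReal.inv_ne_top.2 (hk0 _ (by positivity))) (by simp)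
  intro f L hL hf hfm Ψ B κ hΨm hB hκ hκΨ U hU
  have hΨ0 : ∀ z, 0 ≤ Ψ z := fun z => hκ.le.trans (hκΨ z)
  set F := herglotz Ψ with hF
  have hFd := differentiableOn_herglotz hΨm hB
  have hre : ∀ z ∈ ball (0 : ℂ) 1, 0 < (F z).re := fun z hz => hκ.trans_le (le_re_herglotz hΨm hB hκΨ hz)
  set H : ℂ → ℂ := (ball (0 : ℂ) 1).indicator fun z => Complex.exp (((2 * t)⁻¹ : ℝ) * Complex.log (F z)) with hH
  have hHeq : EqOn H (fun z => Complex.exp (((2 * t)⁻¹ : ℝ) * Complex.log (F z))) (ball 0 1) :=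
    fun z hz => indicator_of_mem hz _
  have hHd' : DifferentiableOn ℂ (fun z => Complex.exp (((2 * t)⁻¹ : ℝ) * Complex.log (F z))) (ball 0 1) :=
    ((hFd.clog fun z hz => Or.inl (hre z hz)).const_mul _).cexp
  have hHd : DifferentiableOn ℂ H (ball 0 1) := hHd'.congr hHeq
  have hHm : Measurable H := by
    classical
    rw [hH, ← piecewise_eq_indicator]
    exact hHd'.continuousOn.measurable_piecewise continuousOn_const measurableSet_ball
  have hHn : ∀ z ∈ ball (0 : ℂ) 1, ‖H z‖ₑ ^ (2 * t) = ‖F z‖ₑ := fun z hz => by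
    have h0 : F z ≠ 0 := fun h => by have := hre z hz; rw [h] at this; simp at this
    have h1 : 0 < ‖F z‖ := by positivity
    rw [hHeq hz, ← ofReal_norm, ← ofReal_norm, ENNReal.ofReal_rpow_of_nonneg (norm_nonneg _) (by positivity)]
    simp only [Complex.norm_exp]
    rw [Complex.re_ofReal_mul, Complex.log_re, ← Real.exp_mul, mul_comm, ← mul_assoc,
      mul_inv_cancel₀ (by positivity), one_mul, Real.exp_log h1]
  have hHne : ∀ z ∈ ball (0 : ℂ) 1, H z ≠ 0 := fun z hz => by
    rw [hHeq hz]; exact Complex.exp_ne_zero _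
  set G : ℂ → ℂ := fun w => f (Complex.exp w) with hG
  set K : ℂ → ℂ := fun w => H (Complex.exp w) with hK
  have hGL : LogHol L G := LogHol.comp_exp hf hfm
  have hG0 : LogHol 0 G := LogHol.comp_exp (hf.mono (ball_subset_ball (Real.exp_le_exp.2 hL.le))) hfm
  have hK0 : LogHol 0 K := LogHol.comp_exp (by simpa using hHd) hHm
  have hGK := hG0.mul hK0
  have hlF : ∀ b < 0, logMean (fun w => F (Complex.exp w)) s' b ≤
      C₀ * ∫⁻ θ : ℝ, ENNReal.ofReal (Ψ (Complex.exp (θ * Complex.I))) ^ s' ∂thetaM := fun b hb => by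
    refine (hR F hFd hre (im_herglotz_zero Ψ) b hb).trans (mul_le_mul_right ?_ _)
    refine le_trans (le_of_eq (lintegral_congr fun θ => ?_))
      (lintegral_re_herglotz_rpow_le hΨm hB hΨ0 hs1'.le hb)
    rw [ENNReal.ofReal_rpow_of_nonneg (hre _ (exp_add_mul_I_mem_ball hb θ)).le (by linarith)]
  set A := logMean G (2 * t * s) 0 with hA
  set E := ∫⁻ θ : ℝ, ENNReal.ofReal (Ψ (Complex.exp (θ * Complex.I))) ^ s' ∂thetaM with hE
  have hlf : ∀ b < 0, logMean G (2 * t * s) b ≤ A := fun b hb => hGL.logMean_mono (by positivity) hb.le hL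
  have hlH : ∀ b < 0, logMean K (2 * t * s') b ≤ C₀ * E := fun b hb => by
    refine le_trans (le_of_eq (lintegral_congr fun θ => ?_)) (hlF b hb)
    rw [ENNReal.rpow_mul, hHn _ (exp_add_mul_I_mem_ball hb θ)]
  have hlfH : ∀ b < 0, logMean (fun w => G w * K w) (2 * t) b ≤ A + C₀ * E := fun b hb => by
    refine le_trans ?_ (add_le_add (hlf b hb) (hlF b hb))
    have hmG : Measurable fun θ : ℝ => ‖G (b + θ * Complex.I)‖ₑ ^ (2 * t * s) :=
      (hGL.meas.comp (measurable_line b)).enorm.pow_const _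
    rw [logMean, logMean, logMean, ← lintegral_add_left hmG]
    refine lintegral_mono fun θ => ?_
    rw [enorm_mul, ENNReal.mul_rpow_of_nonneg _ _ (by positivity), hHn _ (exp_add_mul_I_mem_ball hb θ)]
    refine (ENNReal.young_inequality _ _ hs).trans (add_le_add ?_ ?_)
    · rw [ENNReal.rpow_mul _ (2 * t) s]
      exact ENNReal.div_le_of_le_mul (le_mul_of_one_le_right' (ENNReal.one_le_ofReal.2 hs1.le))
    · exact ENNReal.div_le_of_le_mul (le_mul_of_one_le_right' (ENNReal.one_le_ofReal.2 hs1'.le))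
  have hpt : ∀ τ : ℝ, τ < 0 → ∀ θ : ℝ, ‖G (τ + θ * Complex.I)‖ₑ ^ (2 * t - 2) *
      ‖deriv G (τ + θ * Complex.I)‖ₑ ^ 2 * U (Complex.exp (τ + θ * Complex.I)) ≤
      ENNReal.ofReal (8 * Real.pi) *
       (2 * (‖G (τ + θ * Complex.I) * K (τ + θ * Complex.I)‖ₑ ^ (2 * t - 2) *
          ‖deriv (fun w => G w * K w) (τ + θ * Complex.I)‖ₑ ^ 2) +
        2 * (‖K (τ + θ * Complex.I)‖ₑ ^ (2 * t * s' - 2) * ‖deriv K (τ + θ * Complex.I)‖ₑ ^ 2) +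
        ‖G (τ + θ * Complex.I)‖ₑ ^ (2 * t * s - 2) * ‖deriv G (τ + θ * Complex.I)‖ₑ ^ 2) := fun τ hτ θ => by
    have hin := exp_add_mul_I_mem_ball hτ θ
    set w : ℂ := τ + θ * Complex.I with hw
    have hwm : {w : ℂ | w.re < 0} ∈ 𝓝 w := (isOpen_lt Complex.continuous_re continuous_const).mem_nhds (by
      simpa [hw] using hτ)
    have hU1 : U (Complex.exp w) ≤ ENNReal.ofReal (8 * Real.pi) * ‖F (Complex.exp w)‖ₑ := by
      have hUt : U (Complex.exp w) ≠ ⊤ := by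
        obtain ⟨w₀, h1, h2⟩ : ∃ w₀ : ℂ, ‖w₀‖ = 1 ∧ ‖w₀ - Complex.exp w‖ ≤ 2 * (1 - ‖Complex.exp w‖) := by
          have h1 : ‖Complex.exp w‖ < 1 := by simpa using hin
          have h0 : ‖Complex.exp w‖ ≠ 0 := norm_ne_zero_iff.2 (Complex.exp_ne_zero w)
          refine ⟨Complex.exp w / ‖Complex.exp w‖, ?_, ?_⟩
          · rw [norm_div, Complex.norm_real, norm_norm, div_self h0]
          · have h3 : Complex.exp w / ‖Complex.exp w‖ - Complex.exp w =
                (Complex.exp w / ‖Complex.exp w‖) * ((1 - ‖Complex.exp w‖ : ℝ) : ℂ) := by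
              have : (‖Complex.exp w‖ : ℂ) ≠ 0 := by simp
              field_simp
              push_cast
              ring
            rw [h3, norm_mul, norm_div, Complex.norm_real, norm_norm, div_self h0, one_mul,
              Complex.norm_real, Real.norm_of_nonneg (by linarith)]
            linarith
        exact ne_top_of_le_ne_top ENNReal.ofReal_ne_top (hU _ hin w₀ h1 h2)
      have h4 := le_re_herglotz_of_near hΨm hB hΨ0 hin (u := (U (Complex.exp w)).toReal) ENNReal.toReal_nonneg
        fun v hv hv' => ENNReal.toReal_le_of_le_ofReal (hΨ0 v) (hU _ hin v hv hv')
      rw [← ENNReal.ofReal_toReal hUt, ← ofReal_norm, ← ENNReal.ofReal_mul (by positivity)]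
      exact ENNReal.ofReal_le_ofReal (h4.trans (mul_le_mul_of_nonneg_left (Complex.re_le_norm _) (by positivity)))
    have hd : deriv (fun w => G w * K w) w = deriv G w * K w + G w * deriv K w :=
      deriv_fun_mul (hG0.diff.differentiableAt hwm) (hK0.diff.differentiableAt hwm)
    rw [hd]
    refine le_trans (mul_le_mul_right hU1 _) ?_
    rw [mul_left_comm, ← hHn _ hin]
    exact mul_le_mul_right (density_le ht hs (hHne _ hin)) _
  have hmE2 := fun q => hK0.measurable_logEnergy q
  have hmE3 := fun q => hG0.measurable_logEnergy q
  have hwm : Measurable fun τ : ℝ => ENNReal.ofReal (-τ) := by fun_prop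
  have hI : ∀ {Q : ℂ → ℂ}, LogHol 0 Q → ∀ (q : ℝ) {M : ℝ≥0∞}, 0 < q → (∀ b < 0, logMean Q q b ≤ M) →
      ∫⁻ τ in Iio 0, ENNReal.ofReal (-τ) * logEnergy Q q τ ≤ (k q)⁻¹ * (2 * M) := fun {Q} hQ q M hq hM => by
    have := hQ.lintegral_Iio_zero_logEnergy_le hq hM
    rw [mul_comm (k q)⁻¹, ← div_eq_mul_inv, ENNReal.le_div_iff_mul_le (Or.inl (hk0 q hq))
      (Or.inl ENNReal.ofReal_ne_top), mul_comm]
    exact this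
  calc _ ≤ ∫⁻ τ in Iio 0, ENNReal.ofReal (8 * Real.pi) * (2 * (ENNReal.ofReal (-τ) * logEnergy (fun w => G w * K w) (2 * t) τ) +
        2 * (ENNReal.ofReal (-τ) * logEnergy K (2 * t * s') τ) + ENNReal.ofReal (-τ) * logEnergy G (2 * t * s) τ) := by
        refine setLIntegral_mono' measurableSet_Iio fun τ hτ => ?_
        refine le_trans (mul_le_mul_right (lintegral_mono (hpt τ hτ)) _) (le_of_eq ?_)
        have hm1 : ∀ {Q : ℂ → ℂ}, LogHol 0 Q → ∀ q : ℝ, Measurable fun θ : ℝ => ‖Q (τ + θ * Complex.I)‖ₑ ^ (q - 2) *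
            ‖deriv Q (τ + θ * Complex.I)‖ₑ ^ 2 := fun {Q} hQ q =>
          ((hQ.meas.comp (measurable_line τ)).enorm.pow_const _).mul
            (((measurable_deriv Q).comp (measurable_line τ)).enorm.pow_const _)
        rw [lintegral_const_mul' _ _ ENNReal.ofReal_ne_top, lintegral_add_right _ (hm1 hG0 (2 * t * s)),
          lintegral_add_right _ ((hm1 hK0 (2 * t * s')).const_mul 2), lintegral_const_mul' _ _ (by simp),
          lintegral_const_mul' _ _ (by simp)]
        simp only [logEnergy]
        ring
    _ = ENNReal.ofReal (8 * Real.pi) * (2 * (∫⁻ τ in Iio 0, ENNReal.ofReal (-τ) * logEnergy (fun w => G w * K w) (2 * t) τ) +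
        2 * (∫⁻ τ in Iio 0, ENNReal.ofReal (-τ) * logEnergy K (2 * t * s') τ) +
          ∫⁻ τ in Iio 0, ENNReal.ofReal (-τ) * logEnergy G (2 * t * s) τ) := by
        have hm3 : Measurable fun τ => ENNReal.ofReal (-τ) * logEnergy G (2 * t * s) τ := hwm.mul (hmE3 _)
        have hm2 : Measurable fun τ => 2 * (ENNReal.ofReal (-τ) * logEnergy K (2 * t * s') τ) :=
          (hwm.mul (hmE2 _)).const_mul 2
        rw [lintegral_const_mul' _ _ ENNReal.ofReal_ne_top, lintegral_add_right _ hm3,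
          lintegral_add_right _ hm2, lintegral_const_mul' _ _ (by simp),
          lintegral_const_mul' _ _ (by simp)]
    _ ≤ ENNReal.ofReal (8 * Real.pi) * (2 * ((k (2 * t))⁻¹ * (2 * (A + C₀ * E))) +
        2 * ((k (2 * t * s'))⁻¹ * (2 * (C₀ * E))) + (k (2 * t * s))⁻¹ * (2 * A)) := by
        gcongr
        · exact hI hGK _ (by positivity) hlfH
        · exact hI hK0 _ (by positivity) hlH
        · exact hI hG0 _ (by positivity) hlf
    _ ≤ ENNReal.ofReal (8 * Real.pi) * (2 * ((k (2 * t))⁻¹ * (2 * ((1 + C₀) * (A + E)))) +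
        2 * ((k (2 * t * s'))⁻¹ * (2 * (C₀ * (A + E)))) + (k (2 * t * s))⁻¹ * (2 * (A + E))) := by
        gcongr
        · rw [add_mul, one_mul]
          exact add_le_add le_self_add (mul_le_mul_right le_add_self _)
        · exact le_add_self
        · exact le_self_add
    _ = _ := by ring

end WeightedEnergy

section Anisotropic

variable {n : ℕ}

lemma herm_eq_inner (z w : En n) : herm z w = inner ℂ w z := by
  simp [herm, PiLp.inner_apply]

/-- The nonisotropic distance `|1 - ⟨z,w⟩|`. -/
def aniDist (z w : En n) : ℝ := ‖(1 : ℂ) - inner ℂ w z‖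

lemma aniDist_nonneg (z w : En n) : 0 ≤ aniDist z w := norm_nonneg _

lemma aniDist_comm (z w : En n) : aniDist z w = aniDist w z := by
  unfold aniDist
  rw [← RCLike.norm_conj, map_sub, map_one, inner_conj_symm]

lemma continuous_aniDist : Continuous fun x : En n × En n => aniDist x.1 x.2 := by
  unfold aniDist
  fun_prop

lemma aniDist_le_two {z w : En n} (hz : ‖z‖ ≤ 1) (hw : ‖w‖ ≤ 1) : aniDist z w ≤ 2 := by
  have := norm_inner_le_norm (𝕜 := ℂ) w z
  have h2 : ‖w‖ * ‖z‖ ≤ 1 := mul_le_one₀ hw (norm_nonneg _) hz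
  have h3 := norm_sub_le (1 : ℂ) (inner ℂ w z)
  rw [norm_one] at h3
  unfold aniDist
  linarith

lemma one_sub_norm_le_aniDist {z w : En n} (hw : ‖w‖ ≤ 1) : 1 - ‖z‖ ≤ aniDist z w := by
  have := norm_inner_le_norm (𝕜 := ℂ) w z
  have h2 : ‖w‖ * ‖z‖ ≤ ‖z‖ := mul_le_of_le_one_left (norm_nonneg _) hw
  have h3 := norm_sub_norm_le (1 : ℂ) (inner ℂ w z)
  rw [norm_one] at h3
  unfold aniDist
  linarith

lemma aniDist_smul_left_le {z w : En n} (hz : ‖z‖ ≤ 1) (hw : ‖w‖ ≤ 1) (c : ℂ) :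
    aniDist (c • z) w ≤ aniDist z w + ‖1 - c‖ := by
  unfold aniDist
  rw [inner_smul_right, show (1 : ℂ) - c * inner ℂ w z = (1 - inner ℂ w z) + (1 - c) * inner ℂ w z by ring]
  refine (norm_add_le _ _).trans (add_le_add le_rfl ?_)
  rw [norm_mul]
  refine mul_le_of_le_one_right (norm_nonneg _) ((norm_inner_le_norm (𝕜 := ℂ) w z).trans ?_)
  exact mul_le_one₀ hw (norm_nonneg _) hz

lemma norm_sub_inner_smul_sq (z : En n) {b : En n} (hb : ‖b‖ = 1) :
    ‖z - (inner ℂ b z : ℂ) • b‖ ^ 2 = ‖z‖ ^ 2 - ‖(inner ℂ b z : ℂ)‖ ^ 2 := by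
  have h : inner ℂ ((inner ℂ b z : ℂ) • b) (z - (inner ℂ b z : ℂ) • b) = (0 : ℂ) := by
    rw [inner_smul_left, inner_sub_right, inner_smul_right, inner_self_eq_norm_sq_to_K, hb]
    simp
  have h2 := norm_add_sq_eq_norm_sq_add_norm_sq_of_inner_eq_zero _ _ h
  rw [add_sub_cancel, norm_smul, hb] at h2
  nlinarith

lemma norm_sub_inner_smul_sq_le {z b : En n} (hz : ‖z‖ ≤ 1) (hb : ‖b‖ = 1) :
    ‖z - (inner ℂ b z : ℂ) • b‖ ^ 2 ≤ 2 * aniDist z b := by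
  rw [norm_sub_inner_smul_sq z hb]
  have h1 := norm_sub_norm_le (1 : ℂ) (inner ℂ b z)
  rw [norm_one] at h1
  unfold aniDist
  nlinarith [norm_nonneg z, norm_nonneg (inner ℂ b z : ℂ), norm_inner_le_norm (𝕜 := ℂ) b z,
    sq_nonneg (1 - ‖(inner ℂ b z : ℂ)‖)]

lemma aniDist_triangle_unit {a b c : En n} (ha : ‖a‖ ≤ 1) (hb : ‖b‖ = 1) (hc : ‖c‖ ≤ 1) :
    aniDist a c ≤ 2 * (aniDist a b + aniDist b c) := by
  set u := a - (inner ℂ b a : ℂ) • b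
  set v := c - (inner ℂ b c : ℂ) • b
  have h1 : (1 : ℂ) - inner ℂ c a = (1 - inner ℂ b a) + inner ℂ b a * (1 - inner ℂ c b) - inner ℂ v u := by
    simp only [u, v, inner_sub_left, inner_sub_right, inner_smul_left, inner_smul_right, inner_conj_symm,
      inner_self_eq_norm_sq_to_K, hb]
    push_cast
    ring
  have hu := norm_sub_inner_smul_sq_le ha hb
  have hv := norm_sub_inner_smul_sq_le hc hb
  rw [aniDist_comm c b] at hv
  have h2 : ‖(inner ℂ v u : ℂ)‖ ≤ aniDist a b + aniDist b c := by
    refine (norm_inner_le_norm v u).trans ?_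
    nlinarith [sq_nonneg (‖u‖ - ‖v‖)]
  have h3 : ‖(inner ℂ b a : ℂ)‖ ≤ 1 := (norm_inner_le_norm b a).trans (by rw [hb, one_mul]; exact ha)
  calc aniDist a c = ‖(1 - inner ℂ b a) + inner ℂ b a * (1 - inner ℂ c b) - inner ℂ v u‖ := by
        rw [← h1]; rfl
    _ ≤ ‖(1 : ℂ) - inner ℂ b a‖ + ‖(inner ℂ b a : ℂ)‖ * ‖(1 : ℂ) - inner ℂ c b‖ + ‖(inner ℂ v u : ℂ)‖ := by
        rw [← norm_mul]
        exact (norm_sub_le _ _).trans (add_le_add (norm_add_le _ _) le_rfl)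
    _ ≤ aniDist a b + 1 * aniDist b c + (aniDist a b + aniDist b c) := by
        gcongr
        · rfl
        · rfl
    _ = _ := by ring

lemma exists_unit_smul (z : En n) [NeZero n] : ∃ η : En n, ‖η‖ = 1 ∧ z = ‖z‖ • η := by
  by_cases hz : z = 0
  · exact ⟨EuclideanSpace.single 0 1, by simp, by simp [hz]⟩
  · refine ⟨‖z‖⁻¹ • z, ?_, ?_⟩
    · rw [norm_smul]; simp [hz]
    · rw [smul_inv_smul₀]; simpa using hz

lemma aniDist_le_aniDist_smul_add {ξ x : En n} (hξ : ‖ξ‖ ≤ 1) (hx : ‖x‖ ≤ 1) {r : ℝ} (hr : r ≤ 1) :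
    aniDist ξ x ≤ aniDist (r • ξ) x + (1 - r) := by
  unfold aniDist
  rw [inner_smul_right_eq_smul, Complex.real_smul, show (1 : ℂ) - inner ℂ x ξ =
    (1 - (r : ℂ) * inner ℂ x ξ) - ((1 - r : ℝ) : ℂ) * inner ℂ x ξ by push_cast; ring]
  refine (norm_sub_le _ _).trans (add_le_add le_rfl ?_)
  rw [norm_mul, Complex.norm_real, Real.norm_of_nonneg (by linarith)]
  exact mul_le_of_le_one_right (by linarith) ((norm_inner_le_norm x ξ).trans
    (mul_le_one₀ hx (norm_nonneg _) hξ))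

/-- The nonisotropic dilation with factor `d` along `η` and `√d` in the orthogonal directions. -/
def aniDil (η : En n) (d : ℝ) : En n →ₗ[ℂ] En n :=
  (Real.sqrt d : ℂ) • LinearMap.transvection (((Real.sqrt d - 1 : ℝ) : ℂ) • (innerSL ℂ η).toLinearMap) η

lemma aniDil_apply (η : En n) (d : ℝ) (u : En n) :
    aniDil η d u = (Real.sqrt d : ℂ) • (u + (((Real.sqrt d - 1 : ℝ) : ℂ) * inner ℂ η u) • η) := by
  simp [aniDil, LinearMap.transvection.apply]

lemma inner_aniDil {η : En n} (hη : ‖η‖ = 1) {d : ℝ} (hd : 0 ≤ d) (u : En n) :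
    inner ℂ η (aniDil η d u) = (d : ℂ) * inner ℂ η u := by
  have : (d : ℂ) = (Real.sqrt d : ℂ) * Real.sqrt d := by
    rw [← Complex.ofReal_mul, Real.mul_self_sqrt hd]
  rw [aniDil_apply, inner_smul_right, inner_add_right, inner_smul_right, inner_self_eq_norm_sq_to_K, hη, this]
  push_cast
  ring

lemma aniDil_sub {η : En n} (hη : ‖η‖ = 1) {d : ℝ} (hd : 0 ≤ d) (u : En n) :
    aniDil η d u - (inner ℂ η (aniDil η d u) : ℂ) • η =
      (Real.sqrt d : ℂ) • (u - (inner ℂ η u : ℂ) • η) := by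
  have : (d : ℂ) = (Real.sqrt d : ℂ) * Real.sqrt d := by
    rw [← Complex.ofReal_mul, Real.mul_self_sqrt hd]
  rw [inner_aniDil hη hd, aniDil_apply, this]
  push_cast
  module

lemma det_aniDil {η : En n} (hη : ‖η‖ = 1) {d : ℝ} (hd : 0 ≤ d) :
    ((aniDil η d).restrictScalars ℝ).det = d ^ (n + 1) := by
  have h1 : (aniDil η d).det = ((Real.sqrt d ^ (n + 1) : ℝ) : ℂ) := by
    rw [aniDil, LinearMap.det_smul, LinearMap.transvection.det, finrank_euclideanSpace_fin]
    simp [inner_self_eq_norm_sq_to_K, hη, pow_succ]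
  rw [LinearMap.det_restrictScalars, h1, Algebra.norm_complex_apply, Complex.normSq_ofReal,
    ← mul_pow, Real.mul_self_sqrt hd]

end Anisotropic

section CapMeasure

variable {n : ℕ}

/-- The nonisotropic cap of radius `R` about `η`. -/
def aniCap (η : En n) (R : ℝ) : Set (En n) := {ξ | aniDist ξ η < R}

lemma measurableSet_aniCap (η : En n) (R : ℝ) : MeasurableSet (aniCap η R) :=
  (isOpen_lt (continuous_aniDist.comp (Continuous.prodMk_left η)) continuous_const).measurableSet

lemma lintegral_aniDil {η : En n} (hη : ‖η‖ = 1) {d : ℝ} (hd : 0 < d) (p : En n) {F : En n → ℝ≥0∞}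
    (hF : Measurable F) :
    ENNReal.ofReal (d ^ (n + 1)) * ∫⁻ u, F (p + aniDil η d u) = ∫⁻ w, F w := by
  have hdet := det_aniDil hη hd.le
  have h0 : ((aniDil η d).restrictScalars ℝ).det ≠ 0 := by rw [hdet]; positivity
  have hmap := Measure.map_linearMap_addHaar_eq_smul_addHaar (volume : Measure (En n)) h0
  have hc : Measurable ((aniDil η d).restrictScalars ℝ) :=
    (LinearMap.continuous_of_finiteDimensional _).measurable
  have h1 : ∫⁻ u, F (p + aniDil η d u) = ∫⁻ w, F (p + w) ∂(volume.map ((aniDil η d).restrictScalars ℝ)) :=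
    (lintegral_map (f := fun w => F (p + w)) (hF.comp (measurable_const_add p)) hc).symm
  rw [h1, hmap, lintegral_smul_measure, hdet, smul_eq_mul, ← mul_assoc, abs_of_pos (by positivity),
    ← ENNReal.ofReal_mul (by positivity), mul_inv_cancel₀ (by positivity), ENNReal.ofReal_one, one_mul]
  exact lintegral_add_left_eq_self F p

lemma lintegral_annulus [NeZero n] {G : En n → ℝ≥0∞} (hG : Measurable G) (s : ℝ) :
    ∫⁻ z in {z : En n | s < ‖z‖}, G (‖z‖⁻¹ • z) ∂volN n =
      (∫⁻ r in Ioo (0 : ℝ) 1, (Ioi s).indicator (fun r => ENNReal.ofReal (2 * n * r ^ (2 * n - 1))) r) *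
        ∫⁻ ξ, G ξ ∂sigmaS n := by
  have hS : MeasurableSet {z : En n | s < ‖z‖} := measurableSet_lt measurable_const measurable_norm
  have hm : Measurable fun z : En n => G (‖z‖⁻¹ • z) := hG.comp measurable_normalize
  rw [← lintegral_indicator hS, lintegral_volN_eq (hm.indicator hS), ← lintegral_mul_const'']
  · refine setLIntegral_congr_fun measurableSet_Ioo fun r hr => ?_
    have : ∫⁻ ζ, ({z : En n | s < ‖z‖}.indicator fun z => G (‖z‖⁻¹ • z)) (r • ζ) ∂sigmaS n =
        (Ioi s).indicator 1 r * ∫⁻ ξ, G ξ ∂sigmaS n := by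
      rw [← lintegral_const_mul _ hG]
      refine lintegral_congr_ae ?_
      filter_upwards [sigmaS_ae_norm] with ζ hζ
      have hn : ‖r • ζ‖ = r := by rw [norm_smul, hζ, mul_one, Real.norm_of_nonneg hr.1.le]
      have h2 : ‖r • ζ‖⁻¹ • (r • ζ) = ζ := by rw [hn, inv_smul_smul₀ hr.1.ne']
      by_cases h : s < r
      · rw [indicator_of_mem (by show s < ‖r • ζ‖; rwa [hn]), h2, indicator_of_mem (by exact h)]
        simp
      · rw [indicator_of_notMem (by show ¬ s < ‖r • ζ‖; rwa [hn]), indicator_of_notMem (by exact h)]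
        simp
    simp only [this]
    by_cases h : r ∈ Ioi s
    · simp [indicator_of_mem h]
    · simp [indicator_of_notMem h]
  · exact (Measurable.indicator (by fun_prop) measurableSet_Ioi).aemeasurable

lemma radial_factor_le (s : ℝ) :
    ∫⁻ r in Ioo (0 : ℝ) 1, (Ioi s).indicator (fun r => ENNReal.ofReal (2 * n * r ^ (2 * n - 1))) r ≤
      ENNReal.ofReal (2 * n * (1 - s)) := by
  calc _ ≤ ∫⁻ r in Ioo (0 : ℝ) 1, (Ioi s).indicator (fun r => ENNReal.ofReal (2 * n)) r := by
        refine setLIntegral_mono' measurableSet_Ioo fun r hr => indicator_le_indicator ?_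
        exact ENNReal.ofReal_le_ofReal (mul_le_of_le_one_right (by positivity) (pow_le_one₀ hr.1.le hr.2.le))
    _ = ∫⁻ r in Ioi s ∩ Ioo (0 : ℝ) 1, ENNReal.ofReal (2 * n) := by
        rw [lintegral_indicator measurableSet_Ioi, Measure.restrict_restrict measurableSet_Ioi]
    _ ≤ ENNReal.ofReal (2 * n) * volume (Ioo s 1) := by
        rw [setLIntegral_const]
        gcongr
        exact fun r hr => ⟨hr.1, hr.2.2⟩
    _ = _ := by
        rw [Real.volume_Ioo, ← ENNReal.ofReal_mul (by positivity)]

lemma le_radial_factor [NeZero n] {d : ℝ} (hd : 0 ≤ d) (hd1 : d ≤ 1) :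
    ENNReal.ofReal d ≤ ∫⁻ r in Ioo (0 : ℝ) 1,
      (Ioi (1 - d)).indicator (fun r => ENNReal.ofReal (2 * n * r ^ (2 * n - 1))) r := by
  have hn := Nat.one_le_iff_ne_zero.2 (NeZero.ne n)
  rw [lintegral_indicator measurableSet_Ioi, Measure.restrict_restrict measurableSet_Ioi]
  have hset : Ioi (1 - d) ∩ Ioo 0 1 = Ioo (1 - d) 1 := by
    ext r; simp only [mem_inter_iff, mem_Ioi, mem_Ioo]
    constructor
    · rintro ⟨h1, h2, h3⟩; exact ⟨h1, h3⟩
    · rintro ⟨h1, h3⟩; exact ⟨h1, by linarith, h3⟩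
  have hintg : ∫ r in (1 - d)..1, 2 * n * r ^ (2 * n - 1) = 1 - (1 - d) ^ (2 * n) := by
    rw [intervalIntegral.integral_const_mul, integral_pow]
    have : ((2 * n - 1 : ℕ) : ℝ) + 1 = 2 * n := by
      rw [Nat.cast_sub (by omega)]; push_cast; ring
    rw [this, Nat.sub_add_cancel (by omega)]
    have : (n : ℝ) ≠ 0 := by exact_mod_cast NeZero.ne n
    field_simp
    simp
  rw [hset, restrict_Ioo_eq_restrict_Ioc, ← ofReal_integral_eq_lintegral_ofReal,
    ← intervalIntegral.integral_of_le (by linarith), hintg]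
  · apply ENNReal.ofReal_le_ofReal
    have : (1 - d) ^ (2 * n) ≤ 1 - d := pow_le_of_le_one (by linarith) (by linarith) (by omega)
    linarith
  · exact (Continuous.integrableOn_Icc (by fun_prop)).mono_set Ioc_subset_Icc_self
  · refine (ae_restrict_iff' measurableSet_Ioc).2 (ae_of_all _ fun r hr => ?_)
    have : 0 ≤ r := by linarith [hr.1]
    positivity

lemma volN_le (S : Set (En n)) : volN n S ≤ (volume (Bn n))⁻¹ * volume S := by
  rw [volN, Measure.smul_apply, smul_eq_mul]
  exact mul_le_mul_right (Measure.restrict_apply_le _ _) _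

lemma volume_setOf_aniDil {η : En n} (hη : ‖η‖ = 1) {d : ℝ} (hd : 0 < d) (p : En n) {S : Set (En n)}
    (hS : MeasurableSet S) :
    ENNReal.ofReal (d ^ (n + 1)) * volume {u | p + aniDil η d u ∈ S} = volume S := by
  have hc : Measurable fun u => p + aniDil η d u :=
    (LinearMap.continuous_of_finiteDimensional ((aniDil η d).restrictScalars ℝ)).measurable.const_add p
  have := lintegral_aniDil hη hd p (F := S.indicator 1) (measurable_one.indicator hS)
  rw [lintegral_indicator_one hS] at this
  rw [← this]
  congr 1
  exact (lintegral_indicator_one (hc hS)).symm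

lemma measurableSet_shell_cap (η : En n) (s R : ℝ) :
    MeasurableSet ({z : En n | s < ‖z‖} ∩ {z | ‖z‖⁻¹ • z ∈ aniCap η R}) :=
  (measurableSet_lt measurable_const measurable_norm).inter
    (measurable_normalize (measurableSet_aniCap η R))

lemma volN_shell_cap [NeZero n] (η : En n) (s R : ℝ) :
    volN n ({z : En n | s < ‖z‖} ∩ {z | ‖z‖⁻¹ • z ∈ aniCap η R}) =
      (∫⁻ r in Ioo (0 : ℝ) 1, (Ioi s).indicator (fun r => ENNReal.ofReal (2 * n * r ^ (2 * n - 1))) r) *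
        sigmaS n (aniCap η R) := by
  have h := lintegral_annulus (n := n) (G := (aniCap η R).indicator 1)
    (measurable_one.indicator (measurableSet_aniCap η R)) s
  rw [lintegral_indicator_one (measurableSet_aniCap η R)] at h
  rw [← h, inter_comm]
  have h2 : MeasurableSet {z : En n | ‖z‖⁻¹ • z ∈ aniCap η R} :=
    measurable_normalize (measurableSet_aniCap η R)
  rw [← Measure.restrict_apply h2, ← lintegral_indicator_one h2]
  rfl

lemma exists_sigmaS_aniCap_le (n : ℕ) [NeZero n] : ∃ C : ℝ≥0∞, C ≠ ⊤ ∧ ∀ (η : En n) (d : ℝ), ‖η‖ = 1 → 0 < d →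
    sigmaS n (aniCap η d) ≤ C * ENNReal.ofReal (d ^ n) := by
  refine ⟨(volume (Bn n))⁻¹ * volume (ball (0 : En n) 3) + 1, ?_, fun η d hη hd => ?_⟩
  · exact ENNReal.add_ne_top.2 ⟨ENNReal.mul_ne_top (ENNReal.inv_ne_top.2 volume_Bn_ne_zero)
      measure_ball_lt_top.ne, ENNReal.one_ne_top⟩
  rcases lt_or_ge 1 d with h1 | h1
  · calc sigmaS n (aniCap η d) ≤ 1 := prob_le_one
      _ = 1 * ENNReal.ofReal 1 := by simp
      _ ≤ _ := mul_le_mul' le_add_self (ENNReal.ofReal_le_ofReal (one_le_pow₀ h1.le))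
  set S := {z : En n | 1 - d < ‖z‖} ∩ {z | ‖z‖⁻¹ • z ∈ aniCap η d} ∩ Bn n with hS
  have hSm : MeasurableSet S := (measurableSet_shell_cap η (1 - d) d).inter measurableSet_Bn
  have hv : ENNReal.ofReal d * sigmaS n (aniCap η d) ≤ (volume (Bn n))⁻¹ * volume S := by
    refine le_trans ?_ (volN_le S)
    have : volN n S = volN n ({z : En n | 1 - d < ‖z‖} ∩ {z | ‖z‖⁻¹ • z ∈ aniCap η d}) := by
      rw [volN, Measure.smul_apply, Measure.smul_apply, Measure.restrict_apply hSm,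
        Measure.restrict_apply (measurableSet_shell_cap η _ _), hS, inter_assoc, inter_self]
    rw [this, volN_shell_cap]
    exact mul_le_mul_left (le_radial_factor hd.le h1) _
  have hsub : {u | η + aniDil η d u ∈ S} ⊆ ball 0 3 := by
    rintro u ⟨⟨hz1, hz2⟩, hz3⟩
    set z := η + aniDil η d u with hz
    have hz3' : ‖z‖ < 1 := by simpa [Bn] using hz3
    have hz1' : 1 - d < ‖z‖ := hz1
    have hz0 : 0 < ‖z‖ := by linarith
    have hξ : ‖‖z‖⁻¹ • z‖ ≤ 1 := by rw [norm_smul]; simp [hz0.ne']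
    have hzη : aniDist z η ≤ 2 * d := by
      have h2 := aniDist_smul_left_le hξ hη.le (‖z‖ : ℂ)
      have h3 : ((‖z‖ : ℝ) : ℂ) • (‖z‖⁻¹ • z) = z := by
        rw [Complex.coe_smul, smul_inv_smul₀ hz0.ne']
      have h4 : ‖(1 : ℂ) - ((‖z‖ : ℝ) : ℂ)‖ = 1 - ‖z‖ := by
        rw [← Complex.ofReal_one, ← Complex.ofReal_sub, Complex.norm_real, Real.norm_of_nonneg (by linarith)]
      rw [h3, h4] at h2
      have h5 : aniDist (‖z‖⁻¹ • z) η < d := hz2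
      linarith
    have hin : inner ℂ η z = 1 + (d : ℂ) * inner ℂ η u := by
      rw [hz, inner_add_right, inner_aniDil hη hd.le, inner_self_eq_norm_sq_to_K, hη]; simp
    have ho : z - (inner ℂ η z : ℂ) • η = (Real.sqrt d : ℂ) • (u - (inner ℂ η u : ℂ) • η) := by
      rw [← aniDil_sub hη hd.le, hin, inner_aniDil hη hd.le, hz]
      module
    have h6 := norm_sub_inner_smul_sq_le hz3'.le hη
    rw [ho, norm_smul, mul_pow, Complex.norm_real, Real.norm_of_nonneg (Real.sqrt_nonneg d),
      Real.sq_sqrt hd.le, norm_sub_inner_smul_sq u hη] at h6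
    have h7 : d * ‖(inner ℂ η u : ℂ)‖ ≤ 2 * d := by
      refine le_trans (le_of_eq ?_) hzη
      rw [aniDist, hin, sub_add_cancel_left, norm_neg, norm_mul, Complex.norm_real, Real.norm_of_nonneg hd.le]
    have h8 : ‖(inner ℂ η u : ℂ)‖ ≤ 2 := by
      by_contra! h; nlinarith
    have h9 : ‖u‖ ^ 2 - ‖(inner ℂ η u : ℂ)‖ ^ 2 ≤ 4 := by
      by_contra! h; nlinarith
    rw [mem_ball_zero_iff]
    nlinarith [norm_nonneg u, norm_nonneg (inner ℂ η u : ℂ)]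
  have hvS : volume S ≤ ENNReal.ofReal (d ^ (n + 1)) * volume (ball (0 : En n) 3) := by
    rw [← volume_setOf_aniDil hη hd η hSm]
    exact mul_le_mul_right (measure_mono hsub) _
  have hd0 : ENNReal.ofReal d ≠ 0 := by simpa using hd
  rw [← ENNReal.mul_le_mul_iff_right hd0 ENNReal.ofReal_ne_top]
  calc _ ≤ (volume (Bn n))⁻¹ * (ENNReal.ofReal (d ^ (n + 1)) * volume (ball (0 : En n) 3)) :=
        hv.trans (mul_le_mul_right hvS _)
    _ = ENNReal.ofReal d * ((volume (Bn n))⁻¹ * volume (ball (0 : En n) 3) * ENNReal.ofReal (d ^ n)) := by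
        rw [pow_succ, ENNReal.ofReal_mul (by positivity)]; ring
    _ ≤ _ := mul_le_mul_right (mul_le_mul_left le_self_add _) _

lemma exists_le_sigmaS_aniCap (n : ℕ) [NeZero n] (D : ℝ) : ∃ C : ℝ≥0∞, C ≠ ⊤ ∧ ∀ (η : En n) (d : ℝ), ‖η‖ = 1 →
    0 < d → d ≤ D → ENNReal.ofReal (d ^ n) ≤ C * sigmaS n (aniCap η d) := by
  set b : ℝ≥0∞ := (volume (Bn n))⁻¹ * volume (ball (0 : En n) (1 / 16)) with hb
  have hb0 : b ≠ 0 := mul_ne_zero (ENNReal.inv_ne_zero.2 volume_Bn_ne_top) (measure_ball_pos _ _ (by norm_num)).ne'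
  have hbt : b ≠ ⊤ := ENNReal.mul_ne_top (ENNReal.inv_ne_top.2 volume_Bn_ne_zero) measure_ball_lt_top.ne
  have key : ∀ (η : En n) (d : ℝ), ‖η‖ = 1 → 0 < d → d ≤ 1 →
      ENNReal.ofReal (d ^ n) ≤ b⁻¹ * ENNReal.ofReal (2 * n) * sigmaS n (aniCap η d) := by
    intro η d hη hd hd1
    set S := {z : En n | 1 - d < ‖z‖} ∩ {z | ‖z‖⁻¹ • z ∈ aniCap η d} with hS
    have hSm : MeasurableSet S := measurableSet_shell_cap η (1 - d) d
    have hsub : ball 0 (1 / 16) ⊆ {u | ((1 - d / 4 : ℝ) : ℂ) • η + aniDil η d u ∈ S ∩ Bn n} := by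
      intro u hu
      rw [mem_ball_zero_iff] at hu
      set z := ((1 - d / 4 : ℝ) : ℂ) • η + aniDil η d u with hz
      have hiu : ‖(inner ℂ η u : ℂ)‖ ≤ 1 / 16 := (norm_inner_le_norm η u).trans (by rw [hη, one_mul]; exact hu.le)
      have hin : inner ℂ η z = ((1 - d / 4 : ℝ) : ℂ) + (d : ℂ) * inner ℂ η u := by
        rw [hz, inner_add_right, inner_aniDil hη hd.le, inner_smul_right, inner_self_eq_norm_sq_to_K, hη]; simp
      have ho : z - (inner ℂ η z : ℂ) • η = (Real.sqrt d : ℂ) • (u - (inner ℂ η u : ℂ) • η) := by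
        rw [← aniDil_sub hη hd.le, hin, inner_aniDil hη hd.le, hz]
        module
      have h1 : ‖(inner ℂ η z : ℂ)‖ ≤ 1 - d / 4 + d * (1 / 16) := by
        rw [hin]
        refine (norm_add_le _ _).trans ?_
        rw [norm_mul, Complex.norm_real, Complex.norm_real, Real.norm_of_nonneg (by linarith),
          Real.norm_of_nonneg hd.le]
        gcongr
      have h2 := norm_sub_inner_smul_sq z hη
      rw [ho, norm_smul, mul_pow, Complex.norm_real, Real.norm_of_nonneg (Real.sqrt_nonneg d),
        Real.sq_sqrt hd.le, norm_sub_inner_smul_sq u hη] at h2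
      have hz1 : ‖z‖ < 1 := by
        have hu2 : ‖u‖ ^ 2 ≤ (1 / 16) ^ 2 := by gcongr
        have h3 : ‖(inner ℂ η z : ℂ)‖ ^ 2 ≤ (1 - d / 4 + d * (1 / 16)) ^ 2 := by gcongr
        have h4 : d * (‖u‖ ^ 2 - ‖(inner ℂ η u : ℂ)‖ ^ 2) ≤ d * (1 / 16) ^ 2 := by
          gcongr
          linarith [sq_nonneg ‖(inner ℂ η u : ℂ)‖]
        have h5 : ‖z‖ ^ 2 < 1 := by nlinarith
        exact (sq_lt_one_iff₀ (norm_nonneg z)).1 h5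
      have h6 : aniDist z η ≤ d * (5 / 16) := by
        rw [aniDist, hin, show (1 : ℂ) - (((1 - d / 4 : ℝ) : ℂ) + (d : ℂ) * inner ℂ η u) =
          ((d / 4 : ℝ) : ℂ) - (d : ℂ) * inner ℂ η u by push_cast; ring]
        refine (norm_sub_le _ _).trans ?_
        rw [norm_mul, Complex.norm_real, Complex.norm_real, Real.norm_of_nonneg (by linarith),
          Real.norm_of_nonneg hd.le]
        nlinarith
      have h7 := one_sub_norm_le_aniDist (z := z) hη.le
      have hz0 : 0 < ‖z‖ := by linarith
      have hξ : ‖‖z‖⁻¹ • z‖ ≤ 1 := by rw [norm_smul]; simp [hz0.ne']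
      have h8 := aniDist_le_aniDist_smul_add hξ hη.le hz1.le
      rw [smul_inv_smul₀ hz0.ne'] at h8
      refine ⟨⟨?_, ?_⟩, mem_ball_zero_iff.2 hz1⟩
      · show 1 - d < ‖z‖
        linarith
      · show aniDist _ _ < d
        linarith
    have hvS : ENNReal.ofReal (d ^ (n + 1)) * b ≤ volN n S := by
      rw [volN, Measure.smul_apply, Measure.restrict_apply hSm, smul_eq_mul,
        ← volume_setOf_aniDil hη hd (((1 - d / 4 : ℝ) : ℂ) • η) (hSm.inter measurableSet_Bn), hb,
        mul_left_comm]
      exact mul_le_mul_right (mul_le_mul_right (measure_mono hsub) _) _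
    rw [volN_shell_cap] at hvS
    have h9 := hvS.trans (mul_le_mul_left (radial_factor_le (1 - d)) _)
    rw [sub_sub_cancel] at h9
    have hd0 : ENNReal.ofReal d ≠ 0 := by simpa using hd
    rw [← ENNReal.mul_le_mul_iff_right hd0 ENNReal.ofReal_ne_top]
    rw [mul_assoc, mul_left_comm, mul_comm b⁻¹, ← div_eq_mul_inv, ENNReal.le_div_iff_mul_le (Or.inl hb0) (Or.inl hbt)]
    refine le_trans (le_of_eq ?_) (h9.trans (le_of_eq ?_))
    · rw [pow_succ, ENNReal.ofReal_mul (by positivity)]; ring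
    · rw [ENNReal.ofReal_mul (by positivity)]; ring
  refine ⟨ENNReal.ofReal (max D 1 ^ n) * (b⁻¹ * ENNReal.ofReal (2 * n)), ?_, fun η d hη hd hdD => ?_⟩
  · exact ENNReal.mul_ne_top ENNReal.ofReal_ne_top (ENNReal.mul_ne_top (ENNReal.inv_ne_top.2 hb0) ENNReal.ofReal_ne_top)
  have hm : 0 < min d 1 := lt_min hd one_pos
  have h1 : d ≤ max D 1 * min d 1 := by
    rcases le_total d 1 with h | h
    · rw [min_eq_left h]; nlinarith [le_max_right D 1]
    · rw [min_eq_right h]; linarith [le_max_left D 1]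
  calc ENNReal.ofReal (d ^ n) ≤ ENNReal.ofReal (max D 1 ^ n) * ENNReal.ofReal (min d 1 ^ n) := by
        rw [← ENNReal.ofReal_mul (by positivity), ← mul_pow]
        exact ENNReal.ofReal_le_ofReal (pow_le_pow_left₀ hd.le h1 n)
    _ ≤ ENNReal.ofReal (max D 1 ^ n) * (b⁻¹ * ENNReal.ofReal (2 * n) * sigmaS n (aniCap η (min d 1))) :=
        mul_le_mul_right (key η _ hη hm (min_le_right _ _)) _
    _ ≤ _ := by
        rw [← mul_assoc]
        refine mul_le_mul_right (measure_mono ?_) _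
        exact fun ξ (hξ : aniDist ξ η < min d 1) => lt_of_lt_of_le (b := min d 1) hξ (min_le_left _ _)

end CapMeasure

section MaximalFunction

variable {n : ℕ}

/-- The maximal function over nonisotropic caps with dyadic radii. -/
def capMax (φ : En n → ℝ≥0∞) (ζ : En n) : ℝ≥0∞ :=
  ⨆ k : ℕ, (ENNReal.ofReal ((4 * (1 / 2 : ℝ) ^ k) ^ n))⁻¹ *
    ∫⁻ ξ in aniCap ζ (4 * (1 / 2 : ℝ) ^ k), φ ξ ∂sigmaS n

lemma measurable_lintegral_aniCap [NeZero n] {φ : En n → ℝ≥0∞} (hφ : Measurable φ) (R : ℝ) :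
    Measurable fun ζ => ∫⁻ ξ in aniCap ζ R, φ ξ ∂sigmaS n := by
  have h : MeasurableSet {x : En n × En n | aniDist x.2 x.1 < R} :=
    (isOpen_lt (continuous_aniDist.comp continuous_swap) continuous_const).measurableSet
  have h2 : Measurable fun x : En n × En n => {x : En n × En n | aniDist x.2 x.1 < R}.indicator (fun x => φ x.2) x :=
    (hφ.comp measurable_snd).indicator h
  have h3 : Measurable fun ζ => ∫⁻ ξ, {x : En n × En n | aniDist x.2 x.1 < R}.indicator (fun x => φ x.2) (ζ, ξ) ∂sigmaS n :=
    h2.lintegral_prod_right'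
  convert h3 using 2 with ζ
  rw [← lintegral_indicator (measurableSet_aniCap ζ R)]
  rfl

lemma measurable_capMax [NeZero n] {φ : En n → ℝ≥0∞} (hφ : Measurable φ) : Measurable (capMax φ) :=
  Measurable.iSup fun _ => (measurable_lintegral_aniCap hφ _).const_mul _

lemma lintegral_aniCap_le {φ : En n → ℝ≥0∞} {ζ : En n} (hζ : ‖ζ‖ = 1) {R : ℝ} (hR : 0 < R) :
    ∫⁻ ξ in aniCap ζ R, φ ξ ∂sigmaS n ≤ ENNReal.ofReal ((2 * R) ^ n) * capMax φ ζ := by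
  have key : ∀ k : ℕ, ∫⁻ ξ in aniCap ζ (4 * (1 / 2 : ℝ) ^ k), φ ξ ∂sigmaS n ≤
      ENNReal.ofReal ((4 * (1 / 2 : ℝ) ^ k) ^ n) * capMax φ ζ := fun k => by
    have h0 : ENNReal.ofReal ((4 * (1 / 2 : ℝ) ^ k) ^ n) ≠ 0 := by
      rw [Ne, ENNReal.ofReal_eq_zero, not_le]; positivity
    have h1 := le_iSup (fun k : ℕ => (ENNReal.ofReal ((4 * (1 / 2 : ℝ) ^ k) ^ n))⁻¹ *
      ∫⁻ ξ in aniCap ζ (4 * (1 / 2 : ℝ) ^ k), φ ξ ∂sigmaS n) k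
    refine le_trans (le_of_eq ?_) (mul_le_mul_right h1 _)
    rw [← mul_assoc, ENNReal.mul_inv_cancel h0 ENNReal.ofReal_ne_top, one_mul]
  rcases le_or_gt 4 R with h4 | h4
  · have h1 : ∫⁻ ξ in aniCap ζ R, φ ξ ∂sigmaS n ≤ ∫⁻ ξ in aniCap ζ (4 * (1 / 2 : ℝ) ^ 0), φ ξ ∂sigmaS n := by
      refine (setLIntegral_le_lintegral _ _).trans (le_of_eq ?_)
      rw [← lintegral_indicator (measurableSet_aniCap _ _)]
      refine lintegral_congr_ae ?_
      filter_upwards [sigmaS_ae_norm] with ξ hξ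
      rw [indicator_of_mem]
      show aniDist ξ ζ < _
      linarith [aniDist_le_two hξ.le hζ.le]
    refine h1.trans ((key 0).trans (mul_le_mul_left (ENNReal.ofReal_le_ofReal ?_) _))
    exact pow_le_pow_left₀ (by positivity) (by linarith) n
  · obtain ⟨k, hk1, hk2⟩ := exists_nat_pow_near_of_lt_one (x := R / 4) (y := 1 / 2) (by positivity) (by linarith)
      (by norm_num) (by norm_num)
    have h1 : aniCap ζ R ⊆ aniCap ζ (4 * (1 / 2 : ℝ) ^ k) := fun ξ (hξ : aniDist ξ ζ < R) =>
      show aniDist ξ ζ < _ by linarith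
    refine (lintegral_mono_set h1).trans ((key k).trans (mul_le_mul_left (ENNReal.ofReal_le_ofReal ?_) _))
    refine pow_le_pow_left₀ (by positivity) ?_ n
    rw [pow_succ] at hk1
    linarith

lemma capMax_le_of_le {φ ψ : En n → ℝ≥0∞} (h : ∀ ξ, φ ξ ≤ ψ ξ) (ζ : En n) : capMax φ ζ ≤ capMax ψ ζ :=
  iSup_mono fun _ => mul_le_mul_right (lintegral_mono h) _

lemma capMax_add_le [NeZero n] {φ ψ : En n → ℝ≥0∞} (hφ : Measurable φ) (ζ : En n) :
    capMax (fun ξ => φ ξ + ψ ξ) ζ ≤ capMax φ ζ + capMax ψ ζ := by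
  refine iSup_le fun k => ?_
  rw [lintegral_add_left hφ, mul_add]
  exact add_le_add (le_iSup (fun k : ℕ => (ENNReal.ofReal ((4 * (1 / 2 : ℝ) ^ k) ^ n))⁻¹ *
      ∫⁻ ξ in aniCap ζ (4 * (1 / 2 : ℝ) ^ k), φ ξ ∂sigmaS n) k)
    (le_iSup (fun k : ℕ => (ENNReal.ofReal ((4 * (1 / 2 : ℝ) ^ k) ^ n))⁻¹ *
      ∫⁻ ξ in aniCap ζ (4 * (1 / 2 : ℝ) ^ k), ψ ξ ∂sigmaS n) k)

lemma exists_capMax_le_of_le (n : ℕ) [NeZero n] : ∃ C : ℝ≥0∞, C ≠ ⊤ ∧ C ≠ 0 ∧ ∀ (φ : En n → ℝ≥0∞) (b : ℝ≥0∞),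
    (∀ ξ, φ ξ ≤ b) → ∀ ζ, ‖ζ‖ = 1 → capMax φ ζ ≤ C * b := by
  obtain ⟨C, hC, h⟩ := exists_sigmaS_aniCap_le n
  refine ⟨C + 1, by simp [hC], by simp, fun φ b hφ ζ hζ => iSup_le fun k => ?_⟩
  have h1 := h ζ (4 * (1 / 2 : ℝ) ^ k) hζ (by positivity)
  have h0 : ENNReal.ofReal ((4 * (1 / 2 : ℝ) ^ k) ^ n) ≠ 0 := by
      rw [Ne, ENNReal.ofReal_eq_zero, not_le]; positivity
  rw [mul_comm, ← div_eq_mul_inv]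
  refine ENNReal.div_le_of_le_mul ?_
  calc ∫⁻ ξ in aniCap ζ (4 * (1 / 2 : ℝ) ^ k), φ ξ ∂sigmaS n
      ≤ ∫⁻ ξ in aniCap ζ (4 * (1 / 2 : ℝ) ^ k), b ∂sigmaS n := lintegral_mono hφ
    _ = b * sigmaS n (aniCap ζ (4 * (1 / 2 : ℝ) ^ k)) := setLIntegral_const _ _
    _ ≤ b * (C * ENNReal.ofReal ((4 * (1 / 2 : ℝ) ^ k) ^ n)) := mul_le_mul_right h1 _
    _ = C * b * ENNReal.ofReal ((4 * (1 / 2 : ℝ) ^ k) ^ n) := by ring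
    _ ≤ _ := mul_le_mul_left (mul_le_mul_left le_self_add _) _

lemma exists_weak_type_capMax (n : ℕ) [NeZero n] : ∃ C : ℝ≥0∞, C ≠ ⊤ ∧ ∀ (φ : En n → ℝ≥0∞) (l : ℝ≥0∞),
    l * sigmaS n {ζ | l < capMax φ ζ} ≤ C * ∫⁻ ξ, φ ξ ∂sigmaS n := by
  obtain ⟨C, hC, h⟩ := exists_sigmaS_aniCap_le n
  obtain ⟨C', hC', h'⟩ := exists_le_sigmaS_aniCap n 4
  refine ⟨C * ENNReal.ofReal (6 ^ n), ENNReal.mul_ne_top hC ENNReal.ofReal_ne_top, fun φ l => ?_⟩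
  set R : ℕ → ℝ := fun k => 4 * (1 / 2 : ℝ) ^ k with hR
  have hR0 : ∀ k, 0 < R k := fun k => by positivity
  have hR4 : ∀ k, R k ≤ 4 := fun k =>
    mul_le_of_le_one_right (by norm_num) (pow_le_one₀ (by norm_num) (by norm_num))
  set E : Set (En n) := {ζ | l < capMax φ ζ} ∩ sphere 0 1 with hE
  have hk : ∀ ζ ∈ E, ∃ k, l * ENNReal.ofReal (R k ^ n) ≤ ∫⁻ ξ in aniCap ζ (R k), φ ξ ∂sigmaS n := by
    rintro ζ ⟨hζ, -⟩
    obtain ⟨k, hk⟩ := lt_iSup_iff.1 (show l < capMax φ ζ from hζ)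
    refine ⟨k, ?_⟩
    rw [mul_comm, ← div_eq_mul_inv] at hk
    exact ENNReal.mul_le_of_le_div hk.le
  choose! k hk using hk
  have hself : ∀ ζ ∈ E, ζ ∈ aniCap ζ (R (k ζ)) ∩ sphere 0 1 := by
    rintro ζ ⟨-, hζ⟩
    have h1 : ‖ζ‖ = 1 := by simpa using hζ
    refine ⟨?_, hζ⟩
    show aniDist ζ ζ < _
    rw [aniDist, inner_self_eq_norm_sq_to_K, h1]
    simpa using hR0 _
  obtain ⟨u, huE, hdis, hcov⟩ := Vitali.exists_disjoint_subfamily_covering_enlargement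
    (fun ζ => aniCap ζ (R (k ζ)) ∩ sphere 0 1) E (fun ζ => R (k ζ)) 2 one_lt_two (fun ζ _ => (hR0 _).le) 4
    (fun ζ _ => hR4 _) (fun ζ hζ => ⟨ζ, hself ζ hζ⟩)
  have hBm : ∀ ζ : En n, MeasurableSet (aniCap ζ (R (k ζ)) ∩ sphere 0 1) := fun ζ =>
    (measurableSet_aniCap _ _).inter isClosed_sphere.measurableSet
  have hsph : ∀ s : Set (En n), sigmaS n (s ∩ sphere 0 1) = sigmaS n s := fun s => by
    refine measure_congr ?_
    filter_upwards [sigmaS_ae_norm] with x hx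
    exact propext ⟨fun h => h.1, fun h => ⟨h, mem_sphere_zero_iff_norm.2 hx⟩⟩
  have hnorm : ∀ ζ ∈ E, ‖ζ‖ = 1 := fun ζ hζ => by simpa using hζ.2
  have hcount : Countable u := by
    have h1 := Measure.countable_meas_pos_of_disjoint_iUnion (μ := sigmaS n)
      (As := fun ζ : u => aniCap (ζ : En n) (R (k ζ)) ∩ sphere 0 1) (fun ζ => hBm ζ)
      (fun a b hab => hdis a.2 b.2 (fun h => hab (Subtype.ext h)))
    have h2 : {i : u | 0 < sigmaS n (aniCap (i : En n) (R (k i)) ∩ sphere 0 1)} = univ := by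
      refine eq_univ_of_forall fun i => ?_
      show 0 < sigmaS n (aniCap (i : En n) (R (k i)) ∩ sphere 0 1)
      rw [hsph, pos_iff_ne_zero]
      intro h0
      have := h' i (R (k i)) (hnorm _ (huE i.2)) (hR0 _) (hR4 _)
      rw [h0, mul_zero, nonpos_iff_eq_zero, ENNReal.ofReal_eq_zero] at this
      exact absurd this (not_le.2 (pow_pos (hR0 _) n))
    rw [h2] at h1
    exact countable_univ_iff.1 h1
  have hEsub : E ⊆ ⋃ b : u, aniCap (b : En n) (6 * R (k b)) := by
    intro a ha
    obtain ⟨b, hb, ⟨x, ⟨hx1, hx2⟩, hx3, -⟩, hab⟩ := hcov a ha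
    refine mem_iUnion.2 ⟨⟨b, hb⟩, ?_⟩
    have hxn : ‖x‖ = 1 := by simpa using hx2
    have h1 := aniDist_triangle_unit (hnorm a ha).le hxn (hnorm b (huE hb)).le
    rw [aniDist_comm a x] at h1
    have h2 : aniDist x a < R (k a) := hx1
    have h3 : aniDist x b < R (k b) := hx3
    show aniDist a b < 6 * R (k b)
    linarith
  calc l * sigmaS n {ζ | l < capMax φ ζ} = l * sigmaS n E := by rw [hE, hsph]
    _ ≤ l * ∑' b : u, sigmaS n (aniCap (b : En n) (6 * R (k b))) :=
        mul_le_mul_right ((measure_mono hEsub).trans (measure_iUnion_le _)) _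
    _ ≤ l * ∑' b : u, C * ENNReal.ofReal (6 ^ n) * ENNReal.ofReal (R (k b) ^ n) := by
        refine mul_le_mul_right (ENNReal.tsum_le_tsum fun b => ?_) _
        rw [mul_assoc, ← ENNReal.ofReal_mul (by positivity), ← mul_pow]
        exact h b _ (hnorm _ (huE b.2)) (mul_pos (by norm_num) (hR0 _))
    _ = C * ENNReal.ofReal (6 ^ n) * ∑' b : u, l * ENNReal.ofReal (R (k b) ^ n) := by
        rw [ENNReal.tsum_mul_left, ENNReal.tsum_mul_left]; ring
    _ ≤ C * ENNReal.ofReal (6 ^ n) * ∑' b : u, ∫⁻ ξ in aniCap (b : En n) (R (k b)) ∩ sphere 0 1, φ ξ ∂sigmaS n := by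
        refine mul_le_mul_right (ENNReal.tsum_le_tsum fun b => ?_) _
        refine (hk b (huE b.2)).trans (le_of_eq ?_)
        refine setLIntegral_congr ?_
        filter_upwards [sigmaS_ae_norm] with x hx
        exact propext ⟨fun h => ⟨h, mem_sphere_zero_iff_norm.2 hx⟩, fun h => h.1⟩
    _ = C * ENNReal.ofReal (6 ^ n) * ∫⁻ ξ in ⋃ b : u, aniCap (b : En n) (R (k b)) ∩ sphere 0 1, φ ξ ∂sigmaS n := by
        rw [lintegral_iUnion (fun b : u => hBm b)
          (fun a b hab => hdis a.2 b.2 (fun h => hab (Subtype.ext h)))]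
    _ ≤ _ := mul_le_mul_right (setLIntegral_le_lintegral _ _) _

lemma lintegral_rpow_sub_two_le {p : ℝ} (hp : 1 < p) (y : ℝ≥0∞) :
    ∫⁻ t in Ioi (0 : ℝ), {t : ℝ | ENNReal.ofReal t < y}.indicator (fun t => ENNReal.ofReal (t ^ (p - 2))) t ≤
      ENNReal.ofReal (p - 1)⁻¹ * y ^ (p - 1) := by
  have hp1 : 0 < p - 1 := by linarith
  rcases eq_or_ne y ⊤ with rfl | hy
  · rw [ENNReal.top_rpow_of_pos hp1, ENNReal.mul_top]
    · exact le_top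
    · simpa using hp
  · have hyt := ENNReal.toReal_nonneg (a := y)
    have hm : MeasurableSet {t : ℝ | ENNReal.ofReal t < y} :=
      measurableSet_lt ENNReal.measurable_ofReal measurable_const
    rw [lintegral_indicator hm, Measure.restrict_restrict hm]
    calc _ ≤ ∫⁻ t in Ioc 0 y.toReal, ENNReal.ofReal (t ^ (p - 2)) := by
          refine lintegral_mono_set fun t ht => ⟨ht.2, ?_⟩
          exact (ENNReal.ofReal_le_iff_le_toReal hy).1 (le_of_lt ht.1)
      _ = ENNReal.ofReal (∫ t in Ioc 0 y.toReal, t ^ (p - 2)) := by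
          rw [ofReal_integral_eq_lintegral_ofReal]
          · exact (intervalIntegral.intervalIntegrable_rpow' (by linarith)).1
          · refine (ae_restrict_iff' measurableSet_Ioc).2 (ae_of_all _ fun t ht => ?_)
            exact Real.rpow_nonneg ht.1.le _
      _ = ENNReal.ofReal ((p - 1)⁻¹ * y.toReal ^ (p - 1)) := by
          rw [← intervalIntegral.integral_of_le hyt, integral_rpow (Or.inl (by linarith)),
            show p - 2 + 1 = p - 1 by ring, Real.zero_rpow hp1.ne', sub_zero, div_eq_inv_mul]
      _ = _ := by
          rw [ENNReal.ofReal_mul (by positivity), ← ENNReal.ofReal_rpow_of_nonneg hyt hp1.le,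
            ENNReal.ofReal_toReal hy]
      _ ≤ _ := le_rfl

/-- The cap maximal function is bounded on `L^p` for `p > 1`. -/
lemma exists_lintegral_capMax_rpow_le (n : ℕ) [NeZero n] {p : ℝ} (hp : 1 < p) : ∃ C : ℝ≥0∞, C ≠ ⊤ ∧
    ∀ φ : En n → ℝ≥0∞, Measurable φ →
      ∫⁻ ζ, capMax φ ζ ^ p ∂sigmaS n ≤ C * ∫⁻ ξ, φ ξ ^ p ∂sigmaS n := by
  obtain ⟨C₁, hC₁, hC₁0, h₁⟩ := exists_capMax_le_of_le n
  obtain ⟨C₂, hC₂, h₂⟩ := exists_weak_type_capMax n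
  have hp0 : 0 < p := by linarith
  have hp1 : 0 < p - 1 := by linarith
  set D : ℝ≥0∞ := 2 * C₁ with hD
  have hD0 : D ≠ 0 := by simp [hD, hC₁0]
  have hDt : D ≠ ⊤ := ENNReal.mul_ne_top (by simp) hC₁
  refine ⟨ENNReal.ofReal p * (2 * C₂ * (ENNReal.ofReal (p - 1)⁻¹ * D ^ (p - 1))), ?_, fun φ hφ => ?_⟩
  · exact ENNReal.mul_ne_top ENNReal.ofReal_ne_top (ENNReal.mul_ne_top (ENNReal.mul_ne_top (by simp) hC₂)
      (ENNReal.mul_ne_top ENNReal.ofReal_ne_top (ENNReal.rpow_ne_top_of_nonneg hp1.le hDt)))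
  have hM := measurable_capMax hφ
  have hweak : ∀ t : ℝ, 0 < t → sigmaS n {ζ | ENNReal.ofReal t < capMax φ ζ} * ENNReal.ofReal (t ^ (p - 1)) ≤
      2 * C₂ * ∫⁻ ξ, {x : En n | ENNReal.ofReal t < D * φ x}.indicator (fun x => φ x * ENNReal.ofReal (t ^ (p - 2))) ξ ∂sigmaS n := by
    intro t ht
    have hTm : MeasurableSet {x : En n | ENNReal.ofReal t < D * φ x} :=
      measurableSet_lt measurable_const (hφ.const_mul D)
    set φ₁ : En n → ℝ≥0∞ := {x : En n | ENNReal.ofReal t < D * φ x}.indicator φ with hφ₁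
    have hφ₁m : Measurable φ₁ := hφ.indicator hTm
    have hle : ∀ ξ, φ ξ ≤ φ₁ ξ + ENNReal.ofReal t / D := fun ξ => by
      by_cases h : ξ ∈ {x : En n | ENNReal.ofReal t < D * φ x}
      · rw [hφ₁, indicator_of_mem h]; exact le_self_add
      · refine le_trans ?_ le_add_self
        rw [ENNReal.le_div_iff_mul_le (Or.inl hD0) (Or.inl hDt), mul_comm]
        exact not_lt.1 h
    have hsub : ∀ ζ : En n, ‖ζ‖ = 1 → ENNReal.ofReal t < capMax φ ζ → ENNReal.ofReal t / 2 < capMax φ₁ ζ := by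
      intro ζ hζ h
      have h3 := (capMax_le_of_le hle ζ).trans (capMax_add_le hφ₁m ζ)
      have h4 := h₁ (fun _ => ENNReal.ofReal t / D) (ENNReal.ofReal t / D) (fun _ => le_rfl) ζ hζ
      have h5 : C₁ * (ENNReal.ofReal t / D) = ENNReal.ofReal t / 2 := by
        rw [hD, ← mul_div_assoc, mul_comm 2 C₁, ENNReal.mul_div_mul_left _ _ hC₁0 hC₁]
      rw [h5] at h4
      by_contra! hc
      have h6 := h.trans_le (h3.trans (add_le_add hc h4))
      rw [ENNReal.add_halves] at h6
      exact lt_irrefl _ h6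
    have hmeas : sigmaS n {ζ | ENNReal.ofReal t < capMax φ ζ} ≤ sigmaS n {ζ | ENNReal.ofReal t / 2 < capMax φ₁ ζ} := by
      refine measure_mono_ae ?_
      filter_upwards [sigmaS_ae_norm] with ζ hζ h using hsub ζ hζ h
    have h7 := h₂ φ₁ (ENNReal.ofReal t / 2)
    have h8 : ENNReal.ofReal t * sigmaS n {ζ | ENNReal.ofReal t < capMax φ ζ} ≤ 2 * C₂ * ∫⁻ ξ, φ₁ ξ ∂sigmaS n := by
      calc _ ≤ (2 * (ENNReal.ofReal t / 2)) * sigmaS n {ζ | ENNReal.ofReal t / 2 < capMax φ₁ ζ} := by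
            rw [ENNReal.mul_div_cancel (by simp) (by simp)]
            exact mul_le_mul_right hmeas _
        _ ≤ _ := by rw [mul_assoc, mul_assoc]; exact mul_le_mul_right h7 _
    have h9 : t ^ (p - 1) = t * t ^ (p - 2) := by
      rw [show p - 1 = 1 + (p - 2) by ring, Real.rpow_add ht, Real.rpow_one]
    have h10 : ∀ ξ, {x : En n | ENNReal.ofReal t < D * φ x}.indicator (fun x => φ x * ENNReal.ofReal (t ^ (p - 2))) ξ =
        φ₁ ξ * ENNReal.ofReal (t ^ (p - 2)) := fun ξ => by
      rw [hφ₁, indicator_mul_const]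
    simp_rw [h10]
    rw [lintegral_mul_const _ hφ₁m, h9, ENNReal.ofReal_mul ht.le, ← mul_assoc, ← mul_assoc,
      mul_comm (sigmaS n _)]
    exact mul_le_mul_left h8 _
  have hfin : ∀ N : ℕ, ∫⁻ ζ, (min (capMax φ ζ) N) ^ p ∂sigmaS n ≤
      ENNReal.ofReal p * (2 * C₂ * (ENNReal.ofReal (p - 1)⁻¹ * D ^ (p - 1))) * ∫⁻ ξ, φ ξ ^ p ∂sigmaS n := by
    intro N
    have hmt : ∀ ζ, min (capMax φ ζ) (N : ℝ≥0∞) ≠ ⊤ := fun ζ =>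
      ne_top_of_le_ne_top (ENNReal.natCast_ne_top N) (min_le_right _ _)
    have hmm : Measurable fun ζ => min (capMax φ ζ) (N : ℝ≥0∞) := hM.min measurable_const
    have hlc := lintegral_rpow_eq_lintegral_meas_lt_mul (sigmaS n)
      (f := fun ζ => (min (capMax φ ζ) (N : ℝ≥0∞)).toReal) (ae_of_all _ fun _ => ENNReal.toReal_nonneg)
      hmm.ennreal_toReal.aemeasurable hp0
    have hE : ∀ ζ, ENNReal.ofReal ((min (capMax φ ζ) (N : ℝ≥0∞)).toReal ^ p) = (min (capMax φ ζ) N) ^ p := fun ζ => by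
      rw [← ENNReal.ofReal_rpow_of_nonneg ENNReal.toReal_nonneg hp0.le, ENNReal.ofReal_toReal (hmt ζ)]
    simp_rw [hE] at hlc
    rw [hlc, mul_assoc]
    refine mul_le_mul_right ?_ _
    have hjm : Measurable fun x : ℝ × En n => {x : ℝ × En n | ENNReal.ofReal x.1 < D * φ x.2}.indicator
        (fun x => φ x.2 * ENNReal.ofReal (x.1 ^ (p - 2))) x := by
      refine Measurable.indicator ?_ ?_
      · exact (hφ.comp measurable_snd).mul ((measurable_fst.pow_const _).ennreal_ofReal)
      · exact measurableSet_lt (measurable_fst.ennreal_ofReal) ((hφ.comp measurable_snd).const_mul D)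
    have hIm : Measurable fun t : ℝ => ∫⁻ ξ, {x : En n | ENNReal.ofReal t < D * φ x}.indicator
        (fun x => φ x * ENNReal.ofReal (t ^ (p - 2))) ξ ∂sigmaS n := hjm.lintegral_prod_right'
    calc _ ≤ ∫⁻ t in Ioi (0 : ℝ), 2 * C₂ * ∫⁻ ξ, {x : En n | ENNReal.ofReal t < D * φ x}.indicator
            (fun x => φ x * ENNReal.ofReal (t ^ (p - 2))) ξ ∂sigmaS n := by
          refine setLIntegral_mono' measurableSet_Ioi fun t ht => ?_
          refine le_trans (mul_le_mul_left (measure_mono fun ζ hζ => ?_) _) (hweak t ht)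
          have h1 : t < (min (capMax φ ζ) (N : ℝ≥0∞)).toReal := hζ
          exact ((ENNReal.ofReal_lt_iff_lt_toReal (le_of_lt ht) (hmt ζ)).2 h1).trans_le (min_le_left _ _)
      _ = 2 * C₂ * ∫⁻ ξ, ∫⁻ t in Ioi (0 : ℝ), {x : En n | ENNReal.ofReal t < D * φ x}.indicator
            (fun x => φ x * ENNReal.ofReal (t ^ (p - 2))) ξ ∂volume ∂sigmaS n := by
          rw [lintegral_const_mul _ hIm, lintegral_lintegral_swap hjm.aemeasurable]
      _ ≤ 2 * C₂ * ∫⁻ ξ, ENNReal.ofReal (p - 1)⁻¹ * D ^ (p - 1) * φ ξ ^ p ∂sigmaS n := by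
          refine mul_le_mul_right (lintegral_mono fun ξ => ?_) _
          have h1 : ∀ t : ℝ, {x : En n | ENNReal.ofReal t < D * φ x}.indicator
              (fun x => φ x * ENNReal.ofReal (t ^ (p - 2))) ξ = φ ξ *
              {t : ℝ | ENNReal.ofReal t < D * φ ξ}.indicator (fun t => ENNReal.ofReal (t ^ (p - 2))) t := fun t => by
            by_cases h : ENNReal.ofReal t < D * φ ξ
            · rw [indicator_of_mem (by exact h), indicator_of_mem (by exact h)]
            · rw [indicator_of_notMem (by exact h), indicator_of_notMem (by exact h), mul_zero]
          simp_rw [h1]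
          have hm2 : Measurable fun t : ℝ => {t : ℝ | ENNReal.ofReal t < D * φ ξ}.indicator
              (fun t => ENNReal.ofReal (t ^ (p - 2))) t :=
            Measurable.indicator ((measurable_id.pow_const _).ennreal_ofReal)
              (measurableSet_lt ENNReal.measurable_ofReal measurable_const)
          rw [lintegral_const_mul _ hm2]
          refine (mul_le_mul_right (lintegral_rpow_sub_two_le hp _) _).trans (le_of_eq ?_)
          rw [ENNReal.mul_rpow_of_nonneg _ _ hp1.le]
          have h3 : φ ξ ^ p = φ ξ * φ ξ ^ (p - 1) := by
            conv_rhs => rw [← ENNReal.rpow_one (φ ξ), ← ENNReal.rpow_mul, one_mul]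
            rw [← ENNReal.rpow_add_of_nonneg _ _ zero_le_one hp1.le, add_sub_cancel]
          rw [h3]
          ring
      _ = _ := by
          rw [lintegral_const_mul _ (hφ.pow_const _)]; ring
  have hsup : ∀ ζ, capMax φ ζ ^ p = ⨆ N : ℕ, (min (capMax φ ζ) (N : ℝ≥0∞)) ^ p := fun ζ => by
    have h1 : capMax φ ζ = ⨆ N : ℕ, min (capMax φ ζ) (N : ℝ≥0∞) := by
      rw [← inf_iSup_eq, ENNReal.iSup_natCast, inf_top_eq]
    conv_lhs => rw [h1]
    exact (ENNReal.monotone_rpow_of_nonneg hp0.le).map_iSup_of_continuousAt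
      (ENNReal.continuous_rpow_const.continuousAt) (by simp [hp0])
  simp_rw [hsup]
  rw [lintegral_iSup (fun N => (hM.min measurable_const).pow_const _)]
  · exact iSup_le hfin
  · intro N N' h ζ
    exact ENNReal.rpow_le_rpow (min_le_min le_rfl (by exact_mod_cast h)) hp0.le

end MaximalFunction

section Slices

variable {n : ℕ}

lemma measurable_radD (g : En n → ℂ) : Measurable (radD g) := by
  have h : radD g = fun z => ∑ k, z k * fderiv ℂ g z (EuclideanSpace.single k 1) := by
    funext z
    have hz : z = ∑ k, z k • EuclideanSpace.single k (1 : ℂ) := by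
      ext j
      simp [Finset.sum_apply, Pi.single_apply]
    rw [radD]
    conv_lhs => rw [show fderiv ℂ g z z = fderiv ℂ g z (∑ k, z k • EuclideanSpace.single k (1 : ℂ)) by rw [← hz]]
    simp
  rw [h]
  refine Finset.measurable_sum _ fun k _ => ?_
  exact (by fun_prop : Measurable fun z : En n => z k).mul (measurable_fderiv_apply_const ℂ g _)

lemma exp_smul_mem_Bn {ζ : En n} (hζ : ‖ζ‖ = 1) {w : ℂ} (hw : w.re < 0) : Complex.exp w • ζ ∈ Bn n := by
  rw [Bn, mem_ball_zero_iff, norm_smul, hζ, mul_one, Complex.norm_exp]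
  exact Real.exp_lt_one_iff.2 hw

lemma differentiableOn_slice {g : En n → ℂ} (hg : DifferentiableOn ℂ g (Bn n)) {ζ : En n} (hζ : ‖ζ‖ = 1) :
    DifferentiableOn ℂ (fun l : ℂ => g (l • ζ)) (ball 0 1) := by
  refine hg.comp (by fun_prop) fun l hl => ?_
  rw [Bn, mem_ball_zero_iff, norm_smul, hζ, mul_one]
  simpa using hl

lemma logHol_slice {g : En n → ℂ} (hg : DifferentiableOn ℂ g (Bn n)) (hm : Measurable g) {ζ : En n}
    (hζ : ‖ζ‖ = 1) : LogHol 0 fun w => g (Complex.exp w • ζ) := by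
  have h := LogHol.comp_exp (L := 0) (f := fun l : ℂ => g (l • ζ))
    (by simpa using differentiableOn_slice hg hζ) (hm.comp (by fun_prop))
  exact h

lemma deriv_slice {g : En n → ℂ} (hg : DifferentiableOn ℂ g (Bn n)) {ζ : En n} (hζ : ‖ζ‖ = 1) {w : ℂ}
    (hw : w.re < 0) : deriv (fun w => g (Complex.exp w • ζ)) w = radD g (Complex.exp w • ζ) := by
  have h1 : HasFDerivAt g (fderiv ℂ g (Complex.exp w • ζ)) (Complex.exp w • ζ) :=
    (hg.differentiableAt (isOpen_ball.mem_nhds (exp_smul_mem_Bn hζ hw))).hasFDerivAt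
  have h2 : HasDerivAt (fun w => Complex.exp w • ζ) (Complex.exp w • ζ) w :=
    (Complex.hasDerivAt_exp w).smul_const ζ
  exact (h1.comp_hasDerivAt w h2).deriv

/-- Scalar multiplication by `exp (θ * I)` as an isometry. -/
def rotEn (n : ℕ) (θ : ℝ) : En n ≃ₗᵢ[ℝ] En n where
  toFun z := Complex.exp (θ * Complex.I) • z
  invFun z := Complex.exp (-(θ * Complex.I)) • z
  map_add' := smul_add _
  map_smul' r z := smul_comm _ _ _
  left_inv z := by simp [smul_smul, ← Complex.exp_add]
  right_inv z := by simp [smul_smul, ← Complex.exp_add]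
  norm_map' z := by
    change ‖Complex.exp (θ * Complex.I) • z‖ = ‖z‖
    rw [norm_smul, Complex.norm_exp_ofReal_mul_I, one_mul]

lemma lintegral_rotEn (θ : ℝ) {ψ : En n → ℝ≥0∞} (hψ : Measurable ψ) :
    ∫⁻ ζ, ψ (Complex.exp (θ * Complex.I) • ζ) ∂sigmaS n = ∫⁻ ζ, ψ ζ ∂sigmaS n := by
  conv_rhs => rw [← sigmaS_map (rotEn n θ)]
  rw [lintegral_map (f := ψ) hψ (rotEn n θ).continuous.measurable]
  rfl

variable [NeZero n]

/-- Integration over the sphere by slices. -/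
lemma lintegral_slice {ψ : En n → ℝ≥0∞} (hψ : Measurable ψ) :
    ∫⁻ ζ, ∫⁻ θ, ψ (Complex.exp ((θ : ℝ) * Complex.I) • ζ) ∂thetaM ∂sigmaS n = ∫⁻ ζ, ψ ζ ∂sigmaS n := by
  have hm : Measurable fun p : En n × ℝ => ψ (Complex.exp (p.2 * Complex.I) • p.1) :=
    hψ.comp (by fun_prop)
  rw [lintegral_lintegral_swap hm.aemeasurable]
  simp_rw [lintegral_rotEn _ hψ]
  simp

omit [NeZero n] in
lemma exp_line_smul (τ θ : ℝ) (ζ : En n) :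
    Complex.exp (τ + θ * Complex.I) • ζ = Real.exp τ • (Complex.exp (θ * Complex.I) • ζ) := by
  rw [Complex.exp_add, mul_smul, ← Complex.ofReal_exp, Complex.coe_smul]

lemma lintegral_Ioo_exp (F : ℝ → ℝ≥0∞) :
    ∫⁻ r in Ioo 0 1, F r = ∫⁻ τ in Iio 0, ENNReal.ofReal (Real.exp τ) * F (Real.exp τ) := by
  have h := lintegral_image_eq_lintegral_abs_deriv_mul (s := Iio (0 : ℝ)) (f := Real.exp) (f' := Real.exp)
    measurableSet_Iio (fun x _ => (Real.hasDerivAt_exp x).hasDerivWithinAt) Real.exp_injective.injOn F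
  have hi : Real.exp '' Iio 0 = Ioo 0 1 := by
    ext x
    constructor
    · rintro ⟨y, hy, rfl⟩
      exact ⟨Real.exp_pos y, Real.exp_lt_one_iff.2 hy⟩
    · rintro ⟨h0, h1⟩
      exact ⟨Real.log x, Real.log_neg h0 h1, Real.exp_log h0⟩
  rw [hi] at h
  simpa only [abs_of_pos (Real.exp_pos _)] using h

/-- Integration over the ball in logarithmic polar coordinates on slices. -/
lemma lintegral_volN_log {F : En n → ℝ≥0∞} (hF : Measurable F) :
    ∫⁻ z, F z ∂volN n = ∫⁻ τ in Iio 0, ENNReal.ofReal (2 * n * Real.exp (2 * n * τ)) *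
      ∫⁻ ζ, ∫⁻ θ, F (Complex.exp ((τ : ℝ) + (θ : ℝ) * Complex.I) • ζ) ∂thetaM ∂sigmaS n := by
  rw [lintegral_volN_eq hF, lintegral_Ioo_exp]
  refine lintegral_congr fun τ => ?_
  have hψ : Measurable fun ζ : En n => F (Real.exp τ • ζ) := hF.comp (by fun_prop)
  rw [← mul_assoc, ← ENNReal.ofReal_mul (Real.exp_pos _).le, ← lintegral_slice hψ]
  simp only [exp_line_smul]
  congr 2
  have hn : 1 ≤ 2 * n := by have := NeZero.pos n; omega
  obtain ⟨k, hk⟩ := Nat.exists_eq_add_of_le hn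
  rw [hk, Nat.add_sub_cancel_left, ← Real.exp_nat_mul]
  have : (2 * n * τ : ℝ) = τ + k * τ := by
    have h2 : (2 * n : ℝ) = 1 + k := by exact_mod_cast hk
    rw [h2]; ring
  rw [this, Real.exp_add]
  ring

end Slices

section Mean

variable {n : ℕ}

/-- The integral mean `∫ |g(rζ)|^q dσ(ζ)`. -/
def hMean (g : En n → ℂ) (q r : ℝ) : ℝ≥0∞ := ∫⁻ ζ, ‖g (r • ζ)‖ₑ ^ q ∂sigmaS n

/-- The density `|g|^(2t-2) |Rg|^2`. -/
def wt (g : En n → ℂ) (t : ℝ) (z : En n) : ℝ≥0∞ := ‖g z‖ₑ ^ (2 * t - 2) * ‖radD g z‖ₑ ^ 2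

lemma measurable_wt {g : En n → ℂ} (hm : Measurable g) (t : ℝ) : Measurable (wt g t) :=
  (hm.enorm.pow_const _).mul ((measurable_radD g).enorm.pow_const _)

lemma exp_smul_smul_mem_Bn {ζ : En n} (hζ : ‖ζ‖ = 1) {r : ℝ} (h0 : 0 < r) {w : ℂ}
    (hw : w.re < -Real.log r) : Complex.exp w • (r • ζ) ∈ Bn n := by
  rw [Bn, mem_ball_zero_iff, norm_smul, norm_smul, hζ, mul_one, Complex.norm_exp, Real.norm_of_nonneg h0.le]
  calc Real.exp w.re * r < Real.exp (-Real.log r) * r := by gcongr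
    _ = 1 := by rw [Real.exp_neg, Real.exp_log h0, inv_mul_cancel₀ h0.ne']

lemma differentiableOn_slice_smul {g : En n → ℂ} (hg : DifferentiableOn ℂ g (Bn n)) {ζ : En n}
    (hζ : ‖ζ‖ = 1) {r : ℝ} (h0 : 0 < r) :
    DifferentiableOn ℂ (fun l : ℂ => g (l • (r • ζ))) (ball 0 (Real.exp (-Real.log r))) := by
  refine hg.comp (by fun_prop) fun l hl => ?_
  rw [mem_ball_zero_iff] at hl
  rw [Bn, mem_ball_zero_iff, norm_smul, norm_smul, hζ, mul_one, Real.norm_of_nonneg h0.le]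
  calc ‖l‖ * r < Real.exp (-Real.log r) * r := by gcongr
    _ = 1 := by rw [Real.exp_neg, Real.exp_log h0, inv_mul_cancel₀ h0.ne']

lemma logHol_slice_smul {g : En n → ℂ} (hg : DifferentiableOn ℂ g (Bn n)) (hm : Measurable g) {ζ : En n}
    (hζ : ‖ζ‖ = 1) {r : ℝ} (h0 : 0 < r) :
    LogHol (-Real.log r) fun w => g (Complex.exp w • (r • ζ)) :=
  LogHol.comp_exp (f := fun l : ℂ => g (l • (r • ζ))) (differentiableOn_slice_smul hg hζ h0)
    (hm.comp (by fun_prop))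

lemma deriv_slice_smul {g : En n → ℂ} (hg : DifferentiableOn ℂ g (Bn n)) {ζ : En n} (hζ : ‖ζ‖ = 1)
    {r : ℝ} (h0 : 0 < r) {w : ℂ} (hw : w.re < -Real.log r) :
    deriv (fun w => g (Complex.exp w • (r • ζ))) w = radD g (Complex.exp w • (r • ζ)) := by
  have h1 : HasFDerivAt g (fderiv ℂ g (Complex.exp w • (r • ζ))) (Complex.exp w • (r • ζ)) :=
    (hg.differentiableAt (isOpen_ball.mem_nhds (exp_smul_smul_mem_Bn hζ h0 hw))).hasFDerivAt
  have h2 : HasDerivAt (fun w => Complex.exp w • (r • ζ)) (Complex.exp w • (r • ζ)) w :=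
    (Complex.hasDerivAt_exp w).smul_const (r • ζ)
  exact (h1.comp_hasDerivAt w h2).deriv

variable [NeZero n]

lemma lintegral_logMean_slice {g : En n → ℂ} (hm : Measurable g) (q r : ℝ) :
    ∫⁻ ζ, logMean (fun w => g (Complex.exp w • (r • ζ))) q 0 ∂sigmaS n = hMean g q r := by
  have hψ : Measurable fun ζ : En n => ‖g (r • ζ)‖ₑ ^ q :=
    ((hm.comp (by fun_prop)).enorm).pow_const _
  rw [hMean, ← lintegral_slice hψ]
  simp only [logMean, Complex.ofReal_zero, zero_add]
  simp_rw [smul_comm _ r]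

/-- A weighted volume integral is dominated by integrals over slices. -/
lemma lintegral_volN_mul_le {F : En n → ℝ≥0∞} (hF : Measurable F) {r : ℝ} (h0 : 0 < r) (h1 : r ≤ 1) :
    ∫⁻ z, F z * ENNReal.ofReal (r - ‖z‖) ∂volN n ≤ 2 * n * ∫⁻ ζ, (∫⁻ τ in Iio 0, ENNReal.ofReal (-τ) *
      ∫⁻ θ, F (Complex.exp ((τ : ℝ) + (θ : ℝ) * Complex.I) • (r • ζ)) ∂thetaM) ∂sigmaS n := by
  have hFm : Measurable fun z : En n => F z * ENNReal.ofReal (r - ‖z‖) := hF.mul (by fun_prop)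
  have hb : Real.log r ≤ 0 := Real.log_nonpos h0.le h1
  have hm3 : Measurable fun p : ℝ × En n × ℝ =>
      F (Complex.exp ((p.1 : ℝ) + (p.2.2 : ℝ) * Complex.I) • p.2.1) := hF.comp (by fun_prop)
  rw [lintegral_volN_log hFm]
  calc _ ≤ ∫⁻ τ in Iio (0 : ℝ), 2 * n * (ENNReal.ofReal (Real.log r - τ) * ∫⁻ ζ, ∫⁻ θ,
        F (Complex.exp ((τ : ℝ) + (θ : ℝ) * Complex.I) • ζ) ∂thetaM ∂sigmaS n) := by
        refine setLIntegral_mono' measurableSet_Iio fun τ (hτ : τ < 0) => ?_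
        have e1 : ∫⁻ ζ, ∫⁻ θ, F (Complex.exp ((τ : ℝ) + (θ : ℝ) * Complex.I) • ζ) *
            ENNReal.ofReal (r - ‖Complex.exp ((τ : ℝ) + (θ : ℝ) * Complex.I) • ζ‖) ∂thetaM ∂sigmaS n =
            ENNReal.ofReal (r - Real.exp τ) * ∫⁻ ζ, ∫⁻ θ,
              F (Complex.exp ((τ : ℝ) + (θ : ℝ) * Complex.I) • ζ) ∂thetaM ∂sigmaS n := by
          rw [← lintegral_const_mul' _ _ ENNReal.ofReal_ne_top]
          refine lintegral_congr_ae ?_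
          filter_upwards [sigmaS_ae_norm (n := n)] with ζ hζ
          rw [← lintegral_const_mul' _ _ ENNReal.ofReal_ne_top]
          refine lintegral_congr fun θ => ?_
          rw [norm_smul, hζ, mul_one, Complex.norm_exp, mul_comm]
          simp
        rw [e1, ← mul_assoc, ← mul_assoc]
        refine mul_le_mul_left ?_ _
        have e2 : ENNReal.ofReal (2 * n * Real.exp (2 * n * τ)) ≤ 2 * n := by
          rw [show (2 * n : ℝ≥0∞) = ENNReal.ofReal (2 * n) by
            rw [ENNReal.ofReal_mul zero_le_two]; simp]
          refine ENNReal.ofReal_le_ofReal ?_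
          have : Real.exp (2 * n * τ) ≤ 1 := Real.exp_le_one_iff.2 (by nlinarith [Nat.cast_nonneg (α := ℝ) n])
          nlinarith [Nat.cast_nonneg (α := ℝ) n]
        refine mul_le_mul' e2 ?_
        by_cases hlt : τ < Real.log r
        · refine ENNReal.ofReal_le_ofReal ?_
          have h3 := Real.add_one_le_exp (τ - Real.log r)
          have h4 : Real.exp τ = r * Real.exp (τ - Real.log r) := by
            rw [Real.exp_sub, Real.exp_log h0]; field_simp
          rw [h4]
          nlinarith
        · rw [ENNReal.ofReal_of_nonpos]
          · exact zero_le
          · rw [sub_nonpos]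
            calc r = Real.exp (Real.log r) := (Real.exp_log h0).symm
              _ ≤ _ := Real.exp_le_exp.2 (not_lt.1 hlt)
    _ ≤ ∫⁻ τ : ℝ, 2 * n * (ENNReal.ofReal (Real.log r - τ) * ∫⁻ ζ, ∫⁻ θ,
        F (Complex.exp ((τ : ℝ) + (θ : ℝ) * Complex.I) • ζ) ∂thetaM ∂sigmaS n) := setLIntegral_le_lintegral _ _
    _ = ∫⁻ τ : ℝ, 2 * n * (ENNReal.ofReal (- τ) * ∫⁻ ζ, ∫⁻ θ,
        F (Complex.exp ((τ : ℝ) + (θ : ℝ) * Complex.I) • (r • ζ)) ∂thetaM ∂sigmaS n) := by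
        rw [← lintegral_add_right_eq_self _ (Real.log r)]
        refine lintegral_congr fun τ => ?_
        congr 2
        · congr 1; ring
        · refine lintegral_congr fun ζ => lintegral_congr fun θ => ?_
          congr 1
          rw [← Complex.coe_smul, smul_smul]
          congr 1
          conv_rhs => rw [← Real.exp_log h0, Complex.ofReal_exp, ← Complex.exp_add]
          push_cast
          congr 1; ring
    _ = 2 * n * ∫⁻ τ in Iio (0 : ℝ), (ENNReal.ofReal (- τ) * ∫⁻ ζ, ∫⁻ θ,
        F (Complex.exp ((τ : ℝ) + (θ : ℝ) * Complex.I) • (r • ζ)) ∂thetaM ∂sigmaS n) := by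
        rw [lintegral_const_mul' _ _ (by finiteness), ← lintegral_indicator measurableSet_Iio]
        congr 1
        refine lintegral_congr fun τ => ?_
        by_cases hτ : τ < 0
        · rw [indicator_of_mem (by exact hτ)]
        · rw [indicator_of_notMem (by exact hτ), ENNReal.ofReal_of_nonpos (by linarith), zero_mul]
    _ = _ := by
        congr 1
        have hm4 : Measurable fun p : (ℝ × En n) × ℝ =>
          F (Complex.exp ((p.1.1 : ℝ) + (p.2 : ℝ) * Complex.I) • (r • p.1.2)) := hF.comp (by fun_prop)
        have hm5 : Measurable fun p : ℝ × En n => ENNReal.ofReal (- p.1) * ∫⁻ θ,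
          F (Complex.exp ((p.1 : ℝ) + (θ : ℝ) * Complex.I) • (r • p.2)) ∂thetaM :=
          (by fun_prop : Measurable fun p : ℝ × En n => ENNReal.ofReal (- p.1)).mul hm4.lintegral_prod_right'
        rw [← lintegral_lintegral_swap hm5.aemeasurable]
        refine lintegral_congr fun τ => ?_
        rw [lintegral_const_mul' _ _ ENNReal.ofReal_ne_top]

end Mean

section Area

variable {n : ℕ} {α : ℝ}

lemma mem_Gam_iff {z ζ : En n} : z ∈ Gam α ζ ↔ ‖z‖ < 1 ∧ aniDist z ζ < α / 2 * (1 - ‖z‖ ^ 2) := by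
  rw [Gam, aniDist, ← herm_eq_inner, Bn]
  simp

lemma measurableSet_Gam_prod : MeasurableSet {p : En n × En n | p.2 ∈ Gam α p.1} := by
  simp only [mem_Gam_iff]
  have hc : Continuous fun p : En n × En n => aniDist p.2 p.1 := by unfold aniDist; fun_prop
  have h1 : IsOpen {p : En n × En n | ‖p.2‖ < 1} := isOpen_lt (by fun_prop) continuous_const
  have h2 : IsOpen {p : En n × En n | aniDist p.2 p.1 < α / 2 * (1 - ‖p.2‖ ^ 2)} := isOpen_lt hc (by fun_prop)
  exact (h1.inter h2).measurableSet

lemma measurableSet_Gam (ζ : En n) : MeasurableSet (Gam α ζ) :=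
  measurable_prodMk_left measurableSet_Gam_prod

lemma aniDist_lt_of_mem_Gam {z ζ η : En n} (hη : ‖η‖ = 1) (hzη : z = ‖z‖ • η) (hζ : ‖ζ‖ = 1) (hα : 0 < α)
    (hz : z ∈ Gam α ζ) : aniDist ζ η < (α + 1) * (1 - ‖z‖) := by
  obtain ⟨h1, h2⟩ := mem_Gam_iff.1 hz
  have h3 := aniDist_le_aniDist_smul_add hη.le hζ.le h1.le
  rw [← hzη, aniDist_comm] at h3
  nlinarith [mul_nonneg hα.le (sub_nonneg.2 h1.le), norm_nonneg z,
    mul_nonneg (mul_nonneg hα.le (sub_nonneg.2 h1.le)) (sub_nonneg.2 h1.le)]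

/-- The truncated area integral. -/
def areaTr (α : ℝ) (g : En n → ℂ) (t r : ℝ) (ζ : En n) : ℝ≥0∞ :=
  ∫⁻ z in Gam α ζ, wt g t z * ENNReal.ofReal (((1 - ‖z‖ ^ 2) ^ n)⁻¹) * ENNReal.ofReal (r - ‖z‖) ∂volN n

/-- The average of `φ` over the shadow of `z`. -/
def shadowAvg (α : ℝ) (φ : En n → ℝ≥0∞) (z : En n) : ℝ≥0∞ :=
  ENNReal.ofReal (((1 - ‖z‖ ^ 2) ^ n)⁻¹) * ∫⁻ ζ in {ζ | z ∈ Gam α ζ}, φ ζ ∂sigmaS n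

lemma measurableSet_shadow (z : En n) : MeasurableSet {ζ : En n | z ∈ Gam α ζ} :=
  measurable_prodMk_right measurableSet_Gam_prod

variable [NeZero n]

lemma measurable_shadowAvg {φ : En n → ℝ≥0∞} (hφ : Measurable φ) : Measurable (shadowAvg α φ) := by
  refine (by fun_prop : Measurable fun z : En n => ENNReal.ofReal (((1 - ‖z‖ ^ 2) ^ n)⁻¹)).mul ?_
  have h : Measurable fun p : En n × En n => {p : En n × En n | p.2 ∈ Gam α p.1}.indicator (fun p => φ p.1) p :=
    (hφ.comp measurable_fst).indicator measurableSet_Gam_prod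
  have h2 := h.lintegral_prod_left' (μ := sigmaS n)
  convert h2 using 1
  funext z
  rw [← lintegral_indicator (measurableSet_shadow z)]
  rfl

omit [NeZero n] in
lemma measurable_areaTr {g : En n → ℂ} (hm : Measurable g) (t r : ℝ) : Measurable (areaTr α g t r) := by
  have h : Measurable fun p : En n × En n => {p : En n × En n | p.2 ∈ Gam α p.1}.indicator
      (fun p => wt g t p.2 * ENNReal.ofReal (((1 - ‖p.2‖ ^ 2) ^ n)⁻¹) * ENNReal.ofReal (r - ‖p.2‖)) p := by
    refine Measurable.indicator ?_ measurableSet_Gam_prod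
    exact (((measurable_wt hm t).comp measurable_snd).mul (by fun_prop)).mul (by fun_prop)
  have h2 := h.lintegral_prod_right' (ν := volN n)
  convert h2 using 1
  funext ζ
  rw [areaTr, ← lintegral_indicator (measurableSet_Gam ζ)]
  rfl

lemma lintegral_areaTr_mul {g : En n → ℂ} (hm : Measurable g) (t r : ℝ) {φ : En n → ℝ≥0∞}
    (hφ : Measurable φ) : ∫⁻ ζ, areaTr α g t r ζ * φ ζ ∂sigmaS n =
      ∫⁻ z, wt g t z * shadowAvg α φ z * ENNReal.ofReal (r - ‖z‖) ∂volN n := by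
  set K : En n → ℝ≥0∞ := fun z => wt g t z * ENNReal.ofReal (((1 - ‖z‖ ^ 2) ^ n)⁻¹) * ENNReal.ofReal (r - ‖z‖)
    with hK
  have hKm : Measurable K := ((measurable_wt hm t).mul (by fun_prop)).mul (by fun_prop)
  have h : Measurable fun p : En n × En n => {p : En n × En n | p.2 ∈ Gam α p.1}.indicator
      (fun p => K p.2 * φ p.1) p :=
    ((hKm.comp measurable_snd).mul (hφ.comp measurable_fst)).indicator measurableSet_Gam_prod
  calc _ = ∫⁻ ζ, (∫⁻ z, {p : En n × En n | p.2 ∈ Gam α p.1}.indicator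
      (fun p => K p.2 * φ p.1) (ζ, z) ∂volN n) ∂sigmaS n := by
        refine lintegral_congr fun ζ => ?_
        rw [areaTr, ← lintegral_mul_const _ hKm, ← lintegral_indicator (measurableSet_Gam ζ)]
        rfl
    _ = ∫⁻ z, (∫⁻ ζ, {p : En n × En n | p.2 ∈ Gam α p.1}.indicator
      (fun p => K p.2 * φ p.1) (ζ, z) ∂sigmaS n) ∂volN n := lintegral_lintegral_swap h.aemeasurable
    _ = _ := by
        refine lintegral_congr fun z => ?_
        have : wt g t z * shadowAvg α φ z * ENNReal.ofReal (r - ‖z‖)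
            = K z * ∫⁻ ζ in {ζ | z ∈ Gam α ζ}, φ ζ ∂sigmaS n := by
          rw [hK, shadowAvg]; ring
        rw [this, ← lintegral_const_mul _ hφ, ← lintegral_indicator (measurableSet_shadow z)]
        rfl

lemma shadowAvg_le {φ : En n → ℝ≥0∞} (hα : 0 < α) {z x : En n} (hz : ‖z‖ < 1) (hx : ‖x‖ = 1)
    (hzx : aniDist z x ≤ 2 * (1 - ‖z‖)) :
    shadowAvg α φ z ≤ ENNReal.ofReal ((4 * (α + 4)) ^ n) * capMax φ x := by
  obtain ⟨η, hη, hzη⟩ := exists_unit_smul z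
  have hd : 0 < 1 - ‖z‖ := sub_pos.2 hz
  have hR : 0 < 2 * (α + 4) * (1 - ‖z‖) := by positivity
  have hxη : aniDist η x ≤ 3 * (1 - ‖z‖) := by
    have h3 := aniDist_le_aniDist_smul_add hη.le hx.le hz.le
    rw [← hzη] at h3
    linarith
  have h1 : ∫⁻ ζ in {ζ | z ∈ Gam α ζ}, φ ζ ∂sigmaS n ≤ ∫⁻ ζ in aniCap x (2 * (α + 4) * (1 - ‖z‖)), φ ζ ∂sigmaS n := by
    rw [← lintegral_indicator (measurableSet_shadow z), ← lintegral_indicator (measurableSet_aniCap _ _)]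
    refine lintegral_mono_ae ?_
    filter_upwards [sigmaS_ae_norm (n := n)] with ζ hζ
    by_cases h : z ∈ Gam α ζ
    · rw [indicator_of_mem (by exact h), indicator_of_mem]
      have h4 := aniDist_lt_of_mem_Gam hη hzη hζ hα h
      have h5 := aniDist_triangle_unit hζ.le hη hx.le
      show aniDist ζ x < 2 * (α + 4) * (1 - ‖z‖)
      nlinarith
    · rw [indicator_of_notMem (by exact h)]
      exact zero_le
  calc shadowAvg α φ z ≤ ENNReal.ofReal (((1 - ‖z‖) ^ n)⁻¹) *
        (ENNReal.ofReal ((2 * (2 * (α + 4) * (1 - ‖z‖))) ^ n) * capMax φ x) := by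
        refine mul_le_mul' (ENNReal.ofReal_le_ofReal ?_) (h1.trans (lintegral_aniCap_le hx hR))
        gcongr
        nlinarith [norm_nonneg z]
    _ = _ := by
        rw [← mul_assoc, ← ENNReal.ofReal_mul (by positivity)]
        congr 2
        rw [show 2 * (2 * (α + 4) * (1 - ‖z‖)) = (1 - ‖z‖) * (4 * (α + 4)) by ring, mul_pow,
          inv_mul_cancel_left₀ (by positivity)]

omit [NeZero n] in
lemma aniDist_slice_le {ζ : En n} (hζ : ‖ζ‖ = 1) {r : ℝ} (h0 : 0 < r) (h1 : r ≤ 1) {l w : ℂ}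
    (hw : ‖w‖ = 1) (hl : ‖w - l‖ ≤ 2 * (1 - ‖l‖)) :
    aniDist (l • (r • ζ)) (w • ζ) ≤ 2 * (1 - ‖l • (r • ζ)‖) := by
  have e1 : ‖l • (r • ζ)‖ = ‖l‖ * r := by rw [norm_smul, norm_smul, hζ, Real.norm_of_nonneg h0.le, mul_one]
  have e2 : aniDist (l • (r • ζ)) (w • ζ) = ‖w - r * l‖ := by
    have : w * (1 - (starRingEnd ℂ) w * (l * r)) = w - r * l := by
      have hww : w * (starRingEnd ℂ) w = 1 := by rw [Complex.mul_conj']; simp [hw]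
      linear_combination (-(l * r)) * hww
    rw [aniDist, ← Complex.coe_smul r, smul_smul, inner_smul_left, inner_smul_right, inner_self_eq_norm_sq_to_K, hζ,
      ← this, norm_mul, hw]
    simp
  rw [e1, e2]
  calc ‖w - r * l‖ = ‖(w - l) + (1 - r : ℝ) * l‖ := by congr 1; push_cast; ring
    _ ≤ ‖w - l‖ + (1 - r) * ‖l‖ := by
        refine (norm_add_le _ _).trans ?_
        rw [norm_mul, Complex.norm_real, Real.norm_of_nonneg (by linarith)]
    _ ≤ _ := by nlinarith [norm_nonneg l]

omit [NeZero n] in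
lemma wt_slice_eq {g : En n → ℂ} (hg : DifferentiableOn ℂ g (Bn n)) (t : ℝ) {ζ : En n} (hζ : ‖ζ‖ = 1)
    {r : ℝ} (h0 : 0 < r) (h1 : r ≤ 1) {τ : ℝ} (hτ : τ < 0) (θ : ℝ) :
    wt g t (Complex.exp (τ + θ * Complex.I) • (r • ζ)) =
      ‖g (Complex.exp (τ + θ * Complex.I) • (r • ζ))‖ₑ ^ (2 * t - 2) *
        ‖deriv (fun w => g (Complex.exp w • (r • ζ))) (τ + θ * Complex.I)‖ₑ ^ 2 := by
  rw [wt, deriv_slice_smul hg hζ h0]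
  have := Real.log_nonpos h0.le h1
  simp
  linarith

omit [NeZero n] in
lemma two_mul_natCast_ne_top (n : ℕ) : (2 * n : ℝ≥0∞) ≠ ⊤ := by finiteness

/-- The truncated area integral is controlled in mean by the Hardy mean. -/
lemma exists_lintegral_wt_le (n : ℕ) [NeZero n] {t : ℝ} (ht : 0 < t) : ∃ C : ℝ≥0∞, C ≠ ⊤ ∧ ∀ g : En n → ℂ,
    DifferentiableOn ℂ g (Bn n) → Measurable g → ∀ r : ℝ, 0 < r → r < 1 →
      ∫⁻ z, wt g t z * ENNReal.ofReal (r - ‖z‖) ∂volN n ≤ C * hMean g (2 * t) r := by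
  set c : ℝ := 2 * (2 * t) * min ((2 * t) / 2) 1 with hc
  have hc0 : 0 < c := by have : 0 < min ((2 * t) / 2) 1 := lt_min (by linarith) one_pos; positivity
  have hc1 : ENNReal.ofReal c ≠ 0 := by simpa using hc0
  refine ⟨2 * n * ((ENNReal.ofReal c)⁻¹ * 2), ENNReal.mul_ne_top (two_mul_natCast_ne_top n) (by finiteness), fun g hg hm r h0 h1 => ?_⟩
  refine (lintegral_volN_mul_le (measurable_wt hm t) h0 h1.le).trans ?_
  rw [mul_assoc (2 * (n : ℝ≥0∞))]
  refine mul_le_mul_right ?_ _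
  rw [← lintegral_logMean_slice hm, ← lintegral_const_mul' _ _ (by finiteness)]
  refine lintegral_mono_ae ?_
  filter_upwards [sigmaS_ae_norm (n := n)] with ζ hζ
  have hL : (0 : ℝ) < -Real.log r := by simpa using Real.log_neg h0 h1
  have h := (logHol_slice_smul hg hm hζ h0).lintegral_Iio_logEnergy_le (q := 2 * t) (b := 0) (by linarith) hL
  rw [mul_assoc, ← ENNReal.mul_le_iff_le_inv hc1 ENNReal.ofReal_ne_top]
  refine le_trans (mul_le_mul_right ?_ _) h
  refine setLIntegral_mono' measurableSet_Iio fun τ (hτ : τ < 0) => ?_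
  rw [zero_sub, logEnergy]
  simp_rw [wt_slice_eq hg t hζ h0 h1.le hτ]
  rfl

end Area

section Duality

variable {n : ℕ} {α : ℝ}

lemma exists_lintegral_areaTr_mul_le (n : ℕ) [NeZero n] (hα : 0 < α) {t s s' : ℝ} (ht : 0 < t)
    (hs : s.HolderConjugate s') (hs3 : s' < 3) : ∃ C : ℝ≥0∞, C ≠ ⊤ ∧ ∀ g : En n → ℂ,
      DifferentiableOn ℂ g (Bn n) → Measurable g → ∀ r : ℝ, 0 < r → r < 1 → ∀ φ : En n → ℝ≥0∞, Measurable φ →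
      ∀ b : ℝ≥0∞, b ≠ ⊤ → (∀ ξ, φ ξ ≤ b) → ∀ κ : ℝ, 0 < κ →
      ∫⁻ ζ, areaTr α g t r ζ * φ ζ ∂sigmaS n ≤
        C * (hMean g (2 * t * s) r + ∫⁻ ζ, φ ζ ^ s' ∂sigmaS n + ENNReal.ofReal κ ^ s') := by
  have hs1' := hs.symm.lt
  obtain ⟨C₀, hC₀, h₀⟩ := exists_weighted_energy_le_of_pos ht hs hs3
  obtain ⟨C₁, hC₁, -, h₁⟩ := exists_capMax_le_of_le n
  obtain ⟨C₂, hC₂, h₂⟩ := exists_lintegral_capMax_rpow_le n hs1'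
  set D : ℝ≥0∞ := ENNReal.ofReal ((4 * (α + 4)) ^ n) with hD
  have hDt : D ≠ ⊤ := ENNReal.ofReal_ne_top
  set E : ℝ≥0∞ := (2 : ℝ≥0∞) ^ (s' - 1) with hE
  have hEt : E ≠ ⊤ := ENNReal.rpow_ne_top_of_nonneg (by linarith) (by finiteness)
  have hDst : D ^ s' ≠ ⊤ := ENNReal.rpow_ne_top_of_nonneg (by linarith) hDt
  refine ⟨2 * n * (C₀ * (1 + E * D ^ s' * C₂ + E)), by finiteness, fun g hg hm r hr0 hr1 φ hφ b hb hφb κ hκ => ?_⟩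
  rw [lintegral_areaTr_mul hm t r hφ]
  refine (lintegral_volN_mul_le ((measurable_wt hm t).mul (measurable_shadowAvg hφ)) hr0 hr1.le).trans ?_
  rw [mul_assoc (2 * (n : ℝ≥0∞))]
  refine mul_le_mul_right ?_ _
  have hM := measurable_capMax hφ
  set V : En n → ℝ≥0∞ := fun ζ => min (D * capMax φ ζ) (D * (C₁ * b)) with hV
  have hVm : Measurable V := (hM.const_mul _).min measurable_const
  have hVt : ∀ ζ, V ζ ≠ ⊤ := fun ζ => ((min_le_right _ _).trans_lt (by finiteness)).ne
  have hVs : ∀ ζ, V ζ ^ s' ≤ D ^ s' * capMax φ ζ ^ s' := fun ζ => by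
    rw [← ENNReal.mul_rpow_of_nonneg _ _ (by linarith : 0 ≤ s')]
    exact ENNReal.rpow_le_rpow (min_le_left _ _) (by linarith)
  have hVint : ∫⁻ ζ, (V ζ + ENNReal.ofReal κ) ^ s' ∂sigmaS n ≤
      E * D ^ s' * C₂ * ∫⁻ ζ, φ ζ ^ s' ∂sigmaS n + E * ENNReal.ofReal κ ^ s' := by
    calc _ ≤ ∫⁻ ζ, (E * D ^ s' * capMax φ ζ ^ s' + E * ENNReal.ofReal κ ^ s') ∂sigmaS n := by
          refine lintegral_mono fun ζ => ?_
          refine (ENNReal.rpow_add_le_mul_rpow_add_rpow _ _ hs1'.le).trans ?_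
          rw [mul_add, mul_assoc]
          gcongr
          exact hVs ζ
      _ = E * D ^ s' * ∫⁻ ζ, capMax φ ζ ^ s' ∂sigmaS n + E * ENNReal.ofReal κ ^ s' := by
          rw [lintegral_add_right _ measurable_const, lintegral_const_mul' _ _ (by finiteness)]
          simp
      _ ≤ _ := by
          rw [mul_assoc (E * D ^ s')]
          gcongr
          exact h₂ φ hφ
  have hpt : ∀ ζ : En n, ‖ζ‖ = 1 → (∫⁻ τ in Iio 0, ENNReal.ofReal (-τ) * ∫⁻ θ, wt g t
      (Complex.exp ((τ : ℝ) + (θ : ℝ) * Complex.I) • (r • ζ)) *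
      shadowAvg α φ (Complex.exp ((τ : ℝ) + (θ : ℝ) * Complex.I) • (r • ζ)) ∂thetaM) ≤
      C₀ * (logMean (fun w => g (Complex.exp w • (r • ζ))) (2 * t * s) 0 +
        ∫⁻ θ, (V (Complex.exp ((θ : ℝ) * Complex.I) • ζ) + ENNReal.ofReal κ) ^ s' ∂thetaM) := by
    intro ζ hζ
    have hL : (0 : ℝ) < -Real.log r := by simpa using Real.log_neg hr0 hr1
    have key := h₀ (fun l => g (l • (r • ζ))) (-Real.log r) hL (differentiableOn_slice_smul hg hζ hr0)
      (hm.comp (by fun_prop)) (fun w => (V (w • ζ)).toReal + κ) ((D * (C₁ * b)).toReal + κ) κ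
      ((hVm.comp (by fun_prop)).ennreal_toReal.add_const _)
      (fun z => by
        rw [abs_of_nonneg (by positivity)]
        gcongr
        · finiteness
        · exact min_le_right _ _)
      hκ (fun z => by simp) (fun l => shadowAvg α φ (l • (r • ζ))) ?_
    · have e1 : ∀ z, ENNReal.ofReal ((V z).toReal + κ) = V z + ENNReal.ofReal κ := fun z => by
        rw [ENNReal.ofReal_add ENNReal.toReal_nonneg hκ.le, ENNReal.ofReal_toReal (hVt z)]
      simp only [e1] at key
      refine le_trans (le_of_eq ?_) key
      refine setLIntegral_congr_fun measurableSet_Iio fun τ (hτ : τ < 0) => ?_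
      simp only [wt_slice_eq hg t hζ hr0 hr1.le hτ]
    · intro z hz w hw hwz
      rw [mem_ball_zero_iff] at hz
      have hz1 : ‖z • (r • ζ)‖ < 1 := by
        rw [norm_smul, norm_smul, hζ, Real.norm_of_nonneg hr0.le]
        nlinarith [norm_nonneg z]
      have hwζ : ‖w • ζ‖ = 1 := by rw [norm_smul, hw, hζ, mul_one]
      rw [ENNReal.ofReal_add ENNReal.toReal_nonneg hκ.le, ENNReal.ofReal_toReal (hVt _)]
      refine le_trans ?_ le_self_add
      refine (shadowAvg_le hα hz1 hwζ (aniDist_slice_le hζ hr0 hr1.le hw hwz)).trans (le_min le_rfl ?_)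
      gcongr
      exact h₁ φ b hφb _ hwζ
  calc _ ≤ ∫⁻ ζ, (C₀ * (logMean (fun w => g (Complex.exp w • (r • ζ))) (2 * t * s) 0 +
        ∫⁻ θ, (V (Complex.exp ((θ : ℝ) * Complex.I) • ζ) + ENNReal.ofReal κ) ^ s' ∂thetaM)) ∂sigmaS n := by
        refine lintegral_mono_ae ?_
        filter_upwards [sigmaS_ae_norm (n := n)] with ζ hζ using hpt ζ hζ
    _ = C₀ * (hMean g (2 * t * s) r + ∫⁻ ζ, (V ζ + ENNReal.ofReal κ) ^ s' ∂sigmaS n) := by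
        have hm1 : Measurable fun ζ : En n => (V ζ + ENNReal.ofReal κ) ^ s' := (hVm.add_const _).pow_const _
        have hm2 : Measurable fun ζ : En n =>
            ∫⁻ θ, (V (Complex.exp ((θ : ℝ) * Complex.I) • ζ) + ENNReal.ofReal κ) ^ s' ∂thetaM := by
          have : Measurable fun p : En n × ℝ => (V (Complex.exp (p.2 * Complex.I) • p.1) + ENNReal.ofReal κ) ^ s' :=
            hm1.comp (by fun_prop)
          exact this.lintegral_prod_right'
        rw [lintegral_const_mul' _ _ hC₀, lintegral_add_right _ hm2, lintegral_logMean_slice hm, lintegral_slice hm1]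
    _ ≤ C₀ * (hMean g (2 * t * s) r + (E * D ^ s' * C₂ * ∫⁻ ζ, φ ζ ^ s' ∂sigmaS n + E * ENNReal.ofReal κ ^ s')) := by
        gcongr
    _ ≤ _ := by
        rw [mul_assoc C₀ (_ + _)]
        refine mul_le_mul_right ?_ _
        set H := hMean g (2 * t * s) r
        set P := ∫⁻ ζ, φ ζ ^ s' ∂sigmaS n
        set Q := ENNReal.ofReal κ ^ s'
        set F := E * D ^ s' * C₂
        calc H + (F * P + E * Q) = 1 * H + F * P + E * Q := by ring
          _ ≤ (1 + F + E) * H + (1 + F + E) * P + (1 + F + E) * Q := by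
            gcongr
            · exact le_add_right le_self_add
            · exact le_add_right le_add_self
            · exact le_add_self
          _ = _ := by ring

/-- Absorption of a small multiple. -/
lemma le_two_mul_of_le_add_half {x a : ℝ≥0∞} (hx : x ≠ ⊤) (h : x ≤ a + x / 2) : x ≤ 2 * a := by
  have h2 : x / 2 ≠ ⊤ := ENNReal.div_ne_top hx (by simp)
  have h3 : x / 2 + x / 2 ≤ a + x / 2 := by rwa [ENNReal.add_halves]
  have h4 := (ENNReal.add_le_add_iff_right h2).1 h3
  calc x = 2 * (x / 2) := by rw [two_mul, ENNReal.add_halves]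
    _ ≤ _ := by gcongr

lemma exists_pos_mul_rpow_le_half {C : ℝ≥0∞} (hC : C ≠ ⊤) {a : ℝ} (ha : 0 < a) :
    ∃ ε : ℝ≥0∞, ε ≠ 0 ∧ ε ≠ ⊤ ∧ C * ε ^ a ≤ 1 / 2 := by
  refine ⟨((2 * (C + 1))⁻¹) ^ (1 / a), ?_, ?_, ?_⟩
  · refine (ENNReal.rpow_pos (by simp; finiteness) (by simp)).ne'
  · exact ENNReal.rpow_ne_top_of_nonneg (by positivity) (by simp)
  · rw [← ENNReal.rpow_mul, one_div_mul_cancel ha.ne', ENNReal.rpow_one]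
    rw [ENNReal.mul_inv (by simp) (by simp), one_div, mul_left_comm]
    calc (2⁻¹ : ℝ≥0∞) * (C * (C + 1)⁻¹) ≤ 2⁻¹ * 1 := by
          gcongr
          rw [← div_eq_mul_inv]
          exact ENNReal.div_le_of_le_mul (by rw [one_mul]; exact le_self_add)
      _ = _ := mul_one _

lemma iSup_min_natCast_rpow (x : ℝ≥0∞) {s : ℝ} (hs : 0 < s) : x ^ s = ⨆ N : ℕ, (min x (N : ℝ≥0∞)) ^ s := by
  have h1 : x = ⨆ N : ℕ, min x (N : ℝ≥0∞) := by
    rw [← inf_iSup_eq (a := x) (f := fun N : ℕ => (N : ℝ≥0∞)), ENNReal.iSup_natCast]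
    simp
  conv_lhs => rw [h1]
  refine (ENNReal.monotone_rpow_of_nonneg hs.le).map_iSup_of_continuousAt
    (ENNReal.continuous_rpow_const.continuousAt) (by simp [hs])

/-- The area integral estimate for exponents dual to an exponent smaller than three. -/
lemma exists_lintegral_areaTr_rpow_le_of_conj (n : ℕ) [NeZero n] (hα : 0 < α) {t s s' : ℝ} (ht : 0 < t)
    (hs : s.HolderConjugate s') (hs3 : s' < 3) : ∃ C : ℝ≥0∞, C ≠ ⊤ ∧ ∀ g : En n → ℂ,
      DifferentiableOn ℂ g (Bn n) → Measurable g → ∀ r : ℝ, 0 < r → r < 1 →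
      ∫⁻ ζ, areaTr α g t r ζ ^ s ∂sigmaS n ≤ C * hMean g (2 * t * s) r := by
  obtain ⟨C, hC, h⟩ := exists_lintegral_areaTr_mul_le n hα ht hs hs3
  have hs1 := hs.lt
  have hs1' := hs.symm.lt
  obtain ⟨ε, hε0, hεt, hε⟩ := exists_pos_mul_rpow_le_half hC (sub_pos.2 hs1')
  refine ⟨2 * (ε⁻¹ * C), by finiteness, fun g hg hm r hr0 hr1 => ?_⟩
  set A := areaTr α g t r with hA
  have hAm : Measurable A := measurable_areaTr hm t r
  set H := hMean g (2 * t * s) r with hH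
  have hN : ∀ N : ℕ, ∫⁻ ζ, (min (A ζ) N) ^ s ∂sigmaS n ≤ 2 * (ε⁻¹ * C) * H := by
    intro N
    have hmm : Measurable fun ζ => min (A ζ) (N : ℝ≥0∞) := hAm.min measurable_const
    have hle : ∀ ζ, min (A ζ) (N : ℝ≥0∞) ≤ N := fun ζ => min_le_right _ _
    set X := ∫⁻ ζ, (min (A ζ) N) ^ s ∂sigmaS n with hX
    have hXt : X ≠ ⊤ := by
      refine ((lintegral_mono fun ζ => ENNReal.rpow_le_rpow (hle ζ) (by linarith)).trans_lt ?_).ne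
      rw [lintegral_const, measure_univ, mul_one]
      exact ENNReal.rpow_lt_top_of_nonneg (by linarith) (by simp)
    set φ : En n → ℝ≥0∞ := fun ζ => ε * (min (A ζ) N) ^ (s - 1) with hφ
    have hφm : Measurable φ := (hmm.pow_const _).const_mul _
    have hφs : ∫⁻ ζ, φ ζ ^ s' ∂sigmaS n = ε ^ s' * X := by
      rw [hX, ← lintegral_const_mul _ (hmm.pow_const _)]
      refine lintegral_congr fun ζ => ?_
      rw [hφ, ENNReal.mul_rpow_of_nonneg _ _ (by linarith : 0 ≤ s'), ← ENNReal.rpow_mul, hs.sub_one_mul_conj]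
    have hlow : ε * X ≤ ∫⁻ ζ, A ζ * φ ζ ∂sigmaS n := by
      rw [hX, ← lintegral_const_mul _ (hmm.pow_const _)]
      refine lintegral_mono fun ζ => ?_
      calc ε * (min (A ζ) N) ^ s = min (A ζ) N * (ε * (min (A ζ) N) ^ (s - 1)) := by
            rw [show s = 1 + (s - 1) by ring, ENNReal.rpow_add_of_nonneg _ _ zero_le_one (by linarith),
              ENNReal.rpow_one]
            ring_nf
        _ ≤ _ := by
            gcongr
            exact min_le_left _ _
    have hup : ∀ κ : ℝ, 0 < κ → ε * X ≤ C * (H + ε ^ s' * X + ENNReal.ofReal κ ^ s') := fun κ hκ => by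
      refine hlow.trans ?_
      rw [← hφs]
      refine h g hg hm r hr0 hr1 φ hφm (ε * (N : ℝ≥0∞) ^ (s - 1)) ?_ (fun ξ => ?_) κ hκ
      · exact ENNReal.mul_ne_top hεt (ENNReal.rpow_ne_top_of_nonneg (by linarith) (by simp))
      · simp only [hφ]
        have : 0 ≤ s - 1 := by linarith
        gcongr
        exact hle ξ
    have hlim : ε * X ≤ C * (H + ε ^ s' * X + 0) := by
      have ht1 : Tendsto (fun κ : ℝ => C * (H + ε ^ s' * X + ENNReal.ofReal κ ^ s')) (𝓝[>] 0)
          (𝓝 (C * (H + ε ^ s' * X + 0))) := by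
        refine ENNReal.Tendsto.const_mul (tendsto_const_nhds.add ?_) (Or.inr hC)
        have hc : Continuous fun κ : ℝ => ENNReal.ofReal κ ^ s' :=
          ENNReal.continuous_rpow_const.comp ENNReal.continuous_ofReal
        have := hc.tendsto 0
        rw [ENNReal.ofReal_zero, ENNReal.zero_rpow_of_pos (by linarith)] at this
        exact this.mono_left nhdsWithin_le_nhds
      refine ge_of_tendsto ht1 ?_
      filter_upwards [self_mem_nhdsWithin] with κ hκ using hup κ hκ
    rw [add_zero, mul_add] at hlim
    have hfin : X ≤ ε⁻¹ * C * H + X / 2 := by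
      calc X = ε⁻¹ * (ε * X) := by rw [← mul_assoc, ENNReal.inv_mul_cancel hε0 hεt, one_mul]
        _ ≤ ε⁻¹ * (C * H + C * (ε ^ s' * X)) := by gcongr
        _ = ε⁻¹ * C * H + (ε⁻¹ * ε) * (C * ε ^ (s' - 1)) * X := by
            rw [show s' = 1 + (s' - 1) by ring, ENNReal.rpow_add_of_nonneg _ _ zero_le_one (by linarith),
              ENNReal.rpow_one]
            ring_nf
        _ ≤ _ := by
            rw [ENNReal.inv_mul_cancel hε0 hεt, one_mul, ENNReal.div_eq_inv_mul]
            gcongr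
            rwa [one_div] at hε
    rw [mul_assoc]
    exact le_two_mul_of_le_add_half hXt hfin
  calc ∫⁻ ζ, A ζ ^ s ∂sigmaS n = ⨆ N : ℕ, ∫⁻ ζ, (min (A ζ) N) ^ s ∂sigmaS n := by
        rw [← lintegral_iSup (fun N => (hAm.min measurable_const).pow_const s)]
        · refine lintegral_congr fun ζ => iSup_min_natCast_rpow _ (by linarith)
        · intro N M hNM ζ
          refine ENNReal.rpow_le_rpow (min_le_min_left _ ?_) (by linarith)
          exact_mod_cast hNM
    _ ≤ _ := iSup_le hN

end Duality

section Pointwise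

variable {n : ℕ} {α : ℝ}

lemma lintegral_div_sq_le {δ : ℝ} (h0 : 0 < δ) (h1 : δ ≤ 1) :
    ∫⁻ θ : ℝ, ENNReal.ofReal (δ / (δ + ‖1 - Complex.exp (θ * Complex.I)‖) ^ 2) ∂thetaM ≤ 1 := by
  have hn : ‖((1 - δ : ℝ) : ℂ)‖ = 1 - δ := by rw [Complex.norm_real, Real.norm_of_nonneg (by linarith)]
  have hz : ((1 - δ : ℝ) : ℂ) ∈ ball (0 : ℂ) 1 := by
    rw [mem_ball_zero_iff, hn]; linarith
  rw [← lintegral_poissonKernel hz]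
  refine lintegral_mono fun θ => ENNReal.ofReal_le_ofReal ?_
  rw [poissonKernel_def, sub_zero, sub_zero, hn, Complex.norm_exp_ofReal_mul_I]
  have hpos : 0 < ‖Complex.exp (θ * Complex.I) - ((1 - δ : ℝ) : ℂ)‖ := by
    have := norm_sub_norm_le (Complex.exp (θ * Complex.I)) ((1 - δ : ℝ) : ℂ)
    rw [hn, Complex.norm_exp_ofReal_mul_I] at this
    linarith
  have hle : ‖Complex.exp (θ * Complex.I) - ((1 - δ : ℝ) : ℂ)‖ ≤ δ + ‖1 - Complex.exp (θ * Complex.I)‖ := by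
    calc _ = ‖(δ : ℂ) - (1 - Complex.exp (θ * Complex.I))‖ := by congr 1; push_cast; ring
      _ ≤ ‖(δ : ℂ)‖ + _ := norm_sub_le _ _
      _ = _ := by rw [Complex.norm_real, Real.norm_of_nonneg h0.le]
  refine div_le_div₀ (by nlinarith) (by nlinarith) (by positivity) ?_
  gcongr

variable [NeZero n]

/-- The sub-mean value property over the ball for powers of the modulus. -/
lemma enorm_rpow_le_lintegral_volN {h : En n → ℂ} (hh : DifferentiableOn ℂ h (Bn n)) (hm : Measurable h)
    {q : ℝ} (hq : 0 < q) : ‖h 0‖ₑ ^ q ≤ ∫⁻ u, ‖h u‖ₑ ^ q ∂volN n := by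
  have e := lintegral_volN_log (n := n) (F := fun _ => ‖h 0‖ₑ ^ q) measurable_const
  rw [lintegral_const, measure_univ, mul_one] at e
  rw [e, lintegral_volN_log (hm.enorm.pow_const _)]
  refine setLIntegral_mono' measurableSet_Iio fun τ (hτ : τ < 0) => mul_le_mul_right ?_ _
  refine lintegral_mono_ae ?_
  filter_upwards [sigmaS_ae_norm (n := n)] with ζ hζ
  have hU : closedBall (0 : ℂ) 1 ⊆ ball 0 (Real.exp (-Real.log (Real.exp τ))) := by
    refine closedBall_subset_ball ?_
    rw [Real.log_exp]
    exact Real.one_lt_exp_iff.2 (by linarith)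
  have key := enorm_rpow_le_kernel le_rfl zero_lt_one isOpen_ball hU
    (differentiableOn_slice_smul hh hζ (Real.exp_pos τ)) (hm.comp (by fun_prop)) hq 0
  simp only [lintegral_const, measure_univ, mul_one]
  simp only [Complex.ofReal_zero, zero_smul, zero_mul, sub_zero, norm_one, one_pow, ne_eq, OfNat.ofNat_ne_zero,
    not_false_eq_true, zero_pow, div_one, ENNReal.ofReal_one, mul_one] at key
  refine key.trans (le_of_eq ?_)
  simp only [exp_line_smul]
  simp_rw [smul_comm _ (Real.exp τ)]

omit [NeZero n] in
/-- Position of the points in the anisotropic ellipsoid around `z`. -/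
lemma ellipsoid_bounds {z η u : En n} (hη : ‖η‖ = 1) (hzη : z = ‖z‖ • η) (hz : ‖z‖ < 1) (hu : ‖u‖ < 1) :
    ‖z + aniDil η ((1 - ‖z‖) / 64) u‖ ≤ 1 - 3 / 4 * (1 - ‖z‖) ∧
    1 - ‖z + aniDil η ((1 - ‖z‖) / 64) u‖ < 2 * (1 - ‖z‖) ∧
    aniDist (‖z + aniDil η ((1 - ‖z‖) / 64) u‖⁻¹ • (z + aniDil η ((1 - ‖z‖) / 64) u)) η < 4 * (1 - ‖z‖) := by
  set δ := 1 - ‖z‖ with hδ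
  have hδ0 : 0 < δ := by linarith
  set d := δ / 64 with hd
  have hd0 : 0 < d := by positivity
  set w := z + aniDil η d u with hw
  have hinz : inner ℂ η z = (‖z‖ : ℂ) := by
    conv_lhs => rw [hzη]
    rw [inner_smul_right_eq_smul, inner_self_eq_norm_sq_to_K, hη]
    simp
  have hin : inner ℂ η w = (‖z‖ : ℂ) + d * inner ℂ η u := by
    rw [hw, inner_add_right, inner_aniDil hη hd0.le, hinz]
  have hiu : ‖(inner ℂ η u : ℂ)‖ ≤ 1 := (norm_inner_le_norm η u).trans (by rw [hη]; linarith)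
  have hdu : ‖(d * inner ℂ η u : ℂ)‖ ≤ d := by
    rw [norm_mul, Complex.norm_real, Real.norm_of_nonneg hd0.le]
    nlinarith
  have hperp : w - (inner ℂ η w : ℂ) • η = (Real.sqrt d : ℂ) • (u - (inner ℂ η u : ℂ) • η) := by
    rw [← aniDil_sub hη hd0.le, inner_aniDil hη hd0.le, hin, hw, add_smul]
    have : z = (‖z‖ : ℂ) • η := by rw [Complex.coe_smul]; exact hzη
    nth_rewrite 1 [this]
    abel
  have hn1 : ‖w‖ ^ 2 = ‖(inner ℂ η w : ℂ)‖ ^ 2 + d * ‖u - (inner ℂ η u : ℂ) • η‖ ^ 2 := by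
    have h1 := norm_sub_inner_smul_sq w hη
    rw [hperp, norm_smul, mul_pow, Complex.norm_real, Real.norm_of_nonneg (Real.sqrt_nonneg _),
      Real.sq_sqrt hd0.le] at h1
    linarith
  have hu2 : ‖u - (inner ℂ η u : ℂ) • η‖ ^ 2 ≤ 1 := by
    rw [norm_sub_inner_smul_sq u hη]
    nlinarith [norm_nonneg u, sq_nonneg ‖(inner ℂ η u : ℂ)‖]
  have hz0 := norm_nonneg z
  have hiw : ‖(inner ℂ η w : ℂ)‖ ≤ ‖z‖ + d := by
    rw [hin]
    refine (norm_add_le _ _).trans ?_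
    rw [Complex.norm_real, norm_norm]
    linarith
  have hiw2 : ‖z‖ - d ≤ ‖(inner ℂ η w : ℂ)‖ := by
    rw [hin]
    have := norm_sub_le_norm_add (‖z‖ : ℂ) (d * inner ℂ η u)
    rw [Complex.norm_real, norm_norm] at this
    linarith
  have hb1 : ‖w‖ ≤ 1 - 3 / 4 * δ := by
    have h64 : δ = 64 * d := by rw [hd]; ring
    have hz1 : ‖z‖ = 1 - 64 * d := by linarith
    refine le_of_sq_le_sq ?_ (by nlinarith)
    have h1 : ‖(inner ℂ η w : ℂ)‖ ^ 2 ≤ (‖z‖ + d) ^ 2 := by gcongr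
    have h2 : d * ‖u - (inner ℂ η u : ℂ) • η‖ ^ 2 ≤ d * 1 := by gcongr
    rw [hn1, h64]
    rw [hz1] at h1 hz0
    nlinarith
  have hb2 : 1 - ‖w‖ < 2 * δ := by
    have := norm_inner_le_norm (𝕜 := ℂ) η w
    rw [hη, one_mul] at this
    linarith
  refine ⟨hb1, hb2, ?_⟩
  have hw1 : ‖w‖ ≤ 1 := by linarith
  have hwη : aniDist w η ≤ 2 * δ := by
    rw [aniDist, hin]
    calc ‖(1 : ℂ) - (‖z‖ + d * inner ℂ η u)‖ = ‖(δ : ℂ) - d * inner ℂ η u‖ := by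
          congr 1; rw [hδ]; push_cast; ring
      _ ≤ δ + d := by
          refine (norm_sub_le _ _).trans ?_
          rw [Complex.norm_real, Real.norm_of_nonneg hδ0.le]
          linarith
      _ ≤ _ := by linarith
  have hξ : ‖‖w‖⁻¹ • w‖ ≤ 1 := by
    rw [norm_smul, norm_inv, norm_norm]
    exact inv_mul_le_one
  have h3 := aniDist_le_aniDist_smul_add (r := ‖w‖) hξ hη.le hw1
  have h4 : ‖w‖ • ‖w‖⁻¹ • w = w := by
    rcases eq_or_ne w 0 with h | h
    · simp [h]
    · rw [smul_smul, mul_inv_cancel₀ (norm_ne_zero_iff.2 h), one_smul]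
  rw [h4] at h3
  linarith

omit [NeZero n] in
/-- Kernel estimate along the complex line through `w`. -/
lemma enorm_rpow_le_kernel_slice {g : En n → ℂ} (hg : DifferentiableOn ℂ g (Bn n)) (hm : Measurable g)
    {q : ℝ} (hq : 0 < q) {ρ δ : ℝ} (hρ0 : 0 < ρ) (hρ : ρ < 1) (hδ : 0 < δ) (hρδ : 1 - δ / 2 ≤ ρ) {w : En n}
    (hw : ‖w‖ ≤ 1 - 3 / 4 * δ) (hw2 : 1 - ‖w‖ < 2 * δ) :
    ‖g w‖ₑ ^ q ≤ ∫⁻ θ : ℝ, ‖g (ρ • (Complex.exp (θ * Complex.I) • (‖w‖⁻¹ • w)))‖ₑ ^ q *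
      ENNReal.ofReal (32 ^ (n + 2) * (δ ^ (n + 1) / (δ + ‖1 - Complex.exp (θ * Complex.I)‖) ^ (n + 2))) ∂thetaM := by
  set ξ := ‖w‖⁻¹ • w with hξ
  set x := ‖w‖ / ρ with hx
  have hx0 : 0 ≤ x := by positivity
  have hx1 : x ≤ 1 - δ / 4 := by
    rw [hx, div_le_iff₀ hρ0]
    nlinarith
  have hx2 : 1 - x ≤ 2 * δ := by
    have : ‖w‖ ≤ x := by rw [hx, le_div_iff₀ hρ0]; nlinarith [norm_nonneg w]
    linarith
  have hξ1 : ‖ξ‖ ≤ 1 := by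
    rw [hξ, norm_smul, norm_inv, norm_norm]
    exact inv_mul_le_one
  have h4 : ‖w‖ • ξ = w := by
    rcases eq_or_ne w 0 with h | h
    · simp [h]
    · rw [hξ, smul_smul, mul_inv_cancel₀ (norm_ne_zero_iff.2 h), one_smul]
  have hf : DifferentiableOn ℂ (fun l : ℂ => g (l • (ρ • ξ))) (ball 0 (1 / ρ)) := by
    refine hg.comp (by fun_prop) fun l hl => ?_
    rw [mem_ball_zero_iff, lt_div_iff₀ hρ0] at hl
    rw [Bn, mem_ball_zero_iff, norm_smul, norm_smul, Real.norm_of_nonneg hρ0.le, ← mul_assoc]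
    nlinarith [norm_nonneg ξ, norm_nonneg l, mul_nonneg (norm_nonneg l) hρ0.le]
  have key := enorm_rpow_le_kernel hx0 (by linarith) isOpen_ball
    (closedBall_subset_ball ((one_lt_div hρ0).2 hρ)) hf (hm.comp (by fun_prop)) hq n
  have e1 : ((x : ℝ) : ℂ) • (ρ • ξ) = w := by
    rw [Complex.coe_smul, smul_smul, hx, div_mul_cancel₀ _ hρ0.ne', h4]
  rw [e1] at key
  refine key.trans (lintegral_mono fun θ => ?_)
  rw [smul_comm _ ρ]
  refine mul_le_mul_right (ENNReal.ofReal_le_ofReal ?_) _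
  set e := Complex.exp (θ * Complex.I) with he
  have hen : ‖e‖ = 1 := Complex.norm_exp_ofReal_mul_I θ
  have hk1 : 1 - x ≤ ‖1 - x * e‖ := by
    have := norm_sub_norm_le (1 : ℂ) (x * e)
    rw [norm_mul, hen, Complex.norm_real, Real.norm_of_nonneg hx0, norm_one] at this
    linarith
  have hk2 : ‖1 - e‖ ≤ ‖1 - x * e‖ + (1 - x) := by
    calc ‖1 - e‖ = ‖(1 - x * e) - (1 - x : ℝ) * e‖ := by congr 1; push_cast; ring
      _ ≤ _ := by
        refine (norm_sub_le _ _).trans ?_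
        rw [norm_mul, hen, Complex.norm_real, Real.norm_of_nonneg (by linarith), mul_one]
  have hk : (δ + ‖1 - e‖) / 8 ≤ ‖1 - x * e‖ := by linarith
  have hnum : 1 - x ^ 2 ≤ 4 * δ := by nlinarith
  have hnum0 : 0 ≤ 1 - x ^ 2 := by nlinarith
  calc (1 - x ^ 2) ^ (n + 1) / ‖1 - x * e‖ ^ (n + 2)
      ≤ (4 * δ) ^ (n + 1) / ((δ + ‖1 - e‖) / 8) ^ (n + 2) := by gcongr
    _ = (4 ^ (n + 1) * 8 ^ (n + 2)) * (δ ^ (n + 1) / (δ + ‖1 - e‖) ^ (n + 2)) := by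
        rw [mul_pow, div_pow]; field_simp
    _ ≤ _ := by
        refine mul_le_mul_of_nonneg_right ?_ (by positivity)
        rw [show (32 : ℝ) = 4 * 8 by norm_num, mul_pow]
        gcongr
        · norm_num
        · omega

end Pointwise

section Averaging

variable {n : ℕ} {α : ℝ} [NeZero n]

lemma lintegral_ellipsoid_le {z η : En n} (hη : ‖η‖ = 1) (hzη : z = ‖z‖ • η) (hz : ‖z‖ < 1) {φ : En n → ℝ≥0∞}
    (hφ : Measurable φ) :
    ∫⁻ u, φ (‖z + aniDil η ((1 - ‖z‖) / 64) u‖⁻¹ • (z + aniDil η ((1 - ‖z‖) / 64) u)) ∂volN n ≤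
      ENNReal.ofReal (4 * n * 64 ^ (n + 1) / (1 - ‖z‖) ^ n) * ∫⁻ ξ in aniCap η (4 * (1 - ‖z‖)), φ ξ ∂sigmaS n := by
  set δ := 1 - ‖z‖ with hδ
  have hδ0 : 0 < δ := by linarith
  have hd0 : 0 < δ / 64 := by positivity
  set G : En n → ℝ≥0∞ := (aniCap η (4 * δ)).indicator φ with hG
  have hGm : Measurable G := hφ.indicator (measurableSet_aniCap _ _)
  set S : Set (En n) := {w | 1 - 2 * δ < ‖w‖} with hS
  have hSm : MeasurableSet S := measurableSet_lt measurable_const measurable_norm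
  set F : En n → ℝ≥0∞ := (Bn n).indicator (S.indicator fun w => G (‖w‖⁻¹ • w)) with hF
  have hF1 : Measurable (S.indicator fun w : En n => G (‖w‖⁻¹ • w)) := (hGm.comp measurable_normalize).indicator hSm
  have hFm : Measurable F := hF1.indicator measurableSet_Bn
  have hd0' : ENNReal.ofReal ((δ / 64) ^ (n + 1)) ≠ 0 := by
    rw [Ne, ENNReal.ofReal_eq_zero, not_le]; positivity
  refine (ENNReal.mul_le_mul_iff_right hd0' ENNReal.ofReal_ne_top).1 ?_
  calc ENNReal.ofReal ((δ / 64) ^ (n + 1)) *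
        ∫⁻ u, φ (‖z + aniDil η (δ / 64) u‖⁻¹ • (z + aniDil η (δ / 64) u)) ∂volN n
      ≤ ENNReal.ofReal ((δ / 64) ^ (n + 1)) * ((volume (Bn n))⁻¹ * ∫⁻ u, F (z + aniDil η (δ / 64) u)) := by
        refine mul_le_mul_right ?_ _
        rw [volN, lintegral_smul_measure, smul_eq_mul]
        refine mul_le_mul_right ((setLIntegral_mono' measurableSet_Bn fun u hu => ?_).trans (setLIntegral_le_lintegral _ _)) _
        have hu1 : ‖u‖ < 1 := by rwa [Bn, mem_ball_zero_iff] at hu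
        obtain ⟨h1, h2, h3⟩ := ellipsoid_bounds hη hzη hz hu1
        rw [← hδ] at h1 h2 h3
        rw [hF, indicator_of_mem (by rw [Bn, mem_ball_zero_iff]; linarith),
          indicator_of_mem (by rw [hS, mem_ofPred_eq]; linarith), hG, indicator_of_mem (by exact h3)]
    _ = (volume (Bn n))⁻¹ * ∫⁻ w, F w := by
        rw [mul_left_comm, lintegral_aniDil hη hd0 z hFm]
    _ = ∫⁻ w in S, G (‖w‖⁻¹ • w) ∂volN n := by
        rw [hF, lintegral_indicator measurableSet_Bn, ← lintegral_indicator hSm, volN, lintegral_smul_measure,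
          smul_eq_mul]
    _ ≤ ENNReal.ofReal (2 * n * (1 - (1 - 2 * δ))) * ∫⁻ ξ, G ξ ∂sigmaS n := by
        rw [hS, lintegral_annulus hGm]
        exact mul_le_mul_left (radial_factor_le _) _
    _ = _ := by
        rw [hG, lintegral_indicator (measurableSet_aniCap _ _), ← mul_assoc, ← ENNReal.ofReal_mul (by positivity)]
        congr 2
        rw [div_pow]
        field_simp
        ring

omit [NeZero n] in
lemma setLIntegral_rotEn_le {ζ η : En n} (hη : ‖η‖ = 1) (hζ : ‖ζ‖ = 1) (hα : 0 < α) {δ : ℝ} (hδ : 0 < δ)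
    (hηζ : aniDist ζ η < (α + 1) * δ) {φ : En n → ℝ≥0∞} (hφ : Measurable φ) (θ : ℝ) :
    ∫⁻ ξ in aniCap η (4 * δ), φ (Complex.exp (θ * Complex.I) • ξ) ∂sigmaS n ≤
      ENNReal.ofReal ((4 * (α + 5) * (δ + ‖1 - Complex.exp (θ * Complex.I)‖)) ^ n) * capMax φ ζ := by
  set e := Complex.exp (θ * Complex.I) with he
  set R := 2 * (α + 5) * (δ + ‖1 - e‖) with hR
  have hR0 : 0 < R := by positivity
  calc ∫⁻ ξ in aniCap η (4 * δ), φ (e • ξ) ∂sigmaS n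
      ≤ ∫⁻ ξ, (aniCap ζ R).indicator φ (e • ξ) ∂sigmaS n := by
        rw [← lintegral_indicator (measurableSet_aniCap _ _)]
        refine lintegral_mono_ae ?_
        filter_upwards [sigmaS_ae_norm (n := n)] with ξ hξ
        by_cases hξη : aniDist ξ η < 4 * δ
        swap
        · rw [indicator_of_notMem (by exact hξη)]
          exact zero_le
        rw [indicator_of_mem (by exact hξη), indicator_of_mem]
        have h1 := aniDist_smul_left_le hξ.le hη.le e
        have hen : ‖e • ξ‖ ≤ 1 := by rw [norm_smul, Complex.norm_exp_ofReal_mul_I, hξ, one_mul]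
        have h2 := aniDist_triangle_unit hen hη hζ.le
        rw [aniDist_comm η ζ] at h2
        change aniDist (e • ξ) ζ < R
        nlinarith [norm_nonneg (1 - e)]
    _ = ∫⁻ ξ in aniCap ζ R, φ ξ ∂sigmaS n := by
        rw [lintegral_rotEn θ (hφ.indicator (measurableSet_aniCap _ _)), lintegral_indicator (measurableSet_aniCap _ _)]
    _ ≤ _ := by
        refine (lintegral_aniCap_le hζ hR0).trans (le_of_eq ?_)
        rw [hR]
        ring_nf

/-- Values of `|g|^q` in the approach region are controlled by the maximal function of a dilate. -/
lemma exists_enorm_rpow_le_capMax (n : ℕ) [NeZero n] (hα : 0 < α) :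
    ∃ C : ℝ≥0∞, C ≠ ⊤ ∧ ∀ (q : ℝ) (g : En n → ℂ) (ρ : ℝ) (ζ z : En n), 0 < q → DifferentiableOn ℂ g (Bn n) →
      Measurable g → 0 < ρ → ρ < 1 → ‖ζ‖ = 1 → z ∈ Gam α ζ → 1 - (1 - ‖z‖) / 2 ≤ ρ →
        ‖g z‖ₑ ^ q ≤ C * capMax (fun ξ => ‖g (ρ • ξ)‖ₑ ^ q) ζ := by
  refine ⟨ENNReal.ofReal (32 ^ (n + 2) * (4 * n * 64 ^ (n + 1)) * (4 * (α + 5)) ^ n), ENNReal.ofReal_ne_top, ?_⟩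
  intro q g ρ ζ z hq hg hm hρ0 hρ hζ hzζ hzρ
  obtain ⟨η, hη, hzη⟩ := exists_unit_smul z
  have hz : ‖z‖ < 1 := (mem_Gam_iff.1 hzζ).1
  have hηζ := aniDist_lt_of_mem_Gam hη hzη hζ hα hzζ
  set φ : En n → ℝ≥0∞ := fun ξ => ‖g (ρ • ξ)‖ₑ ^ q with hφ
  have hφm : Measurable φ := (hm.comp (measurable_const_smul ρ)).enorm.pow_const _
  set L := aniDil η ((1 - ‖z‖) / 64) with hL
  have hLc : Continuous L := L.continuous_of_finiteDimensional
  set δ := 1 - ‖z‖ with hδ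
  have hδ0 : 0 < δ := by linarith
  have hδ1 : δ ≤ 1 := by linarith [norm_nonneg z]
  have hball : ∀ᵐ u ∂volN n, u ∈ Bn n := by
    rw [volN]
    exact Measure.ae_smul_measure (ae_restrict_mem measurableSet_Bn) _
  have hdiff : DifferentiableOn ℂ (fun u => g (z + L u)) (Bn n) := by
    refine hg.comp ((differentiableOn_const _).add L.toContinuousLinearMap.differentiable.differentiableOn) fun u hu => ?_
    have hu1 : ‖u‖ < 1 := by rwa [Bn, mem_ball_zero_iff] at hu
    have := (ellipsoid_bounds hη hzη hz hu1).1
    rw [Bn, mem_ball_zero_iff]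
    linarith
  have hLm : Measurable fun u => z + L u := hLc.measurable.const_add z
  have h1 := enorm_rpow_le_lintegral_volN hdiff (hm.comp hLm) hq
  simp only [map_zero, add_zero] at h1
  set K : ℝ → ℝ≥0∞ := fun θ => ENNReal.ofReal (32 ^ (n + 2) *
    (δ ^ (n + 1) / (δ + ‖1 - Complex.exp (θ * Complex.I)‖) ^ (n + 2))) with hK
  have hKm : Measurable K := by fun_prop
  set D : En n → En n := fun u => ‖z + L u‖⁻¹ • (z + L u) with hD
  have hDm : Measurable D := measurable_normalize.comp hLm
  calc ‖g z‖ₑ ^ q ≤ ∫⁻ u, ‖g (z + L u)‖ₑ ^ q ∂volN n := h1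
    _ ≤ ∫⁻ u, (∫⁻ θ : ℝ, φ (Complex.exp (θ * Complex.I) • D u) * K θ ∂thetaM) ∂volN n := by
        refine lintegral_mono_ae ?_
        filter_upwards [hball] with u hu
        have hu1 : ‖u‖ < 1 := by rwa [Bn, mem_ball_zero_iff] at hu
        obtain ⟨h1, h2, -⟩ := ellipsoid_bounds hη hzη hz hu1
        exact enorm_rpow_le_kernel_slice hg hm hq hρ0 hρ hδ0 hzρ h1 h2
    _ = ∫⁻ θ : ℝ, (∫⁻ u, φ (Complex.exp (θ * Complex.I) • D u) * K θ ∂volN n) ∂thetaM := by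
        refine lintegral_lintegral_swap (Measurable.aemeasurable ?_)
        refine Measurable.mul (hφm.comp ?_) (hKm.comp measurable_snd)
        exact Measurable.smul (f := fun x : En n × ℝ => Complex.exp (x.2 * Complex.I)) (by fun_prop) (hDm.comp measurable_fst)
    _ ≤ ∫⁻ θ : ℝ, (ENNReal.ofReal (32 ^ (n + 2) * (4 * n * 64 ^ (n + 1)) * (4 * (α + 5)) ^ n) * capMax φ ζ) *
          ENNReal.ofReal (δ / (δ + ‖1 - Complex.exp (θ * Complex.I)‖) ^ 2) ∂thetaM := by
        refine lintegral_mono fun θ => ?_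
        set e := Complex.exp (θ * Complex.I) with he
        rw [lintegral_mul_const' _ _ ENNReal.ofReal_ne_top]
        have h2 := (lintegral_ellipsoid_le hη hzη hz (φ := fun ξ => φ (e • ξ))
          (hφm.comp (measurable_const_smul e))).trans
          (mul_le_mul_right (setLIntegral_rotEn_le hη hζ hα hδ0 hηζ hφm θ) _)
        refine (mul_le_mul_left h2 _).trans (le_of_eq ?_)
        rw [← hδ, ← he, ← mul_assoc, ← ENNReal.ofReal_mul (by positivity), mul_right_comm, ← ENNReal.ofReal_mul (by positivity),
          mul_right_comm _ (capMax φ ζ), ← ENNReal.ofReal_mul (by positivity)]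
        congr 2
        have : 0 < δ + ‖1 - e‖ := by positivity
        rw [mul_pow _ (δ + ‖1 - e‖)]
        field_simp
        ring
    _ ≤ _ := by
        rw [lintegral_const_mul _ (by fun_prop)]
        exact mul_le_of_le_one_right' (lintegral_div_sq_le hδ0 hδ1)

end Averaging

section Comparison

variable {n : ℕ} {α : ℝ} [NeZero n] {g : En n → ℂ}

lemma lintegral_logMean_slice_log (hm : Measurable g) (q : ℝ) {r : ℝ} (h0 : 0 < r) :
    ∫⁻ ζ, logMean (fun w => g (Complex.exp w • ζ)) q (Real.log r) ∂sigmaS n = hMean g q r := by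
  rw [← lintegral_logMean_slice hm]
  refine lintegral_congr fun ζ => lintegral_congr fun θ => ?_
  simp only [Complex.ofReal_zero, zero_add]
  rw [exp_line_smul, Real.exp_log h0, smul_comm]

lemma hMean_mono (hg : DifferentiableOn ℂ g (Bn n)) (hm : Measurable g) {q : ℝ} (hq : 0 < q) {r₁ r₂ : ℝ}
    (h0 : 0 < r₁) (h : r₁ ≤ r₂) (h1 : r₂ < 1) : hMean g q r₁ ≤ hMean g q r₂ := by
  rw [← lintegral_logMean_slice_log hm q h0, ← lintegral_logMean_slice_log hm q (h0.trans_le h)]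
  refine lintegral_mono_ae ?_
  filter_upwards [sigmaS_ae_norm (n := n)] with ζ hζ
  exact (logHol_slice hg hm hζ).logMean_mono hq (Real.log_le_log h0 h) (Real.log_neg (h0.trans_le h) h1)

lemma hMean_ne_top (hg : DifferentiableOn ℂ g (Bn n)) {q : ℝ} (hq : 0 < q) {r : ℝ} (h0 : 0 ≤ r) (h1 : r < 1) :
    hMean g q r ≠ ⊤ := by
  have hK : IsCompact (closedBall (0 : En n) r) := isCompact_closedBall _ _
  obtain ⟨M, hM⟩ := hK.exists_bound_of_continuousOn (hg.continuousOn.mono (closedBall_subset_ball h1))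
  refine ne_top_of_le_ne_top (b := ENNReal.ofReal M ^ q) (by finiteness) ?_
  calc hMean g q r ≤ ∫⁻ _ζ, ENNReal.ofReal M ^ q ∂sigmaS n := by
        refine lintegral_mono_ae ?_
        filter_upwards [sigmaS_ae_norm (n := n)] with ζ hζ
        refine ENNReal.rpow_le_rpow ?_ hq.le
        rw [← ofReal_norm]
        refine ENNReal.ofReal_le_ofReal (hM _ ?_)
        rw [mem_closedBall_zero_iff, norm_smul, hζ, mul_one, Real.norm_of_nonneg h0]
    _ = _ := by rw [lintegral_const, measure_univ, mul_one]

/-- Almost every zero of `g` is a zero of its radial derivative. -/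
lemma ae_radD_eq_zero (hg : DifferentiableOn ℂ g (Bn n)) (hm : Measurable g) {r : ℝ} (h0 : 0 < r) (h1 : r < 1) :
    ∀ᵐ z ∂volN n, ‖z‖ < r → g z = 0 → radD g z = 0 := by
  obtain ⟨C, hC, h⟩ := exists_lintegral_wt_le n (t := 1 / 2) (by norm_num)
  have h2 : ∫⁻ z, wt g (1 / 2) z * ENNReal.ofReal (r - ‖z‖) ∂volN n ≠ ⊤ :=
    ne_top_of_le_ne_top (ENNReal.mul_ne_top hC (hMean_ne_top hg (by norm_num) h0.le h1)) (h g hg hm r h0 h1)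
  filter_upwards [ae_lt_top ((measurable_wt hm _).mul (by fun_prop)) h2] with z hz hzr hz0
  by_contra hR
  have h3 : ENNReal.ofReal (r - ‖z‖) ≠ 0 := by simpa using hzr
  have h4 : wt g (1 / 2) z = ⊤ := by
    rw [wt, hz0, enorm_zero, ENNReal.zero_rpow_of_neg (by norm_num), ENNReal.top_mul]
    simpa using hR
  rw [Pi.mul_apply, h4, ENNReal.top_mul h3] at hz
  exact lt_irrefl _ hz

omit [NeZero n] in
lemma wt_le_rpow_mul {t₁ t₂ : ℝ} {z : En n} (hz : g z = 0 → radD g z = 0) :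
    wt g t₁ z ≤ ‖g z‖ₑ ^ (2 * (t₁ - t₂)) * wt g t₂ z := by
  by_cases h : g z = 0
  · simp [wt, hz h]
  · rw [wt, wt, ← mul_assoc, ← ENNReal.rpow_add _ _ (by simpa using h) (by simp)]
    ring_nf
    rfl

omit [NeZero n] in
lemma wt_le_rpow_mul_rpow {t t₁ t₂ a b : ℝ} (ha : 0 < a) (hb : 0 < b) (hab : a + b = 1) (ht : t = a * t₁ + b * t₂)
    {z : En n} (hz : g z = 0 → radD g z = 0) : wt g t z ≤ wt g t₁ z ^ a * wt g t₂ z ^ b := by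
  by_cases h : g z = 0
  · simp [wt, hz h]
  · have h0 : ‖g z‖ₑ ≠ 0 := by simpa using h
    rw [wt, wt, wt, ENNReal.mul_rpow_of_nonneg _ _ ha.le, ENNReal.mul_rpow_of_nonneg _ _ hb.le,
      mul_mul_mul_comm, ← ENNReal.rpow_mul, ← ENNReal.rpow_mul, ← ENNReal.rpow_add _ _ h0 (by simp),
      ← ENNReal.rpow_add_of_nonneg _ _ ha.le hb.le, hab, ENNReal.rpow_one]
    refine le_of_eq ?_
    congr 2
    rw [ht]
    linear_combination (2 : ℝ) * hab

lemma exists_areaTr_rpow_le_capMax (n : ℕ) [NeZero n] (hα : 0 < α) : ∃ C : ℝ≥0∞, C ≠ ⊤ ∧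
    ∀ (g : En n → ℂ) (q t₁ t₂ r : ℝ) (ζ : En n), DifferentiableOn ℂ g (Bn n) → Measurable g → 0 < q → t₂ < t₁ →
      0 < r → r < 1 → ‖ζ‖ = 1 → areaTr α g t₁ r ζ ≤
        (C * capMax (fun ξ => ‖g (((1 + r) / 2) • ξ)‖ₑ ^ (q / 2)) ζ) ^ (4 * (t₁ - t₂) / q) * areaTr α g t₂ r ζ := by
  obtain ⟨C, hC, h⟩ := exists_enorm_rpow_le_capMax n hα
  refine ⟨C, hC, fun g q t₁ t₂ r ζ hg hm hq ht h0 h1 hζ => ?_⟩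
  set M := capMax (fun ξ => ‖g (((1 + r) / 2) • ξ)‖ₑ ^ (q / 2)) ζ with hM
  have hmF : Measurable fun z : En n => wt g t₂ z * ENNReal.ofReal (((1 - ‖z‖ ^ 2) ^ n)⁻¹) * ENNReal.ofReal (r - ‖z‖) :=
    ((measurable_wt hm t₂).mul (by fun_prop)).mul (by fun_prop)
  rw [areaTr, areaTr, ← lintegral_const_mul _ hmF]
  have hae := ae_restrict_of_ae (s := Gam α ζ) (ae_radD_eq_zero hg hm h0 h1)
  refine lintegral_mono_ae ?_
  filter_upwards [hae, ae_restrict_mem (measurableSet_Gam ζ)] with z hz hzG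
  by_cases hzr : r ≤ ‖z‖
  · simp [ENNReal.ofReal_of_nonpos (sub_nonpos.2 hzr)]
  rw [not_le] at hzr
  have h3 := h (q / 2) g ((1 + r) / 2) ζ z (by linarith) hg hm (by linarith) (by linarith) hζ hzG (by linarith)
  have h4 : ‖g z‖ₑ ^ (2 * (t₁ - t₂)) ≤ (C * M) ^ (4 * (t₁ - t₂) / q) := by
    calc _ = (‖g z‖ₑ ^ (q / 2)) ^ (4 * (t₁ - t₂) / q) := by
          rw [← ENNReal.rpow_mul]; congr 1; field_simp; ring
      _ ≤ _ := ENNReal.rpow_le_rpow h3 (div_nonneg (by linarith) hq.le)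
  rw [← mul_assoc, ← mul_assoc]
  gcongr
  exact (wt_le_rpow_mul (hz hzr)).trans (mul_le_mul_left h4 _)

/-- Lowering the outer exponent of the area integral at the cost of the Hardy mean. -/
lemma exists_lintegral_areaTr_rpow_le_mul (n : ℕ) [NeZero n] (hα : 0 < α) {q s₁ s₂ : ℝ} (hq : 0 < q) (hs : 0 < s₁)
    (hs₂ : s₁ < s₂) : ∃ C : ℝ≥0∞, C ≠ ⊤ ∧ ∀ g : En n → ℂ, DifferentiableOn ℂ g (Bn n) → Measurable g →
      ∀ r : ℝ, 0 < r → r < 1 → ∫⁻ ζ, areaTr α g (q / (2 * s₁)) r ζ ^ s₁ ∂sigmaS n ≤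
        C * hMean g q ((1 + r) / 2) ^ (1 - s₁ / s₂) *
          (∫⁻ ζ, areaTr α g (q / (2 * s₂)) r ζ ^ s₂ ∂sigmaS n) ^ (s₁ / s₂) := by
  obtain ⟨C, hC, h⟩ := exists_areaTr_rpow_le_capMax (α := α) n hα
  obtain ⟨C', hC', h'⟩ := exists_lintegral_capMax_rpow_le n (p := 2) one_lt_two
  have hs2 : 0 < s₂ := hs.trans hs₂
  have hb1 : s₁ / s₂ < 1 := (div_lt_one hs2).2 hs₂
  have hb0 : 0 < s₁ / s₂ := by positivity
  have ha0 : 0 ≤ 1 - s₁ / s₂ := by linarith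
  refine ⟨(C ^ (2 : ℝ) * C') ^ (1 - s₁ / s₂), by finiteness, fun g hg hm r h0 h1 => ?_⟩
  set φ : En n → ℝ≥0∞ := fun ξ => ‖g (((1 + r) / 2) • ξ)‖ₑ ^ (q / 2) with hφ
  have hφm : Measurable φ := (hm.comp (measurable_const_smul _)).enorm.pow_const _
  have ht : q / (2 * s₂) < q / (2 * s₁) := by gcongr
  calc ∫⁻ ζ, areaTr α g (q / (2 * s₁)) r ζ ^ s₁ ∂sigmaS n
      ≤ ∫⁻ ζ, ((C * capMax φ ζ) ^ (2 : ℝ)) ^ (1 - s₁ / s₂) * (areaTr α g (q / (2 * s₂)) r ζ ^ s₂) ^ (s₁ / s₂) ∂sigmaS n := by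
        refine lintegral_mono_ae ?_
        filter_upwards [sigmaS_ae_norm (n := n)] with ζ hζ
        refine (ENNReal.rpow_le_rpow (h g q _ _ r ζ hg hm hq ht h0 h1 hζ) hs.le).trans (le_of_eq ?_)
        rw [ENNReal.mul_rpow_of_nonneg _ _ hs.le, ← ENNReal.rpow_mul, ← ENNReal.rpow_mul, ← ENNReal.rpow_mul]
        congr 2 <;> field_simp
        ring
    _ ≤ (∫⁻ ζ, (C * capMax φ ζ) ^ (2 : ℝ) ∂sigmaS n) ^ (1 - s₁ / s₂) *
          (∫⁻ ζ, areaTr α g (q / (2 * s₂)) r ζ ^ s₂ ∂sigmaS n) ^ (s₁ / s₂) :=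
        ENNReal.lintegral_mul_norm_pow_le (((measurable_capMax hφm).const_mul _).pow_const _).aemeasurable
          ((measurable_areaTr hm _ r).pow_const _).aemeasurable ha0 hb0.le (by ring)
    _ ≤ _ := by
        refine mul_le_mul_left ?_ _
        rw [← ENNReal.mul_rpow_of_nonneg _ _ ha0]
        refine ENNReal.rpow_le_rpow ?_ ha0
        simp_rw [ENNReal.mul_rpow_of_nonneg _ _ zero_le_two]
        rw [lintegral_const_mul _ ((measurable_capMax hφm).pow_const _), mul_assoc]
        refine mul_le_mul_right ((h' φ hφm).trans (le_of_eq ?_)) _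
        simp_rw [hφ, ← ENNReal.rpow_mul, hMean]
        ring_nf

/-- The area integral is dominated by the Hardy mean. -/
lemma exists_lintegral_areaTr_rpow_le (n : ℕ) [NeZero n] (hα : 0 < α) {q s : ℝ} (hq : 0 < q) (hs : 0 < s) :
    ∃ C : ℝ≥0∞, C ≠ ⊤ ∧ ∀ g : En n → ℂ, DifferentiableOn ℂ g (Bn n) → Measurable g → ∀ r : ℝ, 0 < r → r < 1 →
      ∫⁻ ζ, areaTr α g (q / (2 * s)) r ζ ^ s ∂sigmaS n ≤ C * hMean g q ((1 + r) / 2) := by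
  have big : ∀ s : ℝ, 2 ≤ s → ∃ C : ℝ≥0∞, C ≠ ⊤ ∧ ∀ g : En n → ℂ, DifferentiableOn ℂ g (Bn n) → Measurable g →
      ∀ r : ℝ, 0 < r → r < 1 → ∫⁻ ζ, areaTr α g (q / (2 * s)) r ζ ^ s ∂sigmaS n ≤ C * hMean g q ((1 + r) / 2) := by
    intro s hs
    have hconj : s.HolderConjugate (s.conjExponent) := Real.HolderConjugate.conjExponent (by linarith)
    obtain ⟨C, hC, h⟩ := exists_lintegral_areaTr_rpow_le_of_conj n (α := α) hα (t := q / (2 * s)) (by positivity) hconj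
      (by rw [Real.conjExponent, div_lt_iff₀ (by linarith)]; linarith)
    refine ⟨C, hC, fun g hg hm r h0 h1 => (h g hg hm r h0 h1).trans (mul_le_mul_right ?_ _)⟩
    rw [show 2 * (q / (2 * s)) * s = q by field_simp]
    exact hMean_mono hg hm hq h0 (by linarith) (by linarith)
  rcases le_or_gt 2 s with h2 | h2
  · exact big s h2
  obtain ⟨C₁, hC₁, h₁⟩ := big 3 (by norm_num)
  obtain ⟨C₂, hC₂, h₂⟩ := exists_lintegral_areaTr_rpow_le_mul n hα hq hs (by linarith : s < 3)
  have hs3 : 0 ≤ 1 - s / 3 := by linarith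
  refine ⟨C₂ * C₁ ^ (s / 3), by finiteness, fun g hg hm r h0 h1 => (h₂ g hg hm r h0 h1).trans ?_⟩
  calc _ ≤ C₂ * hMean g q ((1 + r) / 2) ^ (1 - s / 3) * (C₁ * hMean g q ((1 + r) / 2)) ^ (s / 3) := by
        gcongr
        exact h₁ g hg hm r h0 h1
    _ = _ := by
        rw [ENNReal.mul_rpow_of_nonneg _ _ (by positivity)]
        calc _ = C₂ * C₁ ^ (s / 3) * (hMean g q ((1 + r) / 2) ^ (1 - s / 3) * hMean g q ((1 + r) / 2) ^ (s / 3)) := by ring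
          _ = _ := by rw [← ENNReal.rpow_add_of_nonneg _ _ hs3 (by positivity), sub_add_cancel, ENNReal.rpow_one]

/-- Interpolation of the linear area integral between outer exponents smaller than one and three. -/
lemma exists_lintegral_areaTr_le_rpow_mul (n : ℕ) [NeZero n] (hα : 0 < α) {q s : ℝ} (hq : 0 < q) (hs : 0 < s)
    (hs1 : s < 1) : ∃ C : ℝ≥0∞, C ≠ ⊤ ∧ ∀ g : En n → ℂ, DifferentiableOn ℂ g (Bn n) → Measurable g →
      ∀ r : ℝ, 0 < r → r < 1 → ∫⁻ ζ, areaTr α g (q / 2) r ζ ∂sigmaS n ≤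
        C * hMean g q r ^ ((1 - s) / (3 - s)) *
          (∫⁻ ζ, areaTr α g (q / (2 * s)) r ζ ^ s ∂sigmaS n) ^ (2 / (3 - s)) := by
  have hs3 : 0 < 3 - s := by linarith
  obtain ⟨C, hC, h⟩ := exists_lintegral_areaTr_rpow_le_of_conj n (α := α) hα (t := q / 6) (s := 3) (s' := 3 / 2)
    (by positivity) ⟨by norm_num, by norm_num, by norm_num⟩ (by norm_num)
  set a := (1 - s) / (3 - s) with ha
  set b := 2 / (3 - s) with hb
  have ha0 : 0 < a := div_pos (by linarith) hs3
  have hb0 : 0 < b := by positivity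
  have hab : a + b = 1 := by rw [ha, hb]; field_simp; ring
  have hab' : 3 * a + s * b = 1 := by rw [ha, hb]; field_simp; ring
  refine ⟨C ^ a, by finiteness, fun g hg hm r h0 h1 => ?_⟩
  have hmF : ∀ t, Measurable fun z : En n =>
      wt g t z * ENNReal.ofReal (((1 - ‖z‖ ^ 2) ^ n)⁻¹) * ENNReal.ofReal (r - ‖z‖) := fun t =>
    ((measurable_wt hm t).mul (by fun_prop)).mul (by fun_prop)
  calc ∫⁻ ζ, areaTr α g (q / 2) r ζ ∂sigmaS n
      ≤ ∫⁻ ζ, (areaTr α g (q / 6) r ζ ^ (3 : ℝ)) ^ a * (areaTr α g (q / (2 * s)) r ζ ^ s) ^ b ∂sigmaS n := by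
        refine lintegral_mono fun ζ => ?_
        rw [← ENNReal.rpow_mul, ← ENNReal.rpow_mul]
        refine le_trans ?_ (ENNReal.lintegral_mul_norm_pow_le (hmF _).aemeasurable (hmF _).aemeasurable
          (by positivity) (by positivity) hab')
        have hae := ae_restrict_of_ae (s := Gam α ζ) (ae_radD_eq_zero hg hm h0 h1)
        refine lintegral_mono_ae ?_
        filter_upwards [hae] with z hz
        by_cases hzr : r ≤ ‖z‖
        · simp [ENNReal.ofReal_of_nonpos (sub_nonpos.2 hzr)]
        have h3 := wt_le_rpow_mul_rpow (g := g) (t := q / 2) (t₁ := q / 6) (t₂ := q / (2 * s)) (a := 3 * a) (b := s * b)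
          (by positivity) (by positivity) hab' (by rw [show s * b * (q / (2 * s)) = b * q / 2 by field_simp]; linear_combination -(q / 2) * hab) (hz (not_le.1 hzr))
        have hx : ∀ x : ℝ≥0∞, x = x ^ (3 * a) * x ^ (s * b) := fun x => by
          rw [← ENNReal.rpow_add_of_nonneg _ _ (by positivity) (by positivity), hab', ENNReal.rpow_one]
        set X := ENNReal.ofReal (((1 - ‖z‖ ^ 2) ^ n)⁻¹)
        set Y := ENNReal.ofReal (r - ‖z‖)
        simp only [ENNReal.mul_rpow_of_nonneg _ _ (show 0 ≤ 3 * a by positivity),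
          ENNReal.mul_rpow_of_nonneg _ _ (show 0 ≤ s * b by positivity)]
        calc wt g (q / 2) z * X * Y ≤ wt g (q / 6) z ^ (3 * a) * wt g (q / (2 * s)) z ^ (s * b) *
              (X ^ (3 * a) * X ^ (s * b)) * (Y ^ (3 * a) * Y ^ (s * b)) := by
              rw [← hx X, ← hx Y]
              gcongr
          _ = _ := by ring
    _ ≤ (∫⁻ ζ, areaTr α g (q / 6) r ζ ^ (3 : ℝ) ∂sigmaS n) ^ a *
          (∫⁻ ζ, areaTr α g (q / (2 * s)) r ζ ^ s ∂sigmaS n) ^ b :=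
        ENNReal.lintegral_mul_norm_pow_le ((measurable_areaTr hm _ r).pow_const _).aemeasurable
          ((measurable_areaTr hm _ r).pow_const _).aemeasurable ha0.le hb0.le hab
    _ ≤ _ := by
        refine mul_le_mul_left ?_ _
        rw [← ENNReal.mul_rpow_of_nonneg _ _ ha0.le]
        refine ENNReal.rpow_le_rpow ?_ ha0.le
        have := h g hg hm r h0 h1
        rwa [show 2 * (q / 6) * 3 = q by ring] at this

end Comparison

section LowerEnergy

variable {n : ℕ} {α : ℝ} [NeZero n] {g : En n → ℂ}

lemma lintegral_slice_le_lintegral_volN {F : En n → ℝ≥0∞} (hF : Measurable F) {a b : ℝ} (hb : b < 0) :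
    ENNReal.ofReal (Real.exp ((2 * n + 1) * a)) * ∫⁻ ζ, (∫⁻ τ in Ioc a b, ENNReal.ofReal (b - τ) *
      ∫⁻ θ, F (Complex.exp ((τ : ℝ) + (θ : ℝ) * Complex.I) • ζ) ∂thetaM) ∂sigmaS n ≤
      ∫⁻ z in {z | Real.exp a < ‖z‖}, F z * ENNReal.ofReal (Real.exp b - ‖z‖) ∂volN n := by
  have hS : MeasurableSet {z : En n | Real.exp a < ‖z‖} := measurableSet_lt measurable_const measurable_norm
  have hFm : Measurable fun z : En n => F z * ENNReal.ofReal (Real.exp b - ‖z‖) := hF.mul (by fun_prop)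
  have hm3 : Measurable fun p : (En n × ℝ) × ℝ =>
      F (Complex.exp ((p.1.2 : ℝ) + (p.2 : ℝ) * Complex.I) • p.1.1) := hF.comp (by fun_prop)
  have hm4 : Measurable fun p : En n × ℝ => ENNReal.ofReal (b - p.2) *
      ∫⁻ θ, F (Complex.exp ((p.2 : ℝ) + (θ : ℝ) * Complex.I) • p.1) ∂thetaM :=
    Measurable.mul (by fun_prop) hm3.lintegral_prod_right'
  rw [lintegral_lintegral_swap hm4.aemeasurable, ← lintegral_indicator hS, lintegral_volN_log (hFm.indicator hS),
    ← lintegral_const_mul' _ _ ENNReal.ofReal_ne_top]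
  refine le_trans ?_ (lintegral_mono_set (show Ioc a b ⊆ Iio 0 from fun τ hτ => hτ.2.trans_lt hb))
  refine setLIntegral_mono' measurableSet_Ioc fun τ hτ => ?_
  have e1 : ∫⁻ ζ, ∫⁻ θ, {z : En n | Real.exp a < ‖z‖}.indicator (fun z => F z * ENNReal.ofReal (Real.exp b - ‖z‖))
      (Complex.exp ((τ : ℝ) + (θ : ℝ) * Complex.I) • ζ) ∂thetaM ∂sigmaS n =
      ENNReal.ofReal (Real.exp b - Real.exp τ) * ∫⁻ ζ, ∫⁻ θ,
        F (Complex.exp ((τ : ℝ) + (θ : ℝ) * Complex.I) • ζ) ∂thetaM ∂sigmaS n := by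
    rw [← lintegral_const_mul' _ _ ENNReal.ofReal_ne_top]
    refine lintegral_congr_ae ?_
    filter_upwards [sigmaS_ae_norm (n := n)] with ζ hζ
    rw [← lintegral_const_mul' _ _ ENNReal.ofReal_ne_top]
    refine lintegral_congr fun θ => ?_
    have hn : ‖Complex.exp ((τ : ℝ) + (θ : ℝ) * Complex.I) • ζ‖ = Real.exp τ := by
      rw [norm_smul, hζ, mul_one, Complex.norm_exp]; simp
    have hmem : Complex.exp ((τ : ℝ) + (θ : ℝ) * Complex.I) • ζ ∈ {z : En n | Real.exp a < ‖z‖} := by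
      change Real.exp a < ‖_‖
      rw [hn]
      exact Real.exp_lt_exp.2 hτ.1
    rw [indicator_of_mem hmem, hn, mul_comm]
  rw [e1, lintegral_const_mul' _ _ ENNReal.ofReal_ne_top, ← mul_assoc, ← mul_assoc,
    ← ENNReal.ofReal_mul (Real.exp_pos _).le, ← ENNReal.ofReal_mul (by positivity)]
  refine mul_le_mul_left (ENNReal.ofReal_le_ofReal ?_) _
  have hn1 : (1 : ℝ) ≤ n := by exact_mod_cast NeZero.one_le
  have h3 : Real.exp a * (b - τ) ≤ Real.exp b - Real.exp τ := by
    have h4 := Real.add_one_le_exp (b - τ)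
    have h5 : Real.exp b = Real.exp τ * Real.exp (b - τ) := by rw [← Real.exp_add]; ring_nf
    have h6 : Real.exp a ≤ Real.exp τ := Real.exp_le_exp.2 hτ.1.le
    rw [h5]
    nlinarith [hτ.2, Real.exp_pos τ]
  have h4 : Real.exp (2 * n * a) ≤ 2 * n * Real.exp (2 * n * τ) := by
    have : Real.exp (2 * n * a) ≤ Real.exp (2 * n * τ) := Real.exp_le_exp.2 (by nlinarith [hτ.1])
    nlinarith [Real.exp_pos (2 * n * τ)]
  calc Real.exp ((2 * n + 1) * a) * (b - τ) = Real.exp (2 * n * a) * (Real.exp a * (b - τ)) := by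
        rw [← mul_assoc, ← Real.exp_add]; ring_nf
    _ ≤ _ := mul_le_mul h4 h3 (mul_nonneg (Real.exp_pos _).le (by linarith [hτ.2])) (by positivity)

omit [NeZero n] in
lemma mem_Gam_of_aniDist_lt {z η ζ : En n} (hzη : z = ‖z‖ • η) (hz : ‖z‖ < 1) (hα : 1 < α)
    (hzα : α⁻¹ < ‖z‖) (h : aniDist ζ η < (α - 1) / 2 * (1 - ‖z‖)) : z ∈ Gam α ζ := by
  refine mem_Gam_iff.2 ⟨hz, ?_⟩
  have h1 : aniDist z ζ ≤ (1 - ‖z‖) + ‖z‖ * aniDist ζ η := by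
    rw [aniDist_comm ζ η, aniDist, aniDist]
    conv_lhs => rw [hzη]
    rw [inner_smul_right_eq_smul, Complex.real_smul]
    calc ‖1 - (‖z‖ : ℂ) * inner ℂ ζ η‖ = ‖((1 - ‖z‖ : ℝ) : ℂ) + (‖z‖ : ℝ) * (1 - inner ℂ ζ η)‖ := by
          congr 1; push_cast; ring
      _ ≤ _ := by
          refine (norm_add_le _ _).trans ?_
          rw [norm_mul, Complex.norm_real, Complex.norm_real, norm_norm, Real.norm_of_nonneg (by linarith)]
  have h2 : ‖z‖ * aniDist ζ η ≤ aniDist ζ η := mul_le_of_le_one_left (aniDist_nonneg _ _) hz.le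
  have h3 : 1 < α * ‖z‖ := by
    rw [inv_lt_iff_one_lt_mul₀ (by linarith)] at hzα
    linarith
  nlinarith

/-- Points not too close to the origin have large shadows. -/
lemma exists_one_le_shadowAvg (n : ℕ) [NeZero n] (hα : 1 < α) : ∃ C : ℝ≥0∞, C ≠ ⊤ ∧ ∀ z : En n, α⁻¹ < ‖z‖ → ‖z‖ < 1 →
    1 ≤ C * shadowAvg α (fun _ => 1) z := by
  obtain ⟨C, hC, h⟩ := exists_le_sigmaS_aniCap n ((α - 1) / 2)
  have hα0 : 0 < (α - 1) / 2 := by linarith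
  refine ⟨C * ENNReal.ofReal ((2 / ((α - 1) / 2)) ^ n), by finiteness, fun z hz hz1 => ?_⟩
  obtain ⟨η, hη, hzη⟩ := exists_unit_smul z
  have hδ : 0 < 1 - ‖z‖ := by linarith
  have h1 := h η ((α - 1) / 2 * (1 - ‖z‖)) hη (by positivity) (by nlinarith [norm_nonneg z])
  have h2 : sigmaS n (aniCap η ((α - 1) / 2 * (1 - ‖z‖))) ≤ ∫⁻ ζ in {ζ | z ∈ Gam α ζ}, 1 ∂sigmaS n := by
    rw [setLIntegral_one]
    exact measure_mono fun ζ hζ => mem_Gam_of_aniDist_lt hzη hz1 hα hz hζ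
  have h3 : 0 < 1 - ‖z‖ ^ 2 := by nlinarith [norm_nonneg z]
  calc (1 : ℝ≥0∞) ≤ ENNReal.ofReal ((2 / ((α - 1) / 2)) ^ n * ((1 - ‖z‖ ^ 2) ^ n)⁻¹ * ((α - 1) / 2 * (1 - ‖z‖)) ^ n) := by
        rw [ENNReal.one_le_ofReal, ← inv_pow, ← mul_pow, ← mul_pow]
        refine one_le_pow₀ ?_
        rw [show 2 / ((α - 1) / 2) * (1 - ‖z‖ ^ 2)⁻¹ * ((α - 1) / 2 * (1 - ‖z‖)) = 2 * (1 - ‖z‖) / (1 - ‖z‖ ^ 2) by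
          have : α - 1 ≠ 0 := by linarith
          field_simp, one_le_div h3]
        nlinarith [norm_nonneg z]
    _ = ENNReal.ofReal ((2 / ((α - 1) / 2)) ^ n) * ENNReal.ofReal (((1 - ‖z‖ ^ 2) ^ n)⁻¹) *
          ENNReal.ofReal (((α - 1) / 2 * (1 - ‖z‖)) ^ n) := by
        rw [ENNReal.ofReal_mul (by positivity), ENNReal.ofReal_mul (by positivity)]
    _ ≤ ENNReal.ofReal ((2 / ((α - 1) / 2)) ^ n) * ENNReal.ofReal (((1 - ‖z‖ ^ 2) ^ n)⁻¹) *
          (C * ∫⁻ ζ in {ζ | z ∈ Gam α ζ}, 1 ∂sigmaS n) := by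
        gcongr
        exact h1.trans (mul_le_mul_right h2 _)
    _ = _ := by rw [shadowAvg]; ring

lemma exists_lintegral_logEnergy_le (n : ℕ) [NeZero n] (hα : 1 < α) (q : ℝ) : ∃ C : ℝ≥0∞, C ≠ ⊤ ∧
    ∀ g : En n → ℂ, DifferentiableOn ℂ g (Bn n) → Measurable g → ∀ b : ℝ, b < 0 →
      ∫⁻ ζ, (∫⁻ τ in Ioc (-Real.log α) b, tent (-Real.log α) b τ *
        logEnergy (fun w => g (Complex.exp w • ζ)) q τ) ∂sigmaS n ≤
        C * ∫⁻ ζ, areaTr α g (q / 2) (Real.exp b) ζ ∂sigmaS n := by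
  obtain ⟨C, hC, h⟩ := exists_one_le_shadowAvg n hα
  set a := -Real.log α with ha
  have hea : Real.exp a = α⁻¹ := by rw [ha, Real.exp_neg, Real.exp_log (by linarith)]
  have hc0 : ENNReal.ofReal (Real.exp ((2 * n + 1) * a)) ≠ 0 := by
    rw [Ne, ENNReal.ofReal_eq_zero, not_le]; exact Real.exp_pos _
  refine ⟨(ENNReal.ofReal (Real.exp ((2 * n + 1) * a)))⁻¹ * C, by finiteness, fun g hg hm b hb => ?_⟩
  rw [mul_assoc, ← ENNReal.mul_le_iff_le_inv hc0 ENNReal.ofReal_ne_top]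
  have hb1 : Real.exp b < 1 := Real.exp_lt_one_iff.2 hb
  calc _ ≤ ENNReal.ofReal (Real.exp ((2 * n + 1) * a)) * ∫⁻ ζ, (∫⁻ τ in Ioc a b, ENNReal.ofReal (b - τ) *
        ∫⁻ θ, wt g (q / 2) (Complex.exp ((τ : ℝ) + (θ : ℝ) * Complex.I) • ζ) ∂thetaM) ∂sigmaS n := by
        refine mul_le_mul_right (lintegral_mono_ae ?_) _
        filter_upwards [sigmaS_ae_norm (n := n)] with ζ hζ
        refine setLIntegral_mono' measurableSet_Ioc fun τ hτ => ?_
        refine mul_le_mul' (ENNReal.ofReal_le_ofReal (min_le_left _ _)) (lintegral_mono fun θ => ?_)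
        rw [wt, deriv_slice hg hζ (by simpa using hτ.2.trans_lt hb), mul_div_cancel₀ _ (two_ne_zero' ℝ)]
    _ ≤ _ := lintegral_slice_le_lintegral_volN (measurable_wt hm _) hb
    _ ≤ ∫⁻ z, C * (wt g (q / 2) z * shadowAvg α (fun _ => 1) z * ENNReal.ofReal (Real.exp b - ‖z‖)) ∂volN n := by
        have hS : MeasurableSet {z : En n | Real.exp a < ‖z‖} := measurableSet_lt measurable_const measurable_norm
        refine (setLIntegral_mono' hS fun z hz => ?_).trans (setLIntegral_le_lintegral _ _)
        by_cases hzb : Real.exp b ≤ ‖z‖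
        · simp [ENNReal.ofReal_of_nonpos (sub_nonpos.2 hzb)]
        have h1 := h z (by rw [← hea]; exact hz) ((not_le.1 hzb).trans hb1)
        calc wt g (q / 2) z * ENNReal.ofReal (Real.exp b - ‖z‖)
            = wt g (q / 2) z * 1 * ENNReal.ofReal (Real.exp b - ‖z‖) := by rw [mul_one]
          _ ≤ wt g (q / 2) z * (C * shadowAvg α (fun _ => 1) z) * ENNReal.ofReal (Real.exp b - ‖z‖) := by gcongr
          _ = _ := by ring
    _ = _ := by
        rw [lintegral_const_mul' _ _ hC, ← lintegral_areaTr_mul hm _ _ measurable_const]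
        simp only [mul_one]

/-- The Hardy mean is controlled by its value at a smaller radius and the linear area integral. -/
lemma exists_hMean_le (n : ℕ) [NeZero n] (hα : 1 < α) {q : ℝ} (hq : 0 < q) : ∃ C : ℝ≥0∞, C ≠ ⊤ ∧
    ∀ g : En n → ℂ, DifferentiableOn ℂ g (Bn n) → Measurable g → ∀ r : ℝ, Real.exp (-Real.log α / 2) ≤ r → r < 1 →
      hMean g q r ≤ (if g 0 = 0 then 0 else 2 * hMean g q (Real.exp (-Real.log α / 2))) +
        C * ∫⁻ ζ, areaTr α g (q / 2) r ζ ∂sigmaS n := by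
  obtain ⟨C₁, hC₁, h₁⟩ := exists_lintegral_logEnergy_le n hα q
  obtain ⟨C₂, hC₂, h₂⟩ := LogHol.exists_logMean_add_le hq
  set a := -Real.log α with ha
  have ha0 : a < 0 := by rw [ha, neg_lt_zero]; exact Real.log_pos hα
  set ε := ENNReal.ofReal ((1 - Real.exp (q * a / 4)) ^ 2) with hε
  have hε0 : ε ≠ 0 := by
    rw [hε, Ne, ENNReal.ofReal_eq_zero, not_le]
    have : Real.exp (q * a / 4) < 1 := Real.exp_lt_one_iff.2 (by nlinarith)
    exact pow_pos (by linarith) 2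
  have hε1 : 1 ≤ ε⁻¹ := by
    rw [ENNReal.one_le_inv, hε]
    refine ENNReal.ofReal_le_one.2 (pow_le_one₀ ?_ ?_)
    · have : Real.exp (q * a / 4) < 1 := Real.exp_lt_one_iff.2 (by nlinarith)
      linarith
    · linarith [Real.exp_pos (q * a / 4)]
  refine ⟨ε⁻¹ * (C₂ * C₁), by finiteness, fun g hg hm r hr hr1 => ?_⟩
  have hr0 : 0 < r := (Real.exp_pos _).trans_le hr
  set b := Real.log r with hb
  have hb0 : b < 0 := Real.log_neg hr0 hr1
  have hab : a / 2 ≤ b := by rw [hb, Real.le_log_iff_exp_le hr0]; exact hr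
  have hrb : Real.exp b = r := Real.exp_log hr0
  have hE := h₁ g hg hm b hb0
  rw [hrb] at hE
  set E : En n → ℝ≥0∞ := fun ζ => ∫⁻ τ in Ioc a b, tent a b τ * logEnergy (fun w => g (Complex.exp w • ζ)) q τ with hEdef
  rw [← lintegral_logMean_slice_log hm q hr0, ← hb]
  split_ifs with hg0
  · rw [zero_add]
    calc ∫⁻ ζ, logMean (fun w => g (Complex.exp w • ζ)) q b ∂sigmaS n ≤ ∫⁻ ζ, ε⁻¹ * C₂ * E ζ ∂sigmaS n := by
          refine lintegral_mono_ae ?_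
          filter_upwards [sigmaS_ae_norm (n := n)] with ζ hζ
          have hL := logHol_slice hg hm hζ
          rw [mul_assoc, ← ENNReal.mul_le_iff_le_inv hε0 ENNReal.ofReal_ne_top]
          set k : ℂ → ℂ := dslope (fun l : ℂ => g (l • ζ)) 0 with hk
          have hkd : DifferentiableOn ℂ k (ball 0 1) :=
            (Complex.differentiableOn_dslope (isOpen_ball.mem_nhds (mem_ball_self one_pos))).2 (differentiableOn_slice hg hζ)
          have hkm : Measurable k := by
            have hfm : Measurable fun l : ℂ => g (l • ζ) := hm.comp (by fun_prop)
            have : k = Function.update (fun l : ℂ => l⁻¹ * g (l • ζ)) 0 (deriv (fun l : ℂ => g (l • ζ)) 0) := by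
              rw [hk, dslope]
              congr 1
              funext l
              simp [slope_def_field, hg0, div_eq_inv_mul]
            rw [this]
            have hm' : Measurable fun l : ℂ => l⁻¹ * g (l • ζ) := measurable_inv.mul hfm
            have hu : Measurable fun l : ℂ => if l = 0 then deriv (fun l : ℂ => g (l • ζ)) 0 else l⁻¹ * g (l • ζ) :=
              Measurable.ite (measurableSet_singleton 0) measurable_const hm'
            convert hu using 1
            funext l
            simp [Function.update_apply]
          have hK : LogHol 0 fun w => k (Complex.exp w) := LogHol.comp_exp (by simpa using hkd) hkm
          have hGK : (fun w => g (Complex.exp w • ζ)) = fun w => Complex.exp w * k (Complex.exp w) := by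
            funext w
            have := sub_smul_dslope (fun l : ℂ => g (l • ζ)) 0 (Complex.exp w)
            simpa [hg0] using this.symm
          have h3 := LogHol.logMean_le_of_exp_mul hK (q := q) (a := a) (d := (b - a) / 2) hq (by linarith) (by linarith)
          rw [← hGK, show a + (b - a) / 2 = (a + b) / 2 by ring, show a + 2 * ((b - a) / 2) = b by ring] at h3
          have h4 := h3.trans (h₂ 0 _ a b hL (by linarith) hb0)
          have h5 := ENNReal.le_of_add_le_add_left (ENNReal.mul_ne_top ENNReal.ofNat_ne_top
            (hL.logMean_ne_top (by linarith) hq.le)) h4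
          refine le_trans (mul_le_mul_left (ENNReal.ofReal_le_ofReal ?_) _) h5
          have h6 : Real.exp (-(q * ((b - a) / 2))) ≤ Real.exp (q * a / 4) := Real.exp_le_exp.2 (by nlinarith)
          have h7 : Real.exp (q * a / 4) ≤ 1 := Real.exp_le_one_iff.2 (by nlinarith)
          gcongr
      _ = ε⁻¹ * C₂ * ∫⁻ ζ, E ζ ∂sigmaS n := lintegral_const_mul' _ _ (by finiteness)
      _ ≤ ε⁻¹ * C₂ * _ := mul_le_mul_right hE _
      _ = _ := by ring
  · have hmV : Measurable fun ζ => logMean (fun w => g (Complex.exp w • ζ)) q (a / 2) := by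
      have : Measurable fun p : En n × ℝ => ‖g (Complex.exp ((a / 2 : ℝ) + p.2 * Complex.I) • p.1)‖ₑ ^ q :=
        ((hm.comp (by fun_prop)).enorm).pow_const _
      exact this.lintegral_prod_right'
    calc ∫⁻ ζ, logMean (fun w => g (Complex.exp w • ζ)) q b ∂sigmaS n
        ≤ ∫⁻ ζ, (2 * logMean (fun w => g (Complex.exp w • ζ)) q (a / 2) + C₂ * E ζ) ∂sigmaS n := by
          refine lintegral_mono_ae ?_
          filter_upwards [sigmaS_ae_norm (n := n)] with ζ hζ
          have hL := logHol_slice hg hm hζ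
          refine (le_add_self.trans (h₂ 0 _ a b hL (by linarith) hb0)).trans ?_
          gcongr
          exact hL.logMean_mono hq (by linarith) (by linarith)
      _ = 2 * ∫⁻ ζ, logMean (fun w => g (Complex.exp w • ζ)) q (a / 2) ∂sigmaS n + C₂ * ∫⁻ ζ, E ζ ∂sigmaS n := by
          rw [lintegral_add_left (hmV.const_mul _), lintegral_const_mul _ hmV, lintegral_const_mul' _ _ hC₂]
      _ ≤ 2 * hMean g q (Real.exp (a / 2)) + C₂ * (C₁ * ∫⁻ ζ, areaTr α g (q / 2) r ζ ∂sigmaS n) := by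
          rw [← lintegral_logMean_slice_log hm q (Real.exp_pos _), Real.log_exp]
          gcongr
      _ ≤ _ := by
          refine add_le_add le_rfl ?_
          rw [← mul_assoc, mul_assoc ε⁻¹]
          exact le_mul_of_one_le_left' hε1

end LowerEnergy

section Absorb

/-- A sublinear power of `x` on the right can be absorbed. -/
lemma le_add_of_le_add_rpow_mul_rpow {C K x y : ℝ≥0∞} {a b : ℝ} (ha : 0 ≤ a) (hb : 0 < b) (hab : a + b = 1)
    (hx : x ≠ ⊤) (h : x ≤ K + C * (x ^ a * y ^ b)) : x ≤ 2 * K + (2 * C) ^ (1 / b) * y := by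
  rcases le_total (C * (x ^ a * y ^ b)) (x / 2) with h1 | h1
  · exact (le_two_mul_of_le_add_half hx (h.trans (add_le_add le_rfl h1))).trans le_self_add
  refine le_add_left ?_
  rcases eq_or_ne x 0 with rfl | hx0
  · exact zero_le
  have hxa0 : x ^ a ≠ 0 := by simp [hx0, hx, ENNReal.rpow_eq_zero_iff]
  have hxa : x ^ a ≠ ⊤ := ENNReal.rpow_ne_top_of_nonneg ha hx
  have h2 : x ^ a * x ^ b ≤ x ^ a * (2 * C * y ^ b) := by
    rw [← ENNReal.rpow_add_of_nonneg _ _ ha hb.le, hab, ENNReal.rpow_one]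
    calc x = 2 * (x / 2) := (ENNReal.mul_div_cancel two_ne_zero ENNReal.ofNat_ne_top).symm
      _ ≤ 2 * (C * (x ^ a * y ^ b)) := mul_le_mul_right h1 _
      _ = _ := by ring
  rw [ENNReal.mul_le_mul_iff_right hxa0 hxa] at h2
  calc x = (x ^ b) ^ (1 / b) := by rw [← ENNReal.rpow_mul, mul_one_div_cancel hb.ne', ENNReal.rpow_one]
    _ ≤ (2 * C * y ^ b) ^ (1 / b) := ENNReal.rpow_le_rpow h2 (by positivity)
    _ = _ := by
      rw [ENNReal.mul_rpow_of_nonneg _ _ (by positivity), ← ENNReal.rpow_mul, mul_one_div_cancel hb.ne', ENNReal.rpow_one]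

/-- A self-improving inequality along a sequence of at most geometric growth. -/
lemma le_add_of_forall_le_add_rpow_mul_rpow {C K D y : ℝ≥0∞} {x : ℕ → ℝ≥0∞} {a b : ℝ} {m : ℕ} (ha : 0 ≤ a)
    (hb : 0 < b) (hab : a + b = 1) (hD : D ≠ ⊤) (hx : ∀ k, x k ≤ D * (2 ^ m) ^ k)
    (h : ∀ k, x k ≤ K + C * (x (k + 1) ^ a * y ^ b)) :
    x 0 ≤ 2 * K + (2 * (C * ((2 : ℝ≥0∞) ^ m) ^ a)) ^ (1 / b) * y := by
  set θ : ℝ≥0∞ := 2 ^ m with hθ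
  have hθ1 : 1 ≤ θ := one_le_pow₀ one_le_two
  have hθ0 : θ ≠ 0 := (zero_lt_one.trans_le hθ1).ne'
  have hθt : θ ≠ ⊤ := by finiteness
  set S : ℝ≥0∞ := ⨆ k, x k * (θ ^ k)⁻¹ with hS
  have hSt : S ≠ ⊤ := by
    refine ne_top_of_le_ne_top hD (iSup_le fun k => ?_)
    rw [← div_eq_mul_inv]
    exact ENNReal.div_le_of_le_mul (hx k)
  have h0 : x 0 ≤ S := by
    have := le_iSup (fun k => x k * (θ ^ k)⁻¹) 0
    simpa using this
  refine h0.trans (le_add_of_le_add_rpow_mul_rpow ha hb hab hSt (iSup_le fun k => ?_))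
  have h1 : x (k + 1) ≤ S * θ * θ ^ k := by
    have h2 := le_iSup (fun k => x k * (θ ^ k)⁻¹) (k + 1)
    have hp0 : θ ^ (k + 1) ≠ 0 := pow_ne_zero _ hθ0
    rw [← div_eq_mul_inv, ENNReal.div_le_iff hp0 (by finiteness)] at h2
    rw [mul_assoc, ← pow_succ']
    exact h2
  have hk1 : 1 ≤ θ ^ k := one_le_pow₀ hθ1
  rw [← div_eq_mul_inv]
  refine ENNReal.div_le_of_le_mul ((h k).trans ?_)
  rw [add_mul]
  refine add_le_add (le_mul_of_one_le_right' hk1) ?_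
  have h3 : (θ ^ k) ^ a ≤ θ ^ k := by
    calc (θ ^ k) ^ a ≤ (θ ^ k) ^ (1 : ℝ) := ENNReal.rpow_le_rpow_of_exponent_le hk1 (by linarith)
      _ = _ := ENNReal.rpow_one _
  calc C * (x (k + 1) ^ a * y ^ b) ≤ C * ((S * θ * θ ^ k) ^ a * y ^ b) := by gcongr
    _ = C * (S ^ a * θ ^ a * (θ ^ k) ^ a * y ^ b) := by
      rw [ENNReal.mul_rpow_of_nonneg _ _ ha, ENNReal.mul_rpow_of_nonneg _ _ ha]
    _ ≤ C * (S ^ a * θ ^ a * θ ^ k * y ^ b) := by gcongr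
    _ = _ := by ring

end Absorb

section LowerBound

variable {n : ℕ} {α : ℝ} [NeZero n]

/-- Pointwise growth of functions with bounded Hardy means. -/
lemma exists_enorm_rpow_le_hMean (n : ℕ) [NeZero n] (hα : 1 < α) : ∃ C : ℝ≥0∞, C ≠ ⊤ ∧
    ∀ (q : ℝ) (g : En n → ℂ) (z : En n), 0 < q → DifferentiableOn ℂ g (Bn n) → Measurable g → α⁻¹ < ‖z‖ → ‖z‖ < 1 →
      ‖g z‖ₑ ^ q ≤ C * ENNReal.ofReal (((1 - ‖z‖) ^ n)⁻¹) * hMean g q ((1 + ‖z‖) / 2) := by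
  obtain ⟨C₁, hC₁, h₁⟩ := exists_one_le_shadowAvg n hα
  obtain ⟨C₂, hC₂, h₂⟩ := exists_enorm_rpow_le_capMax (α := α) n (by linarith)
  obtain ⟨C₃, hC₃, h₃⟩ := exists_lintegral_capMax_rpow_le n (p := 2) one_lt_two
  refine ⟨C₁ * C₂ ^ (2 : ℝ) * C₃, by finiteness, fun q g z hq hg hm hz hz1 => ?_⟩
  set ρ := (1 + ‖z‖) / 2 with hρ
  have hz0 := norm_nonneg z
  have hφ : Measurable fun ξ : En n => ‖g (ρ • ξ)‖ₑ ^ (q / 2) := ((hm.comp (by fun_prop)).enorm).pow_const _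
  have hb : ENNReal.ofReal (((1 - ‖z‖ ^ 2) ^ n)⁻¹) ≤ ENNReal.ofReal (((1 - ‖z‖) ^ n)⁻¹) := by
    refine ENNReal.ofReal_le_ofReal (inv_anti₀ (pow_pos (by linarith) n) ?_)
    exact pow_le_pow_left₀ (by linarith) (by nlinarith) n
  have hI : ∫⁻ ζ in {ζ : En n | z ∈ Gam α ζ}, ‖g z‖ₑ ^ q ∂sigmaS n ≤ C₂ ^ (2 : ℝ) * (C₃ * hMean g q ρ) := by
    calc ∫⁻ ζ in {ζ : En n | z ∈ Gam α ζ}, ‖g z‖ₑ ^ q ∂sigmaS n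
        ≤ ∫⁻ ζ, C₂ ^ (2 : ℝ) * capMax (fun ξ => ‖g (ρ • ξ)‖ₑ ^ (q / 2)) ζ ^ (2 : ℝ) ∂sigmaS n := by
          rw [← lintegral_indicator (measurableSet_shadow z)]
          refine lintegral_mono_ae ?_
          filter_upwards [sigmaS_ae_norm (n := n)] with ζ hζ
          by_cases hzζ : z ∈ Gam α ζ
          · rw [indicator_of_mem (by exact hzζ), ← ENNReal.mul_rpow_of_nonneg _ _ two_pos.le]
            calc ‖g z‖ₑ ^ q = (‖g z‖ₑ ^ (q / 2)) ^ (2 : ℝ) := by rw [← ENNReal.rpow_mul, div_mul_cancel₀ _ two_ne_zero]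
              _ ≤ _ := ENNReal.rpow_le_rpow (h₂ (q / 2) g ρ ζ z (by positivity) hg hm (by positivity) (by rw [hρ]; linarith)
                  hζ hzζ (by rw [hρ]; linarith)) two_pos.le
          · rw [indicator_of_notMem (by exact hzζ)]
            exact zero_le
      _ = C₂ ^ (2 : ℝ) * ∫⁻ ζ, capMax (fun ξ => ‖g (ρ • ξ)‖ₑ ^ (q / 2)) ζ ^ (2 : ℝ) ∂sigmaS n :=
          lintegral_const_mul' _ _ (by finiteness)
      _ ≤ _ := by
          refine mul_le_mul_right ((h₃ _ hφ).trans_eq ?_) _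
          rw [hMean]
          simp only [← ENNReal.rpow_mul, div_mul_cancel₀ q (two_ne_zero' ℝ)]
  calc ‖g z‖ₑ ^ q = 1 * ‖g z‖ₑ ^ q := (one_mul _).symm
    _ ≤ C₁ * shadowAvg α (fun _ => 1) z * ‖g z‖ₑ ^ q := mul_le_mul_left (h₁ z hz hz1) _
    _ = C₁ * ENNReal.ofReal (((1 - ‖z‖ ^ 2) ^ n)⁻¹) * ∫⁻ ζ in {ζ : En n | z ∈ Gam α ζ}, ‖g z‖ₑ ^ q ∂sigmaS n := by
        rw [shadowAvg, setLIntegral_const, setLIntegral_const]; ring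
    _ ≤ C₁ * ENNReal.ofReal (((1 - ‖z‖) ^ n)⁻¹) * (C₂ ^ (2 : ℝ) * (C₃ * hMean g q ρ)) := by gcongr
    _ = _ := by ring

/-- The value of the Hardy mean at a fixed radius, which is not needed if `g` vanishes at the origin. -/
def hMeanBase (α : ℝ) (g : En n → ℂ) (q : ℝ) : ℝ≥0∞ :=
  if g 0 = 0 then 0 else 2 * hMean g q (Real.exp (-Real.log α / 2))

omit [NeZero n] in
lemma exp_neg_log_div_two_lt_one (hα : 1 < α) : Real.exp (-Real.log α / 2) < 1 :=
  Real.exp_lt_one_iff.2 (by linarith [Real.log_pos hα])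

lemma hMeanBase_ne_top (hα : 1 < α) {g : En n → ℂ} (hg : DifferentiableOn ℂ g (Bn n)) {q : ℝ} (hq : 0 < q) :
    hMeanBase α g q ≠ ⊤ := by
  rw [hMeanBase]
  split_ifs
  · exact ENNReal.zero_ne_top
  · exact ENNReal.mul_ne_top ENNReal.ofNat_ne_top (hMean_ne_top hg hq (Real.exp_pos _).le (exp_neg_log_div_two_lt_one hα))

lemma exists_growth_hMean (hα : 1 < α) {q s : ℝ} (hq : 0 < q) (hs : 1 < s) {g : En n → ℂ}
    (hg : DifferentiableOn ℂ g (Bn n)) (hm : Measurable g) {I : ℝ≥0∞} (hI : I ≠ ⊤)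
    (h : ∀ r < 1, ∫⁻ ζ, areaTr α g (q / (2 * s)) r ζ ^ s ∂sigmaS n ≤ I) :
    ∃ D : ℝ≥0∞, D ≠ ⊤ ∧ ∀ r : ℝ, Real.exp (-Real.log α / 2) ≤ r → r < 1 →
      hMean g q r ≤ D * ENNReal.ofReal (((1 - r) ^ ⌈n * s⌉₊)⁻¹) := by
  have hs0 : 0 < s := by linarith
  obtain ⟨C₁, hC₁, h₁⟩ := exists_enorm_rpow_le_hMean n hα
  obtain ⟨C₂, hC₂, h₂⟩ := exists_hMean_le n hα (q := q / s) (by positivity)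
  have hK := hMeanBase_ne_top hα hg (q := q / s) (by positivity)
  set M := hMeanBase α g (q / s) + C₂ * I ^ (1 / s) with hM
  have hMt : M ≠ ⊤ := by finiteness
  have hmean : ∀ r : ℝ, Real.exp (-Real.log α / 2) ≤ r → r < 1 → hMean g (q / s) r ≤ M := by
    intro r hr hr1
    refine (h₂ g hg hm r hr hr1).trans (add_le_add le_rfl (mul_le_mul_right ?_ _))
    rw [one_div, ENNReal.le_rpow_inv_iff hs0, div_div, mul_comm s 2]
    exact (lintegral_rpow_le_lintegral_rpow (measurable_areaTr hm _ _).aemeasurable hs.le).trans (h r hr1)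
  refine ⟨(C₁ * M) ^ s, by finiteness, fun r hr hr1 => ?_⟩
  have hr0 : 0 < r := (Real.exp_pos _).trans_le hr
  have hαr : α⁻¹ < r := by
    refine lt_of_lt_of_le ?_ hr
    rw [← Real.exp_log (show 0 < α by linarith), ← Real.exp_neg, Real.exp_lt_exp, Real.log_exp]
    linarith [Real.log_pos hα]
  have hpt : ∀ᵐ ζ ∂sigmaS n, ‖g (r • ζ)‖ₑ ^ q ≤ (C₁ * M) ^ s * ENNReal.ofReal (((1 - r) ^ ⌈n * s⌉₊)⁻¹) := by
    filter_upwards [sigmaS_ae_norm (n := n)] with ζ hζ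
    have hn : ‖r • ζ‖ = r := by rw [norm_smul, hζ, mul_one, Real.norm_of_nonneg hr0.le]
    have h3 := h₁ (q / s) g (r • ζ) (by positivity) hg hm (by rw [hn]; exact hαr) (by rw [hn]; exact hr1)
    rw [hn] at h3
    calc ‖g (r • ζ)‖ₑ ^ q = (‖g (r • ζ)‖ₑ ^ (q / s)) ^ s := by rw [← ENNReal.rpow_mul, div_mul_cancel₀ _ hs0.ne']
      _ ≤ (C₁ * ENNReal.ofReal (((1 - r) ^ n)⁻¹) * M) ^ s := by
          refine ENNReal.rpow_le_rpow (h3.trans (mul_le_mul_right (hmean _ ?_ ?_) _)) hs0.le <;> linarith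
      _ = (C₁ * M) ^ s * ENNReal.ofReal (((1 - r) ^ n)⁻¹) ^ s := by
          rw [← ENNReal.mul_rpow_of_nonneg _ _ hs0.le]; ring_nf
      _ ≤ _ := by
          refine mul_le_mul_right ?_ _
          have hr2 : 0 < 1 - r := by linarith
          rw [ENNReal.ofReal_rpow_of_nonneg (by positivity) hs0.le]
          refine ENNReal.ofReal_le_ofReal ?_
          rw [Real.inv_rpow (by positivity), ← Real.rpow_natCast, ← Real.rpow_mul hr2.le, ← Real.rpow_natCast]
          exact inv_anti₀ (by positivity) (Real.rpow_le_rpow_of_exponent_ge hr2 (by linarith) (Nat.le_ceil _))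
  calc hMean g q r ≤ ∫⁻ _ζ, (C₁ * M) ^ s * ENNReal.ofReal (((1 - r) ^ ⌈n * s⌉₊)⁻¹) ∂sigmaS n := lintegral_mono_ae hpt
    _ = _ := by simp

/-- The Hardy means are controlled by the truncated area integrals. -/
lemma exists_hMean_le_of_forall (n : ℕ) [NeZero n] (hα : 1 < α) {q s : ℝ} (hq : 0 < q) (hs : 0 < s) :
    ∃ C : ℝ≥0∞, C ≠ ⊤ ∧ ∀ g : En n → ℂ, DifferentiableOn ℂ g (Bn n) → Measurable g → ∀ I : ℝ≥0∞, I ≠ ⊤ →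
      (∀ r < 1, ∫⁻ ζ, areaTr α g (q / (2 * s)) r ζ ^ s ∂sigmaS n ≤ I) →
      ∀ r : ℝ, Real.exp (-Real.log α / 2) ≤ r → r < 1 → hMean g q r ≤ 2 * hMeanBase α g q + C * I := by
  obtain ⟨C₁, hC₁, h₁⟩ := exists_hMean_le n hα hq
  rcases lt_trichotomy s 1 with hs1 | rfl | hs1
  · obtain ⟨C₂, hC₂, h₂⟩ := exists_lintegral_areaTr_le_rpow_mul (α := α) n (by linarith) hq hs hs1
    have hs3 : 0 < 3 - s := by linarith
    refine ⟨(2 * (C₁ * C₂)) ^ (1 / (2 / (3 - s))), by finiteness, fun g hg hm I _ hI r hr hr1 => ?_⟩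
    have hr0 : 0 < r := (Real.exp_pos _).trans_le hr
    refine le_add_of_le_add_rpow_mul_rpow (div_nonneg (by linarith) hs3.le : 0 ≤ (1 - s) / (3 - s)) (by positivity)
      (by field_simp; ring) (hMean_ne_top hg hq hr0.le hr1) ?_
    refine (h₁ g hg hm r hr hr1).trans (add_le_add le_rfl ?_)
    rw [mul_assoc, ← mul_assoc C₂]
    refine mul_le_mul_right ((h₂ g hg hm r hr0 hr1).trans (mul_le_mul_right ?_ _)) _
    exact ENNReal.rpow_le_rpow (hI r hr1) (by positivity)
  · refine ⟨C₁, hC₁, fun g hg hm I _ hI r hr hr1 => (h₁ g hg hm r hr hr1).trans (add_le_add ?_ ?_)⟩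
    · exact le_mul_of_one_le_left' one_le_two
    · refine mul_le_mul_right ?_ _
      simpa using hI r hr1
  · obtain ⟨C₂, hC₂, h₂⟩ := exists_lintegral_areaTr_rpow_le_mul (α := α) n (by linarith) hq one_pos hs1
    have hb1 : 1 / s < 1 := (div_lt_one hs).2 hs1
    refine ⟨(2 * (C₁ * C₂ * ((2 : ℝ≥0∞) ^ ⌈n * s⌉₊) ^ (1 - 1 / s))) ^ (1 / (1 / s)), by finiteness,
      fun g hg hm I hIt hI r hr hr1 => ?_⟩
    have hr0 : 0 < r := (Real.exp_pos _).trans_le hr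
    obtain ⟨D, hD, hgr⟩ := exists_growth_hMean hα hq hs1 hg hm hIt hI
    set x : ℕ → ℝ := fun k => 1 - (1 - r) * (1 / 2) ^ k with hx
    have hx1 : ∀ k, x k < 1 := fun k => by
      have : 0 < (1 - r) * (1 / 2) ^ k := mul_pos (by linarith) (by positivity)
      simp only [hx]; linarith
    have hxr : ∀ k, r ≤ x k := fun k => by
      have : (1 - r) * (1 / 2) ^ k ≤ 1 - r := mul_le_of_le_one_right (by linarith) (pow_le_one₀ (by norm_num) (by norm_num))
      simp only [hx]; linarith
    have hx0 : x 0 = r := by simp [hx]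
    have hxs : ∀ k, x (k + 1) = (1 + x k) / 2 := fun k => by simp only [hx, pow_succ]; ring
    have key := le_add_of_forall_le_add_rpow_mul_rpow (C := C₁ * C₂) (K := hMeanBase α g q) (y := I)
      (D := D * ENNReal.ofReal (((1 - r) ^ ⌈n * s⌉₊)⁻¹)) (x := fun k => hMean g q (x k)) (a := 1 - 1 / s) (b := 1 / s)
      (m := ⌈n * s⌉₊) (by linarith) (by positivity) (by ring) (by finiteness) (fun k => ?_) (fun k => ?_)
    · simpa only [hx0] using key
    · refine (hgr _ (hr.trans (hxr k)) (hx1 k)).trans_eq ?_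
      rw [mul_assoc]
      congr 1
      rw [show ((2 : ℝ≥0∞) ^ ⌈n * s⌉₊) ^ k = ENNReal.ofReal ((2 ^ ⌈n * s⌉₊) ^ k) by
        rw [ENNReal.ofReal_pow (by positivity), ENNReal.ofReal_pow (by positivity)]; simp,
        ← ENNReal.ofReal_mul (inv_nonneg.2 (pow_nonneg (by linarith) _))]
      congr 1
      simp only [hx, sub_sub_cancel]
      rw [mul_pow, mul_inv, ← pow_mul, ← pow_mul, mul_comm k, one_div, inv_pow, inv_inv]
    · refine (h₁ g hg hm _ (hr.trans (hxr k)) (hx1 k)).trans (add_le_add le_rfl ?_)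
      have h3 := h₂ g hg hm (x k) (hr0.trans_le (hxr k)) (hx1 k)
      simp only [mul_one, ENNReal.rpow_one] at h3
      rw [mul_assoc, ← mul_assoc C₂, hxs]
      exact mul_le_mul_right (h3.trans (mul_le_mul_right (ENNReal.rpow_le_rpow (hI _ (hx1 k)) (by positivity)) _)) _

end LowerBound

section AreaTheorem

variable {n : ℕ} {α : ℝ} {g : En n → ℂ}

lemma hNorm_rpow {q : ℝ} (hq : 0 < q) (g : En n → ℂ) : hNorm n q g ^ q = ⨆ r ∈ Ioo (0 : ℝ) 1, hMean g q r := by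
  rw [hNorm, ← ENNReal.rpow_mul, one_div_mul_cancel hq.ne', ENNReal.rpow_one]
  rfl

lemma areaTr_le_setLIntegral (t : ℝ) {r : ℝ} (hr : r ≤ 1) (ζ : En n) :
    areaTr α g t r ζ ≤ ∫⁻ z in Gam α ζ, wt g t z * ENNReal.ofReal ((1 - ‖z‖ ^ 2) ^ (1 - (n : ℝ))) ∂volN n := by
  refine setLIntegral_mono' (measurableSet_Gam ζ) fun z hz => ?_
  have hz1 : ‖z‖ < 1 := (mem_Gam_iff.1 hz).1
  have hd : 0 < 1 - ‖z‖ ^ 2 := by nlinarith [norm_nonneg z]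
  rw [mul_assoc, ← ENNReal.ofReal_mul (by positivity)]
  refine mul_le_mul_right (ENNReal.ofReal_le_ofReal ?_) _
  rw [Real.rpow_sub hd, Real.rpow_one, Real.rpow_natCast, div_eq_inv_mul]
  exact mul_le_mul_of_nonneg_left (by nlinarith [norm_nonneg z]) (by positivity)

lemma setLIntegral_le_areaTr (t : ℝ) (ζ : En n) :
    ∫⁻ z in Gam α ζ, wt g t z * ENNReal.ofReal ((1 - ‖z‖ ^ 2) ^ (1 - (n : ℝ))) ∂volN n ≤ 2 * areaTr α g t 1 ζ := by
  rw [areaTr, ← lintegral_const_mul' _ _ ENNReal.ofNat_ne_top]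
  refine setLIntegral_mono' (measurableSet_Gam ζ) fun z hz => ?_
  have hz1 : ‖z‖ < 1 := (mem_Gam_iff.1 hz).1
  have hd : 0 < 1 - ‖z‖ ^ 2 := by nlinarith [norm_nonneg z]
  have h2 : (2 : ℝ≥0∞) = ENNReal.ofReal 2 := by simp
  calc wt g t z * ENNReal.ofReal ((1 - ‖z‖ ^ 2) ^ (1 - (n : ℝ)))
      ≤ wt g t z * ENNReal.ofReal (2 * (((1 - ‖z‖ ^ 2) ^ n)⁻¹ * (1 - ‖z‖))) := by
        refine mul_le_mul_right (ENNReal.ofReal_le_ofReal ?_) _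
        rw [Real.rpow_sub hd, Real.rpow_one, Real.rpow_natCast, div_eq_inv_mul, mul_left_comm]
        exact mul_le_mul_of_nonneg_left (by nlinarith [norm_nonneg z]) (by positivity)
    _ = _ := by
        rw [ENNReal.ofReal_mul two_pos.le, ENNReal.ofReal_mul (by positivity), ← h2]
        ring

lemma areaTr_mono (t : ℝ) {r₁ r₂ : ℝ} (h : r₁ ≤ r₂) (ζ : En n) : areaTr α g t r₁ ζ ≤ areaTr α g t r₂ ζ :=
  lintegral_mono fun z => mul_le_mul_right (ENNReal.ofReal_le_ofReal (by linarith)) _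

lemma areaTr_one_eq_iSup (hm : Measurable g) (t : ℝ) {x : ℕ → ℝ} (hx : Monotone x) (hx1 : Tendsto x atTop (𝓝 1))
    (ζ : En n) : areaTr α g t 1 ζ = ⨆ k, areaTr α g t (x k) ζ := by
  have hmono : ∀ z : En n, Monotone fun k => ENNReal.ofReal (x k - ‖z‖) :=
    fun z i j hij => ENNReal.ofReal_le_ofReal (by linarith [hx hij])
  simp only [areaTr]
  rw [← lintegral_iSup]
  · refine lintegral_congr fun z => ?_
    rw [← ENNReal.mul_iSup]
    congr 1
    refine (iSup_eq_of_tendsto (hmono z) ?_).symm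
    exact (ENNReal.continuous_ofReal.tendsto _).comp (hx1.sub_const _)
  · exact fun k => ((measurable_wt hm t).mul (by fun_prop)).mul (by fun_prop)
  · exact fun i j hij z => mul_le_mul_right (hmono z hij) _

lemma Ipt_eq (p t : ℝ) (g : En n → ℂ) : Ipt n α p t g = ∫⁻ ζ, (∫⁻ z in Gam α ζ,
    wt g t z * ENNReal.ofReal ((1 - ‖z‖ ^ 2) ^ (1 - (n : ℝ))) ∂volN n) ^ (p / 2) ∂sigmaS n := rfl

lemma exists_Ipt_le (n : ℕ) [NeZero n] (hα : 0 < α) {p t : ℝ} (hp : 0 < p) (ht : 0 < t) : ∃ C : ℝ≥0∞, C ≠ ⊤ ∧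
    ∀ g : En n → ℂ, DifferentiableOn ℂ g (Bn n) → Measurable g →
      Ipt n α p t g ≤ C * hNorm n (p * t) g ^ (p * t) := by
  have hs : 0 < p / 2 := by positivity
  obtain ⟨C, hC, h⟩ := exists_lintegral_areaTr_rpow_le (α := α) n hα (q := p * t) (by positivity) hs
  rw [show p * t / (2 * (p / 2)) = t by field_simp] at h
  refine ⟨2 ^ (p / 2) * C, by finiteness, fun g hg hm => ?_⟩
  set x : ℕ → ℝ := fun k => 1 - 1 / (k + 1 + 1 : ℝ) with hx
  have hxm : Monotone x := fun i j hij => by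
    have : (i : ℝ) ≤ j := by exact_mod_cast hij
    simp only [hx]
    gcongr
  have hx1 : Tendsto x atTop (𝓝 1) := by
    have h1 := (tendsto_one_div_add_atTop_nhds_zero_nat (𝕜 := ℝ)).comp (tendsto_add_atTop_nat 1)
    simpa [hx, Function.comp_def] using h1.const_sub 1
  have hxI : ∀ k, 0 < x k ∧ x k < 1 := fun k => by
    have h1 : (0 : ℝ) < 1 / (k + 1 + 1 : ℝ) := by positivity
    have h2 : 1 / (k + 1 + 1 : ℝ) < 1 := by
      rw [div_lt_one (by positivity)]
      have : (0 : ℝ) ≤ k := k.cast_nonneg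
      linarith
    simp only [hx]
    constructor <;> linarith
  calc Ipt n α p t g ≤ ∫⁻ ζ, 2 ^ (p / 2) * areaTr α g t 1 ζ ^ (p / 2) ∂sigmaS n := by
        rw [Ipt_eq]
        refine lintegral_mono fun ζ => ?_
        rw [← ENNReal.mul_rpow_of_nonneg _ _ hs.le]
        exact ENNReal.rpow_le_rpow (setLIntegral_le_areaTr t ζ) hs.le
    _ = 2 ^ (p / 2) * ∫⁻ ζ, areaTr α g t 1 ζ ^ (p / 2) ∂sigmaS n := lintegral_const_mul' _ _ (by finiteness)
    _ = 2 ^ (p / 2) * ∫⁻ ζ, (⨆ k, areaTr α g t (x k) ζ ^ (p / 2)) ∂sigmaS n := by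
        congr 1
        refine lintegral_congr fun ζ => ?_
        rw [areaTr_one_eq_iSup hm t hxm hx1]
        exact (ENNReal.orderIsoRpow (p / 2) hs).map_iSup _
    _ = 2 ^ (p / 2) * ⨆ k, ∫⁻ ζ, areaTr α g t (x k) ζ ^ (p / 2) ∂sigmaS n := by
        rw [lintegral_iSup (fun k => (measurable_areaTr hm t _).pow_const _)]
        exact fun i j hij ζ => ENNReal.rpow_le_rpow (areaTr_mono t (hxm hij) ζ) hs.le
    _ ≤ 2 ^ (p / 2) * (C * hNorm n (p * t) g ^ (p * t)) := by
        refine mul_le_mul_right (iSup_le fun k => (h g hg hm _ (hxI k).1 (hxI k).2).trans (mul_le_mul_right ?_ _)) _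
        rw [hNorm_rpow (by positivity)]
        exact le_iSup₂_of_le ((1 + x k) / 2) ⟨by linarith [(hxI k).1], by linarith [(hxI k).2]⟩ le_rfl
    _ = _ := (mul_assoc _ _ _).symm

lemma exists_hNorm_rpow_le (n : ℕ) [NeZero n] (hα : 1 < α) {p t : ℝ} (hp : 0 < p) (ht : 0 < t) : ∃ C : ℝ≥0∞, C ≠ ⊤ ∧
    ∀ g : En n → ℂ, DifferentiableOn ℂ g (Bn n) → Measurable g → Ipt n α p t g ≠ ⊤ →
      hNorm n (p * t) g ^ (p * t) ≤ 2 * hMeanBase α g (p * t) + C * Ipt n α p t g := by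
  have hs : 0 < p / 2 := by positivity
  have hq : 0 < p * t := by positivity
  obtain ⟨C, hC, h⟩ := exists_hMean_le_of_forall n hα hq hs
  rw [show p * t / (2 * (p / 2)) = t by field_simp] at h
  refine ⟨C, hC, fun g hg hm hI => ?_⟩
  have hJ : ∀ r < 1, ∫⁻ ζ, areaTr α g t r ζ ^ (p / 2) ∂sigmaS n ≤ Ipt n α p t g := fun r hr =>
    lintegral_mono fun ζ => ENNReal.rpow_le_rpow (areaTr_le_setLIntegral t hr.le ζ) hs.le
  rw [hNorm_rpow hq]
  refine iSup₂_le fun r hr => ?_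
  refine (hMean_mono hg hm hq hr.1 (le_max_left r (Real.exp (-Real.log α / 2)))
    (max_lt hr.2 (exp_neg_log_div_two_lt_one hα))).trans ?_
  exact h g hg hm _ hI hJ _ (le_max_right _ _) (max_lt hr.2 (exp_neg_log_div_two_lt_one hα))

lemma measurable_indicator_Bn (hg : DifferentiableOn ℂ g (Bn n)) : Measurable ((Bn n).indicator g) := by
  classical
  rw [← piecewise_eq_indicator]
  exact hg.continuousOn.measurable_piecewise continuousOn_const measurableSet_Bn

lemma hNorm_indicator_Bn (n : ℕ) [NeZero n] {q : ℝ} (g : En n → ℂ) : hNorm n q ((Bn n).indicator g) = hNorm n q g := by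
  rw [hNorm, hNorm]
  congr 1
  refine iSup_congr fun r => iSup_congr fun hr => lintegral_congr_ae ?_
  filter_upwards [sigmaS_ae_norm (n := n)] with ζ hζ
  rw [indicator_of_mem]
  rw [Bn, mem_ball_zero_iff, norm_smul, hζ, mul_one, Real.norm_of_nonneg hr.1.le]
  exact hr.2

lemma Ipt_indicator_Bn (p t : ℝ) (g : En n → ℂ) : Ipt n α p t ((Bn n).indicator g) = Ipt n α p t g := by
  refine lintegral_congr fun ζ => ?_
  congr 1
  refine setLIntegral_congr_fun (measurableSet_Gam ζ) fun z hz => ?_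
  have hzB : z ∈ Bn n := hz.1
  have h1 : radD ((Bn n).indicator g) z = radD g z := by
    rw [radD, radD]
    congr 1
    refine Filter.EventuallyEq.fderiv_eq ?_
    filter_upwards [isOpen_ball.mem_nhds hzB] with w hw
    exact indicator_of_mem hw _
  simp only [h1, indicator_of_mem hzB]

end AreaTheorem

/-- **Generalized area theorem.** For `g` holomorphic on `B_n`,
`0 < p, t < ∞` and an aperture `α > 1`: `g ∈ H^{pt}` iff `I_{p,t}(g) < ∞`; moreover, if
`g(0) = 0` then `‖g‖_{H^{pt}}^{pt} ≍ I_{p,t}(g)`, with comparison constants depending only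
on `n,p,t,α`. -/
theorem stmt8 (n : ℕ) (hn : 1 ≤ n) (p t α : ℝ) (hp : 0 < p) (ht : 0 < t) (hα : 1 < α) :
    ∃ c₁ c₂ : ℝ≥0∞, 0 < c₁ ∧ c₁ < ⊤ ∧ 0 < c₂ ∧ c₂ < ⊤ ∧
      ∀ g : En n → ℂ, DifferentiableOn ℂ g (Bn n) →
        ((hNorm n (p * t) g < ⊤ ↔ Ipt n α p t g < ⊤) ∧
          (g 0 = 0 →
            hNorm n (p * t) g ^ (p * t) ≤ c₁ * Ipt n α p t g ∧
            Ipt n α p t g ≤ c₂ * hNorm n (p * t) g ^ (p * t))) := by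
  have : NeZero n := ⟨by omega⟩
  have hq : 0 < p * t := by positivity
  obtain ⟨C₁, hC₁, h₁⟩ := exists_hNorm_rpow_le n hα hp ht
  obtain ⟨C₂, hC₂, h₂⟩ := exists_Ipt_le (α := α) n (by linarith) hp ht
  refine ⟨C₁ + 1, C₂ + 1, by positivity, by finiteness, by positivity, by finiteness, fun f hf => ?_⟩
  set g := (Bn n).indicator f with hgdef
  have hgf : EqOn g f (Bn n) := fun z hz => indicator_of_mem hz _
  have hg : DifferentiableOn ℂ g (Bn n) := hf.congr hgf
  have hm : Measurable g := measurable_indicator_Bn hf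
  have hg0 : g 0 = f 0 := hgf (mem_ball_self one_pos)
  rw [← hNorm_indicator_Bn n f, ← Ipt_indicator_Bn p t f, ← hgdef, ← hg0]
  have hU := h₂ g hg hm
  refine ⟨⟨fun h => ?_, fun h => ?_⟩, fun h0 => ⟨?_, ?_⟩⟩
  · exact hU.trans_lt (ENNReal.mul_lt_top hC₂.lt_top (ENNReal.rpow_lt_top_of_nonneg hq.le h.ne))
  · rw [← ENNReal.rpow_lt_top_iff_of_pos hq]
    refine (h₁ g hg hm h.ne).trans_lt ?_
    have := hMeanBase_ne_top hα hg hq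
    have := h.ne
    finiteness
  · rcases eq_or_ne (Ipt n α p t g) ⊤ with h | h
    · rw [h, ENNReal.mul_top (by positivity)]
      exact le_top
    · refine (h₁ g hg hm h).trans ?_
      rw [hMeanBase, if_pos h0, mul_zero, zero_add]
      exact mul_le_mul_left le_self_add _
  · exact hU.trans (mul_le_mul_left le_self_add _)

end
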